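/- Let M be a positive integer and let f be a transcendental meromorphic function in the plane with Schwarzian derivative S_f = 2A such that: (i) f has finitely many critical values and all multiple points of f have multiplicity at most M; (ii) the inverse function of f has finitely many transcendental singularities. If A is transcendental, then ∞ is not a Borel exceptional value of A; that is, limsup_{r→∞} log N(r,A)/log r = limsup_{r→∞} log T(r,A)/log r. -/

import Mathlib

open Filter Set Topology Bornology MeasureTheory

noncomputable section

/-! ### The extended plane and the chordal metric

ℂ∞ is modelled as `Option ℂ`, with `none` denoting the point ∞. -/

/-- The chordal metric χ on the extended complex plane ℂ∞ (`none` = ∞). -/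
def chordal : Option ℂ → Option ℂ → ℝ
  | Option.none, Option.none => 0
  | Option.none, Option.some w => 1 / Real.sqrt (1 + ‖w‖ ^ 2)
  | Option.some z, Option.none => 1 / Real.sqrt (1 + ‖z‖ ^ 2)
  | Option.some z, Option.some w =>
      ‖z - w‖ / Real.sqrt ((1 + ‖z‖ ^ 2) * (1 + ‖w‖ ^ 2))

/-! ### Meromorphic functions in the plane -/

/-- `f` is meromorphic on the plane with pole set `P`: poles form a discrete closed set,
`f` is analytic off `P`, and `|f| → ∞` at each point of `P`. -/
def MeroPlane (f : ℂ → ℂ) (P : Set ℂ) : Prop :=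
  (∀ K : Set ℂ, IsCompact K → (P ∩ K).Finite) ∧
  (∀ z ∉ P, AnalyticAt ℂ f z) ∧
  ∀ p ∈ P, Tendsto (fun z => ‖f z‖) (nhdsWithin p Pᶜ) atTop

/-- `f` coincides with a rational function away from its poles. -/
def RationalFn (f : ℂ → ℂ) (P : Set ℂ) : Prop :=
  ∃ p q : Polynomial ℂ, q ≠ 0 ∧ ∀ z ∉ P, q.eval z ≠ 0 → f z = p.eval z / q.eval z

/-- `f` is a transcendental meromorphic function in the plane, with pole set `P`. -/
def TranscMeroPlane (f : ℂ → ℂ) (P : Set ℂ) : Prop :=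
  MeroPlane f P ∧ ¬ RationalFn f P

/-- `f` has a pole of order `m` at `z₀`. -/
def PoleOrder (f : ℂ → ℂ) (z₀ : ℂ) (m : ℕ) : Prop :=
  0 < m ∧ ∃ g : ℂ → ℂ, AnalyticAt ℂ g z₀ ∧ g z₀ ≠ 0 ∧
    ∀ᶠ z in nhdsWithin z₀ {z₀}ᶜ, f z = g z / (z - z₀) ^ m

/-- `f` has a zero of order `m` at `z₀`. -/
def ZeroOrder (f : ℂ → ℂ) (z₀ : ℂ) (m : ℕ) : Prop :=
  0 < m ∧ ∃ g : ℂ → ℂ, AnalyticAt ℂ g z₀ ∧ g z₀ ≠ 0 ∧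
    ∀ᶠ z in nhds z₀, f z = (z - z₀) ^ m * g z

/-- `z₀` is a multiple point of `f` of multiplicity `μ`: either a pole of `f` of order `μ ≥ 2`,
or a point of analyticity where `f'` has a zero of order `μ - 1`. -/
def MultiplePointWithMult (f : ℂ → ℂ) (z₀ : ℂ) (μ : ℕ) : Prop :=
  2 ≤ μ ∧ (PoleOrder f z₀ μ ∨ (AnalyticAt ℂ f z₀ ∧ ZeroOrder (deriv f) z₀ (μ - 1)))

/-- `z₀` is a multiple point of `f`. -/
def MultiplePoint (f : ℂ → ℂ) (z₀ : ℂ) : Prop :=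
  ∃ μ, MultiplePointWithMult f z₀ μ

open scoped Classical in
/-- The value of `f` at `z` as an element of ℂ∞, given the pole set `P`. -/
def valueAt (f : ℂ → ℂ) (P : Set ℂ) (z : ℂ) : Option ℂ :=
  if z ∈ P then none else some (f z)

/-- The set of critical values of `f` in ℂ∞ (values at multiple points). -/
def CriticalValues (f : ℂ → ℂ) (P : Set ℂ) : Set (Option ℂ) :=
  {w | ∃ z, MultiplePoint f z ∧ w = valueAt f P z}

/-! ### Transcendental singularities of the inverse function -/

/-- A path tending to infinity on which `f → a`; such a path determines a transcendental
singularity of `f⁻¹` over `a`. -/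
def AsymptoticPath (f : ℂ → ℂ) (P : Set ℂ) (a : Option ℂ) (γ : ℝ → ℂ) : Prop :=
  ContinuousOn γ (Ici 0) ∧
  Tendsto (fun t => ‖γ t‖) atTop atTop ∧
  Tendsto (fun t => chordal (valueAt f P (γ t)) a) atTop (nhds 0)

/-- `C` is a connected component of the set `S`. -/
def IsComponentOf (C S : Set ℂ) : Prop :=
  ∃ x ∈ S, C = connectedComponentIn S x

/-- The paths `γ₁`, `γ₂`, with asymptotic values `a₁`, `a₂` respectively, determine
distinct transcendental singularities of `f⁻¹`. -/
def DistinctSingularities (f : ℂ → ℂ) (P : Set ℂ) (a₁ a₂ : Option ℂ) (γ₁ γ₂ : ℝ → ℂ) : Prop :=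
  a₁ ≠ a₂ ∨ ∃ t : ℝ, 0 < t ∧ ∃ C₁ C₂ : Set ℂ,
    IsComponentOf C₁ {z | chordal (valueAt f P z) a₁ < t} ∧
    IsComponentOf C₂ {z | chordal (valueAt f P z) a₂ < t} ∧
    Disjoint C₁ C₂ ∧
    IsBounded (γ₁ '' Ici 0 \ C₁) ∧ IsBounded (γ₂ '' Ici 0 \ C₂)

/-- The inverse function of `f` has finitely many transcendental singularities: there is a
bound `n` on the size of any family of pairwise distinct transcendental singularities. -/
def FinitelyManyTranscSing (f : ℂ → ℂ) (P : Set ℂ) : Prop :=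
  ∃ n : ℕ, ∀ m : ℕ, ∀ a : Fin m → Option ℂ, ∀ γ : Fin m → ℝ → ℂ,
    (∀ i, AsymptoticPath f P (a i) (γ i)) →
    (∀ i j, i ≠ j → DistinctSingularities f P (a i) (a j) (γ i) (γ j)) →
    m ≤ n

/-- The Schwarzian derivative `S_f = f'''/f' - (3/2)(f''/f')²`. -/
def schwarzian (f : ℂ → ℂ) (z : ℂ) : ℂ :=
  deriv (deriv (deriv f)) z / deriv f z - (3 / 2) * (deriv (deriv f) z / deriv f z) ^ 2

/-- `w` is a singular value of `f⁻¹`: a critical value or an asymptotic value of `f`. -/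
def SingularValue (f : ℂ → ℂ) (P : Set ℂ) (w : Option ℂ) : Prop :=
  w ∈ CriticalValues f P ∨ ∃ γ : ℝ → ℂ, AsymptoticPath f P w γ

/-! ### Nevanlinna theory -/

open scoped Classical in
/-- The order of the pole of `f` at `z` (junk value `0` if there is no pole). -/
def poleOrderAt (f : ℂ → ℂ) (z : ℂ) : ℕ :=
  if h : ∃ m, PoleOrder f z m then h.choose else 0

/-- `n(t, f)`: the number of poles of `f` of modulus at most `t`, counted with multiplicity. -/
def nCount (f : ℂ → ℂ) (t : ℝ) : ℕ :=
  ∑ᶠ z ∈ {w : ℂ | ‖w‖ ≤ t}, poleOrderAt f z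

/-- `N(r, f)`: the integrated counting function of the poles of `f`. -/
def nevN (f : ℂ → ℂ) (r : ℝ) : ℝ :=
  (nCount f 0 : ℝ) * Real.log r + ∫ t in (0:ℝ)..r, ((nCount f t : ℝ) - (nCount f 0 : ℝ)) / t

/-- `m(r, f)`: the Nevanlinna proximity function. -/
def nevm (f : ℂ → ℂ) (r : ℝ) : ℝ :=
  (1 / (2 * Real.pi)) * ∫ θ in (0:ℝ)..(2 * Real.pi),
    Real.log (max 1 (‖f (r * Complex.exp (θ * Complex.I))‖))

/-- `T(r, f)`: the Nevanlinna characteristic. -/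
def nevT (f : ℂ → ℂ) (r : ℝ) : ℝ := nevm f r + nevN f r

/-- The order of growth `ρ(f) = limsup_{r→∞} log T(r,f)/log r`, as an extended real. -/
def growthOrder (f : ℂ → ℂ) : EReal :=
  Filter.limsup (fun r : ℝ => ((Real.log (nevT f r) / Real.log r : ℝ) : EReal)) atTop

/-- ∞ is a Borel exceptional value of `f`. -/
def BorelExceptionalInfty (f : ℂ → ℂ) : Prop :=
  Filter.limsup (fun r : ℝ => ((Real.log (nevN f r) / Real.log r : ℝ) : EReal)) atTop <
  Filter.limsup (fun r : ℝ => ((Real.log (nevT f r) / Real.log r : ℝ) : EReal)) atTop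

/-! ### Meromorphic functions near infinity and the Wiman-Valiron property -/

/-- `A` is meromorphic in `R ≤ |z| < ∞` with pole set `P`. -/
def MeroAnnulus (A : ℂ → ℂ) (R : ℝ) (P : Set ℂ) : Prop :=
  P ⊆ {z : ℂ | R ≤ ‖z‖} ∧
  (∀ K : Set ℂ, IsCompact K → (P ∩ K).Finite) ∧
  (∀ z : ℂ, R < ‖z‖ → z ∉ P → AnalyticAt ℂ A z) ∧
  ∀ p ∈ P, Tendsto (fun z => ‖A z‖) (nhdsWithin p Pᶜ) atTop

/-- `A` (meromorphic near ∞ with pole set `P`) has an essential singularity at infinity: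
it is not the case that the poles are bounded and `A(z) ~ c zⁿ` as `z → ∞`. -/
def EssSingAtInfty (A : ℂ → ℂ) (P : Set ℂ) : Prop :=
  ¬ (IsBounded P ∧ ∃ (n : ℤ) (c : ℂ), c ≠ 0 ∧
      Tendsto (fun z : ℂ => A z / z ^ n)
        (Filter.comap (fun z : ℂ => ‖z‖) atTop ⊓ Filter.principal Pᶜ) (nhds c))

/-- The logarithmic rectangle `D(z_r, L)` of Definition 2.1. -/
def WVDisk (z₀ : ℂ) (Nr phir L : ℝ) : Set ℂ :=
  {z : ℂ | ∃ τ : ℂ, z = z₀ * Complex.exp τ ∧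
    |τ.re| ≤ L * phir / Nr ∧ |τ.im| ≤ L * phir / Nr}

/-- Data witnessing the Wiman-Valiron property for `A`, meromorphic in `R ≤ |z| < ∞`:
an unbounded set `F1 ⊆ [R,∞)`, functions `N : F1 → [2,∞)`, `phi : F1 → [1,∞)` and points
`zr r` with `|zr r| = r`, such that `N(r) → ∞`, `phi(r)/N(r) → 0`, `phi(r)/log N(r) → ∞`,
`phi(r) = o(log⁺ |A(zr r)|)`, and `A(z) ~ (z/zr r)^{N(r)} A(zr r)` on `D(zr r, 8)`,
uniformly as `r → ∞` in `F1`.  (For `z = zr r · e^τ` one has `(z/zr r)^{N(r)} = e^{N(r)τ}`.) -/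
structure WVData (A : ℂ → ℂ) (R : ℝ) where
  F1 : Set ℝ
  N : ℝ → ℝ
  phi : ℝ → ℝ
  zr : ℝ → ℂ
  F1_sub : F1 ⊆ Ici R
  F1_unbounded : ∀ c : ℝ, ∃ r ∈ F1, c < r
  N_ge : ∀ r ∈ F1, 2 ≤ N r
  phi_ge : ∀ r ∈ F1, 1 ≤ phi r
  N_tendsto : Tendsto N (atTop ⊓ Filter.principal F1) atTop
  phi_over_N : Tendsto (fun r => phi r / N r) (atTop ⊓ Filter.principal F1) (nhds 0)
  phi_over_logN : Tendsto (fun r => phi r / Real.log (N r)) (atTop ⊓ Filter.principal F1) atTop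
  zr_abs : ∀ r ∈ F1, ‖zr r‖ = r
  phi_small : Tendsto (fun r => phi r / Real.log (max 1 (‖A (zr r)‖)))
      (atTop ⊓ Filter.principal F1) (nhds 0)
  approx : ∀ ε : ℝ, 0 < ε → ∀ᶠ r in atTop ⊓ Filter.principal F1, ∀ τ : ℂ,
      |τ.re| ≤ 8 * phi r / N r → |τ.im| ≤ 8 * phi r / N r →
      ‖A (zr r * Complex.exp τ) - Complex.exp ((N r : ℂ) * τ) * A (zr r)‖
        ≤ ε * ‖Complex.exp ((N r : ℂ) * τ) * A (zr r)‖

/-- `A` has the Wiman-Valiron property (Definition 2.1). -/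
def HasWVProp (A : ℂ → ℂ) (R : ℝ) : Prop := Nonempty (WVData A R)

/-- The point `w_r = z_r exp(-4 phi(r)/N(r))`. -/
def WVwr {A : ℂ → ℂ} {R : ℝ} (W : WVData A R) (r : ℝ) : ℂ :=
  W.zr r * Complex.exp (((-(4 * W.phi r / W.N r) : ℝ) : ℂ))

/-- The quantity `Z_r = |2 z_r A(z_r)^{1/2} / (N(r)+2)|`. -/
def WVZr {A : ℂ → ℂ} {R : ℝ} (W : WVData A R) (r : ℝ) : ℝ :=
  2 * r * Real.sqrt (‖A (W.zr r)‖) / (W.N r + 2)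

/-- The data of an analytic branch `sqA r` of `A^{1/2}` on `D(z_r, 4)` together with the
primitive `Z r` of `A^{1/2}` with `Z r (w_r) = 2 w_r A(w_r)^{1/2}/(N+2)`; this encodes
`Z(z) = 2 w_r A(w_r)^{1/2}/(N+2) + ∫_{w_r}^z A(t)^{1/2} dt`. -/
def IsZData {A : ℂ → ℂ} {R : ℝ} (W : WVData A R) (sqA Z : ℝ → ℂ → ℂ) (r : ℝ) : Prop :=
  (∀ z ∈ WVDisk (W.zr r) (W.N r) (W.phi r) 4,
      (sqA r z) ^ 2 = A z ∧ AnalyticAt ℂ (sqA r) z ∧ HasDerivAt (Z r) (sqA r z) z) ∧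
  Z r (WVwr W r) = 2 * WVwr W r * sqA r (WVwr W r) / ((W.N r : ℂ) + 2)

/-- The closed logarithmic rectangle `J₁ = {Z : |log|Z/Z_r|| ≤ phi(r), |arg Z| ≤ π/4}`. -/
def J1 (Zr phir : ℝ) : Set ℂ :=
  {w : ℂ | w ≠ 0 ∧ |Real.log (‖w‖ / Zr)| ≤ phir ∧ |Complex.arg w| ≤ Real.pi / 4}

/-! ### ε-sets -/

/-- An ε-set: a countable union of discs `B(b_j, ρ_j)` with `|b_j| → ∞` and
`Σ ρ_j/|b_j| < ∞`. -/
def IsEpsilonSet (E : Set ℂ) : Prop :=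
  ∃ (b : ℕ → ℂ) (ρ : ℕ → ℝ), (∀ j, 0 ≤ ρ j) ∧
    Tendsto (fun j => ‖b j‖) atTop atTop ∧
    Summable (fun j => ρ j / ‖b j‖) ∧
    E = ⋃ j, Metric.ball (b j) (ρ j)


-- HELPERS

section

lemma exp_one_const {X : Type*} [TopologicalSpace X] {s : Set X} (hs : IsPreconnected s) {F : X → ℂ}
    (hF : ContinuousOn F s) (h1 : ∀ x ∈ s, Complex.exp (F x) = 1) {x y : X} (hx : x ∈ s)
    (hy : y ∈ s) : F x = F y := by
  have hd : DiscreteTopology {z : ℂ | Complex.exp z = 1} := by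
    apply DiscreteTopology.of_forall_le_dist (r := 1) one_pos
    rintro ⟨a, ha⟩ ⟨b, hb⟩ hab
    obtain ⟨m, hm⟩ := Complex.exp_eq_one_iff.1 ha
    obtain ⟨n, hn⟩ := Complex.exp_eq_one_iff.1 hb
    have hmn : m ≠ n := by rintro rfl; exact hab (by simp [hm, hn])
    show 1 ≤ dist a b
    rw [hm, hn, dist_eq_norm, ← sub_mul, norm_mul]
    have h2 : (1:ℝ) ≤ ‖((m:ℂ) - n)‖ := by
      have : (1:ℤ) ≤ |m - n| := Int.one_le_abs (sub_ne_zero.2 hmn)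
      have h3 : ((m:ℂ) - n) = ((m - n : ℤ) : ℂ) := by push_cast; ring
      rw [h3, Complex.norm_intCast]; exact_mod_cast this
    have h4 : (1:ℝ) ≤ ‖(2 * Real.pi * Complex.I : ℂ)‖ := by
      simp [abs_of_pos Real.pi_pos]; linarith [Real.pi_gt_three]
    nlinarith
  exact hs.constant_of_mapsTo ⟨hd⟩ hF (T := {z : ℂ | Complex.exp z = 1}) h1 hx hy

/-- zero winding number -/
def WZ (J : ℝ → ℂ) (q : ℂ) : Prop :=
  ∃ L : ℝ → ℂ, ContinuousOn L (Icc 0 1) ∧ (∀ t ∈ Icc (0:ℝ) 1, Complex.exp (L t) = J t - q) ∧ L 0 = L 1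

lemma WZ_near {J : ℝ → ℂ} (hJ : ContinuousOn J (Icc 0 1)) (hl : J 0 = J 1) {q q' : ℂ}
    (h : ∀ t ∈ Icc (0:ℝ) 1, ‖q - q'‖ < ‖J t - q‖) (hq : WZ J q) : WZ J q' := by
  obtain ⟨L, hL, hLe, hL1⟩ := hq
  have hne : ∀ t ∈ Icc (0:ℝ) 1, J t - q ≠ 0 := fun t ht h0 => by
    have := h t ht; rw [h0, norm_zero] at this; linarith [norm_nonneg (q - q')]
  have hs : ∀ t ∈ Icc (0:ℝ) 1, (J t - q') / (J t - q) ∈ Complex.slitPlane := by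
    intro t ht
    have : (J t - q') / (J t - q) = 1 + (q - q') / (J t - q) := by
      field_simp [hne t ht]; ring
    rw [this]
    apply Complex.mem_slitPlane_of_norm_lt_one
    rw [norm_div, div_lt_one (norm_pos_iff.2 (hne t ht))]; exact h t ht
  refine ⟨fun t => L t + Complex.log ((J t - q') / (J t - q)), ?_, ?_, ?_⟩
  · refine hL.add (ContinuousOn.clog ?_ hs)
    exact (hJ.sub continuousOn_const).div (hJ.sub continuousOn_const) hne
  · intro t ht
    rw [Complex.exp_add, hLe t ht, Complex.exp_log (Complex.slitPlane_ne_zero (hs t ht))]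
    field_simp [hne t ht]
  · simp only [hL1, hl]

lemma WZ_of_unbounded {J : ℝ → ℂ} (hJ : ContinuousOn J (Icc 0 1)) (hl : J 0 = J 1) {K : Set ℂ}
    (hK : IsPreconnected K) (hu : ¬ IsBounded K) (hd : ∀ t ∈ Icc (0:ℝ) 1, J t ∉ K) {q : ℂ}
    (hq : q ∈ K) : WZ J q := by
  have hc : IsCompact (J '' Icc 0 1) := isCompact_Icc.image_of_continuousOn hJ
  have hne : (J '' Icc 0 1).Nonempty := ⟨J 0, 0, by simp, rfl⟩
  obtain ⟨R, hR⟩ := hc.isBounded.exists_norm_le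
  have hfar : ∃ p ∈ K, WZ J p := by
    by_contra hno
    push Not at hno
    apply hu
    refine (Metric.isBounded_closedBall (x := (0:ℂ)) (r := |R| + 1)).subset fun p hp => ?_
    by_contra hpf
    apply hno p hp
    have hpR : |R| + 1 < ‖p‖ := by simpa using hpf
    have hp0 : p ≠ 0 := by rintro rfl; simp at hpR; linarith [abs_nonneg R]
    have hs : ∀ t ∈ Icc (0:ℝ) 1, 1 + (- J t / p) ∈ Complex.slitPlane := by
      intro t ht
      apply Complex.mem_slitPlane_of_norm_lt_one
      rw [norm_div, norm_neg, div_lt_one (norm_pos_iff.2 hp0)]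
      have := hR _ (mem_image_of_mem J ht)
      linarith [le_abs_self R]
    refine ⟨fun t => Complex.log (-p) + Complex.log (1 + (- J t / p)), ?_, ?_, ?_⟩
    · exact continuousOn_const.add (ContinuousOn.clog (continuousOn_const.add (hJ.neg.div_const p)) hs)
    · intro t ht
      rw [Complex.exp_add, Complex.exp_log (neg_ne_zero.2 hp0),
        Complex.exp_log (Complex.slitPlane_ne_zero (hs t ht))]
      field_simp
      ring
    · simp only [hl]
  have hpos : ∀ x ∈ K, 0 < Metric.infDist x (J '' Icc 0 1) := by
    intro x hx
    rw [← hc.isClosed.notMem_iff_infDist_pos hne]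
    rintro ⟨t, ht, rfl⟩
    exact hd t ht hx
  have hdist : ∀ x, ∀ t ∈ Icc (0:ℝ) 1, Metric.infDist x (J '' Icc 0 1) ≤ ‖J t - x‖ := by
    intro x t ht
    rw [← dist_eq_norm, dist_comm]
    exact Metric.infDist_le_dist_of_mem (mem_image_of_mem J ht)
  obtain ⟨p, hpK, hp⟩ := hfar
  by_contra hqn
  have key : ∀ x ∈ K, ∀ y, dist y x < Metric.infDist x (J '' Icc 0 1) / 2 → (WZ J x ↔ WZ J y) := by
    intro x hx y hy
    have h0 := hpos x hx
    constructor
    · refine WZ_near hJ hl fun t ht => ?_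
      have := hdist x t ht
      rw [dist_comm, dist_eq_norm] at hy
      linarith
    · refine WZ_near hJ hl fun t ht => ?_
      have h1 := hdist x t ht
      have h2 : ‖J t - x‖ ≤ ‖J t - y‖ + ‖y - x‖ := by
        have := norm_add_le (J t - y) (y - x); simpa using this
      rw [dist_eq_norm] at hy
      linarith
  let U1 : Set ℂ := ⋃ x ∈ {x ∈ K | WZ J x}, Metric.ball x (Metric.infDist x (J '' Icc 0 1) / 2)
  let U2 : Set ℂ := ⋃ x ∈ {x ∈ K | ¬ WZ J x}, Metric.ball x (Metric.infDist x (J '' Icc 0 1) / 2)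
  have h1 : IsOpen U1 := isOpen_biUnion fun _ _ => Metric.isOpen_ball
  have h2 : IsOpen U2 := isOpen_biUnion fun _ _ => Metric.isOpen_ball
  have hm : ∀ x ∈ K, x ∈ Metric.ball x (Metric.infDist x (J '' Icc 0 1) / 2) := fun x hx =>
    Metric.mem_ball_self (half_pos (hpos x hx))
  obtain ⟨y, hy, hy1, hy2⟩ := hK U1 U2 h1 h2 (by
      intro x hx
      by_cases hw : WZ J x
      · exact Or.inl (mem_biUnion (show x ∈ {x ∈ K | WZ J x} from ⟨hx, hw⟩) (hm x hx))
      · exact Or.inr (mem_biUnion (show x ∈ {x ∈ K | ¬ WZ J x} from ⟨hx, hw⟩) (hm x hx)))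
      ⟨p, hpK, mem_biUnion (show p ∈ {x ∈ K | WZ J x} from ⟨hpK, hp⟩) (hm p hpK)⟩
      ⟨q, hq, mem_biUnion (show q ∈ {x ∈ K | ¬ WZ J x} from ⟨hq, hqn⟩) (hm q hq)⟩
  simp only [U1, U2, mem_iUnion] at hy1 hy2
  obtain ⟨x1, hx1, hb1⟩ := hy1
  obtain ⟨x2, hx2, hb2⟩ := hy2
  exact hx2.2 ((key x2 hx2.1 y hb2).2 ((key x1 hx1.1 y hb1).1 hx1.2))

theorem crossing {J : ℝ → ℂ} (hJ : ContinuousOn J (Icc 0 1)) (hl : J 0 = J 1) {K1 K2 : Set ℂ}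
    (hK1 : IsPreconnected K1) (hu1 : ¬ IsBounded K1) (hd1 : ∀ t ∈ Icc (0:ℝ) 1, J t ∉ K1)
    (hK2 : IsPreconnected K2) (hu2 : ¬ IsBounded K2) (hd2 : ∀ t ∈ Icc (0:ℝ) 1, J t ∉ K2)
    {a b : ℝ} (ha : 0 < a) (hb : 0 < b) (hq1 : J 0 + a ∈ K1) (hq2 : J 0 - b ∈ K2)
    (hseg : ∀ t ∈ Ioo (0:ℝ) 1, (J t).im = (J 0).im → (J t).re ∈ Icc ((J 0).re - b) ((J 0).re + a) → False)
    {η : ℝ} (hη : 0 < η) (hη1 : η < 1)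
    (h0 : ∀ t ∈ Ioo (0:ℝ) η, (J 0).im < (J t).im) (h1 : ∀ t ∈ Ioo (1 - η) 1, (J t).im < (J 0).im) :
    False := by
  obtain ⟨L1, hL1, hLe1, hc1⟩ := WZ_of_unbounded hJ hl hK1 hu1 hd1 hq1
  obtain ⟨L2, hL2, hLe2, hc2⟩ := WZ_of_unbounded hJ hl hK2 hu2 hd2 hq2
  set ρ : ℝ → ℂ := fun t => (J t - (J 0 + a)) / (J t - (J 0 - b)) with hρ
  have hne1 : ∀ t ∈ Icc (0:ℝ) 1, J t - (J 0 + a) ≠ 0 := fun t ht => by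
    rw [← hLe1 t ht]; exact Complex.exp_ne_zero _
  have hne2 : ∀ t ∈ Icc (0:ℝ) 1, J t - (J 0 - b) ≠ 0 := fun t ht => by
    rw [← hLe2 t ht]; exact Complex.exp_ne_zero _
  have hρc : ContinuousOn ρ (Icc 0 1) :=
    (hJ.sub continuousOn_const).div (hJ.sub continuousOn_const) hne2
  have hexp : ∀ t ∈ Icc (0:ℝ) 1, Complex.exp (L1 t - L2 t) = ρ t := fun t ht => by
    rw [Complex.exp_sub, hLe1 t ht, hLe2 t ht]
  have him : ∀ t, (ρ t).im = (a + b) * ((J t).im - (J 0).im) / Complex.normSq (J t - (J 0 - b)) := by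
    intro t
    simp only [hρ, Complex.div_im, Complex.sub_re, Complex.sub_im, Complex.add_re, Complex.add_im,
      Complex.ofReal_re, Complex.ofReal_im]
    ring
  have hre : ∀ t, (J t).im = (J 0).im → (ρ t).re = ((J t).re - (J 0).re - a) * ((J t).re - (J 0).re + b) / Complex.normSq (J t - (J 0 - b)) := by
    intro t ht
    simp only [hρ, Complex.div_re, Complex.sub_re, Complex.sub_im, Complex.add_re, Complex.add_im,
      Complex.ofReal_re, Complex.ofReal_im, ht]
    ring
  have hnp : ∀ t ∈ Icc (0:ℝ) 1, 0 < Complex.normSq (J t - (J 0 - b)) := fun t ht =>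
    Complex.normSq_pos.2 (hne2 t ht)
  have hslit : ∀ t ∈ Ioo (0:ℝ) 1, ρ t ∈ Complex.slitPlane := by
    intro t ht
    have ht' := Ioo_subset_Icc_self ht
    rw [Complex.mem_slitPlane_iff]
    by_cases hi : (J t).im = (J 0).im
    · left
      rw [hre t hi]
      apply div_pos _ (hnp t ht')
      by_contra hneg
      push Not at hneg
      apply hseg t ht hi
      constructor <;> by_contra hcon <;> push Not at hcon <;> nlinarith
    · right
      rw [him t]
      exact div_ne_zero (mul_ne_zero (by positivity) (sub_ne_zero.2 hi)) (hnp t ht').ne'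
  have hlog : ContinuousOn (fun t => Complex.log (ρ t) - (L1 t - L2 t)) (Ioo 0 1) :=
    (ContinuousOn.clog (hρc.mono Ioo_subset_Icc_self) hslit).sub
      ((hL1.sub hL2).mono Ioo_subset_Icc_self)
  have hconst : ∀ t ∈ Ioo (0:ℝ) 1, Complex.log (ρ t) - (L1 t - L2 t)
      = Complex.log (ρ (1/2)) - (L1 (1/2) - L2 (1/2)) := by
    intro t ht
    refine exp_one_const (isPreconnected_Ioo) hlog ?_ ht (by norm_num)
    intro x hx
    rw [Complex.exp_sub, hexp x (Ioo_subset_Icc_self hx),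
      Complex.exp_log (Complex.slitPlane_ne_zero (hslit x hx)),
      div_self (Complex.slitPlane_ne_zero (hslit x hx))]
  set c := Complex.log (ρ (1/2)) - (L1 (1/2) - L2 (1/2)) with hcdef
  have hρ0 : ρ 0 = ((-(a / b) : ℝ) : ℂ) := by simp only [hρ]; push_cast; field_simp; ring
  have hρ1 : ρ 1 = ρ 0 := by simp only [hρ, hl]
  have hneg : (ρ 0).re < 0 := by rw [hρ0, Complex.ofReal_re]; simp; positivity
  have hz : (ρ 0).im = 0 := by rw [hρ0, Complex.ofReal_im]
  have hm0 : ∀ᶠ t in 𝓝[>] (0:ℝ), t ∈ Ioo (0:ℝ) η := Ioo_mem_nhdsGT hη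
  have hm1 : ∀ᶠ t in 𝓝[<] (1:ℝ), t ∈ Ioo (1-η:ℝ) 1 := Ioo_mem_nhdsLT (by linarith)
  have lim0 : Tendsto ρ (𝓝[>] 0) (𝓝 (ρ 0)) :=
    ((hρc 0 (by simp)).mono_of_mem_nhdsWithin (Icc_mem_nhdsGE one_pos)).tendsto.mono_left
      (nhdsWithin_mono _ Ioi_subset_Ici_self)
  have lim1 : Tendsto ρ (𝓝[<] 1) (𝓝 (ρ 0)) := by
    rw [← hρ1]
    exact ((hρc 1 (by simp)).mono_of_mem_nhdsWithin (Icc_mem_nhdsLE one_pos)).tendsto.mono_left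
      (nhdsWithin_mono _ Iio_subset_Iic_self)
  have l0 : Tendsto (fun t => L1 t - L2 t) (𝓝[>] 0) (𝓝 (L1 0 - L2 0)) :=
    (((hL1.sub hL2) 0 (by simp)).mono_of_mem_nhdsWithin (Icc_mem_nhdsGE one_pos)).tendsto.mono_left
      (nhdsWithin_mono _ Ioi_subset_Ici_self)
  have l1 : Tendsto (fun t => L1 t - L2 t) (𝓝[<] 1) (𝓝 (L1 0 - L2 0)) := by
    rw [hc1, hc2]
    exact (((hL1.sub hL2) 1 (by simp)).mono_of_mem_nhdsWithin (Icc_mem_nhdsLE one_pos)).tendsto.mono_left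
      (nhdsWithin_mono _ Iio_subset_Iic_self)
  have g0 : Tendsto (fun t => Complex.log (ρ t)) (𝓝[>] 0) (𝓝 (Real.log ‖ρ 0‖ + Real.pi * Complex.I)) := by
    refine (Complex.tendsto_log_nhdsWithin_im_nonneg_of_re_neg_of_im_zero hneg hz).comp ?_
    refine tendsto_nhdsWithin_iff.2 ⟨lim0, ?_⟩
    filter_upwards [hm0] with t ht
    show 0 ≤ (ρ t).im
    rw [him t]
    have := hnp t ⟨ht.1.le, (ht.2.trans hη1).le⟩
    have := h0 t ht
    apply div_nonneg _ (by linarith)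
    apply mul_nonneg <;> linarith
  have g1 : Tendsto (fun t => Complex.log (ρ t)) (𝓝[<] 1) (𝓝 (Real.log ‖ρ 0‖ - Real.pi * Complex.I)) := by
    refine (Complex.tendsto_log_nhdsWithin_im_neg_of_re_neg_of_im_zero hneg hz).comp ?_
    refine tendsto_nhdsWithin_iff.2 ⟨lim1, ?_⟩
    filter_upwards [hm1] with t ht
    show (ρ t).im < 0
    rw [him t]
    have := hnp t ⟨by linarith [ht.1], ht.2.le⟩
    have := h1 t ht
    apply div_neg_of_neg_of_pos _ (by linarith)
    apply mul_neg_of_pos_of_neg <;> linarith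
  have e0 : (Real.log ‖ρ 0‖ + Real.pi * Complex.I) - (L1 0 - L2 0) = c := by
    refine tendsto_nhds_unique (g0.sub l0) ?_
    refine tendsto_const_nhds.congr' ?_
    filter_upwards [hm0] with t ht
    exact (hconst t ⟨ht.1, ht.2.trans hη1⟩).symm
  have e1 : (Real.log ‖ρ 0‖ - Real.pi * Complex.I) - (L1 0 - L2 0) = c := by
    refine tendsto_nhds_unique (g1.sub l1) ?_
    refine tendsto_const_nhds.congr' ?_
    filter_upwards [hm1] with t ht
    exact (hconst t ⟨by linarith [ht.1], ht.2⟩).symm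
  have : (2 * Real.pi * Complex.I : ℂ) = 0 := by linear_combination e0 - e1
  exact Complex.two_pi_I_ne_zero this

end

section

def v1 : Option ℂ → ℂ
  | none => 1
  | some a => a / (Real.sqrt (1 + ‖a‖ ^ 2) : ℝ)

def v2 : Option ℂ → ℂ
  | none => 0
  | some a => 1 / (Real.sqrt (1 + ‖a‖ ^ 2) : ℝ)

lemma sq1_pos (a : ℂ) : 0 < Real.sqrt (1 + ‖a‖ ^ 2) := Real.sqrt_pos.2 (by positivity)

lemma v_norm (a : Option ℂ) : ‖v1 a‖ ^ 2 + ‖v2 a‖ ^ 2 = 1 := by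
  cases a with
  | none => simp [v1, v2]
  | some a =>
    have h := sq1_pos a
    have h2 : Real.sqrt (1 + ‖a‖ ^ 2) ^ 2 = 1 + ‖a‖ ^ 2 := Real.sq_sqrt (by positivity)
    simp only [v1, v2, norm_div, norm_one, Complex.norm_real, Real.norm_eq_abs, abs_of_pos h, div_pow, h2]
    field_simp
    ring

lemma chordal_eq (a b : Option ℂ) : chordal a b = ‖v1 a * v2 b - v2 a * v1 b‖ := by
  rcases a with _ | a <;> rcases b with _ | b <;>
    simp only [chordal, v1, v2]
  · simp
  · simp [abs_of_nonneg (Real.sqrt_nonneg _)]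
  · simp [abs_of_nonneg (Real.sqrt_nonneg _)]
  · have ha := sq1_pos a
    have hb := sq1_pos b
    have ha' : ((Real.sqrt (1 + ‖a‖ ^ 2) : ℝ) : ℂ) ≠ 0 := by exact_mod_cast ha.ne'
    have hb' : ((Real.sqrt (1 + ‖b‖ ^ 2) : ℝ) : ℂ) ≠ 0 := by exact_mod_cast hb.ne'
    rw [Real.sqrt_mul (by positivity)]
    have : a / ((Real.sqrt (1 + ‖a‖ ^ 2) : ℝ) : ℂ) * (1 / ((Real.sqrt (1 + ‖b‖ ^ 2) : ℝ) : ℂ)) - 1 / ((Real.sqrt (1 + ‖a‖ ^ 2) : ℝ) : ℂ) * (b / ((Real.sqrt (1 + ‖b‖ ^ 2) : ℝ) : ℂ)) = (a - b) / (((Real.sqrt (1 + ‖a‖ ^ 2) : ℝ) : ℂ) * ((Real.sqrt (1 + ‖b‖ ^ 2) : ℝ) : ℂ)) := by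
      field_simp
    rw [this, norm_div, norm_mul, Complex.norm_real, Complex.norm_real, Real.norm_eq_abs,
      Real.norm_eq_abs, abs_of_pos ha, abs_of_pos hb]

lemma chordal_nonneg (a b : Option ℂ) : 0 ≤ chordal a b := by rw [chordal_eq]; exact norm_nonneg _

lemma chordal_comm (a b : Option ℂ) : chordal a b = chordal b a := by
  rw [chordal_eq, chordal_eq, ← norm_neg]; congr 1; ring

lemma chordal_self (a : Option ℂ) : chordal a a = 0 := by
  rw [chordal_eq, norm_eq_zero]; ring

lemma chordal_eq_zero {a b : Option ℂ} (h : chordal a b = 0) : a = b := by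
  rcases a with _ | a <;> rcases b with _ | b <;> simp only [chordal] at h
  · rfl
  · exact absurd h (one_div_pos.2 (sq1_pos b)).ne'
  · exact absurd h (one_div_pos.2 (sq1_pos a)).ne'
  · have h2 : Real.sqrt ((1 + ‖a‖ ^ 2) * (1 + ‖b‖ ^ 2)) ≠ 0 := (Real.sqrt_pos.2 (by positivity)).ne'
    have := (div_eq_zero_iff.1 h).resolve_right h2
    rw [norm_eq_zero, sub_eq_zero] at this
    rw [this]

lemma inner_le {a1 a2 b1 b2 : ℂ} (ha : ‖a1‖ ^ 2 + ‖a2‖ ^ 2 = 1) (hb : ‖b1‖ ^ 2 + ‖b2‖ ^ 2 = 1) :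
    ‖a1 * b1 + a2 * b2‖ ≤ 1 := by
  refine (norm_add_le _ _).trans ?_
  rw [norm_mul, norm_mul]
  nlinarith [sq_nonneg (‖a1‖ - ‖b1‖), sq_nonneg (‖a2‖ - ‖b2‖)]

lemma chordal_le_one (a b : Option ℂ) : chordal a b ≤ 1 := by
  rw [chordal_eq, sub_eq_add_neg, ← mul_neg]
  exact inner_le (v_norm a) (by rw [norm_neg, add_comm]; exact v_norm b)

lemma chordal_tri (c a b : Option ℂ) : chordal a b ≤ chordal c a + chordal c b := by
  rw [chordal_eq, chordal_eq, chordal_eq]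
  have h1 : (starRingEnd ℂ) (v1 c) * v1 c + (starRingEnd ℂ) (v2 c) * v2 c = 1 := by
    rw [mul_comm, Complex.mul_conj, mul_comm, Complex.mul_conj, Complex.normSq_eq_norm_sq,
      Complex.normSq_eq_norm_sq]; exact_mod_cast v_norm c
  have key : v1 a * v2 b - v2 a * v1 b =
      (v1 c * v2 b - v2 c * v1 b) * ((starRingEnd ℂ) (v1 c) * v1 a + (starRingEnd ℂ) (v2 c) * v2 a)
      - (v1 c * v2 a - v2 c * v1 a) * ((starRingEnd ℂ) (v1 c) * v1 b + (starRingEnd ℂ) (v2 c) * v2 b) := by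
    linear_combination (-(v1 a * v2 b - v2 a * v1 b)) * h1
  have hc : ‖(starRingEnd ℂ) (v1 c)‖ ^ 2 + ‖(starRingEnd ℂ) (v2 c)‖ ^ 2 = 1 := by
    simp only [RCLike.norm_conj]; exact v_norm c
  rw [key]
  refine (norm_sub_le _ _).trans ?_
  rw [norm_mul, norm_mul, add_comm]
  exact add_le_add (mul_le_of_le_one_right (norm_nonneg _) (inner_le hc (v_norm b)))
    (mul_le_of_le_one_right (norm_nonneg _) (inner_le hc (v_norm a)))

/-- homogeneous representation of the value at `w` -/
def HRep (g : ℂ → ℂ) (P : Set ℂ) (y1 y2 : ℂ → ℂ) (w : ℂ) : Prop :=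
  (y1 w ≠ 0 ∨ y2 w ≠ 0) ∧ (w ∈ P ↔ y2 w = 0) ∧ (w ∉ P → y1 w = g w * y2 w)

lemma HRep.norm_pos {g : ℂ → ℂ} {P : Set ℂ} {y1 y2 : ℂ → ℂ} {w : ℂ} (h : HRep g P y1 y2 w) :
    0 < ‖y1 w‖ ^ 2 + ‖y2 w‖ ^ 2 := by
  rcases h.1 with h | h
  · have := norm_pos_iff.2 h; positivity
  · have := norm_pos_iff.2 h; positivity

lemma HRep.chordal {g : ℂ → ℂ} {P : Set ℂ} {y1 y2 : ℂ → ℂ} {w : ℂ} (h : HRep g P y1 y2 w)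
    (a : Option ℂ) : chordal (valueAt g P w) a =
      ‖y1 w * v2 a - y2 w * v1 a‖ / Real.sqrt (‖y1 w‖ ^ 2 + ‖y2 w‖ ^ 2) := by
  rw [chordal_eq]
  by_cases hw : w ∈ P
  · have h2 := h.2.1.1 hw
    have h1 : y1 w ≠ 0 := h.1.resolve_right (by simpa using h2)
    have h1' := norm_pos_iff.2 h1
    simp [valueAt, hw, v1, v2, h2, Real.sqrt_sq h1'.le]
    field_simp
  · have h2 : y2 w ≠ 0 := fun h0 => hw (h.2.1.2 h0)
    have h2' := norm_pos_iff.2 h2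
    rw [h.2.2 hw]
    have e1 : ‖g w * y2 w‖ ^ 2 + ‖y2 w‖ ^ 2 = ‖y2 w‖ ^ 2 * (1 + ‖g w‖ ^ 2) := by
      rw [norm_mul]; ring
    have hs := sq1_pos (g w)
    have hs' : ((Real.sqrt (1 + ‖g w‖ ^ 2) : ℝ) : ℂ) ≠ 0 := by exact_mod_cast hs.ne'
    have e2 : g w * y2 w * v2 a - y2 w * v1 a = y2 w * (g w * v2 a - v1 a) := by ring
    rw [e1, e2, Real.sqrt_mul (by positivity), Real.sqrt_sq h2'.le, norm_mul,
      mul_div_mul_left _ _ h2'.ne']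
    have e4 : valueAt g P w = some (g w) := by simp [valueAt, hw]
    rw [e4]
    change ‖g w / ((Real.sqrt (1 + ‖g w‖ ^ 2) : ℝ) : ℂ) * v2 a - 1 / ((Real.sqrt (1 + ‖g w‖ ^ 2) : ℝ) : ℂ) * v1 a‖ = _
    have e3 : g w / ((Real.sqrt (1 + ‖g w‖ ^ 2) : ℝ) : ℂ) * v2 a - 1 / ((Real.sqrt (1 + ‖g w‖ ^ 2) : ℝ) : ℂ) * v1 a = (g w * v2 a - v1 a) / ((Real.sqrt (1 + ‖g w‖ ^ 2) : ℝ) : ℂ) := by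
      field_simp
    rw [e3, norm_div, Complex.norm_real, Real.norm_eq_abs, abs_of_pos hs]

structure Pk (g : ℂ → ℂ) (P : Set ℂ) (S : Set (Option ℂ)) (M : ℕ) : Prop where
  mero : MeroPlane g P
  fin : S.Finite
  inf : none ∈ S
  crit : CriticalValues g P ⊆ S
  asym : ∀ a γ, AsymptoticPath g P a γ → a ∈ S
  mult : ∀ z μ, MultiplePointWithMult g z μ → μ ≤ M
  hM : 0 < M
  ncst : ∀ z, ¬ ∀ᶠ w in 𝓝[≠] z, deriv g w = 0

lemma MeroPlane.isolated {g : ℂ → ℂ} {P : Set ℂ} (h : MeroPlane g P) (z : ℂ) :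
    ∀ᶠ w in 𝓝[≠] z, w ∉ P := by
  have hf := h.1 _ (isCompact_closedBall z 1)
  have h1 : ((P ∩ Metric.closedBall z 1) \ ({z} : Set ℂ))ᶜ ∈ 𝓝 z :=
    (hf.subset sdiff_subset).isClosed.isOpen_compl.mem_nhds (by simp)
  rw [eventually_nhdsWithin_iff]
  filter_upwards [h1, Metric.closedBall_mem_nhds z one_pos] with w hw hw1 hwz hwP
  exact hw ⟨⟨hwP, hw1⟩, hwz⟩

lemma MeroPlane.isClosed {g : ℂ → ℂ} {P : Set ℂ} (h : MeroPlane g P) : IsClosed P := by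
  rw [← isOpen_compl_iff, isOpen_iff_mem_nhds]
  intro z hz
  filter_upwards [eventually_nhdsWithin_iff.1 (h.isolated z)] with w hw
  by_cases hwz : w = z
  · rw [hwz]; exact hz
  · exact hw hwz

lemma MeroPlane.exists_inv {g : ℂ → ℂ} {P : Set ℂ} (h : MeroPlane g P) {p : ℂ} (hp : p ∈ P) :
    ∃ G : ℂ → ℂ, AnalyticAt ℂ G p ∧ G p = 0 ∧ ∀ᶠ z in 𝓝[≠] p, z ∉ P ∧ G z ≠ 0 ∧ g z = (G z)⁻¹ := by
  have hiso := h.isolated p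
  have hle : 𝓝[≠] p ≤ 𝓝[Pᶜ] p := le_inf inf_le_left (le_principal_iff.2 hiso)
  have ht : Tendsto (fun z => ‖g z‖) (𝓝[≠] p) atTop := (h.2.2 p hp).mono_left hle
  have ht0 : Tendsto (fun z => (g z)⁻¹) (𝓝[≠] p) (𝓝 0) :=
    tendsto_inv₀_cobounded.comp (tendsto_norm_atTop_iff_cobounded.1 ht)
  have hne : ∀ᶠ z in 𝓝[≠] p, g z ≠ 0 := by
    filter_upwards [ht.eventually_gt_atTop 0] with z hz
    exact norm_pos_iff.1 hz
  refine ⟨Function.update (fun z => (g z)⁻¹) p 0, ?_, by simp, ?_⟩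
  · apply Complex.analyticAt_of_differentiable_on_punctured_nhds_of_continuousAt
    · filter_upwards [hiso, hne, self_mem_nhdsWithin] with z hz hz0 hzp
      have h1 : DifferentiableAt ℂ (fun z => (g z)⁻¹) z := (h.2.1 z hz).differentiableAt.inv hz0
      refine h1.congr_of_eventuallyEq ?_
      filter_upwards [isOpen_ne.mem_nhds hzp] with y hy
      exact Function.update_of_ne hy _ _
    · exact continuousAt_update_same.2 ht0
  · filter_upwards [hiso, hne, self_mem_nhdsWithin] with z hz hz0 hzp
    rw [Function.update_of_ne hzp]
    exact ⟨hz, inv_ne_zero hz0, (inv_inv _).symm⟩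

lemma MeroPlane.exists_rep {g : ℂ → ℂ} {P : Set ℂ} (h : MeroPlane g P) (z : ℂ) :
    ∃ y1 y2 : ℂ → ℂ, AnalyticAt ℂ y1 z ∧ AnalyticAt ℂ y2 z ∧ ∀ᶠ w in 𝓝 z, HRep g P y1 y2 w := by
  by_cases hz : z ∈ P
  · obtain ⟨G, hG, hG0, hGe⟩ := h.exists_inv hz
    refine ⟨fun _ => 1, G, analyticAt_const, hG, ?_⟩
    filter_upwards [eventually_nhdsWithin_iff.1 hGe] with w hw
    by_cases hwz : w = z
    · subst hwz; exact ⟨Or.inl one_ne_zero, ⟨fun _ => hG0, fun _ => hz⟩, fun h => absurd hz h⟩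
    · obtain ⟨a, b, c⟩ := hw hwz
      exact ⟨Or.inl one_ne_zero, ⟨fun h => absurd h a, fun h => absurd h b⟩, fun _ => by
        rw [c, inv_mul_cancel₀ b]⟩
  · refine ⟨g, fun _ => 1, h.2.1 z hz, analyticAt_const, ?_⟩
    filter_upwards [h.isClosed.isOpen_compl.mem_nhds hz] with w hw
    exact ⟨Or.inr one_ne_zero, ⟨fun h => absurd h hw, fun h => absurd h one_ne_zero⟩, fun _ => by simp⟩

lemma MeroPlane.chi_cont {g : ℂ → ℂ} {P : Set ℂ} (h : MeroPlane g P) (a : Option ℂ) :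
    Continuous (fun z => chordal (valueAt g P z) a) := by
  rw [continuous_iff_continuousAt]
  intro z
  obtain ⟨y1, y2, h1, h2, hr⟩ := h.exists_rep z
  have : ContinuousAt (fun w => ‖y1 w * v2 a - y2 w * v1 a‖ / Real.sqrt (‖y1 w‖ ^ 2 + ‖y2 w‖ ^ 2)) z := by
    have c1 := h1.continuousAt
    have c2 := h2.continuousAt
    refine ContinuousAt.div (by fun_prop) ?_ (Real.sqrt_pos.2 hr.self_of_nhds.norm_pos).ne'
    exact ((c1.norm.pow 2).add (c2.norm.pow 2)).sqrt
  refine this.congr ?_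
  filter_upwards [hr] with w hw
  exact (hw.chordal a).symm

lemma Pk.chi_isolated {g : ℂ → ℂ} {P : Set ℂ} {S : Set (Option ℂ)} {M : ℕ} (h : Pk g P S M)
    (a : Option ℂ) (z : ℂ) : ∀ᶠ w in 𝓝[≠] z, chordal (valueAt g P w) a ≠ 0 := by
  obtain ⟨y1, y2, h1, h2, hr⟩ := h.mero.exists_rep z
  have han : AnalyticAt ℂ (fun w => y1 w * v2 a - y2 w * v1 a) z := by fun_prop
  rcases han.eventually_eq_zero_or_eventually_ne_zero with h0 | h0
  · exfalso
    apply h.ncst z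
    have hval : ∀ᶠ w in 𝓝 z, valueAt g P w = a := by
      filter_upwards [h0, hr] with w hw hwr
      apply chordal_eq_zero
      rw [hwr.chordal, hw]; simp
    have hiso := h.mero.isolated z
    have hval' := (eventually_eventually_nhds.2 hval).filter_mono (nhdsWithin_le_nhds (s := {z}ᶜ))
    filter_upwards [hval', hiso] with w hw hwP
    have : g =ᶠ[𝓝 w] fun _ => g w := by
      have e0 := hw.self_of_nhds
      filter_upwards [hw, h.mero.isClosed.isOpen_compl.mem_nhds hwP] with x hx hxP
      rw [← e0] at hx
      have hxP' : x ∉ P := hxP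
      simpa [valueAt, hxP', hwP] using hx
    rw [this.deriv_eq]; simp
  · filter_upwards [h0, hr.filter_mono nhdsWithin_le_nhds] with w hw hwr
    rw [hwr.chordal]
    exact div_ne_zero (norm_ne_zero_iff.2 hw) (Real.sqrt_pos.2 hwr.norm_pos).ne'

/-- a connected set meeting a ball and missing its boundary is inside the ball -/
lemma stay {t : Set ℂ} (ht : IsPreconnected t) {z : ℂ} {r : ℝ}
    (hm : (t ∩ Metric.ball z r).Nonempty) (hs : ∀ w ∈ t, dist w z ≠ r) : t ⊆ Metric.ball z r := by
  refine ht.subset_left_of_subset_union Metric.isOpen_ball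
    (Metric.isClosed_closedBall (x := z) (ε := r)).isOpen_compl ?_ ?_ hm
  · exact Set.disjoint_compl_right_iff_subset.2 Metric.ball_subset_closedBall
  · intro w hw
    rcases lt_or_gt_of_ne (hs w hw) with h | h
    · exact Or.inl h
    · exact Or.inr (by simpa using h)

lemma Pk.exists_ring {g : ℂ → ℂ} {P : Set ℂ} {S : Set (Option ℂ)} {M : ℕ} (h : Pk g P S M)
    (a : Option ℂ) (z : ℂ) {r0 : ℝ} (hr0 : 0 < r0) : ∃ r, 0 < r ∧ r < r0 ∧ ∃ c > 0, ∀ w, dist w z = r →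
      c ≤ chordal (valueAt g P w) a := by
  have := h.chi_isolated a z
  rw [eventually_nhdsWithin_iff, Metric.eventually_nhds_iff] at this
  obtain ⟨ε, hε, he⟩ := this
  set r := min (r0 / 2) (ε / 2)
  have hr : 0 < r := by positivity
  have hne : (Metric.sphere z r).Nonempty := (NormedSpace.sphere_nonempty).2 hr.le
  obtain ⟨x, hx, hmin⟩ := (isCompact_sphere z r).exists_isMinOn hne (h.mero.chi_cont a).continuousOn
  refine ⟨r, hr, lt_of_le_of_lt (min_le_left _ _) (half_lt_self hr0), chordal (valueAt g P x) a, ?_, fun w hw => hmin hw⟩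
  refine lt_of_le_of_ne (chordal_nonneg _ _) (Ne.symm (he ?_ ?_))
  · rw [Metric.mem_sphere.1 hx]; exact lt_of_le_of_lt (min_le_right _ _) (half_lt_self hε)
  · intro hxz; rw [mem_singleton_iff.1 hxz] at hx; simp at hx; linarith

lemma Pk.dichotomy {g : ℂ → ℂ} {P : Set ℂ} {S : Set (Option ℂ)} {M : ℕ} (h : Pk g P S M)
    {a : Option ℂ} {γ : ℝ → ℂ} (hγ : ContinuousOn γ (Ici 0))
    (ht : Tendsto (fun t => chordal (valueAt g P (γ t)) a) atTop (𝓝 0)) :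
    Tendsto (fun t => ‖γ t‖) atTop atTop ∨ ∃ z, Tendsto γ atTop (𝓝 z) ∧ valueAt g P z = a := by
  by_cases hinf : Tendsto (fun t => ‖γ t‖) atTop atTop
  · exact Or.inl hinf
  right
  rw [tendsto_atTop] at hinf
  push Not at hinf
  obtain ⟨R, hR⟩ := hinf
  have hR' : ∃ᶠ t in atTop, γ t ∈ Metric.closedBall (0:ℂ) R := by
    refine hR.mono fun t ht => ?_
    simpa using ht.le
  obtain ⟨z, -, hz⟩ := (isCompact_closedBall (0:ℂ) R).exists_mapClusterPt_of_frequently hR'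
  have hlim : Tendsto γ atTop (𝓝 z) := by
    rw [Metric.tendsto_nhds]
    intro ε hε
    obtain ⟨r, hr, hrε, c, hc, hring⟩ := h.exists_ring a z hε
    have ev : ∀ᶠ t in atTop, chordal (valueAt g P (γ t)) a < c := ht.eventually_lt_const hc
    obtain ⟨T, hT⟩ := eventually_atTop.1 (ev.and (eventually_ge_atTop 0))
    have hfr : ∃ᶠ t in atTop, γ t ∈ Metric.ball z r := hz.frequently (Metric.ball_mem_nhds z hr)
    obtain ⟨t1, ht1, hb⟩ := frequently_atTop.1 hfr T
    have hsub : γ '' Ici T ⊆ Metric.ball z r := by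
      apply stay (isPreconnected_Ici.image γ (hγ.mono fun t ht => (hT t ht).2))
      · exact ⟨γ t1, mem_image_of_mem γ ht1, hb⟩
      · rintro w ⟨t, ht, rfl⟩ hd
        exact absurd (hT t ht).1 (not_lt.2 (hring _ hd))
    filter_upwards [eventually_ge_atTop T] with t ht
    exact lt_trans (hsub (mem_image_of_mem γ ht)) hrε
  refine ⟨z, hlim, chordal_eq_zero ?_⟩
  exact tendsto_nhds_unique (((h.mero.chi_cont a).tendsto z).comp hlim) ht

end

section

section
variable {g : ℂ → ℂ} {P : Set ℂ} {S : Set (Option ℂ)} {M : ℕ}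

def Good (g : ℂ → ℂ) (P : Set ℂ) (S : Set (Option ℂ)) : Set ℂ := {z | z ∉ P ∧ some (g z) ∉ S}

lemma Pk.deriv_ne (h : Pk g P S M) {z : ℂ} (hz : z ∈ Good g P S) : deriv g z ≠ 0 := by
  intro h0
  have han : AnalyticAt ℂ (deriv g) z := (h.mero.2.1 z hz.1).deriv
  have hfin : analyticOrderAt (deriv g) z ≠ ⊤ := by
    rw [Ne, analyticOrderAt_eq_top]
    intro h1
    exact h.ncst z (h1.filter_mono nhdsWithin_le_nhds)
  obtain ⟨G, hG, hG0, hGe⟩ := (han.analyticOrderAt_ne_top).1 hfin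
  set m := analyticOrderNatAt (deriv g) z
  have hm : 0 < m := by
    rcases Nat.eq_zero_or_pos m with hm | hm
    · exfalso
      have := hGe.self_of_nhds
      rw [h0, hm] at this
      simp at this; exact hG0 this.symm
    · exact hm
  apply hz.2
  apply h.crit
  refine ⟨z, ⟨m + 1, by omega, Or.inr ⟨h.mero.2.1 z hz.1, by simpa using hm, G, hG, hG0, ?_⟩⟩, ?_⟩
  · filter_upwards [hGe] with w hw
    simpa using hw
  · simp [valueAt, hz.1]

lemma Pk.good_open (h : Pk g P S M) : IsOpen (Good g P S) := by
  rw [isOpen_iff_mem_nhds]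
  intro z hz
  have hc : ContinuousAt g z := (h.mero.2.1 z hz.1).continuousAt
  have hS : (some ⁻¹' S : Set ℂ).Finite := h.fin.preimage (Option.some_injective ℂ).injOn
  have h1 := hc.preimage_mem_nhds (hS.isClosed.isOpen_compl.mem_nhds hz.2)
  filter_upwards [h1, h.mero.isClosed.isOpen_compl.mem_nhds hz.1] with w hw1 hw2
  exact ⟨hw2, hw1⟩

lemma Pk.homeo (h : Pk g P S M) : IsLocalHomeomorph (fun z : Good g P S => g z) := by
  rw [isLocalHomeomorph_iff_isLocalHomeomorphOn_univ]
  have h1 : IsLocalHomeomorphOn g (Good g P S) := by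
    intro z hz
    have hd : HasStrictDerivAt g (deriv g z) z := (h.mero.2.1 z hz.1).hasStrictDerivAt
    refine ⟨(hd.hasStrictFDerivAt_equiv (h.deriv_ne hz)).toOpenPartialHomeomorph g, ?_, rfl⟩
    exact HasStrictFDerivAt.mem_toOpenPartialHomeomorph_source _
  exact h1.comp (h.good_open.isOpenEmbedding_subtypeVal.isLocalHomeomorph.isLocalHomeomorphOn (s := univ))
    fun z _ => z.2

lemma sep_good : IsSeparatedMap (fun z : Good g P S => g z) := T2Space.isSeparatedMap _

lemma Pk.agree (h : Pk g P S M) {α : Type*} [TopologicalSpace α] {s : Set α} (hs : IsPreconnected s)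
    {h1 h2 : α → ℂ} (c1 : ContinuousOn h1 s) (c2 : ContinuousOn h2 s)
    (m1 : ∀ x ∈ s, h1 x ∈ Good g P S) (m2 : ∀ x ∈ s, h2 x ∈ Good g P S)
    (he : ∀ x ∈ s, g (h1 x) = g (h2 x)) {a : α} (ha : a ∈ s) (haa : h1 a = h2 a) : EqOn h1 h2 s := by
  have : PreconnectedSpace s := isPreconnected_iff_preconnectedSpace.1 hs
  have := sep_good.eq_of_comp_eq h.homeo.isLocallyInjective
    (g₁ := fun x : s => (⟨h1 x, m1 x x.2⟩ : Good g P S)) (g₂ := fun x : s => ⟨h2 x, m2 x x.2⟩)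
    (by rw [continuousOn_iff_continuous_domRestrict] at c1; exact c1.subtype_mk _)
    (by rw [continuousOn_iff_continuous_domRestrict] at c2; exact c2.subtype_mk _)
    (by ext x; exact he x x.2) ⟨a, ha⟩ (Subtype.ext haa)
  intro x hx
  exact congrArg Subtype.val (congrFun this ⟨x, hx⟩)

lemma Pk.path_lift (h : Pk g P S M) {γ : ℝ → ℂ} (hγ : ContinuousOn γ (Icc 0 1))
    (hS : ∀ t ∈ Icc (0:ℝ) 1, some (γ t) ∉ S) {e : ℂ} (heP : e ∉ P) (he : g e = γ 0) :
    ∃ Γ : ℝ → ℂ, ContinuousOn Γ (Icc 0 1) ∧ Γ 0 = e ∧ ∀ t ∈ Icc (0:ℝ) 1, Γ t ∉ P ∧ g (Γ t) = γ t := by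
  let L : ℝ → (ℝ → ℂ) → Prop := fun s Γ => ContinuousOn Γ (Icc 0 s) ∧ Γ 0 = e ∧
    ∀ t ∈ Icc (0:ℝ) s, Γ t ∉ P ∧ g (Γ t) = γ t
  let T : Set ℝ := {s | s ∈ Icc (0:ℝ) 1 ∧ ∃ Γ, L s Γ}
  have h0T : (0:ℝ) ∈ T := by
    refine ⟨⟨le_rfl, zero_le_one⟩, fun _ => e, continuousOn_const, rfl, ?_⟩
    intro t ht
    have : t = 0 := le_antisymm ht.2 ht.1
    subst this; exact ⟨heP, he⟩
  have hbdd : BddAbove T := ⟨1, fun s hs => hs.1.2⟩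
  set s0 := sSup T with hs0
  have hs00 : 0 ≤ s0 := le_csSup hbdd h0T
  have hs01 : s0 ≤ 1 := csSup_le ⟨0, h0T⟩ fun s hs => hs.1.2
  have hagree : ∀ s s' Γ Γ', s ≤ s' → s ∈ Icc (0:ℝ) 1 → s' ≤ 1 → L s Γ → L s' Γ' → EqOn Γ Γ' (Icc 0 s) := by
    intro s s' Γ Γ' hss hs hs' hL hL'
    have hsub : Icc 0 s ⊆ Icc 0 s' := Icc_subset_Icc_right hss
    refine h.agree isPreconnected_Icc hL.1 (hL'.1.mono hsub) ?_ ?_ ?_ (left_mem_Icc.2 hs.1) (hL.2.1.trans hL'.2.1.symm)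
    · intro x hx; refine ⟨(hL.2.2 x hx).1, ?_⟩; rw [(hL.2.2 x hx).2]; exact hS x ⟨hx.1, hx.2.trans hs.2⟩
    · intro x hx; refine ⟨(hL'.2.2 x (hsub hx)).1, ?_⟩; rw [(hL'.2.2 x (hsub hx)).2]; exact hS x ⟨hx.1, hx.2.trans hs.2⟩
    · intro x hx; rw [(hL.2.2 x hx).2, (hL'.2.2 x (hsub hx)).2]
  -- s0 ∈ T
  have hs0T : s0 ∈ T := by
    rcases eq_or_lt_of_le hs00 with h00 | h00
    · rw [← h00]; exact h0T
    have hex : ∀ s, s < s0 → ∃ s' Γ, s < s' ∧ s' ∈ T ∧ L s' Γ := by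
      intro s hs
      obtain ⟨s', hs'T, hss⟩ := exists_lt_of_lt_csSup ⟨0, h0T⟩ hs
      obtain ⟨Γ, hΓ⟩ := hs'T.2
      exact ⟨s', Γ, hss, hs'T, hΓ⟩
    choose! s' G hss' hs'T hG using hex
    let Γ0 : ℝ → ℂ := fun s => G s s
    have hloc : ∀ s ∈ Ico 0 s0, ∀ t ∈ Icc 0 (s' s), t < s0 → Γ0 t = G s t := by
      intro s hs t ht hts
      rcases le_total (s' t) (s' s) with hle | hle
      · exact hagree _ _ _ _ hle (hs'T t hts).1 (hs'T s hs.2).1.2 (hG t hts) (hG s hs.2) ⟨ht.1, (hss' t hts).le⟩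
      · exact (hagree _ _ _ _ hle (hs'T s hs.2).1 (hs'T t hts).1.2 (hG s hs.2) (hG t hts) ht).symm
    have hlift0 : ∀ t ∈ Ico 0 s0, Γ0 t ∉ P ∧ g (Γ0 t) = γ t := fun t ht =>
      (hG t ht.2).2.2 t ⟨ht.1, (hss' t ht.2).le⟩
    have hcont : ContinuousOn Γ0 (Ico 0 s0) := by
      intro s hs
      have h1 : ContinuousWithinAt (G s) (Icc 0 (s' s)) s := (hG s hs.2).1 s ⟨hs.1, (hss' s hs.2).le⟩
      have h2 : Icc 0 (s' s) ∈ 𝓝[Ico 0 s0] s := by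
        filter_upwards [self_mem_nhdsWithin, nhdsWithin_le_nhds (Iio_mem_nhds (hss' s hs.2))] with t ht ht2
        exact ⟨ht.1, le_of_lt ht2⟩
      have h3 : ContinuousWithinAt (G s) (Ico 0 s0) s := h1.mono_of_mem_nhdsWithin h2
      refine h3.congr_of_eventuallyEq ?_ rfl
      filter_upwards [self_mem_nhdsWithin, h2] with t ht ht2
      exact hloc s hs t ht2 ht.2
    let φ : ℝ → ℝ := fun t => s0 * (t / (1 + t))
    have hφm : ∀ t ∈ Ici (0:ℝ), φ t ∈ Ico 0 s0 := by
      intro t ht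
      have ht' : (0:ℝ) ≤ t := ht
      have h1t : 0 < 1 + t := by linarith
      refine ⟨by positivity, ?_⟩
      have : t / (1 + t) < 1 := by rw [div_lt_one h1t]; linarith
      exact mul_lt_of_lt_one_right h00 this
    have hφc : ContinuousOn φ (Ici 0) := by
      refine continuousOn_const.mul (continuousOn_id.div (by fun_prop) ?_)
      intro t ht; have : (0:ℝ) ≤ t := ht; simp; linarith
    have hφl : Tendsto φ atTop (𝓝 s0) := by
      have : Tendsto (fun t : ℝ => s0 * (1 - (1 + t)⁻¹)) atTop (𝓝 (s0 * (1 - 0))) :=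
        tendsto_const_nhds.mul (tendsto_const_nhds.sub
          (tendsto_inv_atTop_zero.comp (tendsto_atTop_add_const_left _ _ tendsto_id)))
      simp only [sub_zero, mul_one] at this
      refine this.congr' ?_
      filter_upwards [eventually_ge_atTop 0] with t ht
      simp only [φ]; field_simp; ring
    have hchi : Tendsto (fun t => chordal (valueAt g P (Γ0 (φ t))) (some (γ s0))) atTop (𝓝 0) := by
      have hγ' : Tendsto (fun t => γ (φ t)) atTop (𝓝 (γ s0)) := by
        refine (hγ s0 ⟨hs00, hs01⟩).tendsto.comp (tendsto_nhdsWithin_iff.2 ⟨hφl, ?_⟩)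
        filter_upwards [eventually_ge_atTop 0] with t ht
        exact ⟨(hφm t ht).1, (hφm t ht).2.le.trans hs01⟩
      have h1 : Tendsto (fun t => ‖γ (φ t) - γ s0‖) atTop (𝓝 0) := by
        have := (hγ'.sub_const (γ s0)).norm
        simpa using this
      refine squeeze_zero' (Eventually.of_forall fun t => chordal_nonneg _ _) ?_ h1
      filter_upwards [eventually_ge_atTop 0] with t ht
      obtain ⟨ha, hb⟩ := hlift0 _ (hφm t ht)
      simp only [valueAt, ha, if_false, hb, chordal]
      apply div_le_self (norm_nonneg _)
      rw [Real.one_le_sqrt]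
      nlinarith [sq_nonneg ‖γ (φ t)‖, sq_nonneg ‖γ s0‖, mul_nonneg (sq_nonneg ‖γ (φ t)‖) (sq_nonneg ‖γ s0‖)]
    have hcφ : ContinuousOn (fun t => Γ0 (φ t)) (Ici 0) := hcont.comp hφc hφm
    rcases h.dichotomy hcφ hchi with hinf | ⟨z, hz, hza⟩
    · exact absurd (h.asym _ _ ⟨hcφ, hinf, hchi⟩) (hS s0 ⟨hs00, hs01⟩)
    have hzP : z ∉ P := by intro hzP; simp [valueAt, hzP] at hza
    have hgz : g z = γ s0 := by simpa [valueAt, hzP] using hza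
    -- Γ0 → z at s0
    have hlim : Tendsto Γ0 (𝓝[<] s0) (𝓝 z) := by
      let χ : ℝ → ℝ := fun s => (s / s0) / (1 - s / s0)
      have hχ : Tendsto χ (𝓝[<] s0) atTop := by
        have h1 : Tendsto (fun s => s / s0) (𝓝[<] s0) (𝓝 1) := by
          have : Tendsto (fun s => s / s0) (𝓝 s0) (𝓝 (s0 / s0)) := tendsto_id.div_const _
          rw [div_self h00.ne'] at this
          exact this.mono_left nhdsWithin_le_nhds
        have h2 : Tendsto (fun s => 1 - s / s0) (𝓝[<] s0) (𝓝[>] 0) := by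
          refine tendsto_nhdsWithin_iff.2 ⟨by simpa using h1.const_sub 1, ?_⟩
          filter_upwards [self_mem_nhdsWithin] with s hs
          have : s / s0 < 1 := by rw [div_lt_one h00]; exact hs
          simpa using this
        change Tendsto (fun s => (s / s0) * (1 - s / s0)⁻¹) _ _
        exact h1.pos_mul_atTop one_pos (tendsto_inv_nhdsGT_zero.comp h2)
      refine (hz.comp hχ).congr' ?_
      filter_upwards [self_mem_nhdsWithin] with s hs
      have hs' : s < s0 := hs
      simp only [Function.comp]
      congr 1
      have : s0 - s ≠ 0 := by linarith
      simp only [φ, χ]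
      have h1 : 1 - s / s0 ≠ 0 := by
        rw [Ne, sub_eq_zero, eq_comm, div_eq_one_iff_eq h00.ne']; exact hs'.ne
      have h2 : 1 + s / s0 / (1 - s / s0) = 1 / (1 - s / s0) := by field_simp; ring
      rw [h2]; field_simp
    refine ⟨⟨hs00, hs01⟩, fun t => if t < s0 then Γ0 t else z, ?_, ?_, ?_⟩
    · intro t ht
      rcases lt_or_eq_of_le ht.2 with hlt | heq
      · have h1 : ContinuousWithinAt Γ0 (Icc 0 s0) t := by
          refine (hcont t ⟨ht.1, hlt⟩).mono_of_mem_nhdsWithin ?_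
          filter_upwards [self_mem_nhdsWithin, nhdsWithin_le_nhds (Iio_mem_nhds hlt)] with x hx hx2
          exact ⟨hx.1, hx2⟩
        refine h1.congr_of_eventuallyEq ?_ (by simp [hlt])
        filter_upwards [nhdsWithin_le_nhds (Iio_mem_nhds hlt)] with x hx
        simp [mem_Iio.1 hx]
      · rw [heq, ← continuousWithinAt_sdiff_self]
        have : Icc 0 s0 \ {s0} = Ico 0 s0 := Icc_sdiff_right
        rw [this]
        unfold ContinuousWithinAt
        simp only [lt_irrefl, if_false]
        refine Tendsto.congr' ?_ (hlim.mono_left (nhdsWithin_mono _ Ico_subset_Iio_self))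
        filter_upwards [self_mem_nhdsWithin] with x hx
        simp [hx.2]
    · simp only [h00, if_true]; exact (hG 0 h00).2.1
    · intro t ht
      rcases lt_or_eq_of_le ht.2 with hlt | heq
      · simp only [hlt, if_true]; exact hlift0 t ⟨ht.1, hlt⟩
      · simp only [heq, lt_irrefl, if_false]; exact ⟨hzP, hgz⟩
  -- s0 = 1
  obtain ⟨-, Γ, hΓc, hΓ0, hΓ⟩ := hs0T
  rcases eq_or_lt_of_le hs01 with h1 | h1
  · rw [h1] at hΓc hΓ; exact ⟨Γ, hΓc, hΓ0, hΓ⟩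
  exfalso
  have hz : Γ s0 ∈ Good g P S := by
    obtain ⟨ha, hb⟩ := hΓ s0 ⟨hs00, le_rfl⟩
    exact ⟨ha, by rw [hb]; exact hS s0 ⟨hs00, hs01⟩⟩
  have hd : HasStrictDerivAt g (deriv g (Γ s0)) (Γ s0) := (h.mero.2.1 _ hz.1).hasStrictDerivAt
  have hd' := hd.hasStrictFDerivAt_equiv (h.deriv_ne hz)
  set Φ := hd'.toOpenPartialHomeomorph g with hΦ
  have hmem : Γ s0 ∈ Φ.source := hd'.mem_toOpenPartialHomeomorph_source
  have hΦg : ∀ x, Φ x = g x := fun x => rfl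
  have hgs : g (Γ s0) = γ s0 := (hΓ s0 ⟨hs00, le_rfl⟩).2
  have hγs : ContinuousWithinAt γ (Icc s0 1) s0 := (hγ s0 ⟨hs00, hs01⟩).mono (Icc_subset_Icc_left hs00)
  have htm : γ s0 ∈ Φ.target := by rw [← hgs, ← hΦg]; exact Φ.map_source hmem
  have hsymm : Φ.symm (γ s0) = Γ s0 := by rw [← hgs, ← hΦg]; exact Φ.left_inv hmem
  have hev : ∀ᶠ t in 𝓝[Icc s0 1] s0, γ t ∈ Φ.target ∧ Φ.symm (γ t) ∉ P := by
    have e1 := hγs.preimage_mem_nhdsWithin (Φ.open_target.mem_nhds htm)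
    have hc : ContinuousWithinAt (fun t => Φ.symm (γ t)) (Icc s0 1) s0 :=
      (Φ.symm.continuousAt (x := γ s0) htm).comp_continuousWithinAt hγs
    have e2 := hc.preimage_mem_nhdsWithin (h.mero.isClosed.isOpen_compl.mem_nhds (by rw [hsymm]; exact hz.1))
    filter_upwards [e1, e2] with t h1 h2
    exact ⟨h1, h2⟩
  rw [eventually_nhdsWithin_iff, Metric.eventually_nhds_iff] at hev
  obtain ⟨δ, hδ, hev⟩ := hev
  set s1 := min 1 (s0 + δ / 2)
  have hs1 : s0 < s1 := lt_min h1 (by linarith)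
  have hs11 : s1 ≤ 1 := min_le_left _ _
  have hnear : ∀ t ∈ Icc s0 s1, γ t ∈ Φ.target ∧ Φ.symm (γ t) ∉ P := by
    intro t ht
    refine hev ?_ ⟨ht.1, ht.2.trans hs11⟩
    rw [Real.dist_eq, abs_of_nonneg (by linarith [ht.1])]
    have := ht.2.trans (min_le_right _ _)
    linarith
  have : s1 ∈ T := by
    refine ⟨⟨hs00.trans hs1.le, hs11⟩, fun t => if t ≤ s0 then Γ t else Φ.symm (γ t), ?_, ?_, ?_⟩
    · rw [← Icc_union_Icc_eq_Icc hs00 hs1.le]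
      apply ContinuousOn.union_of_isClosed _ _ isClosed_Icc isClosed_Icc
      · refine hΓc.congr fun t ht => ?_
        simp [ht.2]
      · have : ContinuousOn (fun t => Φ.symm (γ t)) (Icc s0 s1) :=
          Φ.continuousOn_symm.comp (hγ.mono (Icc_subset_Icc hs00 hs11)) fun t ht => (hnear t ht).1
        refine this.congr fun t ht => ?_
        rcases eq_or_lt_of_le ht.1 with heq | hlt
        · simp [← heq, hsymm]
        · simp [not_le.2 hlt]
    · simp [hs00, hΓ0]
    · intro t ht
      by_cases hts : t ≤ s0
      · simp only [hts, if_true]; exact hΓ t ⟨ht.1, hts⟩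
      · simp only [hts, if_false]
        have := hnear t ⟨(not_le.1 hts).le, ht.2⟩
        refine ⟨this.2, ?_⟩
        rw [← hΦg]; exact Φ.right_inv this.1
  exact absurd (le_csSup hbdd this) (not_le.2 hs1)

end
end

section

section
variable {g : ℂ → ℂ} {P : Set ℂ} {S : Set (Option ℂ)} {M : ℕ}

lemma Pk.star (h : Pk g P S M) {U : Set ℂ} (hU : Convex ℝ U) {π : ℂ → ℂ} (hπ : ContinuousOn π U)
    (hS : ∀ ξ ∈ U, some (π ξ) ∉ S) {ξ0 w0 : ℂ} (hξ0 : ξ0 ∈ U) (hw0 : w0 ∉ P) (hw : g w0 = π ξ0) :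
    ∃ ψ : ℂ → ℂ, ContinuousOn ψ U ∧ ψ ξ0 = w0 ∧ ∀ ξ ∈ U, ψ ξ ∉ P ∧ g (ψ ξ) = π ξ := by
  let l : ℝ → ℂ → ℂ := fun t a => ξ0 + (t : ℂ) * (a - ξ0)
  have hl : ∀ t ∈ Icc (0:ℝ) 1, ∀ a ∈ U, l t a ∈ U := by
    intro t ht a ha
    have := hU.add_smul_sub_mem hξ0 ha ht
    simpa [l] using this
  have hlc : Continuous (fun x : ℝ × ℂ => l x.1 x.2) := by
    simp only [l]; fun_prop
  have hex : ∀ a ∈ U, ∃ Γ : ℝ → ℂ, ContinuousOn Γ (Icc 0 1) ∧ Γ 0 = w0 ∧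
      ∀ t ∈ Icc (0:ℝ) 1, Γ t ∉ P ∧ g (Γ t) = π (l t a) := by
    intro a ha
    refine h.path_lift (γ := fun t => π (l t a)) ?_ ?_ hw0 (by simp [l, hw])
    · exact hπ.comp ((hlc.comp (by fun_prop : Continuous fun t : ℝ => (t, a))).continuousOn) fun t ht => hl t ht a ha
    · intro t ht; exact hS _ (hl t ht a ha)
  choose! Γ hΓc hΓ0 hΓ using hex
  let G : unitInterval × U → Good g P S := fun x =>
    ⟨Γ x.2 x.1, (hΓ x.2 x.2.2 x.1 x.1.2).1, by
      rw [(hΓ x.2 x.2.2 x.1 x.1.2).2]; exact hS _ (hl x.1 x.1.2 x.2 x.2.2)⟩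
  let F : C(unitInterval × U, ℂ) := ⟨fun x => π (l x.1 x.2), by
    have h1 : Continuous (fun x : unitInterval × U => l x.1 x.2) :=
      hlc.comp (by fun_prop : Continuous fun x : unitInterval × U => ((x.1 : ℝ), (x.2 : ℂ)))
    exact hπ.comp_continuous h1 fun x => hl x.1 x.1.2 x.2 x.2.2⟩
  have hG : Continuous G := by
    apply h.homeo.continuous_lift sep_good F
    · ext x; exact (hΓ x.2 x.2.2 x.1 x.1.2).2
    · have : (fun a : U => G (0, a)) = fun _ => (⟨w0, hw0, by rw [hw]; exact hS _ hξ0⟩ : Good g P S) := by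
        ext a; exact hΓ0 a a.2
      rw [this]; exact continuous_const
    · intro a
      refine Continuous.subtype_mk ?_ _
      exact (hΓc a a.2).comp_continuous continuous_subtype_val fun t => t.2
  refine ⟨fun ξ => Γ ξ 1, ?_, ?_, ?_⟩
  · rw [continuousOn_iff_continuous_domRestrict]
    exact continuous_subtype_val.comp (hG.comp (by fun_prop : Continuous fun a : U => ((1 : unitInterval), a)))
  · -- constant path
    have hag := h.agree (s := Icc (0:ℝ) 1) isPreconnected_Icc (hΓc ξ0 hξ0) (h2 := fun _ => w0) continuousOn_const
      (fun x hx => ⟨(hΓ _ hξ0 x hx).1, by rw [(hΓ _ hξ0 x hx).2]; exact hS _ (hl x hx _ hξ0)⟩)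
      (fun x hx => ⟨hw0, by rw [hw]; exact hS _ hξ0⟩)
      (fun x hx => by rw [(hΓ _ hξ0 x hx).2, hw]; simp [l])
      (left_mem_Icc.2 zero_le_one) (hΓ0 _ hξ0)
    exact hag (right_mem_Icc.2 zero_le_one)
  · intro ξ hξ
    have := hΓ ξ hξ 1 (right_mem_Icc.2 zero_le_one)
    simpa [l] using this

lemma Pk.star_inv (h : Pk g P S M) {U : Set ℂ} (hU : Convex ℝ U) {π : ℂ → ℂ} (hπ : ContinuousOn π U)
    (hS : ∀ ξ ∈ U, some (π ξ) ∉ S) {V : Set ℂ} (hV : IsPreconnected V) {e : ℂ → ℂ}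
    (he : ContinuousOn e V) (heU : MapsTo e V U) (hVP : ∀ w ∈ V, w ∉ P) (hg : ∀ w ∈ V, g w = π (e w))
    {w0 : ℂ} (hw0 : w0 ∈ V) :
    ∃ ψ : ℂ → ℂ, ContinuousOn ψ U ∧ (∀ ξ ∈ U, ψ ξ ∉ P ∧ g (ψ ξ) = π ξ) ∧ ∀ w ∈ V, ψ (e w) = w := by
  obtain ⟨ψ, h1, h2, h3⟩ := h.star hU hπ hS (heU hw0) (hVP _ hw0) (hg _ hw0)
  refine ⟨ψ, h1, h3, ?_⟩
  refine h.agree hV (h1.comp he heU) (h2 := fun w => w) continuousOn_id ?_ ?_ ?_ hw0 h2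
  · intro x hx; exact ⟨(h3 _ (heU hx)).1, by rw [(h3 _ (heU hx)).2]; exact hS _ (heU hx)⟩
  · intro x hx; exact ⟨hVP x hx, by rw [hg x hx]; exact hS _ (heU hx)⟩
  · intro x hx; rw [(h3 _ (heU hx)).2, hg x hx]

lemma Pk.inj (h : Pk g P S M) {U : Set ℂ} (hU : Convex ℝ U) {π : ℂ → ℂ} (hπ : ContinuousOn π U)
    (hS : ∀ ξ ∈ U, some (π ξ) ∉ S) {V : Set ℂ} (hV : IsPreconnected V) {e : ℂ → ℂ}
    (he : ContinuousOn e V) (heU : MapsTo e V U) (hVP : ∀ w ∈ V, w ∉ P) (hg : ∀ w ∈ V, g w = π (e w)) :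
    InjOn e V := by
  intro a ha b hb hab
  obtain ⟨ψ, -, -, h3⟩ := h.star_inv hU hπ hS hV he heU hVP hg ha
  rw [← h3 a ha, ← h3 b hb, hab]

lemma count_loc {G : ℂ → ℂ} {z : ℂ} (hG : AnalyticAt ℂ G z)
    (hfin : analyticOrderAt (fun w => G w - G z) z ≠ ⊤) :
    ∃ r > 0, ∀ n : ℕ, ∀ F : Fin n → ℂ, Function.Injective F → (∀ i, F i ∈ Metric.ball z r) →
      (∀ i j, G (F i) = G (F j)) → n ≤ analyticOrderNatAt (fun w => G w - G z) z := by
  have han : AnalyticAt ℂ (fun w => G w - G z) z := hG.sub analyticAt_const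
  obtain ⟨H, hH, hH0, hHe⟩ := (han.analyticOrderAt_ne_top).1 hfin
  set m := analyticOrderNatAt (fun w => G w - G z) z with hm
  have hm0 : 0 < m := by
    rcases Nat.eq_zero_or_pos m with h0 | h0
    · exfalso; have := hHe.self_of_nhds; rw [h0] at this; simp at this; exact hH0 this.symm
    · exact h0
  let k : ℂ → ℂ := fun w => (w - z) * Complex.exp (Complex.log (H w / H z) / m)
  have hHz : H z / H z = 1 := div_self hH0
  have hlog : AnalyticAt ℂ (fun w => Complex.log (H w / H z)) z := by
    apply AnalyticAt.clog (hH.div analyticAt_const hH0)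
    change H z / H z ∈ _
    rw [hHz]; exact Complex.one_mem_slitPlane
  have hexp : AnalyticAt ℂ (fun w => Complex.exp (Complex.log (H w / H z) / m)) z :=
    (hlog.div analyticAt_const (by exact_mod_cast hm0.ne')).cexp
  have hk : AnalyticAt ℂ k z := (analyticAt_id.sub analyticAt_const).mul hexp
  have hdk : HasDerivAt k 1 z := by
    have h1 : HasDerivAt (fun w : ℂ => w - z) 1 z := (hasDerivAt_id z).sub_const z
    have h2 := h1.mul hexp.differentiableAt.hasDerivAt
    refine (h2.congr_deriv ?_)
    simp [hHz]
  have hkd : HasStrictDerivAt k 1 z := by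
    have := hk.hasStrictDerivAt; rwa [hdk.deriv] at this
  have hinj : ∃ U ∈ 𝓝 z, InjOn k U := by
    set Φ := (hkd.hasStrictFDerivAt_equiv one_ne_zero).toOpenPartialHomeomorph k
    exact ⟨Φ.source, Φ.open_source.mem_nhds (HasStrictFDerivAt.mem_toOpenPartialHomeomorph_source _), Φ.injOn⟩
  obtain ⟨U, hU, hUi⟩ := hinj
  have hpow : ∀ᶠ w in 𝓝 z, G w - G z = H z * k w ^ m := by
    filter_upwards [hHe, hH.continuousAt.eventually_ne hH0] with w hw hw0
    rw [hw]
    simp only [k, mul_pow, ← Complex.exp_nat_mul]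
    rw [mul_div_cancel₀ _ (by exact_mod_cast hm0.ne'), Complex.exp_log (div_ne_zero hw0 hH0), smul_eq_mul]
    field_simp
  obtain ⟨r, hr, hball⟩ := Metric.mem_nhds_iff.1 (inter_mem hU hpow)
  refine ⟨r, hr, fun n F hF hFb hFe => ?_⟩
  rcases Nat.eq_zero_or_pos n with hn | hn
  · omega
  let i0 : Fin n := ⟨0, hn⟩
  have hsub : Finset.univ.image (fun i => k (F i)) ⊆ (Polynomial.nthRoots m (k (F i0) ^ m)).toFinset := by
    intro x hx
    obtain ⟨i, -, rfl⟩ := Finset.mem_image.1 hx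
    rw [Multiset.mem_toFinset, Polynomial.mem_nthRoots hm0]
    have h1 := (hball (hFb i)).2
    have h2 := (hball (hFb i0)).2
    simp only [mem_ofPred_eq] at h1 h2
    rw [hFe i i0, h2] at h1
    exact (mul_left_cancel₀ hH0 h1).symm
  have hc := Finset.card_le_card hsub
  rw [Finset.card_image_of_injective] at hc
  · have h3 := (Multiset.toFinset_card_le _).trans (Polynomial.card_nthRoots m (k (F i0) ^ m))
    simpa using hc.trans h3
  · intro i j hij
    exact hF (hUi (hball (hFb i)).1 (hball (hFb j)).1 hij)

lemma Pk.count (h : Pk g P S M) (z : ℂ) : ∃ r > 0, ∀ F : Fin (M + 1) → ℂ, Function.Injective F →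
    (∀ i, F i ∈ Metric.ball z r ∧ F i ∉ P) → (∀ i j, g (F i) = g (F j)) → False := by
  by_cases hz : z ∈ P
  · obtain ⟨G, hG, hG0, hGe⟩ := h.mero.exists_inv hz
    have hfin : analyticOrderAt (fun w => G w - G z) z ≠ ⊤ := by
      rw [Ne, analyticOrderAt_eq_top]
      intro h1
      have := (h1.filter_mono (nhdsWithin_le_nhds (s := {z}ᶜ))).and hGe
      obtain ⟨w, hw1, hw2⟩ := this.exists
      rw [hG0, sub_zero] at hw1
      exact hw2.2.1 hw1
    obtain ⟨r, hr, hc⟩ := count_loc hG hfin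
    have han : AnalyticAt ℂ (fun w => G w - G z) z := hG.sub analyticAt_const
    obtain ⟨H, hH, hH0, hHe⟩ := (han.analyticOrderAt_ne_top).1 hfin
    set m := analyticOrderNatAt (fun w => G w - G z) z with hm
    have hmM : m ≤ M := by
      rcases Nat.lt_or_ge m 2 with h2 | h2
      · have := h.hM; omega
      · refine h.mult z m ⟨h2, Or.inl ⟨by omega, fun w => (H w)⁻¹, hH.inv hH0, inv_ne_zero hH0, ?_⟩⟩
        filter_upwards [hGe, hHe.filter_mono nhdsWithin_le_nhds] with w hw hw2
        rw [hG0, sub_zero, smul_eq_mul] at hw2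
        rw [hw.2.2, hw2, mul_inv, div_eq_mul_inv, mul_comm]
    rw [eventually_nhdsWithin_iff, Metric.eventually_nhds_iff] at hGe
    obtain ⟨ε, hε, hGe⟩ := hGe
    refine ⟨min r ε, lt_min hr hε, fun F hF hFb hFe => ?_⟩
    have hGF : ∀ i, g (F i) = (G (F i))⁻¹ := fun i =>
      (hGe (lt_of_lt_of_le (hFb i).1 (min_le_right _ _)) (fun hi => (hFb i).2 (by rw [mem_singleton_iff.1 hi]; exact hz))).2.2
    have := hc (M + 1) F hF (fun i => Metric.ball_subset_ball (min_le_left _ _) (hFb i).1) (fun i j => by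
      have := hFe i j; rw [hGF, hGF] at this; exact inv_injective this)
    omega
  · have hg := h.mero.2.1 z hz
    have hfin : analyticOrderAt (fun w => g w - g z) z ≠ ⊤ := by
      rw [Ne, analyticOrderAt_eq_top]
      intro h1
      apply h.ncst z
      have h2 := (eventually_eventually_nhds.2 h1).filter_mono (nhdsWithin_le_nhds (s := {z}ᶜ))
      filter_upwards [h2] with w hw
      have : g =ᶠ[𝓝 w] fun _ => g z := by
        filter_upwards [hw] with x hx; exact sub_eq_zero.1 hx
      rw [this.deriv_eq]; simp
    obtain ⟨r, hr, hc⟩ := count_loc hg hfin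
    have han : AnalyticAt ℂ (fun w => g w - g z) z := hg.sub analyticAt_const
    have hmM : analyticOrderNatAt (fun w => g w - g z) z ≤ M := by
      set m := analyticOrderNatAt (fun w => g w - g z) z with hm
      rcases Nat.lt_or_ge m 2 with h2 | h2
      · have := h.hM; omega
      obtain ⟨H, hH, hH0, hHe⟩ := (han.analyticOrderAt_ne_top).1 hfin
      rw [← hm] at hHe
      refine h.mult z m ⟨h2, Or.inr ⟨hg, by omega, fun w => m * H w + (w - z) * deriv H w, ?_, ?_, ?_⟩⟩
      · have := hH.deriv; fun_prop
      · simp [hH0]; omega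
      · have hH' := hH.eventually_analyticAt
        filter_upwards [eventually_eventually_nhds.2 hHe, hH'] with w hw hwH
        have e1 : g =ᶠ[𝓝 w] fun x => g z + (x - z) ^ m * H x := by
          filter_upwards [hw] with x hx
          rw [smul_eq_mul] at hx; rw [← hx]; ring
        rw [e1.deriv_eq]
        have hd : HasDerivAt (fun x => g z + (x - z) ^ m * H x) ((m * (w - z) ^ (m - 1) * 1) * H w + (w - z) ^ m * deriv H w) w := by
          have h1 : HasDerivAt (fun x : ℂ => (x - z) ^ m) (m * (w - z) ^ (m - 1) * 1) w :=
            ((hasDerivAt_id w).sub_const z).pow m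
          exact (h1.mul hwH.differentiableAt.hasDerivAt).const_add _
        rw [hd.deriv]
        obtain ⟨k, hk⟩ : ∃ k, m = k + 1 := ⟨m - 1, by omega⟩
        rw [hk]
        simp only [Nat.add_sub_cancel]
        ring
    refine ⟨r, hr, fun F hF hFb hFe => ?_⟩
    have := hc (M + 1) F hF (fun i => (hFb i).1) hFe
    omega

lemma Pk.ray (h : Pk g P S M) {s : ℝ} {π : ℂ → ℂ} {a : Option ℂ} (hπ : ContinuousOn π {ξ | ξ.re < s})
    (hS : ∀ ξ : ℂ, ξ.re < s → some (π ξ) ∉ S) (hper : ∀ ξ (n : ℕ), π (ξ + n * (2 * Real.pi * Complex.I)) = π ξ)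
    (ha : ∀ ε > 0, ∃ x0 : ℝ, ∀ ξ : ℂ, ξ.re < x0 → chordal (some (π ξ)) a < ε)
    {V : Set ℂ} (hV : IsPreconnected V) {e : ℂ → ℂ}
    (he : ContinuousOn e V) (heU : ∀ w ∈ V, (e w).re < s) (hVP : ∀ w ∈ V, w ∉ P) (hg : ∀ w ∈ V, g w = π (e w))
    {W : ℕ → ℂ} (hW : ∀ j ≤ M, W j ∈ V ∧ e (W j) = e (W 0) + j * (2 * Real.pi * Complex.I)) :
    ∃ γ : ℝ → ℂ, ContinuousOn γ (Ici 0) ∧ γ 0 = W 0 ∧ Tendsto (fun t => ‖γ t‖) atTop atTop ∧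
      ∀ t ∈ Ici (0:ℝ), γ t ∉ P ∧ g (γ t) = π (e (W 0) - t) := by
  have hconv : Convex ℝ {ξ : ℂ | ξ.re < s} := convex_halfSpace_re_lt s
  have hW0 := (hW 0 (Nat.zero_le _)).1
  set ξ0 := e (W 0) with hξ0
  obtain ⟨ψ, hψc, hψ, hψe⟩ := h.star_inv hconv hπ hS hV he heU hVP hg hW0
  have hre : ∀ t : ℝ, 0 ≤ t → (ξ0 - t).re < s := by
    intro t ht; have := heU _ hW0; simp only [Complex.sub_re, Complex.ofReal_re]; linarith
  have hcγ : ContinuousOn (fun t : ℝ => ψ (ξ0 - t)) (Ici 0) :=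
    hψc.comp (by fun_prop) fun t ht => hre t ht
  refine ⟨fun t => ψ (ξ0 - t), hcγ, by simp [hξ0, hψe _ hW0], ?_, fun t ht => hψ _ (hre t ht)⟩
  have hval : ∀ ξ : ℂ, ξ.re < s → valueAt g P (ψ ξ) = some (π ξ) := by
    intro ξ hξ; simp [valueAt, (hψ ξ hξ).1, (hψ ξ hξ).2]
  have hchi : Tendsto (fun t : ℝ => chordal (valueAt g P (ψ (ξ0 - t))) a) atTop (𝓝 0) := by
    rw [Metric.tendsto_nhds]
    intro ε hε
    obtain ⟨x0, hx0⟩ := ha ε hε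
    filter_upwards [eventually_ge_atTop 0, eventually_gt_atTop (ξ0.re - x0)] with t ht ht2
    rw [Real.dist_0_eq_abs, abs_of_nonneg (chordal_nonneg _ _), hval _ (hre t ht)]
    apply hx0; simp only [Complex.sub_re, Complex.ofReal_re]; linarith
  rcases h.dichotomy hcγ hchi with hinf | ⟨p, hp, -⟩
  · exact hinf
  exfalso
  obtain ⟨r0, hr0, hcount⟩ := h.count p
  obtain ⟨r, hr, hrr, c, hc, hring⟩ := h.exists_ring a p hr0
  obtain ⟨x0, hx0⟩ := ha c hc
  set x1 := min x0 s
  have himg : ψ '' {ξ | ξ.re < x1} ⊆ Metric.ball p r := by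
    apply stay
    · exact ((convex_halfSpace_re_lt x1).isPreconnected).image ψ (hψc.mono fun ξ hξ => show ξ.re < s from lt_of_lt_of_le hξ (min_le_right _ _))
    · have e1 : ∀ᶠ t : ℝ in atTop, ψ (ξ0 - t) ∈ Metric.ball p r := hp (Metric.ball_mem_nhds p hr)
      obtain ⟨t, ht, ht2⟩ := (e1.and (eventually_gt_atTop (ξ0.re - x1))).exists
      refine ⟨_, ⟨ξ0 - t, ?_, rfl⟩, ht⟩
      simp only [mem_ofPred_eq, Complex.sub_re, Complex.ofReal_re]; linarith
    · rintro w ⟨ξ, hξ, rfl⟩ hd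
      have := hring _ hd
      rw [hval ξ (lt_of_lt_of_le hξ (min_le_right _ _))] at this
      exact absurd (hx0 ξ (lt_of_lt_of_le hξ (min_le_left _ _))) (not_lt.2 this)
  let τ : ℂ := 2 * Real.pi * Complex.I
  have hτre : ∀ (ξ : ℂ) (n : ℕ), (ξ + n * τ).re = ξ.re := by intro ξ n; simp [τ]
  set ξ1 : ℂ := ((x1 - 1 : ℝ) : ℂ) with hξ1
  have hξ1re : ξ1.re < x1 := by simp [hξ1]
  have hni : ¬ Function.Injective (fun i : Fin (M + 1) => ψ (ξ1 + (i : ℕ) * τ)) := by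
    intro hinj
    refine hcount _ hinj (fun i => ⟨Metric.ball_subset_ball hrr.le (himg ⟨_, ?_, rfl⟩), ?_⟩) ?_
    · simp only [mem_ofPred_eq, hτre]; exact hξ1re
    · exact (hψ _ (by rw [mem_ofPred_eq, hτre]; exact lt_of_lt_of_le hξ1re (min_le_right _ _))).1
    · intro i j
      have hx : ∀ i : Fin (M+1), g (ψ (ξ1 + (i : ℕ) * τ)) = π ξ1 := by
        intro i
        rw [(hψ _ (by rw [mem_ofPred_eq, hτre]; exact lt_of_lt_of_le hξ1re (min_le_right _ _))).2]
        exact hper _ _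
      rw [hx, hx]
  rw [Function.Injective] at hni
  push Not at hni
  obtain ⟨i, j, hij, hne⟩ := hni
  have hag := h.agree hconv.isPreconnected (h1 := fun ξ => ψ (ξ + (i : ℕ) * τ)) (h2 := fun ξ => ψ (ξ + (j : ℕ) * τ))
    (hψc.comp (by fun_prop) fun ξ hξ => by rw [mem_ofPred_eq, hτre]; exact hξ)
    (hψc.comp (by fun_prop) fun ξ hξ => by rw [mem_ofPred_eq, hτre]; exact hξ)
    (fun ξ hξ => by
      have := hψ (ξ + (i : ℕ) * τ) (by rw [mem_ofPred_eq, hτre]; exact hξ)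
      exact ⟨this.1, by rw [this.2]; exact hS _ (by rw [hτre]; exact hξ)⟩)
    (fun ξ hξ => by
      have := hψ (ξ + (j : ℕ) * τ) (by rw [mem_ofPred_eq, hτre]; exact hξ)
      exact ⟨this.1, by rw [this.2]; exact hS _ (by rw [hτre]; exact hξ)⟩)
    (fun ξ hξ => by
      have h1 := hψ (ξ + (i : ℕ) * τ) (by rw [mem_ofPred_eq, hτre]; exact hξ)
      have h2 := hψ (ξ + (j : ℕ) * τ) (by rw [mem_ofPred_eq, hτre]; exact hξ)
      rw [h1.2, h2.2, hper, hper])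
    (a := ξ1) (lt_of_lt_of_le hξ1re (min_le_right _ _)) hij
  have hi := hW i (by omega)
  have hj := hW j (by omega)
  have := hag (heU _ hW0)
  simp only [τ] at this
  rw [← hξ0, ← hi.2, ← hj.2, hψe _ hi.1, hψe _ hj.1] at this
  have h5 := hi.2
  rw [this, hj.2] at h5
  have h6 : (2 * (Real.pi : ℂ) * Complex.I) ≠ 0 := by simp [Real.pi_ne_zero]
  have h7 : ((j : ℕ) : ℂ) = ((i : ℕ) : ℂ) := mul_right_cancel₀ h6 (add_left_cancel h5)
  exact hne (Fin.ext (by exact_mod_cast h7.symm))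

end
end

section

lemma glue {U : Set ℂ} {F : ℂ → ℂ} (h : ∀ z ∈ U, ∃ G, AnalyticAt ℂ G z ∧ F =ᶠ[𝓝[≠] z] G)
    (hU : IsOpen U) : ∃ F' : ℂ → ℂ, ∀ z ∈ U, AnalyticAt ℂ F' z ∧ F =ᶠ[𝓝[≠] z] F' ∧
      ∀ G, AnalyticAt ℂ G z → F =ᶠ[𝓝[≠] z] G → F' =ᶠ[𝓝 z] G := by
  choose! G hG hFG using h
  have huniq : ∀ z ∈ U, ∀ H, ContinuousAt H z → F =ᶠ[𝓝[≠] z] H → G z z = H z := by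
    intro z hz H hH hFH
    have h1 : G z =ᶠ[𝓝[≠] z] H := (hFG z hz).symm.trans hFH
    exact tendsto_nhds_unique (((hG z hz).continuousAt.tendsto.mono_left nhdsWithin_le_nhds))
      ((hH.tendsto.mono_left nhdsWithin_le_nhds).congr' h1.symm)
  have key : ∀ z ∈ U, ∀ H, AnalyticAt ℂ H z → F =ᶠ[𝓝[≠] z] H → (fun w => G w w) =ᶠ[𝓝 z] H := by
    intro z hz H hH hFH
    have e1 := hH.eventually_analyticAt
    have e2 : ∀ᶠ w in 𝓝[≠] z, ∀ᶠ x in 𝓝 w, F x = H x := by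
      have := eventually_eventually_nhdsWithin.2 hFH
      filter_upwards [this, self_mem_nhdsWithin] with w hw hwz
      have : 𝓝 w ≤ 𝓝[≠] z ⊔ 𝓝 w := le_sup_right
      have hn : 𝓝[{z}ᶜ] w = 𝓝 w := nhdsWithin_eq_nhds.2 (isOpen_ne.mem_nhds hwz)
      rw [hn] at hw
      exact hw
    rw [eventually_nhdsWithin_iff] at e2
    filter_upwards [e1, e2, hU.mem_nhds hz] with w h1 h2 hwU
    by_cases hwz : w = z
    · subst hwz; exact huniq w hz H hH.continuousAt hFH
    · exact huniq w hwU H h1.continuousAt ((h2 hwz).filter_mono nhdsWithin_le_nhds)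
  refine ⟨fun w => G w w, fun z hz => ?_⟩
  have := key z hz (G z) (hG z hz) (hFG z hz)
  refine ⟨(hG z hz).congr this.symm, ?_, key z hz⟩
  filter_upwards [hFG z hz, this.filter_mono nhdsWithin_le_nhds] with w h1 h2
  rw [h1, h2]

/-- derivative equality on punctured nhds -/
lemma evEq_deriv {F H : ℂ → ℂ} {z : ℂ} (h : F =ᶠ[𝓝[≠] z] H) : deriv F =ᶠ[𝓝[≠] z] deriv H := by
  have := eventually_eventually_nhdsWithin.2 h
  filter_upwards [this, self_mem_nhdsWithin] with w hw hwz
  have hn : 𝓝[{z}ᶜ] w = 𝓝 w := nhdsWithin_eq_nhds.2 (isOpen_ne.mem_nhds hwz)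
  rw [hn] at hw
  exact Filter.EventuallyEq.deriv_eq hw

lemma hasD_zpow {w z : ℂ} (k : ℤ) (h : w - z ≠ 0) :
    HasDerivAt (fun w : ℂ => (w - z) ^ k) (k * (w - z) ^ (k - 1) * 1) w := by
  have hs : HasDerivAt (fun x : ℂ => x - z) 1 w := (hasDerivAt_id w).sub_const z
  exact HasDerivAt.comp (h₂ := fun y : ℂ => y ^ k) w (hasDerivAt_zpow k (w - z) (Or.inl h)) hs

lemma ord_schw {g q H : ℂ → ℂ} {z : ℂ} {k : ℤ} (hH : AnalyticAt ℂ H z) (hH0 : H z ≠ 0)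
    (hD : deriv g =ᶠ[𝓝[≠] z] fun w => (w - z) ^ k * H w) (hq : ContinuousAt q z)
    (hS : ∀ᶠ w in 𝓝[≠] z, schwarzian g w = 2 * q w) : k = 0 ∨ k = -2 := by
  set Mm : ℂ → ℂ := fun w => deriv H w / H w with hMm
  have hM : AnalyticAt ℂ Mm z := hH.deriv.div hH hH0
  have hHne := hH.continuousAt.eventually_ne hH0
  have hD1 : deriv (deriv g) =ᶠ[𝓝[≠] z] fun w => ((w - z) ^ k * H w) * (k / (w - z) + Mm w) := by
    refine (evEq_deriv hD).trans ?_
    filter_upwards [hH.eventually_analyticAt.filter_mono nhdsWithin_le_nhds, hHne.filter_mono nhdsWithin_le_nhds,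
      self_mem_nhdsWithin] with w h1 h2 h3
    have h3' : w - z ≠ 0 := sub_ne_zero.2 h3
    have ha : HasDerivAt (fun w : ℂ => (w - z) ^ k) (k * (w - z) ^ (k - 1) * 1) w :=
      hasD_zpow k h3'
    have hc : HasDerivAt (fun w => (w - z) ^ k * H w) _ w := ha.mul h1.differentiableAt.hasDerivAt
    rw [hc.deriv, zpow_sub_one₀ h3']
    simp only [hMm]
    field_simp
  have hD2 : deriv (deriv (deriv g)) =ᶠ[𝓝[≠] z] fun w => ((w - z) ^ k * H w) *
      ((k / (w - z) + Mm w) ^ 2 + (-k / (w - z) ^ 2 + deriv Mm w)) := by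
    refine (evEq_deriv hD1).trans ?_
    filter_upwards [hH.eventually_analyticAt.filter_mono nhdsWithin_le_nhds, hHne.filter_mono nhdsWithin_le_nhds,
      hM.eventually_analyticAt.filter_mono nhdsWithin_le_nhds, self_mem_nhdsWithin] with w h1 h2 hm h3
    have h3' : w - z ≠ 0 := sub_ne_zero.2 h3
    have ha : HasDerivAt (fun w : ℂ => (w - z) ^ k) (k * (w - z) ^ (k - 1) * 1) w :=
      hasD_zpow k h3'
    have hb : HasDerivAt (fun w : ℂ => (k : ℂ) / (w - z)) (-k / (w - z) ^ 2) w := by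
      have := ((hasDerivAt_id w).sub_const z).inv h3'
      have := this.const_mul (k : ℂ)
      refine (this.congr_deriv ?_)
      simp [div_eq_mul_inv]
    have hc : HasDerivAt (fun w => (w - z) ^ k * H w) _ w := ha.mul h1.differentiableAt.hasDerivAt
    have hd : HasDerivAt (fun w => (k : ℂ) / (w - z) + Mm w) _ w := hb.add hm.differentiableAt.hasDerivAt
    have he : HasDerivAt (fun w => ((w - z) ^ k * H w) * (k / (w - z) + Mm w)) _ w := hc.mul hd
    rw [he.deriv, zpow_sub_one₀ h3']
    have : deriv H w = Mm w * H w := by simp only [hMm]; field_simp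
    rw [this]
    field_simp
  have hfin : ∀ᶠ w in 𝓝[≠] z, (w - z) ^ 2 * (2 * q w) =
      -k + (w - z) ^ 2 * deriv Mm w - (1 / 2) * (k + (w - z) * Mm w) ^ 2 := by
    filter_upwards [hS, hD, hD1, hD2, hHne.filter_mono nhdsWithin_le_nhds, self_mem_nhdsWithin] with w h1 h2 h3 h4 h5 h6
    have h6' : w - z ≠ 0 := sub_ne_zero.2 h6
    have h7 : (w - z) ^ k * H w ≠ 0 := mul_ne_zero (zpow_ne_zero _ h6') h5
    rw [← h1, schwarzian, h2, h3, h4, mul_div_cancel_left₀ _ h7, mul_div_cancel_left₀ _ h7]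
    field_simp
    ring
  have l1 : Tendsto (fun w => (w - z) ^ 2 * (2 * q w)) (𝓝[≠] z) (𝓝 ((z - z) ^ 2 * (2 * q z))) := by
    have : ContinuousAt (fun w => (w - z) ^ 2 * (2 * q w)) z := by fun_prop
    exact this.tendsto.mono_left nhdsWithin_le_nhds
  have l2 : Tendsto (fun w => -(k:ℂ) + (w - z) ^ 2 * deriv Mm w - (1 / 2) * (k + (w - z) * Mm w) ^ 2) (𝓝[≠] z)
      (𝓝 (-(k:ℂ) + (z - z) ^ 2 * deriv Mm z - (1 / 2) * (k + (z - z) * Mm z) ^ 2)) := by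
    have c1 := hM.continuousAt
    have c2 := hM.deriv.continuousAt
    have : ContinuousAt (fun w => -(k:ℂ) + (w - z) ^ 2 * deriv Mm w - (1 / 2) * (k + (w - z) * Mm w) ^ 2) z := by fun_prop
    exact this.tendsto.mono_left nhdsWithin_le_nhds
  have := tendsto_nhds_unique (l1.congr' hfin) l2
  simp only [sub_self] at this
  have h8 : (k : ℂ) * (k + 2) = 0 := by linear_combination 2 * this
  rcases mul_eq_zero.1 h8 with h | h
  · left; exact_mod_cast h
  · right
    have : ((k + 2 : ℤ) : ℂ) = 0 := by push_cast; exact h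
    have : k + 2 = 0 := by exact_mod_cast this
    omega

lemma MeroPlane.loc_simple {g : ℂ → ℂ} {P : Set ℂ} (hm : MeroPlane g P)
    (hn : ∀ z, ¬ ∀ᶠ w in 𝓝[≠] z, deriv g w = 0) {q : ℂ → ℂ} {B : Set ℂ} (hB : IsOpen B)
    (hq : ∀ z ∈ B, ContinuousAt q z)
    (hS : ∀ w ∈ B, w ∉ P → deriv g w ≠ 0 → schwarzian g w = 2 * q w) {z : ℂ} (hz : z ∈ B) :
    (z ∉ P → deriv g z ≠ 0) ∧ (z ∈ P → ∃ h, AnalyticAt ℂ h z ∧ h z ≠ 0 ∧ ∀ᶠ w in 𝓝[≠] z, g w = h w / (w - z)) := by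
  have key : ∀ (k : ℤ) (H : ℂ → ℂ), AnalyticAt ℂ H z → H z ≠ 0 →
      deriv g =ᶠ[𝓝[≠] z] (fun w => (w - z) ^ k * H w) → k = 0 ∨ k = -2 := by
    intro k H hH hH0 hD
    refine ord_schw hH hH0 hD (hq z hz) ?_
    filter_upwards [hm.isolated z, hD, (hH.continuousAt.eventually_ne hH0).filter_mono nhdsWithin_le_nhds,
      self_mem_nhdsWithin, nhdsWithin_le_nhds (hB.mem_nhds hz)] with w h1 h2 h3 h4 h5
    refine hS w h5 h1 ?_
    rw [h2]; exact mul_ne_zero (zpow_ne_zero _ (sub_ne_zero.2 h4)) h3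
  constructor
  · intro hzP h0
    have han : AnalyticAt ℂ (deriv g) z := (hm.2.1 z hzP).deriv
    have hfin : analyticOrderAt (deriv g) z ≠ ⊤ := by
      rw [Ne, analyticOrderAt_eq_top]
      intro h1
      exact hn z (h1.filter_mono nhdsWithin_le_nhds)
    obtain ⟨H, hH, hH0, hHe⟩ := (han.analyticOrderAt_ne_top).1 hfin
    set m := analyticOrderNatAt (deriv g) z
    rcases key m H hH hH0 (by
      filter_upwards [hHe.filter_mono nhdsWithin_le_nhds] with w hw
      simpa using hw) with h | h
    · have hm0 : m = 0 := by exact_mod_cast h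
      have := hHe.self_of_nhds
      rw [h0, hm0] at this; simp at this; exact hH0 this.symm
    · omega
  · intro hzP
    obtain ⟨G, hG, hG0, hGe⟩ := hm.exists_inv hzP
    have hfin : analyticOrderAt G z ≠ ⊤ := by
      rw [Ne, analyticOrderAt_eq_top]
      intro h1
      obtain ⟨w, hw1, hw2⟩ := ((h1.filter_mono (nhdsWithin_le_nhds (s := {z}ᶜ))).and hGe).exists
      exact hw2.2.1 hw1
    obtain ⟨H, hH, hH0, hHe⟩ := (hG.analyticOrderAt_ne_top).1 hfin
    set m := analyticOrderNatAt G z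
    have hm0 : m ≠ 0 := by
      intro hm0
      have := hHe.self_of_nhds
      rw [hG0, hm0] at this; simp at this; exact hH0 this.symm
    set h : ℂ → ℂ := fun w => (H w)⁻¹ with hh
    have hhan : AnalyticAt ℂ h z := hH.inv hH0
    have hh0 : h z ≠ 0 := inv_ne_zero hH0
    have hg : g =ᶠ[𝓝[≠] z] fun w => (w - z) ^ (-(m:ℤ)) * h w := by
      filter_upwards [hGe, hHe.filter_mono nhdsWithin_le_nhds] with w h1 h2
      rw [h1.2.2, h2, smul_eq_mul, mul_inv, zpow_neg, zpow_natCast]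
    have hD : deriv g =ᶠ[𝓝[≠] z] fun w => (w - z) ^ (-(m:ℤ) - 1) * (-m * h w + (w - z) * deriv h w) := by
      refine (evEq_deriv hg).trans ?_
      filter_upwards [hhan.eventually_analyticAt.filter_mono nhdsWithin_le_nhds, self_mem_nhdsWithin] with w h1 h3
      have h3' : w - z ≠ 0 := sub_ne_zero.2 h3
      have ha : HasDerivAt (fun w : ℂ => (w - z) ^ (-(m:ℤ))) (((-(m:ℤ) : ℤ) : ℂ) * (w - z) ^ (-(m:ℤ) - 1) * 1) w :=
        hasD_zpow _ h3'
      have hc : HasDerivAt (fun w => (w - z) ^ (-(m:ℤ)) * h w) _ w := ha.mul h1.differentiableAt.hasDerivAt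
      rw [hc.deriv, zpow_sub_one₀ h3']
      push_cast
      field_simp
    have := key _ _ (by have := hhan.deriv; fun_prop) (by simp [hm0, hh0]) hD
    have hm1 : m = 1 := by omega
    refine ⟨h, hhan, hh0, ?_⟩
    filter_upwards [hg] with w hw
    rw [hw, hm1]; simp [zpow_neg_one, div_eq_mul_inv, mul_comm]

def IsSol (q : ℂ → ℂ) (U : Set ℂ) (y y' : ℂ → ℂ) : Prop :=
  ∀ w ∈ U, HasDerivAt y (y' w) w ∧ HasDerivAt y' (-q w * y w) w

lemma eq_of_nhdsNE {F H : ℂ → ℂ} {z : ℂ} (hF : ContinuousAt F z) (hH : ContinuousAt H z)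
    (h : F =ᶠ[𝓝[≠] z] H) : F z = H z :=
  tendsto_nhds_unique (hF.tendsto.mono_left nhdsWithin_le_nhds)
    ((hH.tendsto.mono_left nhdsWithin_le_nhds).congr' h.symm)

lemma exists_sqrt_ball {F : ℂ → ℂ} {K : ℝ} (hK : 0 < K) (hF : ∀ z ∈ Metric.ball (0:ℂ) K, AnalyticAt ℂ F z)
    (h0 : ∀ z ∈ Metric.ball (0:ℂ) K, F z ≠ 0) :
    ∃ s : ℂ → ℂ, ∀ z ∈ Metric.ball (0:ℂ) K, AnalyticAt ℂ s z ∧ s z ^ 2 = F z := by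
  have hd : DifferentiableOn ℂ (fun z => deriv F z / F z) (Metric.ball 0 K) := fun z hz =>
    (((hF z hz).deriv.div (hF z hz) (h0 z hz)).differentiableAt).differentiableWithinAt
  obtain ⟨L, hL⟩ := hd.isExactOn_ball
  have hLan : ∀ z ∈ Metric.ball (0:ℂ) K, AnalyticAt ℂ L z := fun z hz =>
    DifferentiableOn.analyticAt (s := Metric.ball 0 K) (fun w hw => (hL w hw).differentiableAt.differentiableWithinAt)
      (Metric.isOpen_ball.mem_nhds hz)
  obtain ⟨c, hc⟩ := IsAlgClosed.exists_pow_nat_eq (F 0 * Complex.exp (-L 0)) two_pos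
  refine ⟨fun z => c * Complex.exp (L z / 2), fun z hz => ⟨?_, ?_⟩⟩
  · have := hLan z hz; fun_prop
  · have hconst : ∀ w ∈ Metric.ball (0:ℂ) K, F w * Complex.exp (-L w) = F 0 * Complex.exp (-L 0) := by
      intro w hw
      refine (Metric.isOpen_ball (x := (0:ℂ)) (ε := K)).is_const_of_deriv_eq_zero (convex_ball _ _).isPreconnected
        (f := fun w => F w * Complex.exp (-L w)) ?_ ?_ hw (Metric.mem_ball_self hK)
      · intro x hx
        exact ((hF x hx).differentiableAt.mul (hL x hx).differentiableAt.neg.cexp).differentiableWithinAt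
      · intro x hx
        have : HasDerivAt (fun w => F w * Complex.exp (-L w)) _ x := ((hF x hx).differentiableAt.hasDerivAt).mul ((hL x hx).neg.cexp)
        rw [this.deriv]
        have := h0 x hx
        simp only [Pi.neg_apply, Pi.zero_apply]
        field_simp
        ring
    have e1 : c ^ 2 = F z * Complex.exp (-L z) := by rw [hconst z hz, hc]
    rw [mul_pow, e1, ← Complex.exp_nat_mul, mul_assoc, ← Complex.exp_add]
    push_cast
    rw [show -L z + 2 * (L z / 2) = 0 by ring]; simp

end

section

lemma sol_loc {g q Y : ℂ → ℂ} {z : ℂ} (hg : AnalyticAt ℂ g z) (hg0 : deriv g z ≠ 0)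
    (hS : ∀ᶠ w in 𝓝 z, schwarzian g w = 2 * q w) (hY : AnalyticAt ℂ Y z)
    (h1 : ∀ᶠ w in 𝓝 z, Y w ^ 2 * deriv g w = 1) :
    deriv Y z = - (1/2) * (deriv (deriv g) z / deriv g z) * Y z ∧ deriv (deriv Y) z = - q z * Y z := by
  have hE : ∀ᶠ w in 𝓝 z, deriv Y w = - (1/2) * (deriv (deriv g) w / deriv g w) * Y w := by
    filter_upwards [hY.eventually_analyticAt, hg.deriv.eventually_analyticAt,
      eventually_eventually_nhds.2 h1, hg.deriv.continuousAt.eventually_ne hg0] with w a b c d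
    have e : HasDerivAt (fun w => Y w ^ 2 * deriv g w) _ w :=
      (a.differentiableAt.hasDerivAt.pow 2).mul b.differentiableAt.hasDerivAt
    have e2 : deriv (fun w => Y w ^ 2 * deriv g w) w = 0 := by
      rw [Filter.EventuallyEq.deriv_eq (f := fun _ => (1:ℂ)) c]; simp
    rw [e.deriv] at e2
    simp only [Pi.pow_apply] at e2
    have hY0 : Y w ≠ 0 := by
      intro h0
      have := c.self_of_nhds; simp [h0] at this
    push_cast at e2
    have : Y w * (2 * deriv Y w * deriv g w + Y w * deriv (deriv g) w) = 0 := by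
      linear_combination e2
    have := (mul_eq_zero.1 this).resolve_left hY0
    field_simp
    linear_combination this
  have e0 := hE.self_of_nhds
  refine ⟨e0, ?_⟩
  rw [Filter.EventuallyEq.deriv_eq (show deriv Y =ᶠ[𝓝 z] _ from hE)]
  have hd : HasDerivAt (fun w => deriv (deriv g) w / deriv g w) _ z :=
    (hg.deriv.deriv.differentiableAt.hasDerivAt).div hg.deriv.differentiableAt.hasDerivAt hg0
  have hd2 : HasDerivAt (fun w => - (1/2) * (deriv (deriv g) w / deriv g w) * Y w) _ z :=
    (hd.const_mul (-(1/2))).mul hY.differentiableAt.hasDerivAt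
  rw [hd2.deriv, e0]
  have hs := hS.self_of_nhds
  rw [schwarzian] at hs
  have hq : q z = (1/2) * (deriv (deriv (deriv g)) z / deriv g z - 3 / 2 * (deriv (deriv g) z / deriv g z) ^ 2) := by
    rw [hs]; ring
  rw [hq]
  field_simp
  ring

lemma sol_exists {g : ℂ → ℂ} {P : Set ℂ} (hm : MeroPlane g P)
    (hn : ∀ z, ¬ ∀ᶠ w in 𝓝[≠] z, deriv g w = 0) {q : ℂ → ℂ} {K : ℝ} (hK : 0 < K)
    (hq : ∀ z ∈ Metric.ball (0:ℂ) K, ContinuousAt q z)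
    (hS : ∀ w ∈ Metric.ball (0:ℂ) K, w ∉ P → deriv g w ≠ 0 → schwarzian g w = 2 * q w) :
    ∃ Y1 Y1' Y2 Y2' : ℂ → ℂ, IsSol q (Metric.ball 0 K) Y1 Y1' ∧ IsSol q (Metric.ball 0 K) Y2 Y2' ∧
      (∀ w ∈ Metric.ball (0:ℂ) K, Y1' w * Y2 w - Y1 w * Y2' w = 1) ∧
      ∀ w ∈ Metric.ball (0:ℂ) K, HRep g P Y1 Y2 w := by
  set B := Metric.ball (0:ℂ) K
  have hBo : IsOpen B := Metric.isOpen_ball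
  have loc := fun z (hz : z ∈ B) => hm.loc_simple hn hBo hq hS hz
  set Fn := (hm.1 _ (isCompact_closedBall (0:ℂ) K)).toFinset with hFn
  have hmem : ∀ z ∈ B, (z ∈ Fn ↔ z ∈ P) := by
    intro z hz
    simp only [hFn, Set.Finite.mem_toFinset, mem_inter_iff, and_iff_left_iff_imp]
    intro _; exact Metric.ball_subset_closedBall hz
  set Q : ℂ → ℂ := fun w => ∏ u ∈ Fn, (w - u) with hQ
  have hQa : ∀ z, AnalyticAt ℂ Q z := fun z => by
    have : Differentiable ℂ Q := by intro z; simp only [hQ]; fun_prop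
    exact this.analyticAt z
  have hQ0 : ∀ z ∈ B, z ∉ P → Q z ≠ 0 := by
    intro z hz hzP
    refine Finset.prod_ne_zero_iff.2 fun u hu => sub_ne_zero.2 ?_
    rintro rfl; exact hzP ((hmem _ hz).1 hu)
  -- local factor at poles
  have hpole : ∀ z ∈ B, z ∈ P → ∃ Q1 h : ℂ → ℂ, AnalyticAt ℂ Q1 z ∧ Q1 z ≠ 0 ∧ AnalyticAt ℂ h z ∧ h z ≠ 0 ∧
      (∀ w, Q w = (w - z) * Q1 w) ∧ g =ᶠ[𝓝[≠] z] fun w => h w / (w - z) := by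
    intro z hz hzP
    obtain ⟨h, ha, h0, he⟩ := (loc z hz).2 hzP
    refine ⟨fun w => ∏ u ∈ Fn.erase z, (w - u), h, ?_, ?_, ha, h0, ?_, he⟩
    · have : Differentiable ℂ (fun w : ℂ => ∏ u ∈ Fn.erase z, (w - u)) := by fun_prop
      exact this.analyticAt z
    · refine Finset.prod_ne_zero_iff.2 fun u hu => sub_ne_zero.2 ?_
      rintro rfl; exact Finset.notMem_erase _ _ hu
    · intro w; simp only [hQ]
      rw [Finset.mul_prod_erase Fn (fun u => w - u) ((hmem z hz).2 hzP)]
  have hF0 : ∀ z ∈ B, ∃ G, AnalyticAt ℂ G z ∧ (fun w => (deriv g w * Q w ^ 2)⁻¹) =ᶠ[𝓝[≠] z] G ∧ G z ≠ 0 := by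
    intro z hz
    by_cases hzP : z ∈ P
    · obtain ⟨Q1, h, hQ1, hQ10, hh, hh0, hQe, hge⟩ := hpole z hz hzP
      have hne : (-h z + (z - z) * deriv h z) * Q1 z ^ 2 ≠ 0 := by
        simp [hh0, hQ10]
      refine ⟨fun w => ((-h w + (w - z) * deriv h w) * Q1 w ^ 2)⁻¹, ?_, ?_, inv_ne_zero hne⟩
      · have := hh.deriv
        have h2 : AnalyticAt ℂ (fun w => (-h w + (w - z) * deriv h w) * Q1 w ^ 2) z := by fun_prop
        exact h2.inv hne
      · filter_upwards [evEq_deriv hge, self_mem_nhdsWithin,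
          hh.eventually_analyticAt.filter_mono nhdsWithin_le_nhds] with w h1 h2 h3
        have h2' : w - z ≠ 0 := sub_ne_zero.2 h2
        have hs : HasDerivAt (fun x : ℂ => x - z) 1 w := (hasDerivAt_id w).sub_const z
        have hd : HasDerivAt (fun w => h w / (w - z)) _ w := h3.differentiableAt.hasDerivAt.div hs h2'
        rw [h1, hd.deriv, hQe]
        congr 1
        field_simp
        ring
    · have hne : deriv g z * Q z ^ 2 ≠ 0 := mul_ne_zero ((loc z hz).1 hzP) (pow_ne_zero _ (hQ0 z hz hzP))
      refine ⟨_, ?_, EventuallyEq.rfl, inv_ne_zero hne⟩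
      have := (hm.2.1 z hzP).deriv
      have h2 : AnalyticAt ℂ (fun w => deriv g w * Q w ^ 2) z := by have := hQa z; fun_prop
      exact h2.inv hne
  obtain ⟨F, hF⟩ := glue (fun z hz => (hF0 z hz).imp fun G h => ⟨h.1, h.2.1⟩) hBo
  have hFne : ∀ z ∈ B, F z ≠ 0 := by
    intro z hz
    obtain ⟨G, h1, h2, h3⟩ := hF0 z hz
    rw [((hF z hz).2.2 G h1 h2).self_of_nhds]; exact h3
  have hFoff : ∀ z ∈ B, z ∉ P → F z = (deriv g z * Q z ^ 2)⁻¹ := by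
    intro z hz hzP
    have hne : deriv g z * Q z ^ 2 ≠ 0 := mul_ne_zero ((loc z hz).1 hzP) (pow_ne_zero _ (hQ0 z hz hzP))
    have := (hm.2.1 z hzP).deriv
    have h2 : AnalyticAt ℂ (fun w => deriv g w * Q w ^ 2) z := by have := hQa z; fun_prop
    exact ((hF z hz).2.2 _ (h2.inv hne) EventuallyEq.rfl).self_of_nhds
  obtain ⟨s, hs⟩ := exists_sqrt_ball hK (fun z hz => (hF z hz).1) hFne
  have hs0 : ∀ z ∈ B, s z ≠ 0 := fun z hz h => hFne z hz (by rw [← (hs z hz).2, h]; simp)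
  set Y2 : ℂ → ℂ := fun w => Q w * s w with hY2
  have hY2a : ∀ z ∈ B, AnalyticAt ℂ Y2 z := fun z hz => (hQa z).mul (hs z hz).1
  have hY2e : ∀ z ∈ B, z ∉ P → Y2 z ^ 2 * deriv g z = 1 := by
    intro z hz hzP
    have a := (loc z hz).1 hzP
    have b := hQ0 z hz hzP
    simp only [hY2]
    rw [mul_pow, (hs z hz).2, hFoff z hz hzP]; field_simp
  have hG0 : ∀ z ∈ B, ∃ G, AnalyticAt ℂ G z ∧ (fun w => g w * Y2 w) =ᶠ[𝓝[≠] z] G := by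
    intro z hz
    by_cases hzP : z ∈ P
    · obtain ⟨Q1, h, hQ1, hQ10, hh, hh0, hQe, hge⟩ := hpole z hz hzP
      refine ⟨fun w => h w * Q1 w * s w, (hh.mul hQ1).mul (hs z hz).1, ?_⟩
      filter_upwards [hge, self_mem_nhdsWithin] with w h1 h2
      have h2' : w - z ≠ 0 := sub_ne_zero.2 h2
      simp only [hY2]
      rw [h1, hQe]; field_simp
    · exact ⟨_, (hm.2.1 z hzP).mul (hY2a z hz), EventuallyEq.rfl⟩
  obtain ⟨Y1, hY1⟩ := glue hG0 hBo
  have hPc : IsOpen Pᶜ := hm.isClosed.isOpen_compl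
  have hY1a : ∀ z ∈ B, AnalyticAt ℂ Y1 z := fun z hz => (hY1 z hz).1
  have hY1e : ∀ z ∈ B, z ∉ P → Y1 =ᶠ[𝓝 z] fun w => g w * Y2 w := fun z hz hzP =>
    (hY1 z hz).2.2 _ ((hm.2.1 z hzP).mul (hY2a z hz)) EventuallyEq.rfl
  have hoff : ∀ z ∈ B, z ∉ P → deriv (deriv Y2) z = -q z * Y2 z ∧ deriv (deriv Y1) z = -q z * Y1 z ∧
      deriv Y1 z * Y2 z - Y1 z * deriv Y2 z = 1 := by
    intro z hz hzP
    have hU : ∀ᶠ w in 𝓝 z, w ∈ B ∧ w ∉ P := (hBo.eventually_mem hz).and (hPc.eventually_mem hzP)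
    have hg := hm.2.1 z hzP
    have hg0 := (loc z hz).1 hzP
    have hYa := hY2a z hz
    obtain ⟨d1, d2⟩ := sol_loc (q := q) hg hg0 (hU.mono fun w hw => hS w hw.1 hw.2 ((loc w hw.1).1 hw.2)) hYa
      (hU.mono fun w hw => hY2e w hw.1 hw.2)
    have e1 := hY1e z hz hzP
    have dd : deriv Y1 =ᶠ[𝓝 z] fun w => deriv g w * Y2 w + g w * deriv Y2 w := by
      filter_upwards [eventually_eventually_nhds.2 e1, hg.eventually_analyticAt, hYa.eventually_analyticAt] with w a b c
      have : HasDerivAt (fun w => g w * Y2 w) _ w := b.differentiableAt.hasDerivAt.mul c.differentiableAt.hasDerivAt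
      rw [Filter.EventuallyEq.deriv_eq a, this.deriv]
    have d0 : deriv Y1 z = _ := dd.self_of_nhds
    refine ⟨d2, ?_, ?_⟩
    · rw [Filter.EventuallyEq.deriv_eq dd]
      have h2 : HasDerivAt (fun w => deriv g w * Y2 w + g w * deriv Y2 w) _ z :=
        (hg.deriv.differentiableAt.hasDerivAt.mul hYa.differentiableAt.hasDerivAt).add
          (hg.differentiableAt.hasDerivAt.mul hYa.deriv.differentiableAt.hasDerivAt)
      rw [h2.deriv, d2, d1, e1.self_of_nhds]
      field_simp
      ring
    · rw [d0, e1.self_of_nhds]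
      linear_combination hY2e z hz hzP
  have hev : ∀ z ∈ B, ∀ᶠ w in 𝓝[≠] z, w ∈ B ∧ w ∉ P := fun z hz =>
    ((hBo.eventually_mem hz).filter_mono nhdsWithin_le_nhds).and (hm.isolated z)
  have c1 : ∀ z ∈ B, deriv (deriv Y2) z = -q z * Y2 z := fun z hz =>
    eq_of_nhdsNE (F := deriv (deriv Y2)) (H := fun z => -q z * Y2 z) (hY2a z hz).deriv.deriv.continuousAt
      ((hq z hz).neg.mul (hY2a z hz).continuousAt) ((hev z hz).mono fun w hw => (hoff w hw.1 hw.2).1)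
  have c2 : ∀ z ∈ B, deriv (deriv Y1) z = -q z * Y1 z := fun z hz =>
    eq_of_nhdsNE (F := deriv (deriv Y1)) (H := fun z => -q z * Y1 z) (hY1a z hz).deriv.deriv.continuousAt
      ((hq z hz).neg.mul (hY1a z hz).continuousAt) ((hev z hz).mono fun w hw => (hoff w hw.1 hw.2).2.1)
  have c3 : ∀ z ∈ B, deriv Y1 z * Y2 z - Y1 z * deriv Y2 z = 1 := fun z hz =>
    eq_of_nhdsNE (F := fun z => deriv Y1 z * Y2 z - Y1 z * deriv Y2 z) (H := fun _ => 1)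
      (((hY1a z hz).deriv.continuousAt.mul (hY2a z hz).continuousAt).sub
        ((hY1a z hz).continuousAt.mul (hY2a z hz).deriv.continuousAt))
      continuousAt_const ((hev z hz).mono fun w hw => (hoff w hw.1 hw.2).2.2)
  refine ⟨Y1, deriv Y1, Y2, deriv Y2, fun w hw => ⟨(hY1a w hw).differentiableAt.hasDerivAt, ?_⟩,
    fun w hw => ⟨(hY2a w hw).differentiableAt.hasDerivAt, ?_⟩, c3, fun w hw => ⟨?_, ⟨?_, ?_⟩, ?_⟩⟩
  · rw [← c2 w hw]; exact (hY1a w hw).deriv.differentiableAt.hasDerivAt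
  · rw [← c1 w hw]; exact (hY2a w hw).deriv.differentiableAt.hasDerivAt
  · by_contra hcon
    push Not at hcon
    have := c3 w hw
    simp [hcon.1, hcon.2] at this
  · intro hP
    simp only [hY2, hQ]
    rw [Finset.prod_eq_zero ((hmem w hw).2 hP) (sub_self w), zero_mul]
  · intro h0
    by_contra hP
    have := hY2e w hw hP
    simp [h0] at this
  · intro hP
    exact (hY1e w hw hP).self_of_nhds

end

section

/-- WKB data on the ball of radius `K`. -/
structure WK (K B : ℝ) (l Z : ℂ → ℂ) : Prop where
  hB : 1 ≤ B
  an : ∀ w ∈ Metric.ball (0:ℂ) K, AnalyticAt ℂ l w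
  l0 : ∀ w ∈ Metric.ball (0:ℂ) K, ‖l w‖ ≤ 1 / 100
  l1 : ∀ w ∈ Metric.ball (0:ℂ) K, ‖deriv l w‖ ≤ 1
  l2 : ∀ w ∈ Metric.ball (0:ℂ) K, ‖deriv (deriv l) w‖ ≤ 1
  hZ : ∀ w ∈ Metric.ball (0:ℂ) K, HasDerivAt Z (B * Complex.exp ((w + l w) / 2)) w
  Zb : ∀ w ∈ Metric.ball (0:ℂ) K, ‖Z w - 2 * B * Complex.exp (w / 2)‖ ≤ B / 1000

def dd (B : ℝ) (l : ℂ → ℂ) (w : ℂ) : ℂ := (Real.sqrt B : ℂ) * Complex.exp ((w + l w) / 4)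
def ee (l : ℂ → ℂ) (w : ℂ) : ℂ := (1 + deriv l w) / 4
def qq (B : ℝ) (l : ℂ → ℂ) (w : ℂ) : ℂ := (B : ℂ) ^ 2 * Complex.exp (w + l w)
def kap (B : ℝ) (l : ℂ → ℂ) (s w : ℂ) : ℂ :=
  Complex.I * (ee l w ^ 2 - deriv (deriv l) w / 4) / (2 * (s * dd B l w ^ 2))
def PX (B : ℝ) (l Z : ℂ → ℂ) (s : ℂ) (y y' : ℂ → ℂ) (w : ℂ) : ℂ :=
  (dd B l w * y w + (ee l w * y w + y' w) / (Complex.I * s * dd B l w)) / 2 * Complex.exp (-(Complex.I * s * Z w))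
def PV (B : ℝ) (l Z : ℂ → ℂ) (s : ℂ) (y y' : ℂ → ℂ) (w : ℂ) : ℂ :=
  (dd B l w * y w - (ee l w * y w + y' w) / (Complex.I * s * dd B l w)) / 2 * Complex.exp (-(Complex.I * s * Z w))

variable {K B : ℝ} {l Z : ℂ → ℂ}

lemma WK.d_ne (h : WK K B l Z) (w : ℂ) : dd B l w ≠ 0 := by
  have := h.hB
  have : Real.sqrt B ≠ 0 := (Real.sqrt_pos.2 (by linarith)).ne'
  exact mul_ne_zero (by exact_mod_cast this) (Complex.exp_ne_zero _)

lemma WK.d_sq (h : WK K B l Z) (w : ℂ) : dd B l w ^ 2 = B * Complex.exp ((w + l w) / 2) := by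
  have := h.hB
  rw [dd, mul_pow, ← Complex.exp_nat_mul, ← Complex.ofReal_pow, Real.sq_sqrt (by linarith)]
  congr 2; push_cast; ring

lemma WK.d_four (h : WK K B l Z) (w : ℂ) : dd B l w ^ 4 = qq B l w := by
  rw [show dd B l w ^ 4 = (dd B l w ^ 2) ^ 2 by ring, h.d_sq, mul_pow, ← Complex.exp_nat_mul, qq]
  congr 2; push_cast; ring

lemma WK.d_deriv (h : WK K B l Z) {w : ℂ} (hw : w ∈ Metric.ball (0:ℂ) K) :
    HasDerivAt (dd B l) (ee l w * dd B l w) w := by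
  have h1 : HasDerivAt (fun w => (w + l w) / 4) ((1 + deriv l w) / 4) w :=
    ((hasDerivAt_id w).add (h.an w hw).differentiableAt.hasDerivAt).div_const 4
  have h2 : HasDerivAt (fun w => (Real.sqrt B : ℂ) * Complex.exp ((w + l w) / 4)) _ w := h1.cexp.const_mul _
  refine h2.congr_deriv ?_
  simp only [ee, dd]; ring

lemma WK.e_deriv (h : WK K B l Z) {w : ℂ} (hw : w ∈ Metric.ball (0:ℂ) K) :
    HasDerivAt (ee l) (deriv (deriv l) w / 4) w :=
  ((h.an w hw).deriv.differentiableAt.hasDerivAt.const_add 1).div_const 4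

lemma WK.P_deriv (h : WK K B l Z) {w s : ℂ} (hw : w ∈ Metric.ball (0:ℂ) K) (hs : s ^ 2 = 1)
    {y y' : ℂ → ℂ} (hy : IsSol (qq B l) (Metric.ball 0 K) y y') :
    HasDerivAt (PX B l Z s y y') (kap B l s w * (PX B l Z s y y' w + PV B l Z s y y' w)) w ∧
    HasDerivAt (PV B l Z s y y') (-(2 * Complex.I * (s * dd B l w ^ 2)) * PV B l Z s y y' w
      - kap B l s w * (PX B l Z s y y' w + PV B l Z s y y' w)) w := by
  have hd := h.d_deriv hw
  have he := h.e_deriv hw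
  obtain ⟨h1, h2⟩ := hy w hw
  have hd0 := h.d_ne w
  have hs0 : s ≠ 0 := by rintro rfl; simp at hs
  have hI := Complex.I_ne_zero
  have hZ := h.hZ w hw
  rw [← h.d_sq] at hZ
  rw [← h.d_four] at h2
  have hE : HasDerivAt (fun w => Complex.exp (-(Complex.I * s * Z w))) _ w := ((hZ.const_mul (Complex.I * s)).neg).cexp
  have hP : HasDerivAt (fun w => dd B l w * y w) _ w := hd.mul h1
  have hR : HasDerivAt (fun w => (ee l w * y w + y' w) / (Complex.I * s * dd B l w)) _ w :=
    ((he.mul h1).add h2).div (hd.const_mul (Complex.I * s)) (by positivity)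
  have e1 : HasDerivAt (fun w => (dd B l w * y w + (ee l w * y w + y' w) / (Complex.I * s * dd B l w)) / 2 * Complex.exp (-(Complex.I * s * Z w))) _ w :=
    ((hP.add hR).div_const 2).mul hE
  have e2 : HasDerivAt (fun w => (dd B l w * y w - (ee l w * y w + y' w) / (Complex.I * s * dd B l w)) / 2 * Complex.exp (-(Complex.I * s * Z w))) _ w :=
    ((hP.sub hR).div_const 2).mul hE
  have hs' : s⁻¹ = s := by field_simp; exact hs.symm
  have hsi : s⁻¹ * s = 1 := inv_mul_cancel₀ hs0
  have hii := Complex.I_sq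
  constructor
  · refine e1.congr_deriv ?_
    simp only [PX, PV, kap, Pi.add_apply, Pi.sub_apply, Pi.mul_apply]
    generalize Complex.exp (-(Complex.I * s * Z w)) = E
    generalize dd B l w = d at *
    generalize ee l w = e
    generalize deriv (deriv l) w = l2
    field_simp
    ring_nf
    simp only [show s ^ 2 = 1 from hs, show s ^ 3 = s by rw [pow_succ, hs, one_mul], show s^4 = 1 by rw [show s^4 = (s^2)^2 by ring, hs]; ring, Complex.I_sq, Complex.I_pow_three, Complex.I_pow_four]
    ring
  · refine e2.congr_deriv ?_
    simp only [PX, PV, kap, Pi.add_apply, Pi.sub_apply, Pi.mul_apply]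
    generalize Complex.exp (-(Complex.I * s * Z w)) = E
    generalize dd B l w = d at *
    generalize ee l w = e
    generalize deriv (deriv l) w = l2
    field_simp
    ring_nf
    simp only [show s ^ 2 = 1 from hs, show s ^ 3 = s by rw [pow_succ, hs, one_mul], show s^4 = 1 by rw [show s^4 = (s^2)^2 by ring, hs]; ring, Complex.I_sq, Complex.I_pow_three, Complex.I_pow_four]
    ring

end

section

variable {K B : ℝ} {l Z : ℂ → ℂ}

def PhiF (B : ℝ) (l Z : ℂ → ℂ) (s : ℂ) (y y' : ℂ → ℂ) (w : ℂ) : ℝ :=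
  ‖PX B l Z s y y' w - 1‖ ^ 2 + ‖PV B l Z s y y' w‖ ^ 2

lemma seg_ineq {X V k c : ℂ} {m : ℝ} (hc : c.re ≤ 0) (hm : 6 * ‖k‖ ≤ m) :
    2 * inner ℝ (X - 1) (k * (X + V)) + 2 * inner ℝ V (c * V - k * (X + V)) ≤
      m * (‖X - 1‖ ^ 2 + ‖V‖ ^ 2 + 1) := by
  have h1 : inner ℝ V (c * V - k * (X + V)) = c.re * ‖V‖ ^ 2 - inner ℝ V (k * (X + V)) := by
    rw [inner_sub_right]
    congr 1
    rw [Complex.inner, ← Complex.normSq_eq_norm_sq, show c * V * (starRingEnd ℂ) V = c * (V * (starRingEnd ℂ) V) by ring, Complex.mul_conj]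
    simp
  have h2 := real_inner_le_norm (X - 1) (k * (X + V))
  have h3 := abs_le.1 (abs_real_inner_le_norm V (k * (X + V)))
  rw [norm_mul] at h2 h3
  have h4 : ‖X + V‖ ≤ 1 + ‖X - 1‖ + ‖V‖ := by
    calc ‖X + V‖ = ‖1 + (X - 1) + V‖ := by congr 1; ring
      _ ≤ _ := by
        refine (norm_add_le _ _).trans (add_le_add_left ((norm_add_le _ _).trans ?_) _)
        simp
  rw [h1]
  have hk := norm_nonneg k
  set a := ‖X - 1‖
  set b := ‖V‖
  have ha : 0 ≤ a := norm_nonneg _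
  have hb : 0 ≤ b := norm_nonneg _
  have h5 : c.re * b ^ 2 ≤ 0 := mul_nonpos_of_nonpos_of_nonneg hc (sq_nonneg _)
  have h6 : (a + b) * (1 + a + b) ≤ 3 * (a ^ 2 + b ^ 2 + 1) := by nlinarith [sq_nonneg (a - b), sq_nonneg (a + b - 1)]
  have h7 : (a + b) * (‖k‖ * ‖X + V‖) ≤ ‖k‖ * (3 * (a ^ 2 + b ^ 2 + 1)) := by
    calc (a + b) * (‖k‖ * ‖X + V‖) ≤ (a + b) * (‖k‖ * (1 + a + b)) := by gcongr
      _ = ‖k‖ * ((a + b) * (1 + a + b)) := by ring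
      _ ≤ _ := by gcongr
  have h8 : ‖k‖ * 6 * (a ^ 2 + b ^ 2 + 1) ≤ m * (a ^ 2 + b ^ 2 + 1) := by gcongr; linarith
  nlinarith

lemma WK.seg (h : WK K B l Z) {s : ℂ} (hs : s ^ 2 = 1) {y y' : ℂ → ℂ}
    (hy : IsSol (qq B l) (Metric.ball 0 K) y y') {w v : ℂ} {m : ℝ}
    (hw : w ∈ Metric.ball (0:ℂ) K) (hv : w + v ∈ Metric.ball (0:ℂ) K)
    (H : ∀ t ∈ Icc (0:ℝ) 1, (s * dd B l (w + t * v) ^ 2 * v).im ≤ 0 ∧ 6 * ‖kap B l s (w + t * v) * v‖ ≤ m) :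
    PhiF B l Z s y y' (w + v) + 1 ≤ (PhiF B l Z s y y' w + 1) * Real.exp m := by
  have hball : ∀ t ∈ Icc (0:ℝ) 1, w + t * v ∈ Metric.ball (0:ℂ) K := by
    intro t ht
    have := (convex_ball (0:ℂ) K).add_smul_mem hw hv ht
    simpa using this
  have hder : ∀ t ∈ Icc (0:ℝ) 1, ∃ D, HasDerivAt (fun t : ℝ => (PhiF B l Z s y y' (w + t * v) + 1) * Real.exp (-(m * t))) D t ∧ D ≤ 0 := by
    intro t ht
    obtain ⟨a, b⟩ := h.P_deriv (hball t ht) hs hy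
    have hl : HasDerivAt (fun t : ℝ => w + t * v) v t := by
      simpa using ((Complex.ofRealCLM.hasDerivAt (x := t)).mul_const v).const_add w
    have a' := (HasDerivAt.comp (h := fun t : ℝ => w + t * v) t a hl).sub_const 1
    have b' := (HasDerivAt.comp (h := fun t : ℝ => w + t * v) t b hl)
    have c := ((a'.norm_sq).add (b'.norm_sq)).add_const 1
    have e : HasDerivAt (fun t : ℝ => Real.exp (-(m * t))) (Real.exp (-(m * t)) * (-(m * 1))) t :=
      (((hasDerivAt_id t).const_mul m).neg).exp
    have f := c.mul e
    refine ⟨_, f, ?_⟩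
    have key := seg_ineq (X := PX B l Z s y y' (w + t * v)) (V := PV B l Z s y y' (w + t * v))
      (k := kap B l s (w + t * v) * v) (c := -(2 * Complex.I * (s * dd B l (w + t * v) ^ 2)) * v) (m := m) (by
        have := (H t ht).1
        have e : (-(2 * Complex.I * (s * dd B l (w + t * v) ^ 2)) * v) = -(2 * (Complex.I * (s * dd B l (w + t * v) ^ 2 * v))) := by ring
        rw [e]
        simp only [Complex.neg_re, Complex.mul_re, Complex.I_re, Complex.I_im, Complex.re_ofNat, Complex.im_ofNat] at this ⊢
        simp only [Complex.mul_im] at this ⊢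
        simp only [Complex.mul_im, Complex.mul_re, Complex.I_re, Complex.I_im] at this ⊢
        nlinarith) ((H t ht).2)
    simp only [Function.comp, Pi.add_apply]
    have hexp := Real.exp_pos (-(m * t))
    have k2 : ∀ x y E : ℝ, x ≤ m * y → 0 < E → x * E + y * (E * (-(m * 1))) ≤ 0 := by
      intro x y E h1 h2; nlinarith
    refine k2 _ _ _ ?_ hexp
    convert key using 3 <;> congr 1 <;> ring
  have anti : AntitoneOn (fun t : ℝ => (PhiF B l Z s y y' (w + t * v) + 1) * Real.exp (-(m * t))) (Icc 0 1) := by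
    refine antitoneOn_of_deriv_nonpos (convex_Icc 0 1) ?_ ?_ ?_
    · intro t ht; obtain ⟨D, hD, _⟩ := hder t ht; exact hD.continuousAt.continuousWithinAt
    · intro t ht; obtain ⟨D, hD, _⟩ := hder t (interior_subset ht); exact hD.differentiableAt.differentiableWithinAt
    · intro t ht; obtain ⟨D, hD, h0⟩ := hder t (interior_subset ht); rw [hD.deriv]; exact h0
  have := anti (left_mem_Icc.2 zero_le_one) (right_mem_Icc.2 zero_le_one) zero_le_one
  simp only [Complex.ofReal_one, one_mul, mul_one, Complex.ofReal_zero, zero_mul, add_zero, mul_zero, neg_zero, Real.exp_zero] at this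
  rw [Real.exp_neg] at this
  have hexp := Real.exp_pos m
  field_simp at this
  linarith

end

section

variable {K B : ℝ} {l Z : ℂ → ℂ}

def cc (k : ℕ) : ℝ := (2 * k + 1) * Real.pi
def sg (k : ℕ) : ℂ := (-1) ^ k

lemma sg_sq (k : ℕ) : sg k ^ 2 = 1 := by rw [sg, ← pow_mul, mul_comm, pow_mul]; simp
lemma sg_succ (k : ℕ) : sg (k + 1) = - sg k := by rw [sg, sg, pow_succ]; ring
lemma cc_succ (k : ℕ) : cc (k + 1) = cc k + 2 * Real.pi := by simp only [cc]; push_cast; ring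
lemma cc_pos (k : ℕ) : 0 < cc k := by have := Real.pi_pos; unfold cc; positivity

lemma sg_exp (k : ℕ) (x p : ℝ) : sg k * Complex.exp ((x + (cc k + p) * Complex.I) / 2) =
    Real.exp (x / 2) * (Complex.I * Complex.exp (p / 2 * Complex.I)) := by
  have h1 : ((x:ℂ) + (cc k + p) * Complex.I) / 2 = (x / 2 : ℂ) + (p / 2 * Complex.I) + k * (Real.pi * Complex.I) + Real.pi / 2 * Complex.I := by
    simp only [cc]; push_cast; ring
  rw [h1, Complex.exp_add, Complex.exp_add, Complex.exp_add, Complex.exp_nat_mul, Complex.exp_pi_mul_I,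
    Complex.exp_pi_div_two_mul_I]
  have := sg_sq k
  rw [sg] at *
  push_cast
  linear_combination (Complex.exp (x / 2) * Complex.I * Complex.exp (p / 2 * Complex.I)) * this

lemma WK.dir (h : WK K B l Z) (k : ℕ) {x p : ℝ} {v : ℂ}
    (hp : (x + (cc k + p) * Complex.I : ℂ) ∈ Metric.ball (0:ℂ) K)
    (hv : (Complex.exp (p / 2 * Complex.I) * v).re ≤ - ‖v‖ / 50) :
    (sg k * dd B l (x + (cc k + p) * Complex.I) ^ 2 * v).im ≤ 0 := by
  rw [h.d_sq]
  set w : ℂ := x + (cc k + p) * Complex.I with hw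
  have e1 : Complex.exp ((w + l w) / 2) = Complex.exp (w / 2) * Complex.exp (l w / 2) := by
    rw [← Complex.exp_add]; ring_nf
  have e2 : sg k * (B * Complex.exp ((w + l w) / 2)) * v =
      ((B * Real.exp (x / 2) : ℝ) : ℂ) * (Complex.I * (Complex.exp (p / 2 * Complex.I) * v * Complex.exp (l w / 2))) := by
    rw [e1]; have := sg_exp k x p; rw [← hw] at this; push_cast at this ⊢
    linear_combination (B * v * Complex.exp (l w / 2)) * this
  rw [e2, Complex.im_ofReal_mul]
  have hB := h.hB
  refine mul_nonpos_of_nonneg_of_nonpos (by positivity) ?_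
  rw [Complex.I_mul_im]
  have h3 : ‖Complex.exp (l w / 2) - 1‖ ≤ 1 / 100 := by
    have h4 : ‖l w / 2‖ ≤ 1 / 200 := by
      rw [norm_div]; have := h.l0 w hp; simp only [Complex.norm_ofNat]; linarith
    exact (Complex.norm_exp_sub_one_le (h4.trans (by norm_num))).trans (by linarith)
  set u := Complex.exp (p / 2 * Complex.I) * v with hu
  have hun : ‖u‖ = ‖v‖ := by
    rw [hu, norm_mul, show (p / 2 * Complex.I : ℂ) = ((p / 2 : ℝ) : ℂ) * Complex.I by push_cast; ring, Complex.norm_exp_ofReal_mul_I, one_mul]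
  have h5 : (u * (Complex.exp (l w / 2) - 1)).re ≤ ‖v‖ / 100 := by
    refine (Complex.re_le_norm _).trans ?_
    rw [norm_mul, hun]; have := norm_nonneg v; nlinarith
  have : u * Complex.exp (l w / 2) = u + u * (Complex.exp (l w / 2) - 1) := by ring
  rw [this, Complex.add_re]
  have := norm_nonneg v
  linarith

lemma WK.kap_le (h : WK K B l Z) {s w : ℂ} (hs : s ^ 2 = 1) (hw : w ∈ Metric.ball (0:ℂ) K) (hx : -2 ≤ w.re) :
    ‖kap B l s w‖ ≤ 1 / B := by
  have hB := h.hB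
  have hs1 : ‖s‖ = 1 := by
    have : ‖s‖ ^ 2 = 1 := by rw [← norm_pow, hs]; simp
    nlinarith [norm_nonneg s]
  have h1 : ‖ee l w‖ ≤ 1 / 2 := by
    rw [ee, norm_div]
    have := norm_add_le 1 (deriv l w)
    have := h.l1 w hw
    simp only [Complex.norm_ofNat, norm_one] at *; linarith
  have h2 : ‖ee l w ^ 2 - deriv (deriv l) w / 4‖ ≤ 1 / 2 := by
    refine (norm_sub_le _ _).trans ?_
    rw [norm_pow, norm_div]
    have := h.l2 w hw
    simp only [Complex.norm_ofNat]
    nlinarith [norm_nonneg (ee l w)]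
  have h3 : B * (1 / 4) ≤ ‖dd B l w ^ 2‖ := by
    rw [h.d_sq, norm_mul, Complex.norm_exp, Complex.norm_real, Real.norm_eq_abs, abs_of_pos (by linarith)]
    gcongr
    have h4 : -1.01 ≤ ((w + l w) / 2).re := by
      have h5 := h.l0 w hw
      have h6 := (abs_le.1 ((Complex.abs_re_le_norm (l w)).trans h5)).1
      have : ((w + l w) / 2).re = (w.re + (l w).re) / 2 := by simp
      rw [this]; norm_num at h6 ⊢; linarith
    refine le_trans ?_ (Real.exp_le_exp.2 h4)
    have : (1.01 : ℝ) = 1 + 0.01 := by norm_num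
    rw [Real.exp_neg, this, Real.exp_add, one_div]
    refine inv_anti₀ (by positivity) ?_
    have := Real.exp_one_lt_d9
    have h7 := Real.exp_bound_div_one_sub_of_interval (x := 0.01) (by norm_num) (by norm_num)
    norm_num at h7 this ⊢
    nlinarith [Real.exp_pos (1/100)]
  rw [kap, norm_div, norm_mul, norm_mul, norm_mul, hs1, Complex.norm_I, Complex.norm_ofNat, one_mul, one_mul]
  rw [div_le_div_iff₀ (by linarith) (by linarith)]
  nlinarith

lemma mem_ballK {k : ℕ} (hK : cc k + 30 ≤ K) {x p : ℝ} (hx : |x| ≤ 15) (hp : |p| ≤ 7) :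
    (x + (cc k + p) * Complex.I : ℂ) ∈ Metric.ball (0:ℂ) K := by
  rw [mem_ball_zero_iff]
  have := Complex.norm_le_abs_re_add_abs_im (x + (cc k + p) * Complex.I : ℂ)
  simp at this
  have h2 := abs_add_le (cc k) p
  rw [abs_of_pos (cc_pos k)] at h2
  linarith

lemma exp_mul_re (p a b : ℝ) : (Complex.exp (p / 2 * Complex.I) * (a + b * Complex.I)).re =
    a * Real.cos (p / 2) - b * Real.sin (p / 2) := by
  rw [show (p / 2 * Complex.I : ℂ) = ((p / 2 : ℝ) : ℂ) * Complex.I by push_cast; ring, Complex.exp_mul_I,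
    ← Complex.ofReal_cos, ← Complex.ofReal_sin]
  simp only [Complex.mul_re, Complex.add_re, Complex.add_im, Complex.mul_im, Complex.ofReal_re, Complex.ofReal_im,
    Complex.I_re, Complex.I_im]
  ring

lemma WK.seg' (h : WK K B l Z) (k : ℕ) (hK : cc k + 30 ≤ K) {y y' : ℂ → ℂ}
    (hy : IsSol (qq B l) (Metric.ball 0 K) y y') {x p a b : ℝ}
    (hp : |p| ≤ 7) (hp2 : |p + b| ≤ 7) (hx : -2 ≤ x) (hx' : -2 ≤ x + a) (hx1 : x ≤ 15) (hx1' : x + a ≤ 15)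
    (H : ∀ t ∈ Icc (0:ℝ) 1, a * Real.cos ((p + t * b) / 2) - b * Real.sin ((p + t * b) / 2) ≤ -(|a| + |b|) / 50) :
    PhiF B l Z (sg k) y y' ((x + a : ℝ) + (cc k + (p + b : ℝ)) * Complex.I) + 1 ≤
      (PhiF B l Z (sg k) y y' (x + (cc k + p) * Complex.I) + 1) * Real.exp (6 * (|a| + |b|) / B) := by
  have hn : ‖(a + b * Complex.I : ℂ)‖ ≤ |a| + |b| := by
    simpa using Complex.norm_le_abs_re_add_abs_im (a + b * Complex.I : ℂ)
  have e : ∀ t : ℝ, (x + (cc k + p) * Complex.I : ℂ) + t * (a + b * Complex.I) =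
      ((x + t * a : ℝ) : ℂ) + (cc k + (p + t * b : ℝ)) * Complex.I := by intro t; push_cast; ring
  have hbd : ∀ t ∈ Icc (0:ℝ) 1, -2 ≤ x + t * a ∧ |x + t * a| ≤ 15 ∧ |p + t * b| ≤ 7 := by
    intro t ht
    obtain ⟨t0, t1⟩ := ht
    rw [abs_le] at *
    rw [abs_le]
    refine ⟨?_, ⟨?_, ?_⟩, ?_, ?_⟩ <;> nlinarith [hp.1, hp.2, hp2.1, hp2.2]
  have := h.seg (sg_sq k) hy (w := (x + (cc k + p) * Complex.I : ℂ)) (v := (a + b * Complex.I : ℂ)) (m := 6 * (|a| + |b|) / B)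
    (mem_ballK hK (by simpa using (hbd 0 (by simp)).2.1) hp)
    (by have := e 1; simp only [Complex.ofReal_one, one_mul] at this; rw [this]
        exact mem_ballK hK (by simpa using (hbd 1 (by simp)).2.1) hp2) ?_
  · have e1 := e 1; simp only [Complex.ofReal_one, one_mul] at e1; rwa [e1] at this
  · intro t ht
    rw [e t]
    obtain ⟨b1, b2, b3⟩ := hbd t ht
    have hmem := mem_ballK hK b2 b3
    refine ⟨h.dir k hmem ?_, ?_⟩
    · rw [exp_mul_re]; refine (H t ht).trans ?_; rw [neg_div, neg_div]; gcongr
    · rw [norm_mul]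
      have hB := h.hB
      have := h.kap_le (sg_sq k) hmem (by simpa using b1)
      calc 6 * (_ * _) ≤ 6 * (1 / B * (|a| + |b|)) := by gcongr
        _ = _ := by ring

lemma trig1 {u : ℝ} (hu0 : 0 ≤ u) (hu1 : u ≤ Real.pi / 2) : 1 ≤ Real.cos u + Real.pi * Real.sin u := by
  have hpi := Real.pi_gt_d2
  have hc := Real.cos_nonneg_of_neg_pi_div_two_le_of_le (by linarith) hu1
  have hs := Real.sin_nonneg_of_nonneg_of_le_pi hu0 (by linarith)
  have hcs : 1 ≤ Real.cos u + Real.sin u := by nlinarith [Real.sin_sq_add_cos_sq u]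
  nlinarith

lemma trig2 {u : ℝ} (hu0 : 0 ≤ u) (hu1 : u ≤ Real.pi / 2 + 0.1) : 0.1 ≤ Real.sin u + Real.pi * Real.cos u := by
      have hpi := Real.pi_gt_d2
      have hpi2 := Real.pi_lt_d2
      have hs := Real.sin_nonneg_of_nonneg_of_le_pi hu0 (by norm_num at hu1; linarith)
      have key : 0.1 ≤ Real.sin u + Real.pi * Real.cos u := by
        have hsc := Real.sin_sq_add_cos_sq u
        rcases le_total u (Real.pi / 2) with h5 | h5
        · have hc := Real.cos_nonneg_of_neg_pi_div_two_le_of_le (by linarith) h5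
          have hcs : 1 ≤ Real.cos u + Real.sin u := by nlinarith
          norm_num; nlinarith
        · have hc1 : -0.1 ≤ Real.cos u := by
            have h6 := Real.sin_le (x := u - Real.pi / 2) (by linarith)
            rw [Real.sin_sub_pi_div_two] at h6; norm_num at h6 hu1 ⊢; linarith
          have hc2 : Real.cos u ≤ 0 := Real.cos_nonpos_of_pi_div_two_le_of_le h5 (by norm_num at hu1; linarith)
          have : 0.9 ≤ Real.sin u := by
            norm_num at hc1 ⊢; nlinarith
          norm_num at hc1 this ⊢; nlinarith
      exact key

set_option maxHeartbeats 1000000 in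
lemma WK.prop (h : WK K B l Z) (k : ℕ) (hK : cc k + 30 ≤ K) {y y' : ℂ → ℂ}
    (hy : IsSol (qq B l) (Metric.ball 0 K) y y') {xb : ℝ} (hxb : xb ≤ 11) {w : ℂ} (h1 : -1/2 ≤ w.re)
    (h2 : w.re ≤ xb - 2) (h3 : |w.im - cc k| ≤ 2 * Real.pi + 0.2) :
    PhiF B l Z (sg k) y y' w + 1 ≤ (PhiF B l Z (sg k) y y' (xb + cc k * Complex.I) + 1) * Real.exp (200 / B) := by
  have hB := h.hB
  have hpi := Real.pi_gt_d2
  have hpi2 := Real.pi_lt_d2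
  set f := w.im - cc k with hf
  obtain ⟨ς, hς, hςf⟩ : ∃ ς : ℝ, (ς = 1 ∨ ς = -1) ∧ f = ς * |f| := by
    rcases le_total 0 f with h | h
    · exact ⟨1, Or.inl rfl, by rw [abs_of_nonneg h]; ring⟩
    · exact ⟨-1, Or.inr rfl, by rw [abs_of_nonpos h]; ring⟩
  set t1 := min (|f| / Real.pi) 1 with ht1
  set t2 := |f| / Real.pi - t1 with ht2
  have hf0 := abs_nonneg f
  have hq0 : 0 ≤ |f| / Real.pi := by positivity
  have hq1 : |f| / Real.pi ≤ 2 + 0.07 := by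
    rw [div_le_iff₀ Real.pi_pos]; norm_num at h3 ⊢; linarith
  have ht10 : 0 ≤ t1 := le_min hq0 zero_le_one
  have ht11 : t1 ≤ 1 := min_le_right _ _
  have ht20 : 0 ≤ t2 := by have := min_le_left (|f| / Real.pi) 1; linarith
  have ht21 : t2 ≤ 1.07 ∧ t2 * Real.pi ≤ Real.pi + 0.2 ∧ (t1 = 1 ∨ t2 = 0) := by
    rcases le_total (|f| / Real.pi) 1 with h | h
    · have : t1 = |f| / Real.pi := min_eq_left h
      have h0 : t2 = 0 := by rw [ht2, this]; ring
      rw [h0]; norm_num; linarith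
    · have : t1 = 1 := min_eq_right h
      refine ⟨by rw [ht2, this]; norm_num at hq1 ⊢; linarith, ?_, Or.inl this⟩
      rw [ht2, this, sub_mul, div_mul_cancel₀ _ Real.pi_pos.ne']; linarith
  have hsum : f = ς * (t1 * Real.pi) + ς * (t2 * Real.pi) := by
    rw [hςf, ht2]; field_simp; ring
  have ht1p : t1 * Real.pi ≤ Real.pi := mul_le_of_le_one_left Real.pi_pos.le ht11
  have ht1q : t1 * Real.pi ≤ t1 * 3.15 := mul_le_mul_of_nonneg_left hpi2.le ht10
  have ht2q : t2 * Real.pi ≤ t2 * 3.15 := mul_le_mul_of_nonneg_left hpi2.le ht20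
  have hςa : |ς| = 1 := by rcases hς with h | h <;> simp [h]
  have hςs : ς * ς = 1 := by rcases hς with h | h <;> simp [h]
  have hsin : ∀ u, ς * Real.sin (ς * u) = Real.sin u := by
    intro u; rcases hς with h | h <;> simp [h]
  have hcos : ∀ u, Real.cos (ς * u) = Real.cos u := by
    intro u; rcases hς with h | h <;> simp [h]
  have hAb : ∀ u : ℝ, |ς * u| = |u| := by intro u; rw [abs_mul, hςa, one_mul]
  -- segment 1
  have A := h.seg' k hK hy (x := xb) (p := 0) (a := -(xb - (w.re + t1 - t2))) (b := 0) (by simp) (by simp)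
    (by linarith) (by linarith [ht21.1]) (by linarith) (by linarith) (by
      intro t ht
      rw [abs_neg, abs_of_nonneg (by linarith), mul_zero, add_zero, zero_div, Real.cos_zero, abs_zero, zero_mul]
      linarith)
  have Bq := h.seg' k hK hy (x := w.re + t1 - t2) (p := 0) (a := -t1) (b := ς * (t1 * Real.pi)) (by simp)
    (by rw [zero_add, hAb, abs_of_nonneg (by positivity)]; linarith)
    (by linarith [ht21.1]) (by linarith [ht21.1]) (by linarith) (by linarith) (by
      intro t ht
      rw [hAb, abs_neg, abs_of_nonneg ht10, abs_of_nonneg (by positivity)]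
      rw [show (0 + t * (ς * (t1 * Real.pi))) / 2 = ς * (t * t1 * Real.pi / 2) by ring, hcos]
      set u := t * t1 * Real.pi / 2 with hu
      have hu0 : 0 ≤ u := by have := ht.1; positivity
      have hu1 : u ≤ Real.pi / 2 := by
        have : t * t1 ≤ 1 := mul_le_one₀ ht.2 ht10 ht11
        have : t * t1 * Real.pi ≤ 1 * Real.pi := by gcongr
        rw [hu]; linarith
      have e : ς * (t1 * Real.pi) * Real.sin (ς * u) = t1 * Real.pi * Real.sin u := by
        rw [← hsin u]; ring
      rw [e]
      have := mul_le_mul_of_nonneg_left (trig1 hu0 hu1) ht10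
      linarith)
  have Cq := h.seg' k hK hy (x := w.re + t1 - t2 + -t1) (p := 0 + ς * (t1 * Real.pi)) (a := t2) (b := ς * (t2 * Real.pi))
    (by rw [zero_add, hAb, abs_of_nonneg (by positivity)]; linarith)
    (by rw [zero_add, ← hsum]; norm_num at h3 ⊢; linarith)
    (by linarith [ht21.1]) (by linarith [ht21.1]) (by linarith) (by linarith) (by
      intro t ht
      rcases ht21.2.2 with ht1' | ht2'
      swap
      · simp [ht2']
      rw [hAb, abs_of_nonneg ht20, abs_of_nonneg (by positivity)]
      rw [ht1', show (0 + ς * (1 * Real.pi) + t * (ς * (t2 * Real.pi))) / 2 = ς * (t * t2 * Real.pi / 2 + Real.pi / 2) by ring, hcos]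
      set u := t * t2 * Real.pi / 2 with hu
      have e : ς * (t2 * Real.pi) * Real.sin (ς * (u + Real.pi / 2)) = t2 * Real.pi * Real.sin (u + Real.pi / 2) := by
        rw [← hsin (u + Real.pi / 2)]; ring
      rw [e, Real.sin_add_pi_div_two, Real.cos_add_pi_div_two]
      have hu0 : 0 ≤ u := by have := ht.1; positivity
      have hu1 : u ≤ Real.pi / 2 + 0.1 := by
        have : t * (t2 * Real.pi) ≤ 1 * (t2 * Real.pi) := by gcongr; exact ht.2
        rw [hu]; norm_num at ht21 ⊢; linarith
      have key := trig2 hu0 hu1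
      have := mul_le_mul_of_nonneg_left key ht20
      linarith)
  have e1 : ((xb + -(xb - (w.re + t1 - t2)) : ℝ) : ℂ) + (cc k + ((0:ℝ) + (0:ℝ) : ℝ)) * Complex.I =
      ((w.re + t1 - t2 : ℝ) : ℂ) + (cc k + (0:ℝ)) * Complex.I := by push_cast; ring
  have e3 : ((w.re + t1 - t2 + -t1 + t2 : ℝ) : ℂ) + (cc k + (0 + ς * (t1 * Real.pi) + ς * (t2 * Real.pi) : ℝ)) * Complex.I = w := by
    rw [zero_add, ← hsum, hf]; push_cast
    rw [show (w.re + t1 - t2 + -t1 + t2 : ℂ) = w.re by ring, show (cc k + (w.im - cc k) : ℂ) = w.im by ring]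
    exact Complex.re_add_im w
  have e0 : (xb : ℂ) + (cc k + (0:ℝ)) * Complex.I = xb + cc k * Complex.I := by simp
  rw [e1, e0] at A
  rw [e3] at Cq
  refine Cq.trans ?_
  refine (mul_le_mul_of_nonneg_right (Bq.trans (mul_le_mul_of_nonneg_right A (Real.exp_pos _).le)) (Real.exp_pos _).le).trans ?_
  rw [mul_assoc, mul_assoc, ← Real.exp_add, ← Real.exp_add]
  have : 0 ≤ PhiF B l Z (sg k) y y' (xb + cc k * Complex.I) := by unfold PhiF; positivity
  gcongr
  rw [← add_div, ← add_div, hAb, hAb, abs_zero, abs_neg, abs_neg, abs_of_nonneg ht10, abs_of_nonneg ht20,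
    abs_of_nonneg (show 0 ≤ t1 * Real.pi by positivity), abs_of_nonneg (show 0 ≤ t2 * Real.pi by positivity), abs_of_nonneg (by linarith)]
  gcongr
  linarith [ht21.1, ht21.2.1]

end

section

variable {K B : ℝ} {l Z : ℂ → ℂ}

/-- normalized solution -/
def hh (B : ℝ) (l Z : ℂ → ℂ) (s : ℂ) (y : ℂ → ℂ) (w : ℂ) : ℂ := dd B l w * y w * Complex.exp (-(Complex.I * s * Z w))

lemma hh_eq (s : ℂ) (y y' : ℂ → ℂ) (w : ℂ) : hh B l Z s y w = PX B l Z s y y' w + PV B l Z s y y' w := by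
  simp only [hh, PX, PV]; ring

lemma Phi_bd {s : ℂ} {y y' : ℂ → ℂ} {w : ℂ} {η : ℝ} (hη : 0 ≤ η) (h : PhiF B l Z s y y' w ≤ η ^ 2) :
    ‖PX B l Z s y y' w - 1‖ ≤ η ∧ ‖PV B l Z s y y' w‖ ≤ η ∧ ‖hh B l Z s y w - 1‖ ≤ 2 * η := by
  unfold PhiF at h
  have h1 : ‖PX B l Z s y y' w - 1‖ ≤ η := by
    refine (sq_le_sq₀ (norm_nonneg _) hη).1 (by linarith [sq_nonneg ‖PV B l Z s y y' w‖])
  have h2 : ‖PV B l Z s y y' w‖ ≤ η := by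
    refine (sq_le_sq₀ (norm_nonneg _) hη).1 (by linarith [sq_nonneg ‖PX B l Z s y y' w - 1‖])
  refine ⟨h1, h2, ?_⟩
  rw [hh_eq s y y', show PX B l Z s y y' w + PV B l Z s y y' w - 1 = (PX B l Z s y y' w - 1) + PV B l Z s y y' w by ring]
  exact (norm_add_le _ _).trans (by linarith)

lemma WK.wron (h : WK K B l Z) {s : ℂ} (hs : s ^ 2 = 1) (y y' z z' : ℂ → ℂ) (w : ℂ) :
    y' w * z w - y w * z' w = 2 * Complex.I * s * (PX B l Z s y y' w * PX B l Z (-s) z z' w -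
      PV B l Z s y y' w * PV B l Z (-s) z z' w) := by
  have hd0 := h.d_ne w
  have hs0 : s ≠ 0 := by rintro rfl; simp at hs
  have hI := Complex.I_ne_zero
  simp only [PX, PV]
  have hE : Complex.exp (-(Complex.I * -s * Z w)) = (Complex.exp (-(Complex.I * s * Z w)))⁻¹ := by
    rw [← Complex.exp_neg]; congr 1; ring
  rw [hE]
  have hE0 := Complex.exp_ne_zero (-(Complex.I * s * Z w))
  generalize Complex.exp (-(Complex.I * s * Z w)) = E at *
  field_simp
  ring

lemma IsSol.lin {q : ℂ → ℂ} {U : Set ℂ} {y1 y1' y2 y2' : ℂ → ℂ} (h1 : IsSol q U y1 y1') (h2 : IsSol q U y2 y2') (a b : ℂ) :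
    IsSol q U (fun w => a * y1 w + b * y2 w) (fun w => a * y1' w + b * y2' w) := by
  intro w hw
  refine ⟨((h1 w hw).1.const_mul a).add ((h2 w hw).1.const_mul b), ?_⟩
  refine (((h1 w hw).2.const_mul a).add ((h2 w hw).2.const_mul b)).congr_deriv ?_
  ring

lemma PXV_lin (s a b w : ℂ) (y1 y1' y2 y2' : ℂ → ℂ) :
    PX B l Z s (fun w => a * y1 w + b * y2 w) (fun w => a * y1' w + b * y2' w) w =
      a * PX B l Z s y1 y1' w + b * PX B l Z s y2 y2' w ∧
    PV B l Z s (fun w => a * y1 w + b * y2 w) (fun w => a * y1' w + b * y2' w) w =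
      a * PV B l Z s y1 y1' w + b * PV B l Z s y2 y2' w := by
  simp only [PX, PV]
  constructor <;> ring

lemma PX_flip (s w : ℂ) (y y' : ℂ → ℂ) :
    PX B l Z s y y' w = PV B l Z (-s) y y' w * Complex.exp (-(2 * Complex.I * s * Z w)) ∧
    PV B l Z s y y' w = PX B l Z (-s) y y' w * Complex.exp (-(2 * Complex.I * s * Z w)) := by
  have e : Complex.exp (-(Complex.I * s * Z w)) = Complex.exp (-(Complex.I * -s * Z w)) * Complex.exp (-(2 * Complex.I * s * Z w)) := by
    rw [← Complex.exp_add]; congr 1; ring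
  simp only [PX, PV]
  rw [e]
  constructor <;> ring

lemma WK.base (h : WK K B l Z) {s : ℂ} (hs : s ^ 2 = 1) {y1 y1' y2 y2' : ℂ → ℂ} {w : ℂ}
    (hW : y1' w * y2 w - y1 w * y2' w = 1) :
    ∃ a b : ℂ, PhiF B l Z s (fun w => a * y1 w + b * y2 w) (fun w => a * y1' w + b * y2' w) w = 0 := by
  have hd0 := h.d_ne w
  have hs0 : s ≠ 0 := by rintro rfl; simp at hs
  have hI := Complex.I_ne_zero
  set p := Complex.exp (Complex.I * s * Z w) / dd B l w with hp
  set p' := Complex.I * s * dd B l w * Complex.exp (Complex.I * s * Z w) - ee l w * p with hp'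
  refine ⟨p' * y2 w - p * y2' w, p * y1' w - p' * y1 w, ?_⟩
  have e1 : (p' * y2 w - p * y2' w) * y1 w + (p * y1' w - p' * y1 w) * y2 w = p := by
    linear_combination p * hW
  have e2 : (p' * y2 w - p * y2' w) * y1' w + (p * y1' w - p' * y1 w) * y2' w = p' := by
    linear_combination p' * hW
  have hE : Complex.exp (-(Complex.I * s * Z w)) = (Complex.exp (Complex.I * s * Z w))⁻¹ := by
    rw [← Complex.exp_neg]
  have hE0 := Complex.exp_ne_zero (Complex.I * s * Z w)
  simp only [PhiF, PX, PV]
  rw [e1, e2, hE]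
  have f1 : dd B l w * p = Complex.exp (Complex.I * s * Z w) := by rw [hp]; field_simp
  have f2 : (ee l w * p + p') / (Complex.I * s * dd B l w) = Complex.exp (Complex.I * s * Z w) := by
    rw [hp']; field_simp; ring
  rw [f1, f2]
  field_simp
  norm_num

/-- asymptotics of the phase -/
lemma WK.phase (h : WK K B l Z) (k : ℕ) {x p : ℝ} (hp : (x + (cc k + p) * Complex.I : ℂ) ∈ Metric.ball (0:ℂ) K) :
    ‖2 * Complex.I * sg k * Z (x + (cc k + p) * Complex.I) + 4 * B * Real.exp (x / 2) * Complex.exp (p / 2 * Complex.I)‖ ≤ B / 500 := by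
  have h1 := h.Zb _ hp
  have h2 := sg_exp k x p
  set w : ℂ := x + (cc k + p) * Complex.I
  have e : 2 * Complex.I * sg k * Z w + 4 * B * Real.exp (x / 2) * Complex.exp (p / 2 * Complex.I) =
      2 * Complex.I * sg k * (Z w - 2 * B * Complex.exp (w / 2)) := by
    have := Complex.I_sq
    linear_combination (4 * B * Complex.I) * h2 + (4 * B * Real.exp (x / 2) * Complex.exp (p / 2 * Complex.I)) * this
  rw [e, norm_mul]
  have : ‖2 * Complex.I * sg k‖ = 2 := by simp [sg]
  rw [this]; linarith

lemma WK.phase_re (h : WK K B l Z) (k : ℕ) {x p : ℝ} (hp : (x + (cc k + p) * Complex.I : ℂ) ∈ Metric.ball (0:ℂ) K) :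
    |(2 * Complex.I * sg k * Z (x + (cc k + p) * Complex.I)).re + 4 * B * Real.exp (x / 2) * Real.cos (p / 2)| ≤ B / 500 := by
  have h1 := (Complex.abs_re_le_norm _).trans (h.phase k hp)
  rw [Complex.add_re, show (4 * B * Real.exp (x / 2) * Complex.exp (p / 2 * Complex.I) : ℂ) =
    ((4 * B * Real.exp (x / 2) : ℝ) : ℂ) * (Complex.exp (p / 2 * Complex.I)) by push_cast; ring, Complex.re_ofReal_mul] at h1
  have := exp_mul_re p 1 0
  simp only [Complex.ofReal_one, Complex.ofReal_zero, zero_mul, add_zero, mul_one, one_mul, sub_zero] at this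
  rwa [this] at h1

/-- local logarithm of `E` along the phase -/
def eL (s : ℂ) (Z E : ℂ → ℂ) (w : ℂ) : ℂ :=
  2 * Complex.I * s * Z w + Complex.log (E w * Complex.exp (-(2 * Complex.I * s * Z w)))

lemma eL_exp {s w : ℂ} {Z E : ℂ → ℂ} (h : ‖E w * Complex.exp (-(2 * Complex.I * s * Z w)) - 1‖ ≤ 1 / 2) :
    Complex.exp (eL s Z E w) = E w ∧ ‖eL s Z E w - 2 * Complex.I * s * Z w‖ ≤ 1 ∧
      E w * Complex.exp (-(2 * Complex.I * s * Z w)) ∈ Complex.slitPlane := by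
  set u := E w * Complex.exp (-(2 * Complex.I * s * Z w)) with hu
  have hsp : u ∈ Complex.slitPlane := by
    left
    have := (abs_le.1 ((Complex.abs_re_le_norm _).trans h)).1
    simp at this; linarith
  refine ⟨?_, ?_, hsp⟩
  · rw [eL, Complex.exp_add, Complex.exp_log (Complex.slitPlane_ne_zero hsp), hu, mul_comm, mul_assoc, ← Complex.exp_add]
    simp
  · rw [eL, add_sub_cancel_left, ← hu]
    have := Complex.norm_log_one_add_half_le_self (z := u - 1) h
    rw [add_sub_cancel] at this
    linarith

lemma eL_an {s w : ℂ} {Z E : ℂ → ℂ} (hZ : AnalyticAt ℂ Z w) (hE : AnalyticAt ℂ E w)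
    (h : ‖E w * Complex.exp (-(2 * Complex.I * s * Z w)) - 1‖ ≤ 1 / 2) : AnalyticAt ℂ (eL s Z E) w := by
  have h3 := (eL_exp h).2.2
  have h1 : AnalyticAt ℂ (fun w => E w * Complex.exp (-(2 * Complex.I * s * Z w))) w := by fun_prop
  have h2 : AnalyticAt ℂ (fun w => 2 * Complex.I * s * Z w) w := by fun_prop
  exact h2.add (h1.clog h3)

lemma WK.Z_an (h : WK K B l Z) {w : ℂ} (hw : w ∈ Metric.ball (0:ℂ) K) : AnalyticAt ℂ Z w :=
  DifferentiableOn.analyticAt (s := Metric.ball 0 K) (fun w hw => (h.hZ w hw).differentiableAt.differentiableWithinAt)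
      (Metric.isOpen_ball.mem_nhds hw)

lemma exp_sub_one_lower {u : ℂ} (h : ‖u‖ ≤ 1) : ‖u‖ - ‖u‖ ^ 2 ≤ ‖Complex.exp u - 1‖ := by
  have := Complex.norm_exp_sub_one_sub_id_le h
  have h2 := norm_sub_norm_le u (-(Complex.exp u - 1 - u))
  rw [norm_neg, show u - -(Complex.exp u - 1 - u) = Complex.exp u - 1 by ring] at h2
  linarith

lemma WK.eL_diff (h : WK K B l Z) (k : ℕ) {E : ℂ → ℂ} {w w0 : ℂ} (hw : w ∈ Metric.ball (0:ℂ) K)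
    (hw0 : w0 ∈ Metric.ball (0:ℂ) K) (hE : ‖E w * Complex.exp (-(2 * Complex.I * sg k * Z w)) - 1‖ ≤ 1 / 2)
    (hE0 : ‖E w0 * Complex.exp (-(2 * Complex.I * sg k * Z w0)) - 1‖ ≤ 1 / 2) :
    ‖eL (sg k) Z E w - eL (sg k) Z E w0 - 4 * Complex.I * sg k * B * (Complex.exp (w / 2) - Complex.exp (w0 / 2))‖ ≤ B / 250 + 2 := by
  have a := (eL_exp hE).2.1
  have b := (eL_exp hE0).2.1
  have c := h.Zb _ hw
  have d := h.Zb _ hw0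
  have n2 : ‖2 * Complex.I * sg k‖ = 2 := by simp [sg]
  have e : eL (sg k) Z E w - eL (sg k) Z E w0 - 4 * Complex.I * sg k * B * (Complex.exp (w / 2) - Complex.exp (w0 / 2)) =
    ((eL (sg k) Z E w - 2 * Complex.I * sg k * Z w) - (eL (sg k) Z E w0 - 2 * Complex.I * sg k * Z w0)) +
     (2 * Complex.I * sg k * (Z w - 2 * B * Complex.exp (w / 2)) - 2 * Complex.I * sg k * (Z w0 - 2 * B * Complex.exp (w0 / 2))) := by ring
  rw [e]
  refine (norm_add_le _ _).trans ?_
  have x1 := norm_sub_le (eL (sg k) Z E w - 2 * Complex.I * sg k * Z w) (eL (sg k) Z E w0 - 2 * Complex.I * sg k * Z w0)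
  have x2 := norm_sub_le (2 * Complex.I * sg k * (Z w - 2 * B * Complex.exp (w / 2))) (2 * Complex.I * sg k * (Z w0 - 2 * B * Complex.exp (w0 / 2)))
  rw [norm_mul (2 * Complex.I * sg k), norm_mul (2 * Complex.I * sg k), n2] at x2
  linarith

lemma WK.low (h : WK K B l Z) (hB : 100 ≤ B) (k : ℕ) {E : ℂ → ℂ} {w0 : ℂ} (hx : 0 ≤ w0.re)
    (hb : ∀ w ∈ Metric.closedBall w0 0.1, w ∈ Metric.ball (0:ℂ) K ∧ AnalyticAt ℂ E w ∧
      ‖E w * Complex.exp (-(2 * Complex.I * sg k * Z w)) - 1‖ ≤ 1 / 2) :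
    ∀ w ∈ Metric.sphere w0 0.1, B / 10 ≤ ‖eL (sg k) Z E w - eL (sg k) Z E w0‖ := by
  have h0 := hb w0 (Metric.mem_closedBall_self (by norm_num))
  intro w hw
  have hm := hb w (Metric.sphere_subset_closedBall hw)
  have hd := h.eL_diff k hm.1 h0.1 hm.2.2 h0.2.2
  have hn : ‖w / 2 - w0 / 2‖ = 1 / 20 := by
    have : ‖w - w0‖ = 0.1 := by simpa [dist_eq_norm] using hw
    rw [← sub_div, norm_div, this]; norm_num
  have he := exp_sub_one_lower (u := w / 2 - w0 / 2) (by rw [hn]; norm_num)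
  rw [hn] at he
  have e1 : Complex.exp (w / 2) - Complex.exp (w0 / 2) = Complex.exp (w0 / 2) * (Complex.exp (w / 2 - w0 / 2) - 1) := by
    rw [mul_sub, ← Complex.exp_add]; ring_nf
  have e2 : 1 ≤ ‖Complex.exp (w0 / 2)‖ := by
    rw [Complex.norm_exp]; exact Real.one_le_exp (by simp; linarith)
  have e3 : B * (19 / 100) ≤ ‖4 * Complex.I * sg k * B * (Complex.exp (w / 2) - Complex.exp (w0 / 2))‖ := by
    have : ‖4 * Complex.I * sg k * (B:ℂ)‖ = 4 * B := by simp [sg]; linarith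
    rw [norm_mul, this, e1, norm_mul]
    have : (19 / 400 : ℝ) ≤ ‖Complex.exp (w0 / 2)‖ * ‖Complex.exp (w / 2 - w0 / 2) - 1‖ := by
      refine le_trans ?_ (mul_le_mul e2 he (by norm_num) (norm_nonneg _)); norm_num
    nlinarith
  have := norm_sub_norm_le (4 * Complex.I * sg k * B * (Complex.exp (w / 2) - Complex.exp (w0 / 2))) (eL (sg k) Z E w - eL (sg k) Z E w0)
  rw [norm_sub_rev (4 * Complex.I * sg k * B * (Complex.exp (w / 2) - Complex.exp (w0 / 2)))] at this
  linarith

/-- local surjectivity of the logarithmic coordinate -/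
lemma WK.surj (h : WK K B l Z) (hB : 100 ≤ B) (k : ℕ) {E : ℂ → ℂ} {w0 : ℂ} (hx : 0 ≤ w0.re)
    (hb : ∀ w ∈ Metric.closedBall w0 0.1, w ∈ Metric.ball (0:ℂ) K ∧ AnalyticAt ℂ E w ∧
      ‖E w * Complex.exp (-(2 * Complex.I * sg k * Z w)) - 1‖ ≤ 1 / 2) :
    Metric.ball (eL (sg k) Z E w0) (B / 20) ⊆ eL (sg k) Z E '' Metric.closedBall w0 0.1 := by
  have han : ∀ w ∈ Metric.closedBall w0 0.1, AnalyticAt ℂ (eL (sg k) Z E) w := fun w hw =>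
    eL_an (h.Z_an (hb w hw).1) (hb w hw).2.1 (hb w hw).2.2
  have low := h.low hB k hx hb
  have hcl : DiffContOnCl ℂ (eL (sg k) Z E) (Metric.ball w0 0.1) := by
    refine DifferentiableOn.diffContOnCl ?_
    rw [closure_ball _ (by norm_num)]
    exact fun w hw => (han w hw).differentiableAt.differentiableWithinAt
  have := hcl.ball_subset_image_closedBall (by norm_num) low ?_
  · rwa [show B / 10 / 2 = B / 20 by ring] at this
  · by_contra hcon
    rw [not_frequently] at hcon
    have hc : ∀ᶠ z in 𝓝 w0, eL (sg k) Z E z = eL (sg k) Z E w0 := hcon.mono fun z hz => not_not.1 hz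
    have hcv : AnalyticOnNhd ℂ (eL (sg k) Z E) (Metric.closedBall w0 0.1) := fun w hw => han w hw
    have hE := hcv.eqOn_of_preconnected_of_eventuallyEq (g := fun _ => eL (sg k) Z E w0) analyticOnNhd_const
      (convex_closedBall _ _).isPreconnected (Metric.mem_closedBall_self (by norm_num)) hc
    have hs : w0 + (0.1 : ℝ) ∈ Metric.sphere w0 0.1 := by simp; norm_num
    have l1 := low _ hs
    rw [hE (Metric.sphere_subset_closedBall hs)] at l1
    simp at l1; linarith

end

section

variable {K B : ℝ} {l Z : ℂ → ℂ} {g : ℂ → ℂ} {P : Set ℂ} {S : Set (Option ℂ)} {M : ℕ} {Y1 Y1' Y2 Y2' : ℂ → ℂ}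

lemma w_eq (k : ℕ) (w : ℂ) : ((w.re : ℝ) + ((cc k : ℝ) + ((w.im - cc k : ℝ) : ℂ)) * Complex.I : ℂ) = w := by
  apply Complex.ext <;> simp

lemma mem_ballw {k : ℕ} (hK : cc k + 30 ≤ K) {w : ℂ} (h1 : |w.re| ≤ 15) (h2 : |w.im - cc k| ≤ 7) : w ∈ Metric.ball (0:ℂ) K := by
  have := mem_ballK hK h1 h2
  rwa [w_eq] at this

lemma WK.phase_w (h : WK K B l Z) (k : ℕ) {w : ℂ} (hw : w ∈ Metric.ball (0:ℂ) K) :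
    |(2 * Complex.I * sg k * Z w).re + 4 * B * Real.exp (w.re / 2) * Real.cos ((w.im - cc k) / 2)| ≤ B / 500 := by
  have := h.phase_re k (x := w.re) (p := w.im - cc k) (by rwa [w_eq])
  rwa [w_eq] at this

lemma WK.re_abs (h : WK K B l Z) (k : ℕ) {w : ℂ} {y : ℝ} (hw : w ∈ Metric.ball (0:ℂ) K) (hy : Real.exp (w.re / 2) ≤ y) :
    |(2 * Complex.I * sg k * Z w).re| ≤ B * (4 * y + 1 / 500) := by
  have h1 := h.phase_w k hw
  have hB := h.hB
  have h2 : |4 * B * Real.exp (w.re / 2) * Real.cos ((w.im - cc k) / 2)| ≤ 4 * B * y := by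
    rw [abs_mul, abs_of_pos (by positivity)]
    calc _ ≤ 4 * B * Real.exp (w.re / 2) * 1 := by
          exact mul_le_mul_of_nonneg_left (Real.abs_cos_le_one _) (by positivity)
      _ ≤ _ := by rw [mul_one]; exact mul_le_mul_of_nonneg_left hy (by positivity)
  rw [abs_le] at *
  constructor <;> linarith [h1.1, h1.2, h2.1, h2.2]

lemma WK.re_le (h : WK K B l Z) (k : ℕ) {w : ℂ} {y : ℝ} (hw : w ∈ Metric.ball (0:ℂ) K) (hy : y ≤ Real.exp (w.re / 2))
    (him : |w.im - cc k| ≤ 0.2) :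
    (2 * Complex.I * sg k * Z w).re ≤ -B * (3.98 * y - 1 / 500) := by
  have h1 := (abs_le.1 (h.phase_w k hw)).2
  have hB := h.hB
  have hc : 0.995 ≤ Real.cos ((w.im - cc k) / 2) := by
    have := Real.one_sub_sq_div_two_le_cos (x := (w.im - cc k) / 2)
    have h3 := abs_le.1 him
    nlinarith [h3.1, h3.2]
  have h2 : 4 * B * y * 0.995 ≤ 4 * B * Real.exp (w.re / 2) * Real.cos ((w.im - cc k) / 2) := by
    refine mul_le_mul (mul_le_mul_of_nonneg_left hy (by positivity)) hc (by norm_num) (by positivity)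
  linarith

/-- quotient of two normalized solutions -/
lemma ratio (h : WK K B l Z) {s w : ℂ} {y z : ℂ → ℂ} (hy : ‖hh B l Z s y w - 1‖ ≤ 0.02) (hz : ‖hh B l Z (-s) z w - 1‖ ≤ 0.02) :
    y w ≠ 0 ∧ z w ≠ 0 ∧ (fun w => y w / z w) w * Complex.exp (-(2 * Complex.I * s * Z w)) = hh B l Z s y w / hh B l Z (-s) z w ∧
      ‖(fun w => y w / z w) w * Complex.exp (-(2 * Complex.I * s * Z w)) - 1‖ ≤ 0.05 := by
  have hd := h.d_ne w
  have ne : ∀ {u : ℂ}, ‖u - 1‖ ≤ 0.02 → u ≠ 0 := by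
    rintro u hu rfl; norm_num at hu
  have n1 := ne hy
  have n2 := ne hz
  have y0 : y w ≠ 0 := by intro h0; apply n1; simp [hh, h0]
  have z0 : z w ≠ 0 := by intro h0; apply n2; simp [hh, h0]
  have e : (fun w => y w / z w) w * Complex.exp (-(2 * Complex.I * s * Z w)) = hh B l Z s y w / hh B l Z (-s) z w := by
    have e1 : Complex.exp (-(2 * Complex.I * s * Z w)) = Complex.exp (-(Complex.I * s * Z w)) / Complex.exp (-(Complex.I * -s * Z w)) := by
      rw [← Complex.exp_sub]; congr 1; ring
    have := Complex.exp_ne_zero (-(Complex.I * -s * Z w))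
    simp only [hh]
    rw [e1]; field_simp
  refine ⟨y0, z0, e, ?_⟩
  rw [e]
  generalize hh B l Z s y w = u at *
  generalize hh B l Z (-s) z w = v at *
  rw [div_sub_one n2, norm_div, div_le_iff₀ (norm_pos_iff.2 n2)]
  have a1 : ‖u - v‖ ≤ ‖u - 1‖ + ‖v - 1‖ := by
    rw [show u - v = (u - 1) - (v - 1) by ring]; exact norm_sub_le _ _
  have a2 := norm_sub_norm_le 1 (1 - v)
  rw [sub_sub_cancel, norm_one, norm_sub_rev] at a2
  norm_num at *
  linarith

lemma absE {E Zv : ℂ} (h : ‖E * Complex.exp (-Zv) - 1‖ ≤ 1 / 2) :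
    1 / 2 * Real.exp Zv.re ≤ ‖E‖ ∧ ‖E‖ ≤ 3 / 2 * Real.exp Zv.re := by
  have e : ‖E‖ = ‖E * Complex.exp (-Zv)‖ * Real.exp Zv.re := by
    rw [norm_mul, Complex.norm_exp, mul_assoc, ← Real.exp_add]; simp
  have a2 := norm_sub_norm_le 1 (1 - E * Complex.exp (-Zv))
  have a3 := norm_sub_norm_le (E * Complex.exp (-Zv)) 1
  rw [sub_sub_cancel, norm_one, norm_sub_rev] at a2
  rw [norm_one] at a3
  rw [e]
  have := Real.exp_pos Zv.re
  constructor <;> refine mul_le_mul_of_nonneg_right ?_ this.le <;> linarith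

/-- Moebius data -/
lemma mob {p q p' q' : ℂ} (hinf : none ∈ S) {X : Set ℂ}
    (hX : ∀ x ∈ X, ∀ a ∈ S, (p - x * p') * v1 a + (q - x * q') * v2 a ≠ 0) :
    ContinuousOn (fun x => -(q - x * q') / (p - x * p')) X ∧ (∀ x ∈ X, some (-(q - x * q') / (p - x * p')) ∉ S) ∧
    ∀ x ∈ X, ∀ w, HRep g P Y1 Y2 w → (p * Y1 w + q * Y2 w) = x * (p' * Y1 w + q' * Y2 w) →
      w ∉ P ∧ g w = -(q - x * q') / (p - x * p') := by
  have h0 : ∀ x ∈ X, p - x * p' ≠ 0 := by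
    intro x hx; have := hX x hx none hinf; simpa [v1, v2] using this
  refine ⟨?_, ?_, ?_⟩
  · exact ContinuousOn.div (by fun_prop) (by fun_prop) h0
  · intro x hx hm
    apply hX x hx _ hm
    have hs := h0 x hx
    have := sq1_pos (-(q - x * q') / (p - x * p'))
    have hs' : ((Real.sqrt (1 + ‖-(q - x * q') / (p - x * p')‖ ^ 2) : ℝ) : ℂ) ≠ 0 := by exact_mod_cast this.ne'
    simp only [v1, v2]
    field_simp
    ring
  · intro x hx w hr he
    have hs := h0 x hx
    have e1 : (p - x * p') * Y1 w = -(q - x * q') * Y2 w := by linear_combination he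
    have hP : w ∉ P := by
      intro hp
      have h2 := hr.2.1.1 hp
      rw [h2, mul_zero] at e1
      rcases hr.1 with h | h
      · exact h ((mul_eq_zero.1 e1).resolve_left hs)
      · exact h h2
    refine ⟨hP, ?_⟩
    have h2 : Y2 w ≠ 0 := fun h0 => hP (hr.2.1.2 h0)
    rw [hr.2.2 hP] at e1
    rw [eq_div_iff hs]
    apply mul_right_cancel₀ h2
    linear_combination e1

/-- linear combinations -/
def yc (Y1 Y2 : ℂ → ℂ) (p q : ℂ) : ℂ → ℂ := fun w => p * Y1 w + q * Y2 w

structure Cx (g : ℂ → ℂ) (P : Set ℂ) (S : Set (Option ℂ)) (M : ℕ) (K B : ℝ) (l Z Y1 Y1' Y2 Y2' : ℂ → ℂ) : Prop where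
  pk : Pk g P S M
  wk : WK K B l Z
  s1 : IsSol (qq B l) (Metric.ball 0 K) Y1 Y1'
  s2 : IsSol (qq B l) (Metric.ball 0 K) Y2 Y2'
  W : ∀ w ∈ Metric.ball (0:ℂ) K, Y1' w * Y2 w - Y1 w * Y2' w = 1
  rep : ∀ w ∈ Metric.ball (0:ℂ) K, HRep g P Y1 Y2 w
  hB : 10 ^ 10 ≤ B

lemma IsSol.an {q : ℂ → ℂ} {y y' : ℂ → ℂ} (h : IsSol q (Metric.ball 0 K) y y') {w : ℂ} (hw : w ∈ Metric.ball (0:ℂ) K) : AnalyticAt ℂ y w :=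
  DifferentiableOn.analyticAt (s := Metric.ball 0 K) (fun w hw => (h w hw).1.differentiableAt.differentiableWithinAt)
      (Metric.isOpen_ball.mem_nhds hw)

lemma Cx.sol (h : Cx g P S M K B l Z Y1 Y1' Y2 Y2') (p q : ℂ) :
    IsSol (qq B l) (Metric.ball 0 K) (yc Y1 Y2 p q) (yc Y1' Y2' p q) := h.s1.lin h.s2 p q

lemma Cx.wr (h : Cx g P S M K B l Z Y1 Y1' Y2 Y2') {w : ℂ} (hw : w ∈ Metric.ball (0:ℂ) K) (p q p' q' : ℂ) :
    yc Y1' Y2' p q w * yc Y1 Y2 p' q' w - yc Y1 Y2 p q w * yc Y1' Y2' p' q' w = p * q' - q * p' := by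
  simp only [yc]; linear_combination (p * q' - q * p') * h.W w hw

/-- Wronskian of two normalized solutions is close to `2 i s` -/
lemma Cx.wr2 (h : Cx g P S M K B l Z Y1 Y1' Y2 Y2') {w : ℂ} (hw : w ∈ Metric.ball (0:ℂ) K) {k : ℕ} {p q p' q' : ℂ}
    (h1 : PhiF B l Z (sg k) (yc Y1 Y2 p q) (yc Y1' Y2' p q) w ≤ 0.01 ^ 2)
    (h2 : PhiF B l Z (-sg k) (yc Y1 Y2 p' q') (yc Y1' Y2' p' q') w ≤ 0.01 ^ 2) :
    ‖(p * q' - q * p') - 2 * Complex.I * sg k‖ ≤ 0.05 := by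
  rw [← h.wr hw, h.wk.wron (sg_sq k)]
  have a := Phi_bd (by norm_num) h1
  have b := Phi_bd (by norm_num) h2
  generalize PX B l Z (sg k) (yc Y1 Y2 p q) (yc Y1' Y2' p q) w = x at *
  generalize PV B l Z (sg k) (yc Y1 Y2 p q) (yc Y1' Y2' p q) w = v at *
  generalize PX B l Z (-sg k) (yc Y1 Y2 p' q') (yc Y1' Y2' p' q') w = x' at *
  generalize PV B l Z (-sg k) (yc Y1 Y2 p' q') (yc Y1' Y2' p' q') w = v' at *
  have e : 2 * Complex.I * sg k * (x * x' - v * v') - 2 * Complex.I * sg k = 2 * Complex.I * sg k * ((x - 1) * (x' - 1) + (x - 1) + (x' - 1) - v * v') := by ring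
  have n2 : ‖2 * Complex.I * sg k‖ = 2 := by simp [sg]
  rw [e, norm_mul, n2]
  have t1 : ‖(x - 1) * (x' - 1)‖ ≤ 0.01 * 0.01 := by
    rw [norm_mul]; exact mul_le_mul a.1 b.1 (norm_nonneg _) (by norm_num)
  have t2 : ‖v * v'‖ ≤ 0.01 * 0.01 := by
    rw [norm_mul]; exact mul_le_mul a.2.1 b.2.1 (norm_nonneg _) (by norm_num)
  have t3 := norm_sub_le ((x - 1) * (x' - 1) + (x - 1) + (x' - 1)) (v * v')
  have t4 := norm_add_le ((x - 1) * (x' - 1) + (x - 1)) (x' - 1)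
  have t5 := norm_add_le ((x - 1) * (x' - 1)) (x - 1)
  have := a.1
  have := b.1
  norm_num at *
  linarith

def Hat (B : ℝ) (l Z Y1 Y1' Y2 Y2' : ℂ → ℂ) (k : ℕ) (p q : ℂ) : Prop :=
  ∀ w : ℂ, -1 / 2 ≤ w.re → w.re ≤ 5 → |w.im - cc k| ≤ 2 * Real.pi + 0.2 →
    PhiF B l Z (sg k) (yc Y1 Y2 p q) (yc Y1' Y2' p q) w ≤ 0.01 ^ 2

end

section

variable {K B : ℝ} {l Z : ℂ → ℂ} {g : ℂ → ℂ} {P : Set ℂ} {S : Set (Option ℂ)} {M : ℕ} {Y1 Y1' Y2 Y2' : ℂ → ℂ}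

lemma Cx.expB (h : Cx g P S M K B l Z Y1 Y1' Y2 Y2') : Real.exp (200 / B) ≤ 1 + 3e-8 := by
  have hB := h.hB
  have h1 : 200 / B ≤ 2e-8 := by
    rw [div_le_iff₀ (by linarith)]; norm_num at *; linarith
  have h0 : 0 ≤ 200 / B := by have : 0 < B := by linarith
                              positivity
  have := Real.abs_exp_sub_one_le (x := 200 / B) (by rw [abs_of_nonneg h0]; norm_num at *; linarith)
  rw [abs_of_nonneg h0] at this
  have h3 := (abs_le.1 this).2
  have h4 := Real.exp_bound_div_one_sub_of_interval h0 (by norm_num at *; linarith)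
  refine h4.trans ?_
  rw [div_le_iff₀ (by norm_num at *; linarith)]
  norm_num at *
  linarith

lemma Cx.y0 (h : Cx g P S M K B l Z Y1 Y1' Y2 Y2') (k : ℕ) (hK : cc k + 30 ≤ K) :
    ∃ p q : ℂ, ∀ w : ℂ, -1 / 2 ≤ w.re → w.re ≤ 9 → |w.im - cc k| ≤ 2 * Real.pi + 0.2 →
      PhiF B l Z (sg k) (yc Y1 Y2 p q) (yc Y1' Y2' p q) w ≤ 0.001 ^ 2 := by
  have hm : ((11:ℝ) + (cc k : ℝ) * Complex.I : ℂ) ∈ Metric.ball (0:ℂ) K := by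
    refine mem_ballw hK ?_ ?_ <;> simp; norm_num
  obtain ⟨p, q, hpq⟩ := h.wk.base (sg_sq k) (h.W _ hm)
  refine ⟨p, q, fun w h1 h2 h3 => ?_⟩
  have := h.wk.prop k hK (h.sol p q) (xb := 11) le_rfl h1 (by linarith) h3
  have hpq' : PhiF B l Z (sg k) (yc Y1 Y2 p q) (yc Y1' Y2' p q) ((11:ℝ) + (cc k : ℝ) * Complex.I) = 0 := hpq
  rw [hpq', zero_add, one_mul] at this
  have h5 := h.expB
  norm_num at *
  linarith

lemma prop_vec {p q : ℂ} {a : Option ℂ} (h : p * v1 a + q * v2 a = 0) : ∃ c : ℂ, p = c * v2 a ∧ q = -(c * v1 a) := by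
  have hn := v_norm a
  have e : v1 a * (starRingEnd ℂ) (v1 a) + v2 a * (starRingEnd ℂ) (v2 a) = 1 := by
    rw [Complex.mul_conj, Complex.mul_conj, Complex.normSq_eq_norm_sq, Complex.normSq_eq_norm_sq]; exact_mod_cast hn
  refine ⟨p * (starRingEnd ℂ) (v2 a) - q * (starRingEnd ℂ) (v1 a), ?_, ?_⟩
  · linear_combination -p * e + (starRingEnd ℂ) (v1 a) * h
  · linear_combination -q * e + (starRingEnd ℂ) (v2 a) * h

lemma Cx.hat (h : Cx g P S M K B l Z Y1 Y1' Y2 Y2') (k : ℕ) (hK : cc (k + 1) + 30 ≤ K) :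
    ∃ a ∈ S, ∃ c : ℂ, c ≠ 0 ∧ Hat B l Z Y1 Y1' Y2 Y2' k (c * v2 a) (-(c * v1 a)) := by
  have hpi := Real.pi_gt_three
  have hpi4 := Real.pi_lt_d2
  have hB := h.hB
  have hB0 : 0 < B := by linarith
  have hcs := cc_succ k
  have hKk : cc k + 30 ≤ K := by linarith
  obtain ⟨p, q, hpq⟩ := h.y0 k hKk
  obtain ⟨p', q', hpq'⟩ := h.y0 (k + 1) hK
  have himk : ∀ w : ℂ, |w.im - cc k| ≤ 0.2 → |w.im - cc k| ≤ 2 * Real.pi + 0.2 ∧ |w.im - cc (k + 1)| ≤ 2 * Real.pi + 0.2 := by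
    intro w hw; rw [abs_le] at *; rw [hcs]
    refine ⟨⟨?_, ?_⟩, ?_⟩
    · linarith [hw.1]
    · linarith [hw.2]
    · rw [abs_le]; constructor <;> linarith [hw.1, hw.2]
  have hin : ∀ w : ℂ, -1 / 2 ≤ w.re → w.re ≤ 9 → |w.im - cc k| ≤ 0.2 → w ∈ Metric.ball (0:ℂ) K := by
    intro w h1 h2 h3
    refine mem_ballw hKk (by rw [abs_le]; constructor <;> linarith) (h3.trans (by norm_num))
  have P1 : ∀ w : ℂ, -1 / 2 ≤ w.re → w.re ≤ 9 → |w.im - cc k| ≤ 0.2 →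
      PhiF B l Z (sg k) (yc Y1 Y2 p q) (yc Y1' Y2' p q) w ≤ 0.001 ^ 2 ∧ PhiF B l Z (-sg k) (yc Y1 Y2 p' q') (yc Y1' Y2' p' q') w ≤ 0.001 ^ 2 := by
    intro w h1 h2 h3
    refine ⟨hpq w h1 h2 (himk w h3).1, ?_⟩
    rw [← sg_succ]; exact hpq' w h1 h2 (himk w h3).2
  set E : ℂ → ℂ := fun w => yc Y1 Y2 p q w / yc Y1 Y2 p' q' w with hE
  have R1 : ∀ w : ℂ, -1 / 2 ≤ w.re → w.re ≤ 9 → |w.im - cc k| ≤ 0.2 → yc Y1 Y2 p' q' w ≠ 0 ∧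
      ‖E w * Complex.exp (-(2 * Complex.I * sg k * Z w)) - 1‖ ≤ 1 / 2 := by
    intro w h1 h2 h3
    obtain ⟨a, b⟩ := P1 w h1 h2 h3
    have := ratio h.wk ((Phi_bd (by norm_num) a).2.2.trans (by norm_num)) ((Phi_bd (by norm_num) b).2.2.trans (by norm_num))
    exact ⟨this.2.1, this.2.2.2.trans (by norm_num)⟩
  set w0 : ℂ := (8.3:ℝ) + (cc k : ℝ) * Complex.I with hw0
  have w0r : w0.re = 8.3 := by simp [hw0]
  have w0i : w0.im = cc k := by simp [hw0]
  have hVr : ∀ w ∈ Metric.ball w0 0.2, 8.1 ≤ w.re ∧ w.re ≤ 9 ∧ |w.im - cc k| ≤ 0.2 := by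
    intro w hw
    rw [Metric.mem_ball, dist_eq_norm] at hw
    have a := (Complex.abs_re_le_norm _).trans hw.le
    have b := (Complex.abs_im_le_norm _).trans hw.le
    rw [Complex.sub_re, w0r, abs_le] at a
    rw [Complex.sub_im, w0i] at b
    refine ⟨?_, ?_, b⟩ <;> norm_num at * <;> linarith [a.1, a.2]
  set r := Real.exp (-(4 * B * Real.exp 4)) with hr
  have hdet : p * q' - q * p' ≠ 0 := by
    have hw : w0 ∈ Metric.ball w0 0.2 := Metric.mem_ball_self (by norm_num)
    obtain ⟨a1, a2, a3⟩ := hVr w0 hw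
    have := h.wr2 (hin w0 (by linarith) a2 a3) ((P1 w0 (by linarith) a2 a3).1.trans (by norm_num)) ((P1 w0 (by linarith) a2 a3).2.trans (by norm_num))
    intro h0
    rw [h0, zero_sub, norm_neg] at this
    have n2 : ‖2 * Complex.I * sg k‖ = 2 := by simp [sg]
    rw [n2] at this; norm_num at this
  have key : ∃ x : ℂ, ‖x‖ < r ∧ ∃ a ∈ S, (p - x * p') * v1 a + (q - x * q') * v2 a = 0 := by
    by_contra hcon
    push Not at hcon
    obtain ⟨m1, m2, m3⟩ := mob (g := g) (P := P) (Y1 := Y1) (Y2 := Y2) h.pk.inf (X := Metric.ball 0 r)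
      (p := p) (q := q) (p' := p') (q' := q') (fun x hx => hcon x (by simpa using hx))
    have hEU : ∀ w ∈ Metric.ball w0 0.2, E w ∈ Metric.ball (0:ℂ) r := by
      intro w hw
      obtain ⟨a1, a2, a3⟩ := hVr w hw
      have b := (absE (R1 w (by linarith) a2 a3).2).2
      have e5 : 1.05 * Real.exp 4 ≤ Real.exp (w.re / 2) := by
        have h1 : Real.exp (4 + 0.05) ≤ Real.exp (w.re / 2) := Real.exp_le_exp.2 (by linarith)
        rw [Real.exp_add] at h1
        have := Real.add_one_le_exp (0.05:ℝ)
        have h4 := Real.exp_pos 4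
        nlinarith
      have c := h.wk.re_le k (hin w (by linarith) a2 a3) e5 a3
      rw [mem_ball_zero_iff]
      refine b.trans_lt ?_
      have e1 : (3/2:ℝ) ≤ Real.exp 1 := by have := Real.exp_one_gt_d9; linarith
      calc _ ≤ Real.exp 1 * Real.exp _ := mul_le_mul_of_nonneg_right e1 (Real.exp_pos _).le
        _ = Real.exp (1 + _) := (Real.exp_add _ _).symm
        _ < r := by
          rw [hr]; apply Real.exp_lt_exp.2
          have : 1 ≤ Real.exp 4 := Real.one_le_exp (by norm_num)
          have : B * 1 ≤ B * Real.exp 4 := mul_le_mul_of_nonneg_left this hB0.le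
          norm_num at *
          linarith
    have hrel : ∀ w ∈ Metric.ball w0 0.2, w ∉ P ∧ g w = -(q - E w * q') / (p - E w * p') := by
      intro w hw
      obtain ⟨a1, a2, a3⟩ := hVr w hw
      refine m3 _ (hEU w hw) w (h.rep w (hin w (by linarith) a2 a3)) ?_
      have := (R1 w (by linarith) a2 a3).1
      exact (div_mul_cancel₀ (yc Y1 Y2 p q w) this).symm
    have hEan : ∀ w ∈ Metric.ball w0 0.2, AnalyticAt ℂ E w := by
      intro w hw
      obtain ⟨a1, a2, a3⟩ := hVr w hw
      have hi := hin w (by linarith) a2 a3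
      exact ((h.sol p q).an hi).div ((h.sol p' q').an hi) (R1 w (by linarith) a2 a3).1
    have hinj := h.pk.inj (convex_ball 0 r) m1 m2 (convex_ball w0 0.2).isPreconnected
      (fun w hw => (hEan w hw).continuousAt.continuousWithinAt) hEU (fun w hw => (hrel w hw).1) (fun w hw => (hrel w hw).2)
    have hsub : Metric.closedBall w0 0.1 ⊆ Metric.ball w0 0.2 := Metric.closedBall_subset_ball (by norm_num)
    have hE0 : ∀ w ∈ Metric.ball w0 0.2, ‖E w * Complex.exp (-(2 * Complex.I * sg k * Z w)) - 1‖ ≤ 1 / 2 := by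
      intro w hw
      obtain ⟨a1, a2, a3⟩ := hVr w hw
      exact (R1 w (by linarith) a2 a3).2
    have hsurj := h.wk.surj (by linarith) k (E := E) (w0 := w0) (by rw [w0r]; norm_num) (fun w hw => by
      obtain ⟨a1, a2, a3⟩ := hVr w (hsub hw)
      exact ⟨hin w (by linarith) a2 a3, hEan w (hsub hw), hE0 w (hsub hw)⟩)
    obtain ⟨w1, hw1, e1⟩ := hsurj (show eL (sg k) Z E w0 + 2 * Real.pi * Complex.I ∈ _ by
      rw [Metric.mem_ball, dist_eq_norm, add_sub_cancel_left]
      simp [abs_of_pos Real.pi_pos]; linarith)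
    have hm0 : w0 ∈ Metric.ball w0 0.2 := Metric.mem_ball_self (by norm_num)
    have : w1 = w0 := by
      apply hinj (hsub hw1) hm0
      rw [← (eL_exp (hE0 _ (hsub hw1))).1, ← (eL_exp (hE0 _ hm0)).1, e1, Complex.exp_periodic]
    rw [this] at e1
    simp [Real.pi_ne_zero] at e1
  obtain ⟨x, hx, a, ha, hxa⟩ := key
  obtain ⟨c, hc1, hc2⟩ := prop_vec hxa
  refine ⟨a, ha, c, ?_, ?_⟩
  · rintro rfl
    apply hdet
    simp at hc1 hc2
    linear_combination q' * hc1 - p' * hc2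
  rw [← hc1, ← hc2]
  set w7 : ℂ := (7:ℝ) + (cc k : ℝ) * Complex.I with hw7
  have w7r : w7.re = 7 := by simp [hw7]
  have w7i : w7.im = cc k := by simp [hw7]
  have hi7 : |w7.im - cc k| ≤ 0.2 := by rw [w7i]; norm_num
  have hr7 : w7.re ≤ 9 := by rw [w7r]; norm_num
  have hr7' : -1/2 ≤ w7.re := by rw [w7r]; norm_num
  have b7 : PhiF B l Z (sg k) (yc Y1 Y2 (p - x * p') (q - x * q')) (yc Y1' Y2' (p - x * p') (q - x * q')) w7 ≤ 1e-5 := by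
    have hrew : ∀ (U V : ℂ → ℂ), yc U V (p - x * p') (q - x * q') = fun w => 1 * yc U V p q w + (-x) * yc U V p' q' w := by
      intro U V; funext w; simp only [yc]; ring
    rw [hrew, hrew]
    obtain ⟨a1, a2⟩ := P1 w7 hr7' hr7 hi7
    have b1 := Phi_bd (by norm_num) a1
    have b2 := Phi_bd (by norm_num) a2
    have L := PXV_lin (B := B) (l := l) (Z := Z) (sg k) 1 (-x) w7 (yc Y1 Y2 p q) (yc Y1' Y2' p q) (yc Y1 Y2 p' q') (yc Y1' Y2' p' q')
    have F := PX_flip (B := B) (l := l) (Z := Z) (sg k) w7 (yc Y1 Y2 p' q') (yc Y1' Y2' p' q')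
    unfold PhiF
    rw [L.1, L.2, F.1, F.2]
    have hexp : ‖x * Complex.exp (-(2 * Complex.I * sg k * Z w7))‖ ≤ 1e-6 := by
      have c := (abs_le.1 (h.wk.re_abs k (hin w7 hr7' hr7 hi7) le_rfl)).1
      rw [norm_mul, Complex.norm_exp]
      have h35 : 1.5 * Real.exp (w7.re / 2) ≤ Real.exp 4 := by
        rw [w7r, show (4:ℝ) = 0.5 + 7 / 2 by norm_num, Real.exp_add]
        have := Real.add_one_le_exp (0.5:ℝ)
        exact mul_le_mul_of_nonneg_right (by linarith) (Real.exp_pos _).le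
      have h36 : 4 ≤ Real.exp (w7.re / 2) := by
        have := Real.add_one_le_exp (w7.re / 2); rw [w7r] at *; linarith
      have hBe := mul_le_mul_of_nonneg_left h35 hB0.le
      have hBf := mul_le_mul_of_nonneg_left h36 hB0.le
      calc ‖x‖ * Real.exp (-(2 * Complex.I * sg k * Z w7)).re ≤ r * Real.exp (B * (4 * Real.exp (w7.re / 2) + 1 / 500)) := by
            refine mul_le_mul hx.le (Real.exp_le_exp.2 ?_) (Real.exp_pos _).le (Real.exp_pos _).le
            rw [Complex.neg_re]; linarith
        _ = Real.exp (-(4 * B * Real.exp 4) + B * (4 * Real.exp (w7.re / 2) + 1 / 500)) := by rw [hr, Real.exp_add]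
        _ ≤ Real.exp (-B) := by apply Real.exp_le_exp.2; linarith
        _ ≤ _ := by
          rw [Real.exp_neg]
          refine inv_le_of_inv_le₀ (by norm_num) ?_
          have := Real.add_one_le_exp B
          norm_num at *; linarith
    set X := PX B l Z (sg k) (yc Y1 Y2 p q) (yc Y1' Y2' p q) w7
    set V := PV B l Z (sg k) (yc Y1 Y2 p q) (yc Y1' Y2' p q) w7
    set X' := PX B l Z (-sg k) (yc Y1 Y2 p' q') (yc Y1' Y2' p' q') w7
    set V' := PV B l Z (-sg k) (yc Y1 Y2 p' q') (yc Y1' Y2' p' q') w7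
    set Q := Complex.exp (-(2 * Complex.I * sg k * Z w7))
    have n1 : ‖1 * X + -x * (V' * Q) - 1‖ ≤ 0.002 := by
      rw [show 1 * X + -x * (V' * Q) - 1 = (X - 1) - (x * Q) * V' by ring]
      refine (norm_sub_le _ _).trans ?_
      rw [norm_mul]
      have : ‖x * Q‖ * ‖V'‖ ≤ 1e-6 * 0.001 := mul_le_mul hexp b2.2.1 (norm_nonneg _) (by norm_num)
      have := b1.1
      norm_num at *; linarith
    have n2 : ‖1 * V + -x * (X' * Q)‖ ≤ 0.002 := by
      rw [show 1 * V + -x * (X' * Q) = V - ((x * Q) * (X' - 1) + x * Q) by ring]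
      refine (norm_sub_le _ _).trans ?_
      have t := norm_add_le ((x * Q) * (X' - 1)) (x * Q)
      rw [norm_mul] at t
      have : ‖x * Q‖ * ‖X' - 1‖ ≤ 1e-6 * 0.001 := mul_le_mul hexp b2.1 (norm_nonneg _) (by norm_num)
      have := b1.2.1
      norm_num at *; linarith
    have s1 := pow_le_pow_left₀ (norm_nonneg _) n1 2
    have s2 := pow_le_pow_left₀ (norm_nonneg _) n2 2
    norm_num at *; linarith
  intro w h1 h2 h3
  have := h.wk.prop k hKk (h.sol (p - x * p') (q - x * q')) (xb := 7) (by norm_num) h1 (by linarith) h3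
  have h5 := h.expB
  have h6 : (PhiF B l Z (sg k) (yc Y1 Y2 (p - x * p') (q - x * q')) (yc Y1' Y2' (p - x * p') (q - x * q')) w7 + 1) * Real.exp (200 / B) ≤ (1e-5 + 1) * (1 + 3e-8) :=
    mul_le_mul (by linarith) h5 (Real.exp_pos _).le (by norm_num)
  have h7 := this.trans h6
  norm_num at h7 ⊢; linarith

end

section

variable {K B d : ℝ} {l Z : ℂ → ℂ} {g : ℂ → ℂ} {P : Set ℂ} {S : Set (Option ℂ)} {M n : ℕ} {Y1 Y1' Y2 Y2' : ℂ → ℂ}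
  {a : ℕ → Option ℂ} {G : ℕ → ℂ}

structure St (g : ℂ → ℂ) (P : Set ℂ) (S : Set (Option ℂ)) (M : ℕ) (K B : ℝ) (l Z Y1 Y1' Y2 Y2' : ℂ → ℂ)
    (d : ℝ) (n : ℕ) (a : ℕ → Option ℂ) (G : ℕ → ℂ) : Prop where
  cx : Cx g P S M K B l Z Y1 Y1' Y2 Y2'
  hK : cc n + 30 ≤ K
  aS : ∀ k ≤ n, a k ∈ S
  G0 : ∀ k ≤ n, G k ≠ 0
  hat : ∀ k ≤ n, Hat B l Z Y1 Y1' Y2 Y2' k (G k * v2 (a k)) (-(G k * v1 (a k)))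
  dd : ∀ b ∈ S, ∀ c ∈ S, b ≠ c → d ≤ chordal b c
  dB : 100 * Real.exp (-(B / 10)) ≤ d
  hM : 2 * Real.pi * M < B / 20

def yh (Y1 Y2 : ℂ → ℂ) (a : ℕ → Option ℂ) (G : ℕ → ℂ) (k : ℕ) : ℂ → ℂ := yc Y1 Y2 (G k * v2 (a k)) (-(G k * v1 (a k)))

def Eqk (Y1 Y2 : ℂ → ℂ) (a : ℕ → Option ℂ) (G : ℕ → ℂ) (k : ℕ) : ℂ → ℂ := fun w => yh Y1 Y2 a G k w / yh Y1 Y2 a G (k + 1) w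

lemma cc_mono {i j : ℕ} (h : i ≤ j) : cc i ≤ cc j := by
  unfold cc
  have : (i:ℝ) ≤ j := by exact_mod_cast h
  have := Real.pi_pos
  nlinarith

lemma St.d0 (h : St g P S M K B l Z Y1 Y1' Y2 Y2' d n a G) : 0 < d := lt_of_lt_of_le (by positivity) h.dB

lemma St.B0 (h : St g P S M K B l Z Y1 Y1' Y2 Y2' d n a G) : 10 ^ 10 ≤ B := h.cx.hB

lemma St.mem (h : St g P S M K B l Z Y1 Y1' Y2 Y2' d n a G) {k : ℕ} (hk : k ≤ n) {w : ℂ} (h1 : |w.re| ≤ 15) (h2 : |w.im - cc k| ≤ 7) :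
    w ∈ Metric.ball (0:ℂ) K := by
  have := cc_mono hk
  exact mem_ballw (by linarith [h.hK]) h1 h2

lemma pair_abs {k : ℕ} {y : ℝ} (h1 : cc k - 0.2 ≤ y) (h2 : y ≤ cc (k + 1) + 0.2) :
    |y - cc k| ≤ 2 * Real.pi + 0.2 ∧ |y - cc (k + 1)| ≤ 2 * Real.pi + 0.2 ∧ |y - cc k| ≤ 7 := by
  have := cc_succ k
  have hpi := Real.pi_gt_three
  have hpi4 := Real.pi_lt_d2
  simp only [abs_le]
  norm_num at *
  refine ⟨⟨?_, ?_⟩, ⟨?_, ?_⟩, ?_, ?_⟩ <;> linarith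

lemma St.pr (h : St g P S M K B l Z Y1 Y1' Y2 Y2' d n a G) {k : ℕ} (hk : k + 1 ≤ n) {w : ℂ} (x1 : -1 / 2 ≤ w.re) (x2 : w.re ≤ 5)
    (h1 : cc k - 0.2 ≤ w.im) (h2 : w.im ≤ cc (k + 1) + 0.2) :
    w ∈ Metric.ball (0:ℂ) K ∧ yh Y1 Y2 a G k w ≠ 0 ∧ yh Y1 Y2 a G (k + 1) w ≠ 0 ∧
      ‖Eqk Y1 Y2 a G k w * Complex.exp (-(2 * Complex.I * sg k * Z w)) - 1‖ ≤ 0.05 ∧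
      ‖(yh Y1 Y2 a G (k + 1) w / yh Y1 Y2 a G k w) * Complex.exp (-(2 * Complex.I * sg (k + 1) * Z w)) - 1‖ ≤ 0.05 ∧
      ‖((G k * v2 (a k)) * (-(G (k + 1) * v1 (a (k + 1)))) - (-(G k * v1 (a k))) * (G (k + 1) * v2 (a (k + 1)))) - 2 * Complex.I * sg k‖ ≤ 0.05 := by
  obtain ⟨m1, m2, m3⟩ := pair_abs h1 h2
  have hm := h.mem (by omega : k ≤ n) (w := w) (by rw [abs_le]; constructor <;> linarith) m3
  have p1 := h.hat k (by omega) w x1 x2 m1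
  have p2 := h.hat (k + 1) hk w x1 x2 m2
  have q1 : _ ≤ (0.02 : ℝ) := (Phi_bd (by norm_num) p1).2.2.trans (by norm_num)
  have q2 : _ ≤ (0.02 : ℝ) := (Phi_bd (by norm_num) p2).2.2.trans (by norm_num)
  have q1' := q1
  have q2' := q2
  have p2' := p2
  rw [sg_succ] at q2' p2'
  rw [show sg k = - sg (k + 1) by rw [sg_succ, neg_neg]] at q1'
  have r1 := ratio h.cx.wk q1 q2'
  have r2 := ratio h.cx.wk q2 q1'
  exact ⟨hm, r1.1, r1.2.1, r1.2.2.2, r2.2.2.2, h.cx.wr2 hm p1 p2'⟩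

lemma det_eq (u v : ℂ) (b c : Option ℂ) : ‖(u * v2 b) * (-(v * v1 c)) - (-(u * v1 b)) * (v * v2 c)‖ = ‖u‖ * ‖v‖ * chordal b c := by
  rw [chordal_eq, ← norm_mul, ← norm_mul]; congr 1; ring

lemma St.gg (h : St g P S M K B l Z Y1 Y1' Y2 Y2' d n a G) {k : ℕ} (hk : k + 1 ≤ n) :
    1.9 ≤ ‖G k‖ * ‖G (k + 1)‖ * chordal (a k) (a (k + 1)) ∧ ‖G k‖ * ‖G (k + 1)‖ * chordal (a k) (a (k + 1)) ≤ 2.1 ∧ a k ≠ a (k + 1) := by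
  have hp := (h.pr hk (w := (0:ℝ) + (cc k : ℝ) * Complex.I) (by simp; norm_num) (by simp) (by simp; norm_num) (by
    have := cc_mono (Nat.le_succ k)
    simp; linarith)).2.2.2.2.2
  rw [← det_eq]
  set D := (G k * v2 (a k)) * (-(G (k + 1) * v1 (a (k + 1)))) - (-(G k * v1 (a k))) * (G (k + 1) * v2 (a (k + 1)))
  have n2 : ‖2 * Complex.I * sg k‖ = 2 := by simp [sg]
  have t1 := norm_sub_norm_le D (2 * Complex.I * sg k)
  have t2 := norm_sub_norm_le (2 * Complex.I * sg k) D
  rw [norm_sub_rev (2 * Complex.I * sg k) D] at t2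
  rw [n2] at *
  have hD : 1.9 ≤ ‖D‖ := by linarith
  refine ⟨hD, by linarith, fun hc => ?_⟩
  rw [det_eq, hc, chordal_self] at hD
  norm_num at hD

lemma St.chi (h : St g P S M K B l Z Y1 Y1' Y2 Y2' d n a G) {k : ℕ} {w : ℂ} (hw : w ∈ Metric.ball (0:ℂ) K) :
    chordal (valueAt g P w) (a k) * ‖G k‖ = ‖yh Y1 Y2 a G k w‖ / Real.sqrt (‖Y1 w‖ ^ 2 + ‖Y2 w‖ ^ 2) := by
  rw [(h.cx.rep w hw).chordal, div_mul_eq_mul_div, ← norm_mul]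
  congr 2; simp only [yh, yc]; ring

lemma St.chiE (h : St g P S M K B l Z Y1 Y1' Y2 Y2' d n a G) {k : ℕ} {w : ℂ} (hw : w ∈ Metric.ball (0:ℂ) K)
    (h0 : yh Y1 Y2 a G (k + 1) w ≠ 0) :
    chordal (valueAt g P w) (a k) * ‖G k‖ = ‖Eqk Y1 Y2 a G k w‖ * (chordal (valueAt g P w) (a (k + 1)) * ‖G (k + 1)‖) := by
  rw [h.chi hw, h.chi hw, Eqk, norm_div]
  have := norm_pos_iff.2 h0
  field_simp

lemma van {u v x : ℂ} {b c e : Option ℂ}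
    (h : (u * v2 b - x * (v * v2 c)) * v1 e + (-(u * v1 b) - x * (-(v * v1 c))) * v2 e = 0) :
    ‖u‖ * chordal b e = ‖x‖ * ‖v‖ * chordal c e := by
  rw [chordal_eq, chordal_eq, ← norm_mul, ← norm_mul, ← norm_mul]
  congr 1; linear_combination -h

lemma St.Ean (h : St g P S M K B l Z Y1 Y1' Y2 Y2' d n a G) {k : ℕ} {w : ℂ} (hw : w ∈ Metric.ball (0:ℂ) K)
    (h0 : yh Y1 Y2 a G (k + 1) w ≠ 0) : AnalyticAt ℂ (Eqk Y1 Y2 a G k) w :=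
  ((h.cx.sol _ _).an hw).div ((h.cx.sol _ _).an hw) h0

/-- the key lower bound -/
lemma St.low (h : St g P S M K B l Z Y1 Y1' Y2 Y2' d n a G) {k : ℕ} (hk : k + 2 ≤ n) :
    Real.exp (-(5 * B)) * ‖G (k + 1)‖ ≤ ‖G k‖ := by
  by_contra hcon
  push Not at hcon
  have hd := h.d0
  have hB := h.B0
  have hB0 : 0 < B := by linarith
  have hpi := Real.pi_gt_three
  have hcs := cc_succ k
  have hcs' := cc_succ (k + 1)
  have hG1 := norm_pos_iff.2 (h.G0 (k + 1) (by omega))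
  have hG2 := norm_pos_iff.2 (h.G0 (k + 2) (by omega))
  have hG := norm_pos_iff.2 (h.G0 k (by omega))
  obtain ⟨-, -, hne⟩ := h.gg (k := k) (by omega)
  obtain ⟨-, -, hne1⟩ := h.gg (k := k + 1) (by omega)
  set V : Set ℂ := Ioo (-0.2) 0.2 ×ℂ Ioo (cc k - 0.2) (cc (k + 2) + 0.2) with hV
  have hVc : Convex ℝ V := ((convex_Ioo (𝕜 := ℝ) (-0.2:ℝ) 0.2).linear_preimage Complex.reLm).inter ((convex_Ioo (𝕜 := ℝ) (cc k - 0.2) (cc (k + 2) + 0.2)).linear_preimage Complex.imLm)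
  have hVm : ∀ w ∈ V, (-0.2 < w.re ∧ w.re < 0.2) ∧ cc k - 0.2 < w.im ∧ w.im < cc (k + 2) + 0.2 := fun w hw => hw
  set E := Eqk Y1 Y2 a G k with hE
  have hrabs : ∀ w ∈ V, w ∈ Metric.ball (0:ℂ) K → |(2 * Complex.I * sg k * Z w).re| ≤ 4.5 * B := by
    intro w hw hb
    refine (h.cx.wk.re_abs k hb (y := 1.12) ?_).trans (by norm_num; linarith)
    have e1 : Real.exp (w.re / 2) ≤ Real.exp 0.1 := Real.exp_le_exp.2 (by linarith [(hVm w hw).1.2])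
    have e2 := Real.exp_bound_div_one_sub_of_interval (x := 0.1) (by norm_num) (by norm_num)
    linarith
  have hall : ∀ w ∈ V, w ∈ Metric.ball (0:ℂ) K ∧ yh Y1 Y2 a G (k + 1) w ≠ 0 ∧
      ‖E w * Complex.exp (-(2 * Complex.I * sg k * Z w)) - 1‖ ≤ 1 / 2 := by
    intro w hw
    obtain ⟨⟨x1, x2⟩, y1, y2⟩ := hVm w hw
    by_cases hc : w.im ≤ cc (k + 1) + 0.2
    · obtain ⟨a1, a2, a3, a4, -⟩ := h.pr (k := k) (by omega) (by linarith) (by linarith) y1.le hc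
      exact ⟨a1, a3, a4.trans (by norm_num)⟩
    · push Not at hc
      obtain ⟨a1, a2, a3, -, a4, a5⟩ := h.pr (k := k + 1) (by omega) (w := w) (by linarith) (by linarith) (by linarith) y2.le
      refine ⟨a1, a2, ?_⟩
      have hp := (h.pr (k := k) (by omega) (w := (0:ℝ) + (cc k : ℝ) * Complex.I) (by simp; norm_num) (by simp) (by simp; norm_num) (by
         simp; linarith)).2.2.2.2.2
      have s2 : sg (k + 1 + 1) = sg k := by rw [sg_succ, sg_succ, neg_neg]
      have n2 : ‖2 * Complex.I * sg k‖ = 2 := by simp [sg]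
      rw [s2] at a4
      rw [sg_succ] at a5
      have d2 := det_eq (G (k + 1)) (G (k + 1 + 1)) (a (k + 1)) (a (k + 1 + 1))
      have d3 := det_eq (G k) (G (k + 1 + 1)) (a k) (a (k + 1 + 1))
      set D1 := (G k * v2 (a k)) * (-(G (k + 1) * v1 (a (k + 1)))) - (-(G k * v1 (a k))) * (G (k + 1) * v2 (a (k + 1)))
      set D2 := (G (k + 1) * v2 (a (k + 1))) * (-(G (k + 1 + 1) * v1 (a (k + 1 + 1)))) - (-(G (k + 1) * v1 (a (k + 1)))) * (G (k + 1 + 1) * v2 (a (k + 1 + 1))) with hD2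
      set D3 := (G k * v2 (a k)) * (-(G (k + 1 + 1) * v1 (a (k + 1 + 1)))) - (-(G k * v1 (a k))) * (G (k + 1 + 1) * v2 (a (k + 1 + 1))) with hD3
      have D2n : 1.9 ≤ ‖D2‖ := by
        have := norm_sub_norm_le (2 * Complex.I * sg k) (-D2)
        rw [n2, norm_neg, show 2 * Complex.I * sg k - -D2 = D2 - 2 * Complex.I * -sg k by ring] at this
        linarith
      have D20 : D2 ≠ 0 := by intro h0; rw [h0] at D2n; norm_num at D2n
      have rel : yh Y1 Y2 a G k w * D2 = -D1 * yh Y1 Y2 a G (k + 1 + 1) w + D3 * yh Y1 Y2 a G (k + 1) w := by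
        simp only [yh, yc, D1, D2, D3]; ring
      set Q := Complex.exp (-(2 * Complex.I * sg k * Z w))
      have e : E w * Q - 1 = (-D1 / D2 - 1) * ((yh Y1 Y2 a G (k + 1 + 1) w / yh Y1 Y2 a G (k + 1) w) * Q) +
          ((yh Y1 Y2 a G (k + 1 + 1) w / yh Y1 Y2 a G (k + 1) w) * Q - 1) + D3 / D2 * Q := by
        have : E w = yh Y1 Y2 a G k w / yh Y1 Y2 a G (k + 1) w := rfl
        rw [this, eq_div_of_mul_eq D20 rel]
        field_simp; ring
      rw [e]
      set u := (yh Y1 Y2 a G (k + 1 + 1) w / yh Y1 Y2 a G (k + 1) w) * Q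
      have b1 : ‖-D1 / D2 - 1‖ ≤ 0.1 := by
        rw [div_sub_one D20, norm_div, div_le_iff₀ (norm_pos_iff.2 D20),
          show -D1 - D2 = -((D1 - 2 * Complex.I * sg k) + (D2 - 2 * Complex.I * -sg k)) by ring, norm_neg]
        refine (norm_add_le _ _).trans ?_
        linarith
      have b2 : ‖u‖ ≤ 1.05 := by
        have := norm_sub_norm_le u 1
        rw [norm_one] at this; linarith
      have b3 : ‖D3 / D2 * Q‖ ≤ 0.01 := by
        have hQ : ‖Q‖ ≤ Real.exp (4.5 * B) := by
          rw [Complex.norm_exp, Complex.neg_re]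
          exact Real.exp_le_exp.2 (by linarith [(abs_le.1 (hrabs w hw a1)).1])
        have h32 : ‖D3 / D2‖ ≤ Real.exp (-(5 * B)) / d := by
          rw [norm_div, d2, d3, div_le_div_iff₀ (by
            have : 0 < ‖D2‖ := by linarith
            rwa [d2] at this) hd]
          have c1 := chordal_le_one (a k) (a (k + 1 + 1))
          have c2 := h.dd _ (h.aS (k+1) (by omega)) _ (h.aS (k+1+1) (by omega)) hne1
          have c3 : ‖G k‖ * ‖G (k + 1 + 1)‖ * chordal (a k) (a (k + 1 + 1)) ≤ Real.exp (-(5 * B)) * ‖G (k + 1)‖ * ‖G (k + 1 + 1)‖ :=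
            (mul_le_of_le_one_right (by positivity) c1).trans (mul_le_mul_of_nonneg_right hcon.le (norm_nonneg _))
          calc _ ≤ Real.exp (-(5 * B)) * ‖G (k + 1)‖ * ‖G (k + 1 + 1)‖ * d := mul_le_mul_of_nonneg_right c3 hd.le
            _ ≤ Real.exp (-(5 * B)) * ‖G (k + 1)‖ * ‖G (k + 1 + 1)‖ * chordal (a (k + 1)) (a (k + 1 + 1)) :=
              mul_le_mul_of_nonneg_left c2 (by positivity)
            _ = _ := by ring
        rw [norm_mul]
        refine (mul_le_mul h32 hQ (norm_nonneg _) (by positivity)).trans ?_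
        rw [div_mul_eq_mul_div, div_le_iff₀ hd, ← Real.exp_add]
        have : Real.exp (-(5 * B) + 4.5 * B) ≤ Real.exp (-(B / 10)) := Real.exp_le_exp.2 (by norm_num; linarith)
        have := h.dB
        linarith
      refine (norm_add_le _ _).trans ((add_le_add_left (norm_add_le _ _) _).trans ?_)
      rw [norm_mul]
      have := mul_le_mul b1 b2 (norm_nonneg _) (by norm_num)
      linarith
  obtain ⟨m1, m2, m3⟩ := mob (g := g) (P := P) (Y1 := Y1) (Y2 := Y2) h.cx.pk.inf (X := {x | Real.exp (-(4.8 * B)) < ‖x‖})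
      (p := G k * v2 (a k)) (q := -(G k * v1 (a k))) (p' := G (k + 1) * v2 (a (k + 1))) (q' := -(G (k + 1) * v1 (a (k + 1)))) (by
    intro x hx b hb h0
    have h1 := van h0
    by_cases hba : b = a (k + 1)
    · rw [hba, chordal_self, mul_zero] at h1
      have := (mul_eq_zero.1 h1).resolve_left hG.ne'
      exact hne (chordal_eq_zero this)
    · have c1 := h.dd _ (h.aS (k+1) (by omega)) _ hb (Ne.symm hba)
      have c2 := chordal_le_one (a k) b
      have c3 : ‖G k‖ * chordal (a k) b ≤ Real.exp (-(5 * B)) * ‖G (k + 1)‖ := (mul_le_of_le_one_right hG.le c2).trans hcon.le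
      have c4 : Real.exp (-(4.8 * B)) * ‖G (k + 1)‖ * d ≤ ‖x‖ * ‖G (k + 1)‖ * chordal (a (k + 1)) b :=
        mul_le_mul (mul_le_mul_of_nonneg_right (le_of_lt hx) hG1.le) c1 hd.le (by positivity)
      have c5 : Real.exp (-(5 * B)) < Real.exp (-(4.8 * B)) * d := by
        refine lt_of_lt_of_le ?_ (mul_le_mul_of_nonneg_left h.dB (Real.exp_pos _).le)
        have : Real.exp (-(5 * B)) ≤ Real.exp (-(4.8 * B)) * Real.exp (-(B / 10)) := by
          rw [← Real.exp_add]; exact Real.exp_le_exp.2 (by norm_num; linarith)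
        have := Real.exp_pos (-(5 * B))
        linarith
      have := mul_lt_mul_of_pos_right c5 hG1
      linarith)
  set U : Set ℂ := {ξ : ℂ | -(4.8 * B) < ξ.re}
  have hUX : ∀ ξ ∈ U, Complex.exp ξ ∈ {x : ℂ | Real.exp (-(4.8 * B)) < ‖x‖} := by
    intro ξ hξ
    rw [mem_ofPred_eq, Complex.norm_exp]; exact Real.exp_lt_exp.2 hξ
  set e := eL (sg k) Z E with he
  have hEan : ∀ w ∈ V, AnalyticAt ℂ E w := fun w hw => h.Ean (hall w hw).1 (hall w hw).2.1
  have heU : MapsTo e V U := by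
    intro w hw
    obtain ⟨a1, a2, a3⟩ := hall w hw
    have b1 := (abs_le.1 ((Complex.abs_re_le_norm _).trans (eL_exp a3).2.1)).1
    have b2 := (abs_le.1 (hrabs w hw a1)).1
    rw [Complex.sub_re] at b1
    show -(4.8 * B) < (e w).re
    linarith
  have hrel : ∀ w ∈ V, w ∉ P ∧ g w = (fun ξ => -(-(G k * v1 (a k)) - Complex.exp ξ * (-(G (k + 1) * v1 (a (k + 1))))) / (G k * v2 (a k) - Complex.exp ξ * (G (k + 1) * v2 (a (k + 1))))) (e w) := by
    intro w hw
    obtain ⟨a1, a2, a3⟩ := hall w hw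
    refine m3 _ (hUX _ (heU hw)) w (h.cx.rep w a1) ?_
    rw [(eL_exp a3).1]
    exact (div_mul_cancel₀ (yh Y1 Y2 a G k w) a2).symm
  have hinj := h.cx.pk.inj (convex_halfSpace_re_gt _) (m1.comp Complex.continuous_exp.continuousOn hUX)
    (fun ξ hξ => m2 _ (hUX ξ hξ)) hVc.isPreconnected
    (fun w hw => (eL_an (h.cx.wk.Z_an (hall w hw).1) (hEan w hw) (hall w hw).2.2).continuousAt.continuousWithinAt)
    heU (fun w hw => (hrel w hw).1) (fun w hw => (hrel w hw).2)
  set w0 : ℂ := (0:ℝ) + ((cc k : ℝ) + (0 : ℝ)) * Complex.I with hw0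
  set w2 : ℂ := (0:ℝ) + ((cc k : ℝ) + (4 * Real.pi : ℝ)) * Complex.I with hw2
  have hsub : ∀ w ∈ Metric.closedBall w0 0.1, w ∈ V ∧ w.im ≤ cc k + 0.1 := by
    intro w hw
    rw [Metric.mem_closedBall, dist_eq_norm] at hw
    have aa := abs_le.1 ((Complex.abs_re_le_norm _).trans hw)
    have bb := abs_le.1 ((Complex.abs_im_le_norm _).trans hw)
    simp [hw0] at aa bb
    have := cc_mono (by omega : k ≤ k + 2)
    refine ⟨⟨⟨?_, ?_⟩, ?_, ?_⟩, ?_⟩ <;> linarith [aa.1, aa.2, bb.1, bb.2]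
  have hm2 : w2 ∈ V := by
    refine ⟨⟨?_, ?_⟩, ?_, ?_⟩ <;> simp [hw2] <;> norm_num <;> linarith
  have hm0 : w0 ∈ V := (hsub w0 (Metric.mem_closedBall_self (by norm_num))).1
  have hsurj := h.cx.wk.surj (by linarith) k (E := E) (w0 := w0) (by simp [hw0]) (fun w hw =>
      ⟨(hall w (hsub w hw).1).1, hEan w (hsub w hw).1, (hall w (hsub w hw).1).2.2⟩)
  have hclose : e w2 ∈ Metric.ball (e w0) (B / 20) := by
    have p0 := h.cx.wk.phase k (hall w0 hm0).1
    have p2 := h.cx.wk.phase k (hall w2 hm2).1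
    have q0 := (eL_exp (hall w0 hm0).2.2).2.1
    have q2 := (eL_exp (hall w2 hm2).2.2).2.1
    have x4 : Complex.exp (((4 * Real.pi : ℝ) : ℂ) / 2 * Complex.I) = 1 := by
      rw [show ((4 * Real.pi : ℝ) : ℂ) / 2 * Complex.I = 2 * Real.pi * Complex.I by push_cast; ring, Complex.exp_two_pi_mul_I]
    have x0 : Complex.exp (((0 : ℝ) : ℂ) / 2 * Complex.I) = 1 := by simp
    rw [← hw0, x0] at p0
    rw [← hw2, x4] at p2
    rw [Metric.mem_ball, dist_eq_norm]
    have ee : e w2 - e w0 = (e w2 - 2 * Complex.I * sg k * Z w2) - (e w0 - 2 * Complex.I * sg k * Z w0) +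
       ((2 * Complex.I * sg k * Z w2 + 4 * B * Real.exp (0 / 2) * 1) - (2 * Complex.I * sg k * Z w0 + 4 * B * Real.exp (0 / 2) * 1)) := by ring
    rw [ee]
    refine (norm_add_le _ _).trans_lt ((add_le_add (norm_sub_le _ _) (norm_sub_le _ _)).trans_lt ?_)
    linarith
  obtain ⟨w1, hw1, e1⟩ := hsurj hclose
  have h12 := hinj (hsub w1 hw1).1 hm2 e1
  have := (hsub w1 hw1).2
  rw [h12] at this
  simp [hw2] at this
  norm_num at this
  linarith

end

section

variable {K B d : ℝ} {l Z : ℂ → ℂ} {g : ℂ → ℂ} {P : Set ℂ} {S : Set (Option ℂ)} {M n : ℕ} {Y1 Y1' Y2 Y2' : ℂ → ℂ}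
  {a : ℕ → Option ℂ} {G : ℕ → ℂ}

/-- exponential comparison: `c e^{-sB} ≤ d² e^{-tB}`, with room -/
lemma St.ed (h : St g P S M K B l Z Y1 Y1' Y2 Y2' d n a G) {s t : ℝ} (hst : t + 1 / 10 ≤ s) :
    100 * Real.exp (-(s * B)) ≤ d * Real.exp (-(t * B)) := by
  have hB := h.B0
  have : Real.exp (-(s * B)) ≤ Real.exp (-(B / 10)) * Real.exp (-(t * B)) := by
    rw [← Real.exp_add]; apply Real.exp_le_exp.2
    have := mul_le_mul_of_nonneg_right hst (by linarith : 0 ≤ B)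
    linarith
  have h2 := mul_le_mul_of_nonneg_right h.dB (Real.exp_pos (-(t * B))).le
  linarith

lemma St.low' (h : St g P S M K B l Z Y1 Y1' Y2 Y2' d n a G) {k : ℕ} (hk : k + 2 ≤ n) :
    ‖G (k + 1)‖ ≤ Real.exp (5 * B) * ‖G k‖ := by
  have := mul_le_mul_of_nonneg_left (h.low hk) (Real.exp_pos (5 * B)).le
  rw [← mul_assoc, ← Real.exp_add] at this
  simpa using this

lemma St.up (h : St g P S M K B l Z Y1 Y1' Y2 Y2' d n a G) {k : ℕ} (hk : k + 3 ≤ n) :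
    ‖G k‖ ≤ Real.exp (6 * B) * ‖G (k + 1)‖ := by
  obtain ⟨-, u1, hne⟩ := h.gg (k := k) (by omega)
  obtain ⟨u2, -, -⟩ := h.gg (k := k + 1) (by omega)
  have u3 := h.low' (k := k + 1) (by omega)
  have hd := h.d0
  have c1 := h.dd _ (h.aS k (by omega)) _ (h.aS (k+1) (by omega)) hne
  have hG1 := norm_pos_iff.2 (h.G0 (k + 1) (by omega))
  have hG := norm_pos_iff.2 (h.G0 k (by omega))
  have hG2 := norm_pos_iff.2 (h.G0 (k + 1 + 1) (by omega))
  have e1 := mul_le_mul_of_nonneg_left c1 (by positivity : 0 ≤ ‖G k‖ * ‖G (k + 1)‖)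
  have e2 := mul_le_of_le_one_right (by positivity : 0 ≤ ‖G (k + 1)‖ * ‖G (k + 1 + 1)‖) (chordal_le_one (a (k + 1)) (a (k + 1 + 1)))
  have e3 := mul_le_mul_of_nonneg_left u3 hG1.le
  have e4 : 100 * Real.exp (5 * B) ≤ d * Real.exp (6 * B) := by
    have := h.ed (s := -5) (t := -6) (by norm_num)
    simpa using this
  have e5 : ‖G k‖ * ‖G (k + 1)‖ * d ≤ 2 * Real.exp (5 * B) * ‖G (k + 1)‖ * ‖G (k + 1)‖ := by linarith
  have e6 : ‖G k‖ * d ≤ 2 * Real.exp (5 * B) * ‖G (k + 1)‖ := by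
    refine le_of_mul_le_mul_right ?_ hG1
    linarith
  have e7 := mul_le_mul_of_nonneg_right e4 hG1.le
  refine le_of_mul_le_mul_right ?_ hd
  have : 0 ≤ Real.exp (5 * B) * ‖G (k + 1)‖ := by positivity
  linarith

lemma exp_lb {x y : ℝ} (h : x ≤ y) {c : ℝ} (hc : c ≤ Real.exp 1 * (1 + (x - 1))) : c ≤ Real.exp y := by
  have h1 := Real.add_one_le_exp (x - 1)
  have h2 : Real.exp x = Real.exp 1 * Real.exp (x - 1) := by rw [← Real.exp_add]; congr 1; ring
  have h3 := mul_le_mul_of_nonneg_left h1 (Real.exp_pos 1).le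
  have := Real.exp_le_exp.2 h
  linarith

lemma St.S2 (h : St g P S M K B l Z Y1 Y1' Y2 Y2' d n a G) {k : ℕ} (hk : k + 3 ≤ n) {w : ℂ} (x1 : -1 / 2 ≤ w.re) (x2 : w.re ≤ 2)
    (h1 : cc k ≤ w.im) (h2 : w.im ≤ cc (k + 1)) :
    Real.exp (-(18 * B)) ≤ chordal (valueAt g P w) (a k) ∧ Real.exp (-(18 * B)) ≤ chordal (valueAt g P w) (a (k + 1)) := by
  obtain ⟨m, y0, y1, hE, -⟩ := h.pr (k := k) (by omega) (w := w) x1 (by linarith) (by linarith) (by linarith)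
  have hB := h.B0
  have hd := h.d0
  obtain ⟨-, -, hne⟩ := h.gg (k := k) (by omega)
  have c1 := h.dd _ (h.aS k (by omega)) _ (h.aS (k+1) (by omega)) hne
  have hG1 := norm_pos_iff.2 (h.G0 (k + 1) (by omega))
  have hG := norm_pos_iff.2 (h.G0 k (by omega))
  have tri := chordal_tri (valueAt g P w) (a k) (a (k + 1))
  have e := h.chiE m y1
  obtain ⟨E1, E2⟩ := absE (hE.trans (by norm_num))
  have hr := abs_le.1 (h.cx.wk.re_abs k m (y := 2.72) ((Real.exp_le_exp.2 (by linarith : w.re / 2 ≤ 1)).trans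
    (by linarith [Real.exp_one_lt_d9])))
  set x := chordal (valueAt g P w) (a k)
  set y := chordal (valueAt g P w) (a (k + 1))
  set N := ‖Eqk Y1 Y2 a G k w‖
  have hx : 0 ≤ x := chordal_nonneg _ _
  have hy : 0 ≤ y := chordal_nonneg _ _
  have r1 : 1 / 2 * Real.exp (-(11 * B)) ≤ N := by
    have : Real.exp (-(11 * B)) ≤ Real.exp (2 * Complex.I * sg k * Z w).re := Real.exp_le_exp.2 (by linarith [hr.1])
    linarith
  have r2 : N ≤ 3 / 2 * Real.exp (11 * B) := by
    have : Real.exp (2 * Complex.I * sg k * Z w).re ≤ Real.exp (11 * B) := Real.exp_le_exp.2 (by linarith [hr.2])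
    linarith
  have f1 : 100 * Real.exp (-(18 * B)) ≤ d * Real.exp (-(17 * B)) := h.ed (by norm_num)
  have f17 : Real.exp (-(17 * B)) ≤ Real.exp (-(16 * B)) := Real.exp_le_exp.2 (by linarith)
  have f0 : Real.exp (-(17 * B)) ≤ 1 := Real.exp_le_one_iff.2 (by linarith)
  -- y ≤ 2 e^{17B} x and x ≤ 2 e^{16B} y
  have g1 : Real.exp (-(17 * B)) * y ≤ 2 * x := by
    have a1 : 1 / 2 * Real.exp (-(11 * B)) * (y * ‖G (k + 1)‖) ≤ x * ‖G k‖ := by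
      rw [e]; exact mul_le_mul_of_nonneg_right r1 (by positivity)
    have a2 : x * ‖G k‖ ≤ x * (Real.exp (6 * B) * ‖G (k + 1)‖) := mul_le_mul_of_nonneg_left (h.up hk) hx
    have a3 : 1 / 2 * Real.exp (-(11 * B)) * y ≤ x * Real.exp (6 * B) := by
      refine le_of_mul_le_mul_right ?_ hG1; linarith
    have a4 := mul_le_mul_of_nonneg_right a3 (Real.exp_pos (-(6 * B))).le
    have a5 : Real.exp (6 * B) * Real.exp (-(6 * B)) = 1 := by rw [← Real.exp_add]; simp
    have a6 : Real.exp (-(11 * B)) * Real.exp (-(6 * B)) = Real.exp (-(17 * B)) := by rw [← Real.exp_add]; congr 1; ring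
    calc Real.exp (-(17 * B)) * y = 2 * (1 / 2 * Real.exp (-(11 * B)) * y * Real.exp (-(6 * B))) := by rw [← a6]; ring
      _ ≤ 2 * (x * Real.exp (6 * B) * Real.exp (-(6 * B))) := by linarith
      _ = _ := by rw [mul_assoc x, a5, mul_one]
  have g2 : Real.exp (-(16 * B)) * x ≤ 3 / 2 * y := by
    have a1 : x * ‖G k‖ ≤ 3 / 2 * Real.exp (11 * B) * (y * ‖G (k + 1)‖) := by
      rw [e]; exact mul_le_mul_of_nonneg_right r2 (by positivity)
    have a2 := mul_le_mul_of_nonneg_left (h.low' (k := k) (by omega)) (by positivity : 0 ≤ 3 / 2 * Real.exp (11 * B) * y)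
    have a3 : x ≤ 3 / 2 * Real.exp (11 * B) * y * Real.exp (5 * B) := by
      refine le_of_mul_le_mul_right ?_ hG; linarith
    have a4 := mul_le_mul_of_nonneg_left a3 (Real.exp_pos (-(16 * B))).le
    have a5 : Real.exp (-(16 * B)) * (Real.exp (11 * B) * Real.exp (5 * B)) = 1 := by
      rw [← Real.exp_add, ← Real.exp_add]; simp; linarith
    calc _ ≤ _ := a4
      _ = 3 / 2 * y * (Real.exp (-(16 * B)) * (Real.exp (11 * B) * Real.exp (5 * B))) := by ring
      _ = _ := by rw [a5, mul_one]
  have p17 := Real.exp_pos (-(17 * B))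
  have p18 := Real.exp_pos (-(18 * B))
  have t1 := mul_le_mul_of_nonneg_left (c1.trans tri) p17.le
  have t2 := mul_le_mul_of_nonneg_right f17 hx
  have t3 := mul_le_mul_of_nonneg_right f0 hx
  have t4 := mul_le_mul_of_nonneg_right f0 hy
  constructor <;> linarith

lemma St.chik (h : St g P S M K B l Z Y1 Y1' Y2 Y2' d n a G) {k : ℕ} (hk : k + 3 ≤ n) {w : ℂ} {c : ℝ} (x1 : -1 / 2 ≤ w.re) (x2 : w.re ≤ 5)
    (h1 : w.im = cc k) (hc : c ≤ Real.exp (w.re / 2)) :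
    chordal (valueAt g P w) (a k) ≤ 3 / 2 * Real.exp (-B * (3.98 * c - 1 / 500) + 5 * B) := by
  have := cc_mono (Nat.le_succ k)
  obtain ⟨m, y0, y1, hE, -⟩ := h.pr (k := k) (by omega) (w := w) x1 (by linarith) (by linarith) (by linarith)
  have hG := norm_pos_iff.2 (h.G0 k (by omega))
  have e := h.chiE m y1
  have E2 := (absE (hE.trans (by norm_num))).2
  have hr := h.cx.wk.re_le k m hc (by rw [h1]; norm_num)
  have r2 := E2.trans (mul_le_mul_of_nonneg_left (Real.exp_le_exp.2 hr) (by norm_num))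
  refine le_of_mul_le_mul_right ?_ hG
  rw [e, Real.exp_add]
  calc _ ≤ 3 / 2 * Real.exp (-B * (3.98 * c - 1 / 500)) * (1 * (Real.exp (5 * B) * ‖G k‖)) :=
        mul_le_mul r2 (mul_le_mul (chordal_le_one _ _) (h.low' (by omega)) (norm_nonneg _) (by norm_num)) (mul_nonneg (chordal_nonneg _ _) (norm_nonneg _)) (by positivity)
    _ = _ := by ring

lemma St.S3 (h : St g P S M K B l Z Y1 Y1' Y2 Y2' d n a G) {k : ℕ} (hk : k + 3 ≤ n) {w : ℂ} (x1 : 3 / 2 ≤ w.re) (x2 : w.re ≤ 4)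
    (h1 : w.im = cc k) {b : Option ℂ} (hb : b ∈ S) (hba : b ≠ a k) : Real.exp (-(18 * B)) ≤ chordal (valueAt g P w) b := by
  have hB := h.B0
  have h2 := h.chik hk (c := 2.03) (by linarith) (by linarith) h1 (exp_lb (x := 3/4) (by linarith) (by linarith [Real.exp_one_gt_d9]))
  have h3 : Real.exp (-B * (3.98 * 2.03 - 1 / 500) + 5 * B) ≤ Real.exp (-(3 * B)) := Real.exp_le_exp.2 (by linarith)
  have tri := chordal_tri (valueAt g P w) b (a k)
  have hd := h.dd _ hb _ (h.aS k (by omega)) hba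
  have e1 : 100 * Real.exp (-(3 * B)) ≤ d := by simpa using h.ed (s := 3) (t := 0) (by norm_num)
  have e2 : Real.exp (-(18 * B)) ≤ Real.exp (-(3 * B)) := Real.exp_le_exp.2 (by linarith)
  have := Real.exp_pos (-(3 * B))
  linarith

lemma St.d18 (h : St g P S M K B l Z Y1 Y1' Y2 Y2' d n a G) : 100 * Real.exp (-(18 * B)) ≤ d ^ 2 ∧ 100 * Real.exp (-(18 * B)) ≤ d * Real.exp (-(9 * B)) ∧ 100 * Real.exp (-(9 * B)) ≤ d := by
  have e1 : 100 * Real.exp (-(9 * B)) ≤ d := by simpa using h.ed (s := 9) (t := 0) (by norm_num)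
  have e2 := h.ed (s := 18) (t := 9) (by norm_num)
  have e3 := mul_le_mul_of_nonneg_left e1 h.d0.le
  have : 0 ≤ d * Real.exp (-(9 * B)) := mul_nonneg h.d0.le (Real.exp_pos _).le
  refine ⟨by nlinarith, e2, e1⟩

def pp (k : ℕ) : ℂ := ((4:ℝ):ℂ) + (cc k : ℝ) * Complex.I

lemma pp_re (k : ℕ) : (pp k).re = 4 := by simp [pp]
lemma pp_im (k : ℕ) : (pp k).im = cc k := by simp [pp]

lemma St.ray (h : St g P S M K B l Z Y1 Y1' Y2 Y2' d n a G) {k : ℕ} (hk : k + 3 ≤ n) :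
    ∃ γ : ℝ → ℂ, ContinuousOn γ (Ici 0) ∧ γ 0 = pp k ∧ Tendsto (fun t => ‖γ t‖) atTop atTop ∧
      (∀ t ∈ Ici (0:ℝ), chordal (valueAt g P (γ t)) (a k) < Real.exp (-(18 * B))) ∧
      Tendsto (fun t => chordal (valueAt g P (γ t)) (a k)) atTop (𝓝 0) := by
  have hB := h.B0
  have hd := h.d0
  have hG1 := norm_pos_iff.2 (h.G0 (k + 1) (by omega))
  have hG := norm_pos_iff.2 (h.G0 k (by omega))
  obtain ⟨-, -, hne⟩ := h.gg (k := k) (by omega)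
  set E := Eqk Y1 Y2 a G k with hEd
  set X : Set ℂ := {x | 0 < ‖x‖ ∧ ‖x‖ < Real.exp (-(25 * B))}
  have hnv : ∀ x ∈ X, ∀ b ∈ S, (G k * v2 (a k) - x * (G (k + 1) * v2 (a (k + 1)))) * v1 b + (-(G k * v1 (a k)) - x * (-(G (k + 1) * v1 (a (k + 1))))) * v2 b ≠ 0 := by
    intro x hx b hb h0
    have h1 := van h0
    by_cases hba : b = a k
    · rw [hba, chordal_self, mul_zero] at h1
      have := (mul_eq_zero.1 h1.symm).resolve_left (mul_pos hx.1 hG1).ne'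
      exact hne (chordal_eq_zero this).symm
    · have c1 := mul_le_mul_of_nonneg_left (h.dd _ (h.aS k (by omega)) _ hb (Ne.symm hba)) hG.le
      have c3 : ‖x‖ * ‖G (k + 1)‖ * chordal (a (k + 1)) b ≤ Real.exp (-(25 * B)) * (Real.exp (5 * B) * ‖G k‖) :=
        (mul_le_of_le_one_right (by positivity) (chordal_le_one _ _)).trans
          (mul_le_mul hx.2.le (h.low' (by omega)) hG1.le (Real.exp_pos _).le)
      rw [← mul_assoc, ← Real.exp_add, show -(25 * B) + 5 * B = -(20 * B) by ring] at c3
      have e1 : 100 * Real.exp (-(20 * B)) ≤ d := by simpa using h.ed (s := 20) (t := 0) (by norm_num)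
      have := mul_le_mul_of_nonneg_right e1 hG.le
      have : 0 < Real.exp (-(20 * B)) * ‖G k‖ := by positivity
      linarith
  obtain ⟨m1, m2, m3⟩ := mob (g := g) (P := P) (Y1 := Y1) (Y2 := Y2) h.cx.pk.inf (X := X)
      (p := G k * v2 (a k)) (q := -(G k * v1 (a k))) (p' := G (k + 1) * v2 (a (k + 1))) (q' := -(G (k + 1) * v1 (a (k + 1)))) hnv
  set mb : ℂ → ℂ := fun x => -(-(G k * v1 (a k)) - x * -(G (k + 1) * v1 (a (k + 1)))) / (G k * v2 (a k) - x * (G (k + 1) * v2 (a (k + 1)))) with hmb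
  have hmX : ∀ ξ : ℂ, ξ.re < -(25 * B) → Complex.exp ξ ∈ X := by
    intro ξ hξ
    refine ⟨by rw [Complex.norm_exp]; exact Real.exp_pos _, ?_⟩
    rw [Complex.norm_exp]; exact Real.exp_lt_exp.2 hξ
  have hchi : ∀ x ∈ X, chordal (some (mb x)) (a k) ≤ ‖x‖ * Real.exp (5 * B) := by
    intro x hx
    have hden : G k * v2 (a k) - x * (G (k + 1) * v2 (a (k + 1))) ≠ 0 := by
      intro h0
      have := hnv x hx none h.cx.pk.inf
      rw [h0, show v2 none = 0 from rfl] at this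
      simp at this
    have hv : mb x * (G k * v2 (a k) - x * (G (k + 1) * v2 (a (k + 1)))) = -(-(G k * v1 (a k)) - x * -(G (k + 1) * v1 (a (k + 1)))) := div_mul_cancel₀ _ hden
    have h1 : (G k * v2 (a k) - x * (G (k + 1) * v2 (a (k + 1)))) * v1 (some (mb x)) + (-(G k * v1 (a k)) - x * (-(G (k + 1) * v1 (a (k + 1))))) * v2 (some (mb x)) = 0 := by
      rw [show v1 (some (mb x)) = mb x / (Real.sqrt (1 + ‖mb x‖ ^ 2) : ℝ) from rfl, show v2 (some (mb x)) = 1 / (Real.sqrt (1 + ‖mb x‖ ^ 2) : ℝ) from rfl]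
      generalize mb x = u at hv ⊢
      generalize v1 (a k) = u1 at hv ⊢
      generalize v1 (a (k + 1)) = u2 at hv ⊢
      generalize v2 (a (k + 1)) = u3 at hv ⊢
      generalize v2 (a k) = u4 at hv ⊢
      linear_combination (1 / ((Real.sqrt (1 + ‖u‖ ^ 2) : ℝ) : ℂ)) * hv
    have h2 := van h1
    rw [chordal_comm] at h2
    refine le_of_mul_le_mul_left ?_ hG
    rw [h2]
    calc _ ≤ ‖x‖ * ‖G (k + 1)‖ := mul_le_of_le_one_right (by positivity) (chordal_le_one _ _)
      _ ≤ ‖x‖ * (Real.exp (5 * B) * ‖G k‖) := mul_le_mul_of_nonneg_left (h.low' (by omega)) (norm_nonneg _)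
      _ = _ := by ring
  set V : Set ℂ := Metric.ball (pp k) 0.2
  have hVm : ∀ w ∈ V, (3.8 < w.re ∧ w.re < 4.2) ∧ |w.im - cc k| < 0.2 := by
    intro w hw
    rw [mem_ball_iff_norm] at hw
    have h1 := abs_lt.1 ((Complex.abs_re_le_norm _).trans_lt hw)
    have h2 := (Complex.abs_im_le_norm _).trans_lt hw
    rw [Complex.sub_re, pp_re] at h1
    rw [Complex.sub_im, pp_im] at h2
    exact ⟨⟨by linarith [h1.1], by linarith [h1.2]⟩, h2⟩
  have hall : ∀ w ∈ V, w ∈ Metric.ball (0:ℂ) K ∧ yh Y1 Y2 a G (k + 1) w ≠ 0 ∧ 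
      ‖E w * Complex.exp (-(2 * Complex.I * sg k * Z w)) - 1‖ ≤ 1 / 2 := by
    intro w hw
    obtain ⟨⟨h1, h2⟩, h3⟩ := hVm w hw
    have h3 := abs_lt.1 h3
    have := cc_mono (Nat.le_succ k)
    obtain ⟨m, y0, y1, hE, -⟩ := h.pr (k := k) (by omega) (w := w) (by linarith) (by linarith) (by linarith [h3.1]) (by linarith [h3.2])
    exact ⟨m, y1, hE.trans (by norm_num)⟩
  have hEan : ∀ w ∈ V, AnalyticAt ℂ E w := fun w hw => h.Ean (hall w hw).1 (hall w hw).2.1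
  have heU : ∀ w ∈ V, (eL (sg k) Z E w).re < -(25 * B) := by
    intro w hw
    obtain ⟨a1, a2, a3⟩ := hall w hw
    obtain ⟨⟨h1, h2⟩, h3⟩ := hVm w hw
    have b1 := (abs_le.1 ((Complex.abs_re_le_norm _).trans (eL_exp a3).2.1)).2
    rw [Complex.sub_re] at b1
    have : 6.6 ≤ Real.exp (w.re / 2) := by
      have e1 : 2.44 ≤ Real.exp 0.9 := exp_lb (x := 0.9) (by norm_num) (by linarith [Real.exp_one_gt_d9])
      have e2 : Real.exp 1.9 = Real.exp 1 * Real.exp 0.9 := by rw [← Real.exp_add]; norm_num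
      have e3 := Real.exp_one_gt_d9
      have e4 := Real.exp_le_exp.2 (by linarith : 1.9 ≤ w.re / 2)
      nlinarith
    have := h.cx.wk.re_le k a1 this h3.le
    linarith
  have hsubV : Metric.closedBall (pp k) 0.1 ⊆ V := Metric.closedBall_subset_ball (by norm_num)
  have hppV : pp k ∈ V := Metric.mem_ball_self (by norm_num)
  have hsurj := h.cx.wk.surj (by linarith) k (E := E) (w0 := pp k) (by rw [pp_re]; norm_num) (fun w hw =>
      ⟨(hall w (hsubV hw)).1, hEan w (hsubV hw), (hall w (hsubV hw)).2.2⟩)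
  have hW : ∀ j : ℕ, ∃ W : ℂ, (j = 0 → W = pp k) ∧ (j ≤ M → W ∈ V ∧ eL (sg k) Z E W = eL (sg k) Z E (pp k) + j * (2 * Real.pi * Complex.I)) := by
    intro j
    rcases Nat.eq_zero_or_pos j with rfl | hj
    · exact ⟨pp k, fun _ => rfl, fun _ => ⟨hppV, by simp⟩⟩
    by_cases hjM : j ≤ M
    · obtain ⟨W, hW, e⟩ := hsurj (show eL (sg k) Z E (pp k) + j * (2 * Real.pi * Complex.I) ∈ _ by
        rw [mem_ball_iff_norm, add_sub_cancel_left]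
        have : ‖(j:ℂ) * (2 * Real.pi * Complex.I)‖ = j * (2 * Real.pi) := by
          simp [abs_of_pos Real.pi_pos]
        rw [this]
        have : (j:ℝ) ≤ M := by exact_mod_cast hjM
        have := mul_le_mul_of_nonneg_right this (by positivity : 0 ≤ 2 * Real.pi)
        linarith [h.hM])
      exact ⟨W, fun h0 => by omega, fun _ => ⟨hsubV hW, e⟩⟩
    · exact ⟨0, fun h0 => by omega, fun h0 => absurd h0 hjM⟩
  choose W hW0 hWj using hW
  have hW00 := hW0 0 rfl
  have hrel : ∀ w ∈ V, w ∉ P ∧ g w = mb (Complex.exp (eL (sg k) Z E w)) := by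
    intro w hw
    obtain ⟨a1, a2, a3⟩ := hall w hw
    refine m3 _ (hmX _ (heU w hw)) w (h.cx.rep w a1) ?_
    rw [(eL_exp a3).1]
    exact (div_mul_cancel₀ (yh Y1 Y2 a G k w) a2).symm
  have hlim : ∀ ε > 0, ∃ x0 : ℝ, ∀ ξ : ℂ, ξ.re < x0 → chordal (some (mb (Complex.exp ξ))) (a k) < ε := by
    intro ε hε
    refine ⟨min (-(25 * B)) (Real.log ε - 5 * B), fun ξ hξ => ?_⟩
    have h1 := hchi _ (hmX ξ (hξ.trans_le (min_le_left _ _)))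
    refine h1.trans_lt ?_
    rw [Complex.norm_exp, ← Real.exp_add, ← Real.lt_log_iff_exp_lt hε]
    linarith [hξ.trans_le (min_le_right (-(25 * B)) (Real.log ε - 5 * B))]
  obtain ⟨γ, γc, γ0, γi, γg⟩ := h.cx.pk.ray (π := fun ξ => mb (Complex.exp ξ)) (s := -(25 * B)) (a := a k)
    (m1.comp Complex.continuous_exp.continuousOn hmX) (fun ξ hξ => m2 _ (hmX ξ hξ)) (by
      intro ξ n
      have : Complex.exp (ξ + n * (2 * Real.pi * Complex.I)) = Complex.exp ξ := by
        rw [Complex.exp_add, Complex.exp_nat_mul_two_pi_mul_I, mul_one]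
      simp only [this]) hlim (V := V) (convex_ball _ _).isPreconnected
    (fun w hw => (eL_an (h.cx.wk.Z_an (hall w hw).1) (hEan w hw) (hall w hw).2.2).continuousAt.continuousWithinAt)
    heU (fun w hw => (hrel w hw).1) (fun w hw => (hrel w hw).2) (W := W) (fun j hj => by
      rw [hW00]; exact hWj j hj)
  have hval : ∀ t ∈ Ici (0:ℝ), valueAt g P (γ t) = some (mb (Complex.exp (eL (sg k) Z E (W 0) - t))) := by
    intro t ht
    simp [valueAt, (γg t ht).1, (γg t ht).2]
  have hre : ∀ t : ℝ, (eL (sg k) Z E (W 0) - t).re < -(25 * B) - t := by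
    intro t
    rw [Complex.sub_re, Complex.ofReal_re, hW00]; linarith [heU _ hppV]
  refine ⟨γ, γc, γ0.trans hW00, γi, fun t ht => ?_, ?_⟩
  · rw [hval t ht]
    have ht : 0 ≤ t := ht
    have h1 : (eL (sg k) Z E (W 0) - t).re < -(25 * B) := (hre t).trans_le (by linarith)
    refine (hchi _ (hmX _ h1)).trans_lt ?_
    rw [Complex.norm_exp, ← Real.exp_add]
    exact Real.exp_lt_exp.2 (by linarith)
  · rw [Metric.tendsto_nhds]
    intro ε hε
    obtain ⟨x0, hx0⟩ := hlim ε hε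
    filter_upwards [Ici_mem_atTop 0, Ici_mem_atTop (-x0)] with t ht ht2
    rw [hval t ht, Real.dist_0_eq_abs, abs_of_nonneg (chordal_nonneg _ _)]
    refine hx0 _ ((hre t).trans_le ?_)
    have ht2 : -x0 ≤ t := ht2
    linarith

end

section

variable {K B d : ℝ} {l Z : ℂ → ℂ} {g : ℂ → ℂ} {P : Set ℂ} {S : Set (Option ℂ)} {M n : ℕ} {Y1 Y1' Y2 Y2' : ℂ → ℂ}
  {a : ℕ → Option ℂ} {G : ℕ → ℂ}

lemma St.key (h : St g P S M K B l Z Y1 Y1' Y2 Y2' d n a G) {k : ℕ} (hk : k + 3 ≤ n) {b : Option ℂ} (hb : b ∈ S)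
    (hb1 : b ≠ a (k + 1)) {u : ℂ} (hu : u ∈ Metric.ball (0:ℂ) K) (hy : yh Y1 Y2 a G (k + 1) u ≠ 0)
    (hc : chordal (valueAt g P u) b < Real.exp (-(18 * B))) :
    ‖((1 * v2 b) * (-(G (k + 1) * v1 (a (k + 1)))) - (-(1 * v1 b)) * (G (k + 1) * v2 (a (k + 1)))) * Eqk Y1 Y2 a G k u +
      ((G k * v2 (a k)) * (-(1 * v1 b)) - (-(G k * v1 (a k))) * (1 * v2 b))‖ * ‖G (k + 1)‖ ≤ d / 20 := by
  have hd := h.d0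
  have hG1 := norm_pos_iff.2 (h.G0 (k + 1) (by omega))
  obtain ⟨-, u1, hne⟩ := h.gg (k := k) (by omega)
  rw [← det_eq] at u1
  have rep := h.cx.rep u hu
  have hN : 0 < Real.sqrt (‖Y1 u‖ ^ 2 + ‖Y2 u‖ ^ 2) := Real.sqrt_pos.2 rep.norm_pos
  have c1 := h.chi (k := k + 1) hu
  have c2 := rep.chordal b
  have tri := chordal_tri (valueAt g P u) b (a (k + 1))
  have dd := h.dd _ hb _ (h.aS (k + 1) (by omega)) hb1
  obtain ⟨d1, d2, d3⟩ := h.d18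
  have d4 : Real.exp (-(9 * B)) ≤ 1 := Real.exp_le_one_iff.2 (by linarith [h.B0])
  have d5 := mul_le_mul_of_nonneg_left d4 hd.le
  set D := (G k * v2 (a k)) * (-(G (k + 1) * v1 (a (k + 1)))) - (-(G k * v1 (a k))) * (G (k + 1) * v2 (a (k + 1))) with hD
  set N := Real.sqrt (‖Y1 u‖ ^ 2 + ‖Y2 u‖ ^ 2)
  set x := chordal (valueAt g P u) b
  set y := chordal (valueAt g P u) (a (k + 1))
  have hx : 0 ≤ x := chordal_nonneg _ _
  rw [eq_div_iff hN.ne'] at c1 c2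
  have hpos := norm_pos_iff.2 hy
  have e : ((1 * v2 b) * (-(G (k + 1) * v1 (a (k + 1)))) - (-(1 * v1 b)) * (G (k + 1) * v2 (a (k + 1)))) * Eqk Y1 Y2 a G k u +
      ((G k * v2 (a k)) * (-(1 * v1 b)) - (-(G k * v1 (a k))) * (1 * v2 b)) = (Y1 u * v2 b - Y2 u * v1 b) * D / yh Y1 Y2 a G (k + 1) u := by
    rw [eq_div_iff hy, Eqk, add_mul, mul_assoc, div_mul_cancel₀ _ hy]
    simp only [yh, yc, hD]; ring
  rw [e, norm_div, norm_mul, ← c1, ← c2]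
  have hy0 : 0 < y := by linarith
  rw [show x * N * ‖D‖ / (y * ‖G (k + 1)‖ * N) * ‖G (k + 1)‖ = x * ‖D‖ / y by field_simp, div_le_iff₀ hy0]
  have y1 : d / 2 ≤ y := by linarith
  have y2 := mul_le_mul_of_nonneg_left y1 hd.le
  have y3 := mul_le_mul_of_nonneg_left u1 hx
  nlinarith

lemma St.S5 (h : St g P S M K B l Z Y1 Y1' Y2 Y2' d n a G) {k : ℕ} (hk : k + 3 ≤ n) {b : Option ℂ} (hb : b ∈ S)
    {C : Set ℂ} (hC : IsPreconnected C) (hCs : ∀ w ∈ C, chordal (valueAt g P w) b < Real.exp (-(18 * B))) {w : ℂ} (hw : w ∈ C)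
    (hre : w.re = 2) (h1 : cc k ≤ w.im) (h2 : w.im ≤ cc (k + 1)) : IsBounded C := by
  have hB := h.B0
  have hd := h.d0
  have s2 := h.S2 hk (w := w) (by linarith) (by linarith) h1 h2
  have hb0 : b ≠ a k := by rintro rfl; linarith [hCs w hw]
  have hb1 : b ≠ a (k + 1) := by rintro rfl; linarith [hCs w hw]
  have hG1 := norm_pos_iff.2 (h.G0 (k + 1) (by omega))
  have hG := norm_pos_iff.2 (h.G0 k (by omega))
  set E := Eqk Y1 Y2 a G k with hEd
  have hall : ∀ u ∈ Metric.closedBall w 0.1, u ∈ Metric.ball (0:ℂ) K ∧ yh Y1 Y2 a G (k + 1) u ≠ 0 ∧ 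
      ‖E u * Complex.exp (-(2 * Complex.I * sg k * Z u)) - 1‖ ≤ 1 / 2 := by
    intro u hu
    rw [mem_closedBall_iff_norm] at hu
    have q1 := abs_le.1 ((Complex.abs_re_le_norm _).trans hu)
    have q2 := abs_le.1 ((Complex.abs_im_le_norm _).trans hu)
    rw [Complex.sub_re] at q1
    rw [Complex.sub_im] at q2
    obtain ⟨m, y0, y1, hE, -⟩ := h.pr (k := k) (by omega) (w := u) (by linarith [q1.1]) (by linarith [q1.2]) (by linarith [q2.1]) (by linarith [q2.2])
    exact ⟨m, y1, hE.trans (by norm_num)⟩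
  have hEan : ∀ u ∈ Metric.closedBall w 0.1, AnalyticAt ℂ E u := fun u hu => h.Ean (hall u hu).1 (hall u hu).2.1
  have hw0 : w ∈ Metric.closedBall w 0.1 := Metric.mem_closedBall_self (by norm_num)
  have hlow := h.cx.wk.low (by linarith) k (E := E) (w0 := w) (by rw [hre]; norm_num) (fun u hu =>
      ⟨(hall u hu).1, hEan u hu, (hall u hu).2.2⟩)
  set e := eL (sg k) Z E with he
  have hec : ContinuousOn e (Metric.closedBall w 0.1) := fun u hu =>
    (eL_an (h.cx.wk.Z_an (hall u hu).1) (hEan u hu) (hall u hu).2.2).continuousAt.continuousWithinAt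
  have gap : ∀ u ∈ C, u ∈ Metric.closedBall w 0.1 → 0.2 < ‖e u - e w‖ → ‖e u - e w‖ < 0.3 → False := by
    intro u huC hu l1 l2
    have k1 := h.key hk hb hb1 (hall u hu).1 (hall u hu).2.1 (hCs u huC)
    have k2 := h.key hk hb hb1 (hall w hw0).1 (hall w hw0).2.1 (hCs w hw)
    have x1 := (eL_exp (hall u hu).2.2).1
    have x2 := (eL_exp (hall w hw0).2.2).1
    have d2 := det_eq (G k) 1 (a k) b
    have dd := h.dd _ (h.aS k (by omega)) _ hb hb0.symm
    have gg := (h.gg (k := k) (by omega)).1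
    have gg2 := mul_le_of_le_one_right (by positivity : 0 ≤ ‖G k‖ * ‖G (k + 1)‖) (chordal_le_one (a k) (a (k + 1)))
    rw [← hEd, ← x1] at k1
    rw [← hEd, ← x2] at k2
    set β := (G k * v2 (a k)) * (-(1 * v1 b)) - (-(G k * v1 (a k))) * (1 * v2 b)
    set α := (1 * v2 b) * (-(G (k + 1) * v1 (a (k + 1)))) - (-(1 * v1 b)) * (G (k + 1) * v2 (a (k + 1)))
    have b1 : 1.9 * d ≤ ‖β‖ * ‖G (k + 1)‖ := by
      rw [d2, norm_one]
      have := mul_le_mul dd (gg.trans gg2) (by norm_num) (chordal_nonneg _ _)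
      linarith
    set ρ := e u - e w with hρ
    have hee : Complex.exp (e u) = Complex.exp (e w) * Complex.exp ρ := by rw [← Complex.exp_add]; congr 1; rw [hρ]; ring
    rw [hee] at k1
    have lo := exp_sub_one_lower (u := ρ) (by linarith)
    have lo2 : 0.16 ≤ ‖Complex.exp ρ - 1‖ := by nlinarith
    set A := α * Complex.exp (e w) with hA
    have t1 : ‖β‖ ≤ ‖A‖ + ‖A + β‖ := by
      have := norm_sub_le (A + β) A
      rw [add_sub_cancel_left] at this; linarith
    have t2 : ‖A‖ * ‖Complex.exp ρ - 1‖ ≤ ‖α * (Complex.exp (e w) * Complex.exp ρ) + β‖ + ‖A + β‖ := by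
      rw [← norm_mul]
      refine le_trans (le_of_eq ?_) (norm_sub_le _ _)
      congr 1; rw [hA]; ring
    have t3 := mul_le_mul_of_nonneg_right t1 hG1.le
    have t4 := mul_le_mul_of_nonneg_right t2 hG1.le
    have t5 : 1.8 * d ≤ ‖A‖ * ‖G (k + 1)‖ := by linarith
    have t6 := mul_le_mul t5 lo2 (by norm_num) (by positivity)
    linarith
  have hO1 : IsOpen {u ∈ Metric.ball w 0.1 | ‖e u - e w‖ < 0.3} := by
    have : ContinuousOn (fun u => ‖e u - e w‖) (Metric.ball w 0.1) := ((hec.mono Metric.ball_subset_closedBall).sub continuousOn_const).norm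
    exact this.isOpen_inter_preimage Metric.isOpen_ball isOpen_Iio
  have hO2 : IsClosed {u ∈ Metric.closedBall w 0.1 | ‖e u - e w‖ ≤ 0.2} := by
    have : ContinuousOn (fun u => ‖e u - e w‖) (Metric.closedBall w 0.1) := (hec.sub continuousOn_const).norm
    exact this.preimage_isClosed_of_isClosed Metric.isClosed_closedBall isClosed_Iic
  by_contra hbd
  obtain ⟨v, hvC, hv⟩ : ∃ v ∈ C, v ∉ Metric.closedBall w 0.1 := by
    by_contra hcon
    push Not at hcon
    exact hbd (Metric.isBounded_closedBall.subset hcon)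
  obtain ⟨u, huC, hu1, hu2⟩ := hC _ _ hO1 hO2.isOpen_compl (by
      intro u huC
      by_cases hu : u ∈ {u ∈ Metric.closedBall w 0.1 | ‖e u - e w‖ ≤ 0.2}
      · left
        refine ⟨?_, by linarith [hu.2]⟩
        by_contra hnb
        have := hlow u (by
          rw [Metric.mem_sphere]
          rw [Metric.mem_ball, not_lt] at hnb
          exact le_antisymm hu.1 hnb)
        linarith [hu.2]
      · right; exact hu) ⟨w, hw, Metric.mem_ball_self (by norm_num), by rw [sub_self, norm_zero]; norm_num⟩ ⟨v, hvC, fun hh => hv hh.1⟩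
  have hu3 := Metric.ball_subset_closedBall hu1.1
  refine gap u huC hu3 ?_ hu1.2
  by_contra hcon
  exact hu2 ⟨hu3, not_lt.1 hcon⟩

end

section

lemma loopx {q : ℂ} {hi lo a b : ℝ} (hhi : 0 < hi) (hlo : 0 < lo) (ha : 0 < a) (hb : 0 < b)
    (pm : Path (q + hi * Complex.I) (q - lo * Complex.I)) {K1 K2 : Set ℂ}
    (hK1 : IsPreconnected K1) (hu1 : ¬ IsBounded K1) (hK2 : IsPreconnected K2) (hu2 : ¬ IsBounded K2)
    (hv : ∀ y ∈ Icc (-lo) hi, q + y * Complex.I ∉ K1 ∧ q + y * Complex.I ∉ K2) (hp : ∀ s, pm s ∉ K1 ∧ pm s ∉ K2)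
    (hq1 : q + a ∈ K1) (hq2 : q - b ∈ K2)
    (hs : ∀ s, (pm s).im = q.im → (pm s).re ∈ Icc (q.re - b) (q.re + a) → False) : False := by
  set J : ℝ → ℂ := fun t => if t ≤ 1 / 4 then q + ((4 * t * hi : ℝ) : ℂ) * Complex.I else
    if t ≤ 3 / 4 then pm.extend (2 * t - 1 / 2) else q + ((-(4 * (1 - t) * lo) : ℝ) : ℂ) * Complex.I with hJ
  have c1 : Continuous J := by
    refine Continuous.if_le (by fun_prop) (Continuous.if_le ?_ (by fun_prop) continuous_id continuous_const ?_) continuous_id continuous_const ?_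
    · exact pm.continuous_extend.comp (by fun_prop)
    · intro t ht
      rw [ht, show (2 * (3 / 4 : ℝ) - 1 / 2) = 1 by norm_num, pm.extend_one]
      push_cast; ring
    · intro t ht
      rw [ht, if_pos (by norm_num), show (2 * (1 / 4 : ℝ) - 1 / 2) = 0 by norm_num, pm.extend_zero]
      push_cast; ring
  have v1 : ∀ t ≤ 1 / 4, J t = q + ((4 * t * hi : ℝ) : ℂ) * Complex.I := fun t ht => by simp only [hJ]; rw [if_pos ht]
  have v2 : ∀ t, 1 / 4 < t → t ≤ 3 / 4 → ∃ s, J t = pm s := fun t ht ht2 => by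
    simp only [hJ]; rw [if_neg (not_le.2 ht), if_pos ht2]
    exact ⟨⟨2 * t - 1 / 2, by linarith, by linarith⟩, pm.extend_apply _⟩
  have v3 : ∀ t, 3 / 4 < t → J t = q + ((-(4 * (1 - t) * lo) : ℝ) : ℂ) * Complex.I := fun t ht => by
    simp only [hJ]; rw [if_neg (by linarith), if_neg (not_le.2 ht)]
  have im : ∀ y : ℝ, (q + (y : ℂ) * Complex.I).im = q.im + y := fun y => by simp
  have cases : ∀ t ∈ Icc (0:ℝ) 1, (∃ y ∈ Icc (-lo) hi, J t = q + (y : ℝ) * Complex.I) ∨ ∃ s, J t = pm s := by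
    intro t ht
    by_cases h1 : t ≤ 1 / 4
    · left; refine ⟨_, ⟨?_, ?_⟩, v1 t h1⟩
      · have := mul_nonneg ht.1 hhi.le; linarith
      · nlinarith
    · by_cases h2 : t ≤ 3 / 4
      · right; exact v2 t (not_le.1 h1) h2
      · left; refine ⟨_, ⟨?_, ?_⟩, v3 t (not_le.1 h2)⟩
        · nlinarith
        · have := mul_nonneg (by linarith [ht.2] : 0 ≤ 1 - t) hlo.le; linarith
  have J0 : J 0 = q := by rw [v1 0 (by norm_num)]; simp
  have J1 : J 1 = q := by rw [v3 1 (by norm_num)]; simp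
  refine crossing (J := J) c1.continuousOn (J0.trans J1.symm) hK1 hu1 ?_ hK2 hu2 ?_ ha hb (by rwa [J0]) (by rwa [J0]) ?_ (η := 1 / 4) (by norm_num) (by norm_num) ?_ ?_
  · intro t ht
    rcases cases t ht with ⟨y, hy, e⟩ | ⟨s, e⟩ <;> rw [e]
    exacts [(hv y hy).1, (hp s).1]
  · intro t ht
    rcases cases t ht with ⟨y, hy, e⟩ | ⟨s, e⟩ <;> rw [e]
    exacts [(hv y hy).2, (hp s).2]
  · intro t ht h1 h2
    rw [J0] at h1 h2
    by_cases q1 : t ≤ 1 / 4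
    · rw [v1 t q1, im] at h1
      have := mul_pos ht.1 hhi; linarith
    · by_cases q2 : t ≤ 3 / 4
      · obtain ⟨s, e⟩ := v2 t (not_le.1 q1) q2
        rw [e] at h1 h2
        exact hs s h1 h2
      · rw [v3 t (not_le.1 q2), im] at h1
        have := mul_pos (by linarith [ht.2] : 0 < 1 - t) hlo; linarith
  · intro t ht
    rw [J0, v1 t ht.2.le, im]
    have := mul_pos ht.1 hhi; linarith
  · intro t ht
    rw [J0, v3 t (by linarith [ht.1]), im]
    have := mul_pos (by linarith [ht.2] : 0 < 1 - t) hlo; linarith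

def bx (a b c d : ℝ) : Set ℂ := {z | (a ≤ z.re ∧ z.re ≤ b) ∧ c ≤ z.im ∧ z.im ≤ d}

lemma bx_convex (a b c d : ℝ) : Convex ℝ (bx a b c d) :=
  ((convex_Icc (𝕜 := ℝ) a b).linear_preimage Complex.reLm).inter ((convex_Icc (𝕜 := ℝ) c d).linear_preimage Complex.imLm)

lemma cc_find {i j : ℕ} {y : ℝ} (hij : i < j) (h1 : cc i ≤ y) (h2 : y ≤ cc j) : ∃ k, k < j ∧ cc k ≤ y ∧ y ≤ cc (k + 1) := by
  induction j with
  | zero => omega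
  | succ m ih =>
    by_cases h : cc m ≤ y
    · exact ⟨m, by omega, h, h2⟩
    · rcases Nat.lt_succ_iff_lt_or_eq.1 hij with h3 | rfl
      · obtain ⟨k, hk, h4⟩ := ih h3 (not_le.1 h).le
        exact ⟨k, by omega, h4⟩
      · exact absurd h1 h

variable {K B d : ℝ} {l Z : ℂ → ℂ} {g : ℂ → ℂ} {P : Set ℂ} {S : Set (Option ℂ)} {M n : ℕ} {Y1 Y1' Y2 Y2' : ℂ → ℂ}
  {a : ℕ → Option ℂ} {G : ℕ → ℂ}

lemma St.comp (h : St g P S M K B l Z Y1 Y1' Y2 Y2' d n a G) :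
    ∃ (γ : ℕ → ℝ → ℂ) (C : ℕ → Set ℂ), ∀ k, k + 3 ≤ n → AsymptoticPath g P (a k) (γ k) ∧ γ k '' Ici 0 ⊆ C k ∧
      C k = connectedComponentIn {z | chordal (valueAt g P z) (a k) < Real.exp (-(18 * B))} (pp k) ∧
      (∀ z ∈ C k, chordal (valueAt g P z) (a k) < Real.exp (-(18 * B))) ∧ pp k ∈ C k ∧ IsPreconnected (C k) ∧ ¬ IsBounded (C k) := by
  have : ∀ k, ∃ γ : ℝ → ℂ, k + 3 ≤ n → AsymptoticPath g P (a k) γ ∧ γ 0 = pp k ∧ ∀ t ∈ Ici (0:ℝ), chordal (valueAt g P (γ t)) (a k) < Real.exp (-(18 * B)) := by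
    intro k
    by_cases hk : k + 3 ≤ n
    · obtain ⟨γ, h1, h2, h3, h4, h5⟩ := h.ray hk
      exact ⟨γ, fun _ => ⟨⟨h1, h3, h5⟩, h2, h4⟩⟩
    · exact ⟨0, fun h => absurd h hk⟩
  choose γ hγ using this
  refine ⟨γ, fun k => connectedComponentIn {z | chordal (valueAt g P z) (a k) < Real.exp (-(18 * B))} (pp k), fun k hk => ?_⟩
  obtain ⟨h1, h2, h3⟩ := hγ k hk
  have hpp : pp k ∈ γ k '' Ici 0 := ⟨0, self_mem_Ici, h2⟩
  have hsub : γ k '' Ici 0 ⊆ {z | chordal (valueAt g P z) (a k) < Real.exp (-(18 * B))} := by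
    rintro _ ⟨t, ht, rfl⟩; exact h3 t ht
  have hs2 := (isPreconnected_Ici.image _ h1.1).subset_connectedComponentIn hpp hsub
  refine ⟨h1, hs2, rfl, fun z hz => by
    have := connectedComponentIn_subset {z | chordal (valueAt g P z) (a k) < Real.exp (-(18 * B))} (pp k) hz
    exact this, hs2 hpp, isPreconnected_connectedComponentIn, fun hb => ?_⟩
  obtain ⟨R, hR⟩ := isBounded_iff_forall_norm_le.1 hb
  obtain ⟨t, ht, ht2⟩ := ((h1.2.1.eventually_gt_atTop R).and (eventually_ge_atTop 0)).exists
  linarith [hR _ (hs2 ⟨t, ht2, rfl⟩)]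

lemma St.sep (h : St g P S M K B l Z Y1 Y1' Y2 Y2' d n a G) {C : ℕ → Set ℂ} {t : ℝ} (ht : t = Real.exp (-(18 * B)))
    (hC : ∀ k, k + 3 ≤ n → C k = connectedComponentIn {z | chordal (valueAt g P z) (a k) < t} (pp k) ∧
      (∀ z ∈ C k, chordal (valueAt g P z) (a k) < t) ∧ pp k ∈ C k ∧ IsPreconnected (C k) ∧ ¬ IsBounded (C k))
    {i j : ℕ} (hij : i + 1 < j) (hj : j + 3 ≤ n) (haij : a (i + 1) = a j) : Disjoint (C (i + 1)) (C j) := by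
  obtain ⟨ei, ci, pi, pci, ui⟩ := hC (i + 1) (by omega)
  obtain ⟨ej, cj, pj, pcj, uj⟩ := hC j (by omega)
  obtain ⟨em, cm, pm, pcm, um⟩ := hC i (by omega)
  have hnx := (h.gg (k := i + 1) (by omega)).2.2
  have hnm := (h.gg (k := i) (by omega)).2.2
  have hj2 : i + 1 + 1 < j := by
    rcases Nat.lt_or_ge (i + 1 + 1) j with h | h
    · exact h
    · exact absurd (haij.trans (by congr 1; omega)) hnx
  obtain ⟨ex, cx, px, pcx, ux⟩ := hC (i + 1 + 1) (by omega)
  by_contra hdis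
  obtain ⟨z, hz1, hz2⟩ := not_disjoint_iff.1 hdis
  have hopen : IsOpen (C (i + 1)) := by
    rw [ei]; exact (isOpen_lt ((h.cx.pk.mero.chi_cont _)) continuous_const).connectedComponentIn
  have hCC : C (i + 1) = C j := by
    rw [ei] at hz1 ⊢
    rw [ej] at hz2 ⊢
    rw [← haij] at hz2 ⊢
    rw [connectedComponentIn_eq hz1, connectedComponentIn_eq hz2]
  have hpc : IsPathConnected (C (i + 1)) := (hopen.isConnected_iff_isPathConnected).1 ⟨⟨_, pi⟩, pci⟩
  have hcs1 := cc_succ i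
  have hcs2 := cc_succ (i + 1)
  have hcs3 := cc_mono hj2
  have hcs4 := cc_succ (i + 1 + 1)
  have hpi := Real.pi_gt_three
  have haS := h.aS
  obtain ⟨d1, d2, d3⟩ := h.d18
  have hd := h.d0
  have htp : 0 < t := by rw [ht]; exact Real.exp_pos _
  have htd : 2 * t < d := by
    have e1 : 100 * Real.exp (-(18 * B)) ≤ d := by simpa using h.ed (s := 18) (t := 0) (by norm_num)
    rw [← ht] at e1; linarith
  have S2 : ∀ {k : ℕ} (hk : k + 3 ≤ n) {w : ℂ} (x1 : -1 / 2 ≤ w.re) (x2 : w.re ≤ 2) (h1 : cc k ≤ w.im) (h2 : w.im ≤ cc (k + 1)),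
    t ≤ chordal (valueAt g P w) (a k) ∧ t ≤ chordal (valueAt g P w) (a (k + 1)) := by rw [ht]; exact h.S2
  have S3 : ∀ {k : ℕ} (hk : k + 3 ≤ n) {w : ℂ} (x1 : 3 / 2 ≤ w.re) (x2 : w.re ≤ 4)
    (h1 : w.im = cc k) {b : Option ℂ} (hb : b ∈ S) (hba : b ≠ a k), t ≤ chordal (valueAt g P w) b := by rw [ht]; exact h.S3
  have S5 : ∀ {b : Option ℂ} (hb : b ∈ S) {C : Set ℂ} (hC : IsPreconnected C) (hCs : ∀ w ∈ C, chordal (valueAt g P w) b < t) (hu : ¬ IsBounded C) {w : ℂ}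
    (hre : w.re = 2) (h1 : cc (i + 1) ≤ w.im) (h2 : w.im ≤ cc j), w ∉ C := by
    intro b hb C hC hCs hu w hre h1 h2 hw
    obtain ⟨k, hk, y1, y2⟩ := cc_find (by omega) h1 h2
    rw [ht] at hCs
    exact hu (h.S5 (k := k) (by omega) hb hC hCs hw hre y1 y2)
  have far : ∀ {b c : Option ℂ} {w : ℂ}, b ∈ S → c ∈ S → b ≠ c → chordal (valueAt g P w) b < t → chordal (valueAt g P w) c < t → False := by
    intro b c w hb hc hbc h1 h2
    have := h.dd b hb c hc hbc
    have := chordal_tri (valueAt g P w) b c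
    linarith
  set q : ℂ := ((2:ℝ):ℂ) + (cc (i + 1 + 1) : ℝ) * Complex.I with hq
  have qre : q.re = 2 := by simp [hq]
  have qim : q.im = cc (i + 1 + 1) := by simp [hq]
  set hi := cc j - cc (i + 1 + 1) with hhi
  set lo := 2 * Real.pi with hlo
  set R : Set ℂ := C (i + 1) ∪ bx 2 4 (cc j) (cc j) ∪ bx 2 4 (cc (i + 1)) (cc (i + 1)) with hR
  have hhipos : 0 < hi := by
    have := cc_mono (show i + 1 + 1 + 1 ≤ j by omega)
    rw [hhi]; linarith
  have tre : ∀ y : ℝ, (q + (y:ℂ) * Complex.I).re = 2 := by intro y; simp [qre]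
  have tim : ∀ y : ℝ, (q + (y:ℂ) * Complex.I).im = cc (i + 1 + 1) + y := by intro y; simp [qim]
  have tre' : ∀ y : ℝ, (q - (y:ℂ) * Complex.I).re = 2 := by intro y; simp [qre]
  have tim' : ∀ y : ℝ, (q - (y:ℂ) * Complex.I).im = cc (i + 1 + 1) - y := by intro y; simp [qim]
  have hJ : JoinedIn R (q + hi * Complex.I) (q - lo * Complex.I) := by
    have j1 : JoinedIn R (q + hi * Complex.I) (pp j) := JoinedIn.of_segment_subset
      (((bx_convex 2 4 (cc j) (cc j)).segment_subset ⟨by rw [tre]; norm_num, by rw [tim]; constructor <;> linarith⟩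
        ⟨by rw [pp_re]; norm_num, by rw [pp_im]; simp⟩).trans (by intro x hx; exact Or.inl (Or.inr hx)))
    have j2 : JoinedIn R (pp j) (pp (i + 1)) := (hpc.joinedIn _ (hCC ▸ pj) _ pi).mono (by intro x hx; exact Or.inl (Or.inl hx))
    have j3 : JoinedIn R (pp (i + 1)) (q - lo * Complex.I) := JoinedIn.of_segment_subset
      (((bx_convex 2 4 (cc (i + 1)) (cc (i + 1))).segment_subset ⟨by rw [pp_re]; norm_num, by rw [pp_im]; simp⟩
        ⟨by rw [tre']; norm_num, by rw [tim']; constructor <;> linarith⟩).trans (by intro x hx; exact Or.inr hx))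
    exact (j1.trans j2).trans j3
  obtain ⟨p, hp⟩ := hJ
  set K2 : Set ℂ := bx (3/2) (3/2) (cc i) (cc (i + 1 + 1)) ∪ bx (3/2) 4 (cc i) (cc i) ∪ C i with hK2
  have hK2p : IsPreconnected K2 := by
    refine IsPreconnected.union (pp i) ?_ pm ?_ pcm
    · exact Or.inr ⟨by rw [pp_re]; norm_num, by rw [pp_im]; simp⟩
    · exact IsPreconnected.union (((3/2 : ℝ) : ℂ) + (cc i : ℝ) * Complex.I) ⟨by simp, by simp; linarith⟩ ⟨by simp; norm_num, by simp⟩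
        (bx_convex _ _ _ _).isPreconnected (bx_convex _ _ _ _).isPreconnected
  -- points of R
  have hRK : ∀ z ∈ R, z ∉ C (i + 1 + 1) ∧ z ∉ K2 := by
    rintro z ((hz | hz) | hz)
    · refine ⟨fun hz2 => far (haS _ (by omega)) (haS _ (by omega)) hnx (ci z hz) (cx z hz2), ?_⟩
      rintro ((hz2 | hz2) | hz2)
      · by_cases hc : z.im ≤ cc (i + 1)
        · exact absurd (ci z hz) (not_lt.2 (S2 (k := i) (by omega) (by linarith [hz2.1.1]) (by linarith [hz2.1.2]) hz2.2.1 hc).2)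
        · exact absurd (ci z hz) (not_lt.2 (S2 (k := i + 1) (by omega) (by linarith [hz2.1.1]) (by linarith [hz2.1.2]) (not_le.1 hc).le hz2.2.2).1)
      · exact absurd (ci z hz) (not_lt.2 (S3 (k := i) (by omega) hz2.1.1 hz2.1.2 (le_antisymm hz2.2.2 hz2.2.1) (haS _ (by omega)) hnm.symm))
      · exact far (haS _ (by omega)) (haS _ (by omega)) hnm (cm z hz2) (ci z hz)
    · have hb : ∀ b ∈ S, b ≠ a j → t ≤ chordal (valueAt g P z) b := fun b hb1 hb2 =>
        S3 (k := j) (by omega) (by linarith [hz.1.1]) hz.1.2 (le_antisymm hz.2.2 hz.2.1) hb1 hb2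
      rw [← haij] at hb
      refine ⟨fun hz2 => absurd (cx z hz2) (not_lt.2 (hb _ (haS _ (by omega)) hnx.symm)), ?_⟩
      rintro ((hz2 | hz2) | hz2)
      · linarith [hz.1.1, hz2.1.2]
      · linarith [hz.2.1, hz2.2.2]
      · exact absurd (cm z hz2) (not_lt.2 (hb _ (haS _ (by omega)) hnm))
    · have hb : ∀ b ∈ S, b ≠ a (i + 1) → t ≤ chordal (valueAt g P z) b := fun b hb1 hb2 =>
        S3 (k := i + 1) (by omega) (by linarith [hz.1.1]) hz.1.2 (le_antisymm hz.2.2 hz.2.1) hb1 hb2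
      refine ⟨fun hz2 => absurd (cx z hz2) (not_lt.2 (hb _ (haS _ (by omega)) hnx.symm)), ?_⟩
      rintro ((hz2 | hz2) | hz2)
      · linarith [hz.1.1, hz2.1.2]
      · linarith [hz.2.1, hz2.2.2]
      · exact absurd (cm z hz2) (not_lt.2 (hb _ (haS _ (by omega)) hnm))
  refine loopx (q := q) (hi := hi) (lo := lo) (a := 2) (b := 1 / 2) hhipos (by positivity) (by norm_num) (by norm_num) p pcx ux hK2p
    (fun hb => um (hb.subset subset_union_right)) ?_ (fun s => hRK _ (hp s)) ?_ ?_ ?_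
  · intro y hy
    have hy1 := hy.1
    have hy2 := hy.2
    have g1 : cc (i + 1) ≤ (q + (y:ℂ) * Complex.I).im := by rw [tim]; linarith
    have g2 : (q + (y:ℂ) * Complex.I).im ≤ cc j := by rw [tim]; linarith
    refine ⟨S5 (haS (i + 1 + 1) (by omega)) pcx cx ux (tre y) g1 g2, ?_⟩
    rintro ((hz2 | hz2) | hz2)
    · have := hz2.1.2; rw [tre] at this; linarith
    · have := hz2.2.2; linarith
    · exact S5 (haS i (by omega)) pcm cm um (tre y) g1 g2 hz2
  · convert px using 1
    rw [hq, pp]; push_cast; ring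
  · refine Or.inl (Or.inl ⟨?_, ?_⟩)
    · have : (q - ((1/2:ℝ):ℂ)).re = 3 / 2 := by rw [Complex.sub_re, qre, Complex.ofReal_re]; norm_num
      rw [this]; simp
    · have : (q - ((1/2:ℝ):ℂ)).im = cc (i + 1 + 1) := by rw [Complex.sub_im, qim, Complex.ofReal_im]; simp
      rw [this]; constructor <;> linarith
  · intro s h1 h2
    rw [qim] at h1
    rw [qre] at h2
    rcases hp s with (hz | hz) | hz
    · exact absurd (ci _ hz) (not_lt.2 (S3 (k := i + 1 + 1) (by omega) (by linarith [h2.1]) (by linarith [h2.2]) h1 (haS _ (by omega)) hnx))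
    · linarith [hz.2.1]
    · linarith [hz.2.2]

lemma St.many (h : St g P S M K B l Z Y1 Y1' Y2 Y2' d n a G) {m : ℕ} (hm : m + 4 ≤ n) :
    ∃ (a' : Fin m → Option ℂ) (γ : Fin m → ℝ → ℂ), (∀ i, AsymptoticPath g P (a' i) (γ i)) ∧
      ∀ i j, i ≠ j → DistinctSingularities g P (a' i) (a' j) (γ i) (γ j) := by
  obtain ⟨γ, C, hC⟩ := h.comp
  have key : ∀ i j : ℕ, i < j → j < m → DistinctSingularities g P (a (i + 1)) (a (j + 1)) (γ (i + 1)) (γ (j + 1)) := by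
    intro i j hij hj
    by_cases ha : a (i + 1) = a (j + 1)
    · right
      obtain ⟨i1, i2, i3, i4, i5, -⟩ := hC (i + 1) (by omega)
      obtain ⟨j1, j2, j3, j4, j5, -⟩ := hC (j + 1) (by omega)
      refine ⟨_, Real.exp_pos _, C (i + 1), C (j + 1), ⟨_, i4 _ i5, i3⟩, ⟨_, j4 _ j5, j3⟩, 
        h.sep rfl (fun k hk => (hC k hk).2.2) (by omega) (by omega) ha, ?_, ?_⟩
      · rw [sdiff_eq_empty.2 i2]; exact isBounded_empty
      · rw [sdiff_eq_empty.2 j2]; exact isBounded_empty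
    · left; exact ha
  refine ⟨fun i => a (i + 1), fun i => γ (i + 1), fun i => (hC _ (by omega)).1, fun i j hij => ?_⟩
  rcases lt_or_gt_of_ne (fun h => hij (Fin.ext h) : (i : ℕ) ≠ j) with h1 | h1
  · exact key i j h1 j.2
  · rcases key j i h1 i.2 with h2 | ⟨t, ht, C1, C2, q1, q2, q3, q4, q5⟩
    · left; exact h2.symm
    · right; exact ⟨t, ht, C2, C1, q2, q1, q3.symm, q5, q4⟩

end

section

lemma wk_of {K B ε : ℝ} {l : ℂ → ℂ} (hK : 0 < K) (hB : 1 ≤ B) (he1 : ε ≤ 1 / 100) (he2 : Real.exp (K / 2) * ε * K ≤ 1 / 1000)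
    (hl : DifferentiableOn ℂ l (Metric.ball 0 (K + 1))) (hb : ∀ w ∈ Metric.ball (0:ℂ) (K + 1), ‖l w‖ ≤ ε) : ∃ Z, WK K B l Z := by
  have sub : Metric.ball (0:ℂ) K ⊆ Metric.ball 0 (K + 1) := Metric.ball_subset_ball (by linarith)
  have an : ∀ w ∈ Metric.ball (0:ℂ) (K + 1), AnalyticAt ℂ l w := fun w hw => hl.analyticAt (Metric.isOpen_ball.mem_nhds hw)
  have e0 : 0 ≤ ε := (norm_nonneg _).trans (hb 0 (by simp; linarith))
  have near : ∀ {R : ℝ} {w z : ℂ}, w ∈ Metric.ball (0:ℂ) R → z ∈ Metric.closedBall w (1/2) → z ∈ Metric.ball (0:ℂ) (R + 1/2) := by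
    intro R w z hw hz
    rw [mem_ball_zero_iff] at *
    rw [Metric.mem_closedBall, dist_eq_norm] at hz
    have := norm_add_le (z - w) w
    rw [sub_add_cancel] at this
    linarith
  have d1 : ∀ w ∈ Metric.ball (0:ℂ) (K + 1/2), ‖deriv l w‖ ≤ ε / (1/2) := by
    intro w hw
    refine Complex.norm_deriv_le_of_forall_mem_sphere_norm_le (by norm_num) ?_ ?_
    · refine DifferentiableOn.diffContOnCl (hl.mono ?_)
      intro z hz
      have := near hw (Metric.closure_ball_subset_closedBall hz)
      convert this using 2; ring
    · intro z hz
      have := near hw (Metric.sphere_subset_closedBall hz)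
      exact hb z (by convert this using 2; ring)
  have d2 : ∀ w ∈ Metric.ball (0:ℂ) K, ‖deriv (deriv l) w‖ ≤ (ε / (1/2)) / (1/2) := by
    intro w hw
    refine Complex.norm_deriv_le_of_forall_mem_sphere_norm_le (by norm_num) ?_ ?_
    · refine DifferentiableOn.diffContOnCl (fun z hz => ?_)
      have := near hw (Metric.closure_ball_subset_closedBall hz)
      exact (an z (Metric.ball_subset_ball (by linarith) this)).deriv.differentiableAt.differentiableWithinAt
    · intro z hz
      exact d1 z (near hw (Metric.sphere_subset_closedBall hz))
  have dF : DifferentiableOn ℂ (fun w => (B:ℂ) * Complex.exp ((w + l w) / 2)) (Metric.ball 0 K) := by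
    have := hl.mono sub
    fun_prop
  obtain ⟨Z0, hZ0⟩ := dF.isExactOn_ball
  set Z := fun w => Z0 w - Z0 0 + 2 * B
  have hZ : ∀ w ∈ Metric.ball (0:ℂ) K, HasDerivAt Z (B * Complex.exp ((w + l w) / 2)) w := fun w hw =>
    ((hZ0 w hw).sub_const _).add_const _
  refine ⟨Z, hB, fun w hw => an w (sub hw), fun w hw => (hb w (sub hw)).trans he1, fun w hw => (d1 w (Metric.ball_subset_ball (by linarith) hw)).trans (by linarith),
    fun w hw => (d2 w hw).trans (by linarith), hZ, fun w hw => ?_⟩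
  have hE : ∀ z ∈ Metric.ball (0:ℂ) K, HasDerivWithinAt (fun w => Z w - 2 * B * Complex.exp (w / 2))
      (B * Complex.exp ((z + l z) / 2) - 2 * B * (Complex.exp (z / 2) * (1 / 2))) (Metric.ball 0 K) z := fun z hz =>
    ((hZ z hz).sub ((((hasDerivAt_id z).div_const 2).cexp).const_mul (2 * (B:ℂ)))).hasDerivWithinAt
  have hbd : ∀ z ∈ Metric.ball (0:ℂ) K, ‖B * Complex.exp ((z + l z) / 2) - 2 * B * (Complex.exp (z / 2) * (1 / 2))‖ ≤ B * (Real.exp (K / 2) * ε) := by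
    intro z hz
    have h1 : B * Complex.exp ((z + l z) / 2) - 2 * B * (Complex.exp (z / 2) * (1 / 2)) = B * (Complex.exp (z / 2) * (Complex.exp (l z / 2) - 1)) := by
      rw [add_div, Complex.exp_add]; ring
    have h2 := hb z (sub hz)
    have h3 : ‖l z / 2‖ ≤ ε / 2 := by rw [norm_div]; norm_num; linarith
    have h4 := Complex.norm_exp_sub_one_le (x := l z / 2) (by linarith)
    rw [h1, norm_mul, norm_mul, Complex.norm_real, Real.norm_of_nonneg (by linarith), Complex.norm_exp]
    have h5 : (z / 2).re ≤ K / 2 := by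
      have := (Complex.re_le_norm z).trans (mem_ball_zero_iff.1 hz).le
      rw [show (z / 2).re = z.re / 2 by simp]; linarith
    gcongr
    linarith
  have := (convex_ball (0:ℂ) K).norm_image_sub_le_of_norm_hasDerivWithin_le hE hbd (Metric.mem_ball_self hK) hw
  have hz0 : Z 0 - 2 * B * Complex.exp (0 / 2) = 0 := by simp [Z]
  simp only [hz0, sub_zero] at this
  refine this.trans ?_
  have hw' := (mem_ball_zero_iff.1 hw).le
  calc B * (Real.exp (K / 2) * ε) * ‖w‖ ≤ B * (Real.exp (K / 2) * ε) * K := by gcongr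
    _ = B * (Real.exp (K / 2) * ε * K) := by ring
    _ ≤ B * (1 / 1000) := by gcongr
    _ = B / 1000 := by ring

theorem strip_final {S : Set (Option ℂ)} (hS : S.Finite) (M N : ℕ) : ∃ K ε B0 : ℝ, 0 < K ∧ 0 < ε ∧ 1 ≤ B0 ∧
    ∀ (g : ℂ → ℂ) (P : Set ℂ), Pk g P S M →
      (∀ m : ℕ, ∀ a : Fin m → Option ℂ, ∀ γ : Fin m → ℝ → ℂ, (∀ i, AsymptoticPath g P (a i) (γ i)) →
        (∀ i j, i ≠ j → DistinctSingularities g P (a i) (a j) (γ i) (γ j)) → m ≤ N) →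
      ∀ (B : ℝ) (l : ℂ → ℂ), B0 ≤ B → DifferentiableOn ℂ l (Metric.ball 0 K) → (∀ w ∈ Metric.ball (0:ℂ) K, ‖l w‖ ≤ ε) →
      (∀ w ∈ Metric.ball (0:ℂ) K, w ∉ P → deriv g w ≠ 0 → schwarzian g w = 2 * qq B l w) → False := by
  obtain ⟨d, hd0, hd⟩ : ∃ d : ℝ, 0 < d ∧ ∀ b ∈ S, ∀ c ∈ S, b ≠ c → d ≤ chordal b c := by
    obtain ⟨x, hx, hx2⟩ := (((hS.prod hS).subset (fun p hp => ⟨hp.1, hp.2.1⟩ : S.offDiag ⊆ S ×ˢ S)).image (fun p => chordal p.1 p.2) |>.insert 1).exists_le_minimal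
      (mem_insert _ _)
    refine ⟨x, ?_, fun b hb c hc hbc => ?_⟩
    · rcases hx2.prop with h | ⟨p, hp, h⟩
      · rw [h]; norm_num
      · rw [← h]
        exact lt_of_le_of_ne (chordal_nonneg _ _) fun h0 => hp.2.2 (chordal_eq_zero h0.symm)
    · by_contra hlt
      have hm : chordal b c ∈ insert 1 ((fun p : Option ℂ × Option ℂ => chordal p.1 p.2) '' S.offDiag) := Or.inr ⟨(b, c), ⟨hb, hc, hbc⟩, rfl⟩
      exact hlt (hx2.le_of_le hm (not_le.1 hlt).le)
  set n := N + 5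
  set K := cc (n + 1) + 30
  have hK : 0 < K := by
    have : 0 ≤ cc (n + 1) := by unfold cc; positivity
    simp only [K]; linarith
  have htend : Tendsto (fun B : ℝ => 100 * Real.exp (-(B / 10))) atTop (𝓝 (100 * 0)) :=
    (Real.tendsto_exp_neg_atTop_nhds_zero.comp (tendsto_id.atTop_div_const (by norm_num))).const_mul 100
  rw [mul_zero] at htend
  obtain ⟨B0, hB0⟩ := ((htend.eventually (ge_mem_nhds hd0)).and ((eventually_ge_atTop (10 ^ 10)).and (eventually_gt_atTop (40 * Real.pi * M)))).exists_forall_of_atTop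
  have hε : 0 < min (1 / 100) (1 / 1000 / (Real.exp (K / 2) * K)) := by positivity
  refine ⟨K + 1, min (1 / 100) (1 / 1000 / (Real.exp (K / 2) * K)), max 1 B0, by linarith, hε, le_max_left _ _, ?_⟩
  intro g P hp hN B l hB hl hlb hq
  obtain ⟨b1, b2, b3⟩ := hB0 B ((le_max_right _ _).trans hB)
  obtain ⟨Z, hZ⟩ := wk_of hK ((le_max_left _ _).trans hB) (min_le_left _ _) (by
    have h := min_le_right (1 / 100) (1 / 1000 / (Real.exp (K / 2) * K))
    rw [le_div_iff₀ (by positivity)] at h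
    linarith) hl hlb
  have sub : Metric.ball (0:ℂ) K ⊆ Metric.ball 0 (K + 1) := Metric.ball_subset_ball (by linarith)
  obtain ⟨Y1, Y1', Y2, Y2', s1, s2, hW, hrep⟩ := sol_exists hp.mero hp.ncst (q := qq B l) hK (fun z hz => by
    have := (hZ.an z hz).continuousAt
    unfold qq; fun_prop) (fun w hw => hq w (sub hw))
  have cx : Cx g P S M K B l Z Y1 Y1' Y2 Y2' := ⟨hp, hZ, s1, s2, hW, hrep, b2⟩
  have hat : ∀ k, ∃ a : Option ℂ, ∃ c : ℂ, k ≤ n → a ∈ S ∧ c ≠ 0 ∧ Hat B l Z Y1 Y1' Y2 Y2' k (c * v2 a) (-(c * v1 a)) := by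
    intro k
    by_cases hk : k ≤ n
    · obtain ⟨a, ha, c, hc, h⟩ := cx.hat k (by have := cc_mono (show k + 1 ≤ n + 1 by omega); simp only [K]; linarith)
      exact ⟨a, c, fun _ => ⟨ha, hc, h⟩⟩
    · exact ⟨none, 0, fun h => absurd h hk⟩
  choose a G haG using hat
  have st : St g P S M K B l Z Y1 Y1' Y2 Y2' d n a G := ⟨cx, by have := cc_mono (show n ≤ n + 1 by omega); simp only [K]; linarith,
    fun k hk => (haG k hk).1, fun k hk => (haG k hk).2.1, fun k hk => (haG k hk).2.2, hd, b1, by linarith⟩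
  obtain ⟨a', γ, h1, h2⟩ := st.many (m := N + 1) (by omega)
  have := hN (N + 1) a' γ h1 h2
  omega

end

section

def aff (z0 c w : ℂ) : ℂ := z0 + c * w

lemma aff_inv {z0 c : ℂ} (hc : c ≠ 0) (z : ℂ) : aff z0 c (aff (-(z0 / c)) c⁻¹ z) = z := by unfold aff; field_simp; ring

lemma aff_inv' {z0 c : ℂ} (hc : c ≠ 0) (z : ℂ) : aff (-(z0 / c)) c⁻¹ (aff z0 c z) = z := by unfold aff; field_simp; ring

lemma aff_cont (z0 c : ℂ) : Continuous (aff z0 c) := by unfold aff; fun_prop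

lemma aff_an (z0 c z : ℂ) : AnalyticAt ℂ (aff z0 c) z := by unfold aff; fun_prop

lemma aff_sub (z0 c z w : ℂ) : aff z0 c z - aff z0 c w = c * (z - w) := by unfold aff; ring

lemma aff_inj {z0 c : ℂ} (hc : c ≠ 0) : Function.Injective (aff z0 c) := fun x y h => by
  rw [← aff_inv' (z0 := z0) hc x, h, aff_inv' hc]

def affH (z0 : ℂ) {c : ℂ} (hc : c ≠ 0) : ℂ ≃ₜ ℂ where
  toFun := aff z0 c
  invFun := aff (-(z0 / c)) c⁻¹
  left_inv := aff_inv' hc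
  right_inv := aff_inv hc
  continuous_toFun := aff_cont _ _
  continuous_invFun := aff_cont _ _

lemma deriv_aff (f : ℂ → ℂ) (z0 c : ℂ) : deriv (fun w => f (aff z0 c w)) = fun w => c * deriv f (aff z0 c w) := by
  funext w
  have := deriv_comp_mul_left c (fun x => f (z0 + x)) w
  rw [deriv_comp_const_add f z0 (c * w)] at this
  exact this

lemma aff_tend {z0 c : ℂ} (hc : c ≠ 0) (z : ℂ) : Tendsto (aff z0 c) (𝓝[≠] z) (𝓝[≠] (aff z0 c z)) := by
  refine tendsto_nhdsWithin_of_tendsto_nhds_of_eventually_within _ ((aff_cont _ _).continuousAt.tendsto.mono_left nhdsWithin_le_nhds) ?_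
  filter_upwards [self_mem_nhdsWithin] with w hw h
  exact hw (aff_inj hc h)

lemma pole_aff {f : ℂ → ℂ} {z0 c z : ℂ} {m : ℕ} (hc : c ≠ 0) (h : PoleOrder f (aff z0 c z) m) : PoleOrder (fun w => f (aff z0 c w)) z m := by
  obtain ⟨h0, g, h1, h2, h3⟩ := h
  refine ⟨h0, fun w => g (aff z0 c w) / c ^ m, (h1.comp (aff_an _ _ _)).div_const, div_ne_zero h2 (pow_ne_zero _ hc), ?_⟩
  filter_upwards [(aff_tend hc z).eventually h3] with w hw
  rw [hw, aff_sub, mul_pow, div_div]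

lemma zero_aff {f : ℂ → ℂ} {z0 c z : ℂ} {m : ℕ} (hc : c ≠ 0) (h : ZeroOrder f (aff z0 c z) m) : ZeroOrder (fun w => c * f (aff z0 c w)) z m := by
  obtain ⟨h0, g, h1, h2, h3⟩ := h
  refine ⟨h0, fun w => c * (g (aff z0 c w) * c ^ m), analyticAt_const.mul ((h1.comp (aff_an _ _ _)).mul analyticAt_const), mul_ne_zero hc (mul_ne_zero h2 (pow_ne_zero _ hc)), ?_⟩
  filter_upwards [(aff_cont z0 c).continuousAt.eventually h3] with w hw
  rw [hw, aff_sub, mul_pow]; ring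

lemma mult_aff' {f : ℂ → ℂ} {z0 c z : ℂ} {m : ℕ} (hc : c ≠ 0) (h : MultiplePointWithMult f (aff z0 c z) m) :
    MultiplePointWithMult (fun w => f (aff z0 c w)) z m := by
  refine ⟨h.1, h.2.imp (pole_aff hc) fun h2 => ⟨h2.1.comp (aff_an _ _ _), ?_⟩⟩
  rw [deriv_aff]
  exact zero_aff hc h2.2

lemma mult_aff {f : ℂ → ℂ} {z0 c z : ℂ} {m : ℕ} (hc : c ≠ 0) (h : MultiplePointWithMult (fun w => f (aff z0 c w)) z m) :
    MultiplePointWithMult f (aff z0 c z) m := by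
  have := mult_aff' (f := fun w => f (aff z0 c w)) (z := aff z0 c z) (z0 := -(z0 / c)) (c := c⁻¹) (m := m) (inv_ne_zero hc) (by rwa [aff_inv' hc])
  simpa only [aff_inv hc] using this

lemma schw_aff (f : ℂ → ℂ) {z0 c : ℂ} (hc : c ≠ 0) (z : ℂ) : schwarzian (fun w => f (aff z0 c w)) z = c ^ 2 * schwarzian f (aff z0 c z) := by
  unfold schwarzian
  have e : ∀ g : ℂ → ℂ, deriv (fun w => c * g w) = fun w => c * deriv g w := fun g => by funext w; exact deriv_const_mul_field c
  simp only [deriv_aff, e]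
  rw [mul_div_mul_left _ _ hc, mul_div_mul_left _ _ hc]; ring

lemma mero_aff {f : ℂ → ℂ} {P : Set ℂ} (h : MeroPlane f P) {z0 c : ℂ} (hc : c ≠ 0) :
    MeroPlane (fun w => f (aff z0 c w)) (aff z0 c ⁻¹' P) := by
  refine ⟨fun K hK => ?_, fun z hz => (h.2.1 _ hz).comp (aff_an _ _ _), fun p hp => ?_⟩
  · refine ((h.1 _ (hK.image (aff_cont z0 c))).preimage (aff_inj hc).injOn).subset fun z hz => ⟨hz.1, z, hz.2, rfl⟩
  · refine (h.2.2 _ hp).comp (tendsto_nhdsWithin_of_tendsto_nhds_of_eventually_within _ ((aff_cont _ _).continuousAt.tendsto.mono_left nhdsWithin_le_nhds) ?_)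
    filter_upwards [self_mem_nhdsWithin] with w hw using hw

lemma val_aff (f : ℂ → ℂ) (P : Set ℂ) (z0 c w : ℂ) : valueAt (fun w => f (aff z0 c w)) (aff z0 c ⁻¹' P) w = valueAt f P (aff z0 c w) := rfl

lemma path_aff {f : ℂ → ℂ} {P : Set ℂ} {a : Option ℂ} {γ : ℝ → ℂ} {z0 c : ℂ} (hc : c ≠ 0)
    (h : AsymptoticPath (fun w => f (aff z0 c w)) (aff z0 c ⁻¹' P) a γ) : AsymptoticPath f P a (fun t => aff z0 c (γ t)) := by
  refine ⟨(aff_cont z0 c).comp_continuousOn h.1, ?_, h.2.2⟩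
  have h1 : Tendsto (fun t => ‖c‖ * ‖γ t‖ + -‖z0‖) atTop atTop :=
    tendsto_atTop_add_const_right _ _ (h.2.1.const_mul_atTop (norm_pos_iff.2 hc))
  refine tendsto_atTop_mono (fun t => ?_) h1
  have := norm_sub_le (z0 + c * γ t) z0
  rw [add_sub_cancel_left, norm_mul] at this
  unfold aff; linarith

lemma dist_aff {f : ℂ → ℂ} {P : Set ℂ} {a b : Option ℂ} {γ γ' : ℝ → ℂ} {z0 c : ℂ} (hc : c ≠ 0)
    (h : DistinctSingularities (fun w => f (aff z0 c w)) (aff z0 c ⁻¹' P) a b γ γ') :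
    DistinctSingularities f P a b (fun t => aff z0 c (γ t)) (fun t => aff z0 c (γ' t)) := by
  refine h.imp id ?_
  rintro ⟨t, ht, C1, C2, h1, h2, h3, h4, h5⟩
  have comp : ∀ (a : Option ℂ) (C : Set ℂ), IsComponentOf C {z | chordal (valueAt (fun w => f (aff z0 c w)) (aff z0 c ⁻¹' P) z) a < t} →
      IsComponentOf (aff z0 c '' C) {z | chordal (valueAt f P z) a < t} := by
    rintro a C ⟨x, hx, rfl⟩
    refine ⟨aff z0 c x, hx, ?_⟩
    have := (affH z0 hc).image_connectedComponentIn hx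
    refine this.trans ?_
    congr 1
    ext z
    constructor
    · rintro ⟨w, hw, rfl⟩; exact hw
    · intro hz
      refine ⟨aff (-(z0 / c)) c⁻¹ z, ?_, aff_inv hc z⟩
      change chordal (valueAt f P (aff z0 c (aff (-(z0 / c)) c⁻¹ z))) a < t
      rw [aff_inv hc]; exact hz
  have bd : ∀ (γ : ℝ → ℂ) (C : Set ℂ), IsBounded (γ '' Ici 0 \ C) → IsBounded ((fun t => aff z0 c (γ t)) '' Ici 0 \ aff z0 c '' C) := by
    intro γ C hb
    obtain ⟨R, hR⟩ := isBounded_iff_forall_norm_le.1 hb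
    refine isBounded_iff_forall_norm_le.2 ⟨‖z0‖ + ‖c‖ * R, ?_⟩
    rintro _ ⟨⟨s, hs, rfl⟩, h2⟩
    have := hR (γ s) ⟨⟨s, hs, rfl⟩, fun h => h2 ⟨_, h, rfl⟩⟩
    refine (norm_add_le _ _).trans ?_
    rw [norm_mul]; gcongr
  exact ⟨t, ht, _, _, comp _ _ h1, comp _ _ h2, (disjoint_image_iff (aff_inj hc)).2 h3, bd _ _ h4, bd _ _ h5⟩

lemma compl_conn {f : ℂ → ℂ} {P : Set ℂ} (h : MeroPlane f P) : IsPreconnected Pᶜ := by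
  have hc : P.Countable := by
    have : P = ⋃ n : ℕ, P ∩ Metric.closedBall 0 n := by
      ext z
      simp only [mem_iUnion, mem_inter_iff, Metric.mem_closedBall, dist_zero_right]
      exact ⟨fun hz => (exists_nat_ge ‖z‖).imp fun n hn => ⟨hz, hn⟩, fun ⟨n, hn⟩ => hn.1⟩
    rw [this]
    exact countable_iUnion fun n => (h.1 _ (isCompact_closedBall _ _)).countable
  exact (hc.isPathConnected_compl_of_one_lt_rank (by rw [Complex.rank_real_complex]; norm_num)).isConnected.isPreconnected

lemma transc_ncst {f : ℂ → ℂ} {P : Set ℂ} (h : TranscMeroPlane f P) (z : ℂ) : ¬ ∀ᶠ w in 𝓝[≠] z, deriv f w = 0 := by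
  intro hz
  apply h.2
  have hop : IsOpen Pᶜ := h.1.isClosed.isOpen_compl
  obtain ⟨w, hw3, hw2⟩ : ∃ w, (∀ᶠ x in 𝓝 w, deriv f x = 0) ∧ w ∉ P := by
    obtain ⟨w, ⟨h1, h2⟩, h3⟩ := (((eventually_eventually_nhdsWithin.2 hz).and (h.1.isolated z)).and self_mem_nhdsWithin).exists
    rw [isOpen_compl_singleton.nhdsWithin_eq h3] at h1
    exact ⟨w, h1, h2⟩
  have hd : EqOn (deriv f) 0 Pᶜ := AnalyticOnNhd.eqOn_zero_of_preconnected_of_eventuallyEq_zero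
    (fun x hx => (h.1.2.1 x hx).deriv) (compl_conn h.1) hw2 hw3
  refine ⟨Polynomial.C (f w), 1, one_ne_zero, fun x hx _ => ?_⟩
  simp only [Polynomial.eval_C, Polynomial.eval_one, div_one]
  exact hop.is_const_of_deriv_eq_zero (compl_conn h.1) (fun x hx => (h.1.2.1 x hx).differentiableAt.differentiableWithinAt) hd hx hw2

theorem no_WV {M : ℕ} (hM : 0 < M) {f A : ℂ → ℂ} {Pf : Set ℂ} (hf : TranscMeroPlane f Pf)
    (hSf : ∀ z, z ∉ Pf → deriv f z ≠ 0 → schwarzian f z = 2 * A z) (hcrit : (CriticalValues f Pf).Finite)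
    (hmult : ∀ z μ, MultiplePointWithMult f z μ → μ ≤ M) (hsing : FinitelyManyTranscSing f Pf) :
    ∃ K ε B0 : ℝ, 0 < K ∧ 0 < ε ∧ 1 ≤ B0 ∧ ∀ (z0 c : ℂ) (B : ℝ) (l : ℂ → ℂ), c ≠ 0 → B0 ≤ B → DifferentiableOn ℂ l (Metric.ball 0 K) →
      (∀ w ∈ Metric.ball (0:ℂ) K, ‖l w‖ ≤ ε ∧ c ^ 2 * A (z0 + c * w) = (B:ℂ) ^ 2 * Complex.exp (w + l w)) → False := by
  obtain ⟨N, hN⟩ := hsing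
  have hfin : {a | ∃ γ, AsymptoticPath f Pf a γ}.Finite := by
    by_contra hinf
    obtain ⟨t, ht, hc⟩ := Set.Infinite.exists_subset_card_eq hinf (N + 1)
    have hγ : ∀ i : Fin (N + 1), ∃ γ, AsymptoticPath f Pf ((t.equivFinOfCardEq hc).symm i : Option ℂ) γ := fun i => ht (Subtype.prop _)
    choose γ hγ using hγ
    have := hN (N + 1) _ γ hγ fun i j hij => Or.inl fun h => hij ((t.equivFinOfCardEq hc).symm.injective (Subtype.ext h))
    omega
  obtain ⟨K, ε, B0, hK, he, hB0, H⟩ := strip_final ((hcrit.union hfin).union (finite_singleton none)) M N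
  refine ⟨K, ε, B0, hK, he, hB0, fun z0 c B l hc hB hl h => ?_⟩
  refine H (fun w => f (aff z0 c w)) (aff z0 c ⁻¹' Pf) ⟨mero_aff hf.1 hc, (hcrit.union hfin).union (finite_singleton none), Or.inr rfl, ?_,
    fun a γ ha => Or.inl (Or.inr ⟨_, path_aff hc ha⟩), fun z μ hz => hmult _ _ (mult_aff hc hz), hM, fun z hz => ?_⟩ ?_ B l hB hl (fun w hw => (h w hw).1) ?_
  · rintro _ ⟨z, ⟨μ, hμ⟩, rfl⟩
    exact Or.inl (Or.inl ⟨_, ⟨μ, mult_aff hc hμ⟩, rfl⟩)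
  · refine transc_ncst hf (aff z0 c z) ?_
    have h1 := aff_tend (z0 := -(z0 / c)) (inv_ne_zero hc) (aff z0 c z)
    rw [aff_inv' hc] at h1
    filter_upwards [h1.eventually hz] with w hw
    rw [deriv_aff] at hw
    simp only [aff_inv hc] at hw
    exact (mul_eq_zero.1 hw).resolve_left hc
  · intro m a γ h1 h2
    exact hN m a _ (fun i => path_aff hc (h1 i)) fun i j hij => dist_aff hc (h2 i j hij)
  · intro w hw h1 h2
    rw [deriv_aff] at h2
    rw [schw_aff f hc, hSf _ h1 (right_ne_zero_of_mul h2), qq, ← (h w hw).2]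
    unfold aff; ring

end

section

lemma max_pt {F : ℂ → ℂ} {r b len E : ℝ} {m j : ℕ} (hr : 0 < r) (hb1 : 3 / 2 * r ≤ b) (hb2 : b ≤ 2 * r) (hl0 : 0 < len) (hl : len ≤ r / 4)
    (hF : ContinuousOn F (Metric.closedBall 0 (2 * r))) (hm : 0 < m) (hj : 32 * r ≤ j * len)
    (grow : ∀ ρ1 ρ2 z, r ≤ ρ1 → ρ1 ≤ ρ2 → ρ2 ≤ 2 * r → ‖z‖ = ρ1 → ∃ z', ‖z'‖ = ρ2 ∧ ‖F z‖ * (ρ2 / ρ1) ^ (m * j) ≤ ‖F z'‖)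
    (hz : ∃ z, ‖z‖ = r ∧ E ≤ ‖F z‖) (hE : 0 < E) :
    ∃ z0 : ℂ, 0 < b - ‖z0‖ ∧ b - ‖z0‖ ≤ len / 2 ∧ E * (len / 4) ^ m ≤ ‖F z0‖ * (b - ‖z0‖) ^ m ∧ 0 < ‖F z0‖ ∧
      ∀ z, b - len ≤ ‖z‖ → ‖z‖ ≤ b → ‖F z‖ * (b - ‖z‖) ^ m ≤ ‖F z0‖ * (b - ‖z0‖) ^ m := by
  set X := Metric.closedBall (0:ℂ) b ∩ {z : ℂ | b - len ≤ ‖z‖}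
  have hX : IsCompact X := (isCompact_closedBall _ _).inter_right (isClosed_le continuous_const continuous_norm)
  have hcont : ContinuousOn (fun z => ‖F z‖ * (b - ‖z‖) ^ m) X := by
    have : ContinuousOn F X := hF.mono fun z hz => Metric.closedBall_subset_closedBall hb2 hz.1
    fun_prop
  obtain ⟨zs, hzs, hEs⟩ := hz
  obtain ⟨z1, hz1, hz1'⟩ := grow r (b - len / 4) zs le_rfl (by linarith) (by linarith) hzs
  have hE1 : E ≤ ‖F z1‖ := by
    refine le_trans ?_ hz1'
    have : 1 ≤ ((b - len / 4) / r) ^ (m * j) := one_le_pow₀ (by rw [le_div_iff₀ hr]; linarith)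
    calc E ≤ ‖F zs‖ := hEs
      _ ≤ _ := le_mul_of_one_le_right (norm_nonneg _) this
  have mem : ∀ z : ℂ, b - len ≤ ‖z‖ → ‖z‖ ≤ b → z ∈ X := fun z h1 h2 => ⟨by simpa using h2, h1⟩
  have hX1 : z1 ∈ X := mem _ (by linarith) (by linarith)
  obtain ⟨z0, hz0, hmax⟩ := hX.exists_isMaxOn ⟨z1, hX1⟩ hcont
  have hmax' : ∀ z, b - len ≤ ‖z‖ → ‖z‖ ≤ b → ‖F z‖ * (b - ‖z‖) ^ m ≤ ‖F z0‖ * (b - ‖z0‖) ^ m := fun z h1 h2 => hmax (mem z h1 h2)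
  have hφ : E * (len / 4) ^ m ≤ ‖F z0‖ * (b - ‖z0‖) ^ m := by
    have := hmax' z1 (by linarith) (by linarith)
    rw [hz1, show b - (b - len / 4) = len / 4 by ring] at this
    exact le_trans (by gcongr) this
  have hpos : 0 < ‖F z0‖ * (b - ‖z0‖) ^ m := lt_of_lt_of_le (by positivity) hφ
  have h0b : ‖z0‖ ≤ b := by simpa using hz0.1
  have hF0 : 0 < ‖F z0‖ := by
    rcases (norm_nonneg (F z0)).eq_or_lt with h | h
    · rw [← h] at hpos; simp at hpos
    · exact h
  have hd : 0 < b - ‖z0‖ := by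
    rcases (sub_nonneg.2 h0b).eq_or_lt with h | h
    · rw [← h, zero_pow hm.ne'] at hpos; simp at hpos
    · exact h
  have h0a : b - len ≤ ‖z0‖ := hz0.2
  refine ⟨z0, hd, ?_, hφ, hF0, hmax'⟩
  by_contra hlt
  push Not at hlt
  obtain ⟨z', hz', hg⟩ := grow ‖z0‖ (b - len / 4) z0 (by linarith) (by linarith) (by linarith) rfl
  have h1 := hmax' z' (by linarith) (by linarith)
  rw [hz', show b - (b - len / 4) = len / 4 by ring] at h1
  have hz0p : 0 < ‖z0‖ := by linarith
  have h2 : 1 + len / (8 * r) ≤ (b - len / 4) / ‖z0‖ := by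
    rw [le_div_iff₀ hz0p]
    have : len / (8 * r) * ‖z0‖ ≤ len / (8 * r) * (2 * r) := by gcongr; linarith
    have e : len / (8 * r) * (2 * r) = len / 4 := by field_simp; ring
    linarith
  have h3 : (5:ℝ) ≤ ((b - len / 4) / ‖z0‖) ^ j := by
    have hb := one_add_mul_le_pow (a := len / (8 * r)) (le_trans (by norm_num) (by positivity : (0:ℝ) ≤ len / (8 * r))) j
    have : (1 + len / (8 * r)) ^ j ≤ ((b - len / 4) / ‖z0‖) ^ j := by gcongr
    have e : (4:ℝ) ≤ j * (len / (8 * r)) := by rw [← mul_div_assoc, le_div_iff₀ (by positivity)]; linarith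
    linarith
  rw [mul_comm m j, pow_mul] at hg
  have h4 : ‖F z0‖ * (5 ^ m * (len / 4) ^ m) ≤ ‖F z0‖ * len ^ m := by
    calc ‖F z0‖ * (5 ^ m * (len / 4) ^ m) = ‖F z0‖ * 5 ^ m * (len / 4) ^ m := by ring
      _ ≤ ‖F z0‖ * (((b - len / 4) / ‖z0‖) ^ j) ^ m * (len / 4) ^ m := by gcongr
      _ ≤ ‖F z'‖ * (len / 4) ^ m := by gcongr
      _ ≤ ‖F z0‖ * (b - ‖z0‖) ^ m := h1
      _ ≤ ‖F z0‖ * len ^ m := by gcongr; linarith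
  have h5 := le_of_mul_le_mul_left h4 hF0
  rw [← mul_pow] at h5
  exact absurd h5 (not_le.2 (pow_lt_pow_left₀ (by linarith) hl0.le hm.ne'))

lemma exp_aux {y : ℝ} (hy : |y| ≤ 1 / 4) : Real.exp (-(y + y ^ 2)) ≤ 1 - y := by
  obtain ⟨hy1, hy2⟩ := abs_le.1 hy
  rw [Real.exp_neg]
  refine inv_le_of_inv_le₀ (by linarith) ?_
  rw [inv_le_iff_one_le_mul₀ (by linarith)]
  by_cases h0 : 0 ≤ y
  · refine le_trans ?_ (mul_le_mul_of_nonneg_right (Real.quadratic_le_exp_of_nonneg (x := y + y ^ 2) (by positivity)) (by linarith))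
    have e : (1 + (y + y ^ 2) + (y + y ^ 2) ^ 2 / 2) * (1 - y) = 1 + y ^ 2 / 2 * (1 - y - y ^ 2 - y ^ 3) := by ring
    have h2 : y ^ 2 ≤ (1 / 4) ^ 2 := by gcongr
    have h3 : y ^ 3 ≤ (1 / 4) ^ 3 := by gcongr
    rw [e]
    have : 0 ≤ y ^ 2 / 2 * (1 - y - y ^ 2 - y ^ 3) := mul_nonneg (by positivity) (by linarith)
    linarith
  · push Not at h0
    refine le_trans ?_ (mul_le_mul_of_nonneg_right (Real.add_one_le_exp (y + y ^ 2)) (by linarith))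
    have e : (y + y ^ 2 + 1) * (1 - y) = 1 - y * y ^ 2 := by ring
    have h3 : y * y ^ 2 ≤ 0 := mul_nonpos_of_nonpos_of_nonneg h0.le (sq_nonneg y)
    linarith

/-- local upper bound near a maximum point -/
lemma loc_bd {F : ℂ → ℂ} {b len K : ℝ} {m : ℕ} {z0 w : ℂ} (hd : 0 < b - ‖z0‖) (hd2 : b - ‖z0‖ ≤ len / 2) (hlen : len ≤ ‖z0‖)
    (hK : 1 ≤ K) (hm : 8 * K ≤ m) (hw : ‖w‖ ≤ K)
    (H : ∀ z, b - len ≤ ‖z‖ → ‖z‖ ≤ b → ‖F z‖ * (b - ‖z‖) ^ m ≤ ‖F z0‖ * (b - ‖z0‖) ^ m) :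
    ‖F (z0 + z0 / ‖z0‖ * ((b - ‖z0‖) / m : ℝ) * w)‖ ≤ ‖F z0‖ * Real.exp (w.re + 5 * K ^ 2 / m) := by
  set δ := b - ‖z0‖ with hδ
  have m0 : (0:ℝ) < m := by linarith
  have hz0 : 0 < ‖z0‖ := by linarith
  set z := z0 + z0 / ‖z0‖ * (δ / m : ℝ) * w with hz
  set s : ℂ := (δ / m : ℝ) * w with hs
  have hsn : ‖s‖ ≤ δ * (K / m) := by
    rw [hs, norm_mul, Complex.norm_real, Real.norm_of_nonneg (by positivity), div_mul_eq_mul_div, mul_div_assoc]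
    gcongr
  have hsre : s.re = δ * (w.re / m) := by rw [hs, Complex.re_ofReal_mul]; ring
  have hKm : K / m ≤ 1 / 8 := by rw [div_le_div_iff₀ m0 (by norm_num)]; linarith
  have hzn : ‖z‖ = ‖(‖z0‖ : ℂ) + s‖ := by
    have h0 : (‖z0‖ : ℂ) ≠ 0 := by exact_mod_cast hz0.ne'
    have : z = z0 / ‖z0‖ * (‖z0‖ + s) := by rw [hz, hs]; field_simp
    rw [this, norm_mul, norm_div, Complex.norm_real, norm_norm, div_self hz0.ne', one_mul]
  have hs8 : ‖s‖ ≤ δ * (1 / 8) := hsn.trans (by gcongr)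
  have hup : ‖z‖ ≤ ‖z0‖ + s.re + ‖s‖ ^ 2 / (2 * ‖z0‖) := by
    have hre := (abs_le.1 (Complex.abs_re_le_norm s)).1
    have hq : 0 ≤ ‖s‖ ^ 2 / (2 * ‖z0‖) := by positivity
    rw [hzn]
    refine abs_le_of_sq_le_sq' ?_ (by linarith) |>.2
    rw [← Complex.normSq_eq_norm_sq, Complex.normSq_apply]
    have e1 : ‖s‖ ^ 2 = s.re * s.re + s.im * s.im := by rw [← Complex.normSq_eq_norm_sq, Complex.normSq_apply]
    have e2 : ‖s‖ ^ 2 / (2 * ‖z0‖) * (2 * ‖z0‖) = ‖s‖ ^ 2 := by field_simp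
    simp only [Complex.add_re, Complex.ofReal_re, Complex.add_im, Complex.ofReal_im]
    generalize ‖s‖ ^ 2 / (2 * ‖z0‖) = y at *
    rw [e1] at e2
    linarith [sq_nonneg (s.re + y)]
  have hlow : ‖z0‖ - ‖s‖ ≤ ‖z‖ := by
    have := norm_sub_le ((‖z0‖ : ℂ) + s) s
    rw [add_sub_cancel_right, Complex.norm_real, norm_norm, ← hzn] at this
    linarith
  have hq : ‖s‖ ^ 2 / (2 * ‖z0‖) ≤ δ * (K / m) ^ 2 := by
    rw [div_le_iff₀ (by positivity)]
    calc ‖s‖ ^ 2 ≤ (δ * (K / m)) ^ 2 := by gcongr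
      _ = δ * (K / m) ^ 2 * δ := by ring
      _ ≤ _ := by gcongr; linarith
  set y := w.re / m + (K / m) ^ 2 with hy
  have hb : δ * (1 - y) ≤ b - ‖z‖ := by
    have : ‖z‖ ≤ ‖z0‖ + δ * y := by rw [hy, mul_add, ← hsre]; linarith
    have e : b = ‖z0‖ + δ := by rw [hδ]; ring
    rw [e]; linarith
  have hwre : |w.re / m| ≤ K / m := by
    rw [abs_div, abs_of_pos m0]; gcongr; exact (Complex.abs_re_le_norm w).trans hw
  have hKm0 : 0 ≤ K / m := by positivity
  have hy2 : |y| ≤ 2 * (K / m) := by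
    rw [hy]
    refine (abs_add_le _ _).trans ?_
    rw [abs_of_nonneg (sq_nonneg (K / (m:ℝ)))]
    have : (K / m) ^ 2 ≤ K / m := by rw [sq]; exact mul_le_of_le_one_left hKm0 (by linarith)
    linarith
  have hy4 : |y| ≤ 1 / 4 := by linarith
  have hy5 := abs_le.1 hy4
  have hzb : ‖z‖ ≤ b := by
    have : 0 ≤ δ * (1 - y) := mul_nonneg hd.le (by linarith)
    linarith
  have h1 := H z (by linarith) hzb
  have hpos : 0 < δ * (1 - y) := mul_pos hd (by linarith)
  have h2 : ‖F z‖ * (1 - y) ^ m ≤ ‖F z0‖ := by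
    have : ‖F z‖ * (δ * (1 - y)) ^ m ≤ ‖F z0‖ * δ ^ m := le_trans (by gcongr) h1
    rw [mul_pow, mul_comm (δ ^ m), ← mul_assoc] at this
    exact le_of_mul_le_mul_right this (by positivity)
  have h3 := exp_aux hy4
  have h4 : Real.exp (-(w.re + 5 * K ^ 2 / m)) ≤ (1 - y) ^ m := by
    refine le_trans ?_ (pow_le_pow_left₀ (Real.exp_pos _).le h3 m)
    rw [← Real.exp_nat_mul, Real.exp_le_exp]
    have : y ^ 2 ≤ 4 * (K / m) ^ 2 := by
      have := pow_le_pow_left₀ (abs_nonneg y) hy2 2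
      rw [sq_abs] at this; linarith
    have e : m * -(y + y ^ 2) = -(w.re + K ^ 2 / m) - m * y ^ 2 := by rw [hy]; field_simp; ring
    have e2 : m * (4 * (K / m) ^ 2) = 4 * K ^ 2 / m := by field_simp
    have e3 := mul_le_mul_of_nonneg_left this m0.le
    rw [e]
    have e4 : 5 * K ^ 2 / m = K ^ 2 / m + 4 * K ^ 2 / m := by ring
    linarith
  have h5 : ‖F z‖ * Real.exp (-(w.re + 5 * K ^ 2 / m)) ≤ ‖F z0‖ := le_trans (by gcongr) h2
  rwa [Real.exp_neg, ← div_eq_mul_inv, div_le_iff₀ (Real.exp_pos _)] at h5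

end

section

lemma wv_local {ι : Type*} {I : Finset ι} {p : ι → ℂ} {F A : ℂ → ℂ} {R s K η : ℝ} {z0 c : ℂ} (hK : 0 < K) (h0 : 0 < η) (hη : η ≤ 1 / 10)
    (hF : DifferentiableOn ℂ F (Metric.ball 0 R)) (hs : s ≠ 0) (hin : ∀ w ∈ Metric.ball (0:ℂ) (2 * K), z0 + c * w ∈ Metric.ball (0:ℂ) R) (hF0 : F z0 ≠ 0)
    (hA : ∀ z ∈ Metric.ball (0:ℂ) R, (∀ i ∈ I, z ≠ p i) → A z * ∏ i ∈ I, ((z - p i) / s) = F z)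
    (hu : ∀ w ∈ Metric.ball (0:ℂ) (2 * K), ‖F (z0 + c * w)‖ ≤ ‖F z0‖ * (Real.exp w.re * (1 + η)))
    (hzp : ∀ i ∈ I, z0 ≠ p i) (hsum : Real.exp (∑ i ∈ I, ‖c‖ * K / ‖z0 - p i‖) - 1 ≤ η) :
    ∃ l : ℂ → ℂ, DifferentiableOn ℂ l (Metric.ball 0 K) ∧ ∀ w ∈ Metric.ball (0:ℂ) K, ‖l w‖ ≤ 6 * η ∧ A (z0 + c * w) = A z0 * Complex.exp (w + l w) := by
  set u : ℂ → ℂ := fun w => F (z0 + c * w) / F z0 * Complex.exp (-w)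
  set Q : ℂ → ℂ := fun w => ∏ i ∈ I, (1 + c * w / (z0 - p i))
  have sub : Metric.ball (0:ℂ) K ⊆ Metric.ball 0 (2 * K) := Metric.ball_subset_ball (by linarith)
  have du : DifferentiableOn ℂ u (Metric.ball 0 (2 * K)) := by
    have : DifferentiableOn ℂ (fun w => F (z0 + c * w)) (Metric.ball 0 (2 * K)) :=
      hF.comp (f := fun w => z0 + c * w) (by fun_prop) hin
    exact (this.div_const _).mul (by fun_prop)
  have dQ : Differentiable ℂ Q := by fun_prop
  have un : ∀ w ∈ Metric.ball (0:ℂ) (2 * K), ‖u w‖ ≤ 1 + η := by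
    intro w hw
    have := hu w hw
    have hp := norm_pos_iff.2 hF0
    simp only [u]
    rw [norm_mul, norm_div, Complex.norm_exp, Complex.neg_re, Real.exp_neg, ← div_eq_mul_inv, div_div, div_le_iff₀ (by positivity)]
    linarith
  have u1 : ∀ w ∈ Metric.ball (0:ℂ) K, ‖u w - 1‖ ≤ 2 * η := by
    intro w hw
    have hw' := mem_ball_zero_iff.1 hw
    have := Complex.borelCaratheodory_zero (f := fun w => u w - 1) (M := η) (R := 2 * K) (z := w) h0 (du.sub_const 1)
      (fun z hz => by
        have := (Complex.re_le_norm _).trans (un z hz)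
        simp only [mem_ofPred_eq, Complex.sub_re, Complex.one_re]; linarith) (by linarith) (sub hw) (by simp [u, hF0])
    refine this.trans ?_
    rw [div_le_iff₀ (by linarith)]
    nlinarith
  have Q1 : ∀ w ∈ Metric.ball (0:ℂ) K, ‖Q w - 1‖ ≤ η := by
    intro w hw
    refine (Finset.norm_prod_one_add_sub_one_le _ _).trans (le_trans ?_ hsum)
    gcongr with i hi
    rw [norm_div, norm_mul]
    gcongr
    exact (mem_ball_zero_iff.1 hw).le
  have Qn : ∀ w ∈ Metric.ball (0:ℂ) K, 1 - η ≤ ‖Q w‖ := by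
    intro w hw
    have := norm_sub_le (Q w) (Q w - 1)
    rw [sub_sub_cancel, norm_one] at this
    linarith [Q1 w hw]
  have Q0 : ∀ w ∈ Metric.ball (0:ℂ) K, Q w ≠ 0 := fun w hw => norm_pos_iff.1 (by linarith [Qn w hw])
  have uQ : ∀ w ∈ Metric.ball (0:ℂ) K, ‖u w / Q w - 1‖ ≤ 4 * η := by
    intro w hw
    have e : u w / Q w - 1 = ((u w - 1) - (Q w - 1)) / Q w := by have := Q0 w hw; field_simp; ring
    rw [e, norm_div, div_le_iff₀ (by linarith [Qn w hw])]
    have := norm_sub_le (u w - 1) (Q w - 1)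
    have h1 := u1 w hw
    have h2 := Q1 w hw
    have h3 : 4 * η * (1 - η) ≤ 4 * η * ‖Q w‖ := by gcongr; exact Qn w hw
    nlinarith
  have sl : ∀ w ∈ Metric.ball (0:ℂ) K, u w / Q w ∈ Complex.slitPlane := by
    intro w hw
    left
    have := (abs_le.1 ((Complex.abs_re_le_norm (u w / Q w - 1)).trans (uQ w hw))).1
    rw [Complex.sub_re, Complex.one_re] at this
    linarith
  refine ⟨fun w => Complex.log (u w / Q w), ((du.mono sub).div dQ.differentiableOn Q0).clog sl, fun w hw => ⟨?_, ?_⟩⟩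
  · have h1 := Complex.norm_log_one_add_half_le_self (z := u w / Q w - 1) ((uQ w hw).trans (by linarith))
    rw [add_sub_cancel] at h1
    linarith [uQ w hw]
  · have hz := hin w (sub hw)
    have hne : ∀ i ∈ I, z0 + c * w ≠ p i := by
      intro i hi h
      apply Q0 w hw
      refine Finset.prod_eq_zero hi ?_
      have := sub_ne_zero.2 (hzp i hi)
      rw [← h] at this ⊢
      have e : c * w / (z0 - (z0 + c * w)) = -1 := by
        rw [div_eq_iff this]; ring
      rw [e]; ring
    have a1 := hA _ hz hne
    have a0 := hA z0 (by simpa using hin 0 (by simpa using hK)) hzp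
    have hprod : ∏ i ∈ I, ((z0 + c * w - p i) / s) = (∏ i ∈ I, ((z0 - p i) / s)) * Q w := by
      rw [← Finset.prod_mul_distrib]
      refine Finset.prod_congr rfl fun i hi => ?_
      have := sub_ne_zero.2 (hzp i hi)
      have hs' : (s:ℂ) ≠ 0 := by exact_mod_cast hs
      field_simp; ring
    have hA0 : A z0 ≠ 0 := fun h => hF0 (by rw [← a0, h, zero_mul])
    have hq0 : ∏ i ∈ I, ((z0 - p i) / (s:ℂ)) ≠ 0 := fun h => hF0 (by rw [← a0, h, mul_zero])
    rw [hprod] at a1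
    have hu0 : u w / Q w ≠ 0 := Complex.slitPlane_ne_zero (sl w hw)
    rw [Complex.exp_add, Complex.exp_log hu0]
    simp only [u]
    rw [← a1, ← a0, Complex.exp_neg]
    have := Q0 w hw
    have := Complex.exp_ne_zero w
    field_simp

lemma wv_core {ι : Type*} {I : Finset ι} {p : ι → ℂ} {F A : ℂ → ℂ} {r D x E K ε η B0 : ℝ} {m j : ℕ} (hr : 0 < r) (hD : 1 ≤ D) (hx1 : 3 / 2 ≤ x) (hx2 : x ≤ 2)
    (hF : DifferentiableOn ℂ F (Metric.ball 0 (4 * r))) (hj : 128 * D ≤ j)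
    (grow : ∀ ρ1 ρ2 z, r ≤ ρ1 → ρ1 ≤ ρ2 → ρ2 ≤ 2 * r → ‖z‖ = ρ1 → ∃ z', ‖z'‖ = ρ2 ∧ ‖F z‖ * (ρ2 / ρ1) ^ (m * j) ≤ ‖F z'‖)
    (hz : ∃ z, ‖z‖ = r ∧ E ≤ ‖F z‖) (hE : 0 < E)
    (hA : ∀ z ∈ Metric.ball (0:ℂ) (4 * r), (∀ i ∈ I, z ≠ p i) → A z * ∏ i ∈ I, ((z - p i) / (8 * r : ℝ)) = F z)
    (hp : ∀ i ∈ I, ‖p i‖ ≤ 4 * r) (hd1 : ∀ i ∈ I, 1 / D ≤ |x - ‖p i‖ / r|) (hd2 : ∑ i ∈ I, 1 / |x - ‖p i‖ / r| ≤ D)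
    (hK : 1 ≤ K) (hη0 : 0 < η) (hη : η ≤ 1 / 10) (hηε : 6 * η ≤ ε) (hm1 : 16 * (K + 4) ≤ m) (hm2 : Real.exp (5 * (2 * (K + 4)) ^ 2 / m) ≤ 1 + η)
    (hm3 : Real.exp ((K + 4) / m) - 1 ≤ η) (hB0 : 0 ≤ B0) (hsz : 4 ^ m * m ^ 2 * B0 ^ 2 ≤ E * (r / (4 * D)) ^ 2) :
    ∃ (z1 c : ℂ) (B : ℝ) (l : ℂ → ℂ), c ≠ 0 ∧ B0 ≤ B ∧ DifferentiableOn ℂ l (Metric.ball 0 K) ∧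
      ∀ w ∈ Metric.ball (0:ℂ) K, ‖l w‖ ≤ ε ∧ c ^ 2 * A (z1 + c * w) = (B:ℂ) ^ 2 * Complex.exp (w + l w) := by
  set len := r / (4 * D) with hlen
  have D0 : 0 < D := by linarith
  have hl0 : 0 < len := by positivity
  have hlD : len * D = r / 4 := by rw [hlen]; field_simp
  have hl : len ≤ r / 4 := by rw [← hlD]; exact le_mul_of_one_le_right hl0.le hD
  have mr : (0:ℝ) < m := by linarith
  have hmpos : 0 < m := by exact_mod_cast mr
  obtain ⟨z0, hδ0, hδ, hEz, hF0, hmax⟩ := max_pt (F := F) (b := r * x) (len := len) (E := E) (m := m) (j := j) hr (by nlinarith) (by nlinarith) hl0 hl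
    (hF.continuousOn.mono (Metric.closedBall_subset_ball (by linarith))) hmpos (by
      have : 128 * D * len ≤ j * len := by gcongr
      nlinarith) grow hz hE
  set δ := r * x - ‖z0‖ with hδd
  have hz0r : r ≤ ‖z0‖ := by nlinarith
  have hz0p : 0 < ‖z0‖ := by linarith
  have hz02 : ‖z0‖ ≤ 2 * r := by nlinarith
  set c : ℂ := z0 / ‖z0‖ * (δ / m : ℝ) with hc
  have hcn : ‖c‖ = δ / m := by
    rw [hc, norm_mul, norm_div, Complex.norm_real, norm_norm, div_self hz0p.ne', one_mul, Complex.norm_real, Real.norm_of_nonneg (by positivity)]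
  have hc0 : c ≠ 0 := norm_pos_iff.1 (by rw [hcn]; positivity)
  have hmK : 2 * (K + 4) / m ≤ 1 / 8 := by rw [div_le_div_iff₀ mr (by norm_num)]; linarith
  have hdist : ∀ i ∈ I, r * |x - ‖p i‖ / r| / 2 ≤ ‖z0 - p i‖ := by
    intro i hi
    have h1 := abs_norm_sub_norm_le z0 (p i)
    have h2 : r * |x - ‖p i‖ / r| = |r * x - ‖p i‖| := by
      rw [← abs_of_pos hr, ← abs_mul, abs_of_pos hr, mul_sub, mul_div_cancel₀ _ hr.ne']
    have h3 : r * |x - ‖p i‖ / r| ≤ δ + |‖z0‖ - ‖p i‖| := by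
      rw [h2]
      have := abs_add_le δ (‖z0‖ - ‖p i‖)
      rw [abs_of_pos hδ0, show δ + (‖z0‖ - ‖p i‖) = r * x - ‖p i‖ by rw [hδd]; ring] at this
      exact this
    have h4 : len * 4 ≤ r * |x - ‖p i‖ / r| := by
      have := mul_le_mul_of_nonneg_left (hd1 i hi) hr.le
      have e : r * (1 / D) = len * 4 := by rw [hlen]; field_simp
      linarith
    linarith
  have hdpos : ∀ i ∈ I, 0 < |x - ‖p i‖ / r| := fun i hi => lt_of_lt_of_le (by positivity) (hd1 i hi)
  have hzp : ∀ i ∈ I, z0 ≠ p i := by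
    intro i hi h
    have := hdist i hi
    rw [h, sub_self, norm_zero] at this
    have := mul_pos hr (hdpos i hi)
    linarith
  obtain ⟨l, hl1, hl2⟩ := wv_local (I := I) (p := p) (F := F) (A := A) (R := 4 * r) (s := 8 * r) (K := K + 4) (η := η) (z0 := z0) (c := c) (by linarith) hη0 hη hF
    (by positivity) (fun w hw => by
      rw [mem_ball_zero_iff] at *
      refine (norm_add_le _ _).trans_lt ?_
      rw [norm_mul, hcn]
      have : δ / m * ‖w‖ ≤ δ / m * (2 * (K + 4)) := by gcongr
      have e : δ / m * (2 * (K + 4)) = δ * (2 * (K + 4) / m) := by ring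
      have : δ * (2 * (K + 4) / m) ≤ δ * (1 / 8) := by gcongr
      linarith) (norm_pos_iff.1 hF0) hA (fun w hw => by
      have := loc_bd (F := F) (K := 2 * (K + 4)) (w := w) hδ0 hδ (by linarith) (by linarith) (by linarith) (mem_ball_zero_iff.1 hw).le hmax
      refine this.trans ?_
      rw [Real.exp_add]
      gcongr) hzp (by
      refine le_trans ?_ hm3
      gcongr
      calc ∑ i ∈ I, ‖c‖ * (K + 4) / ‖z0 - p i‖ ≤ ∑ i ∈ I, (‖c‖ * (K + 4) * (2 / r)) * (1 / |x - ‖p i‖ / r|) := by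
            refine Finset.sum_le_sum fun i hi => ?_
            have h1 := hdist i hi
            have h2 := mul_pos hr (hdpos i hi)
            calc ‖c‖ * (K + 4) / ‖z0 - p i‖ ≤ ‖c‖ * (K + 4) / (r * |x - ‖p i‖ / r| / 2) := by gcongr
              _ = _ := by field_simp
        _ = (‖c‖ * (K + 4) * (2 / r)) * ∑ i ∈ I, 1 / |x - ‖p i‖ / r| := by rw [Finset.mul_sum]
        _ ≤ (‖c‖ * (K + 4) * (2 / r)) * D := by gcongr
        _ = (K + 4) / m * (2 * (δ * D) / r) := by rw [hcn]; ring
        _ ≤ (K + 4) / m * 1 := by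
            gcongr
            rw [div_le_one hr]
            have : δ * D ≤ len / 2 * D := by gcongr
            linarith
        _ = _ := mul_one _)
  -- size
  have hq1 : ‖F z0‖ ≤ ‖A z0‖ := by
    rw [← hA z0 (by rw [mem_ball_zero_iff]; linarith) hzp, norm_mul, norm_prod]
    refine mul_le_of_le_one_right (norm_nonneg _) (Finset.prod_le_one (fun _ _ => norm_nonneg _) fun i hi => ?_)
    rw [norm_div, Complex.norm_real, Real.norm_of_nonneg (by positivity), div_le_one (by positivity)]
    have := norm_sub_le z0 (p i)
    linarith [hp i hi]
  have hm2' : 2 ≤ m := by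
    have : (2:ℝ) ≤ m := by linarith
    exact_mod_cast this
  have hbig : B0 ^ 2 ≤ ‖c ^ 2 * A z0‖ := by
    rw [norm_mul, norm_pow, hcn, div_pow]
    have h1 : E * len ^ 2 ≤ 4 ^ m * (‖F z0‖ * δ ^ 2) := by
      obtain ⟨q, rfl⟩ := Nat.exists_eq_add_of_le hm2'
      have h2 : E * len ^ (2 + q) ≤ 4 ^ (2 + q) * (‖F z0‖ * δ ^ (2 + q)) := by
        rw [div_pow] at hEz
        rw [← mul_div_assoc, div_le_iff₀ (by positivity)] at hEz
        linarith
      have h3 : δ ^ q ≤ len ^ q := by gcongr; linarith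
      have h4 : E * len ^ 2 * len ^ q ≤ 4 ^ (2 + q) * (‖F z0‖ * δ ^ 2) * len ^ q := by
        calc E * len ^ 2 * len ^ q = E * len ^ (2 + q) := by rw [pow_add]; ring
          _ ≤ 4 ^ (2 + q) * (‖F z0‖ * δ ^ (2 + q)) := h2
          _ = 4 ^ (2 + q) * (‖F z0‖ * δ ^ 2) * δ ^ q := by rw [pow_add δ]; ring
          _ ≤ _ := by gcongr
      exact le_of_mul_le_mul_right h4 (by positivity)
    have h5 : (4:ℝ) ^ m * (m ^ 2 * B0 ^ 2) ≤ 4 ^ m * (‖F z0‖ * δ ^ 2) := by linarith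
    have h6 := le_of_mul_le_mul_left h5 (by positivity)
    rw [div_mul_eq_mul_div, le_div_iff₀ (by positivity)]
    calc B0 ^ 2 * m ^ 2 ≤ ‖F z0‖ * δ ^ 2 := by linarith
      _ ≤ ‖A z0‖ * δ ^ 2 := by gcongr
      _ = _ := mul_comm _ _
  set α := Complex.arg (c ^ 2 * A z0)
  have hα : ‖(α * Complex.I : ℂ)‖ < 4 := by
    rw [norm_mul, Complex.norm_I, mul_one, Complex.norm_real]
    exact lt_of_le_of_lt (Complex.abs_arg_le_pi _) (by linarith [Real.pi_lt_d2])
  have hmem : ∀ w ∈ Metric.ball (0:ℂ) K, w - α * Complex.I ∈ Metric.ball (0:ℂ) (K + 4) := by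
    intro w hw
    rw [mem_ball_zero_iff] at *
    linarith [norm_sub_le w (α * Complex.I)]
  refine ⟨z0 - c * (α * Complex.I), c, Real.sqrt ‖c ^ 2 * A z0‖, fun w => l (w - α * Complex.I), hc0, Real.le_sqrt_of_sq_le hbig,
    hl1.comp (f := fun w => w - α * Complex.I) (by fun_prop) hmem, fun w hw => ⟨((hl2 _ (hmem w hw)).1).trans hηε, ?_⟩⟩
  have h1 := (hl2 _ (hmem w hw)).2
  rw [show z0 - c * (α * Complex.I) + c * w = z0 + c * (w - α * Complex.I) by ring, h1, ← mul_assoc, ← Complex.ofReal_pow, Real.sq_sqrt (norm_nonneg _)]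
  conv_lhs => rw [← Complex.norm_mul_exp_arg_mul_I (c ^ 2 * A z0)]
  rw [mul_assoc, ← Complex.exp_add]
  congr 2
  ring

end

section

lemma MeroPlane.meromorphic {A : ℂ → ℂ} {P : Set ℂ} (h : MeroPlane A P) : Meromorphic A := by
  intro z
  by_cases hz : z ∈ P
  · obtain ⟨G, hG, -, hGe⟩ := h.exists_inv hz
    refine (hG.meromorphicAt.inv).congr ?_
    filter_upwards [hGe] with w hw
    simp [hw.2.2]
  · exact (h.2.1 z hz).meromorphicAt

lemma MeroPlane.poleOrder {A : ℂ → ℂ} {P : Set ℂ} (h : MeroPlane A P) {p : ℂ} (hp : p ∈ P) :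
    PoleOrder A p (poleOrderAt A p) := by
  have hex : ∃ m, PoleOrder A p m := by
    obtain ⟨G, hG, hG0, hGe⟩ := h.exists_inv hp
    have h1 : ¬ ∀ᶠ z in 𝓝 p, G z = 0 := by
      intro h2
      obtain ⟨w, h3, h4⟩ := ((h2.filter_mono nhdsWithin_le_nhds).and hGe).exists
      exact h4.2.1 h3
    obtain ⟨n, g, hg, hg0, hge⟩ := hG.exists_eventuallyEq_pow_smul_nonzero_iff.2 h1
    refine ⟨n, ?_, fun z => (g z)⁻¹, hg.inv hg0, inv_ne_zero hg0, ?_⟩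
    · rcases Nat.eq_zero_or_pos n with rfl | hn
      · have := hge.self_of_nhds
        simp [hG0] at this
        exact absurd this.symm hg0
      · exact hn
    · filter_upwards [hGe, hge.filter_mono nhdsWithin_le_nhds] with z h2 h3
      rw [h2.2.2, h3, smul_eq_mul, mul_inv, div_eq_mul_inv, mul_comm]
  unfold poleOrderAt
  rw [dif_pos hex]
  exact hex.choose_spec

lemma MeroPlane.poleOrder0 {A : ℂ → ℂ} {P : Set ℂ} (h : MeroPlane A P) {p : ℂ} (hp : p ∉ P) :
    poleOrderAt A p = 0 := by
  unfold poleOrderAt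
  rw [dif_neg]
  rintro ⟨m, hm, g, hg, hg0, hge⟩
  have h1 : Tendsto (fun z => A z * (z - p) ^ m) (𝓝[≠] p) (𝓝 (A p * (p - p) ^ m)) :=
    (((h.2.1 p hp).continuousAt).mul (by fun_prop)).tendsto.mono_left nhdsWithin_le_nhds
  have h2 : Tendsto g (𝓝[≠] p) (𝓝 (g p)) := hg.continuousAt.tendsto.mono_left nhdsWithin_le_nhds
  have h3 : (fun z => A z * (z - p) ^ m) =ᶠ[𝓝[≠] p] g := by
    filter_upwards [hge, self_mem_nhdsWithin] with z h4 h5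
    have : z - p ≠ 0 := sub_ne_zero.2 h5
    rw [h4]; field_simp
  have := tendsto_nhds_unique h1 (h2.congr' h3.symm)
  simp [hm.ne'] at this
  exact hg0 this.symm

/-- finite set of poles in the closed disc -/
def polesIn {A : ℂ → ℂ} {P : Set ℂ} (h : MeroPlane A P) (t : ℝ) : Finset ℂ :=
  (h.1 (Metric.closedBall 0 t) (isCompact_closedBall 0 t)).toFinset

lemma mem_polesIn {A : ℂ → ℂ} {P : Set ℂ} (h : MeroPlane A P) {t : ℝ} {z : ℂ} : z ∈ polesIn h t ↔ z ∈ P ∧ ‖z‖ ≤ t := by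
  simp [polesIn]

lemma nCount_eq {A : ℂ → ℂ} {P : Set ℂ} (h : MeroPlane A P) (t : ℝ) :
    nCount A t = ∑ z ∈ polesIn h t, poleOrderAt A z := by
  unfold nCount
  apply finsum_mem_eq_sum_of_inter_support_eq
  ext z
  simp only [mem_inter_iff, mem_ofPred_eq, Function.mem_support, Finset.mem_coe, mem_polesIn]
  constructor
  · rintro ⟨h1, h2⟩
    exact ⟨⟨by_contra fun hz => h2 (h.poleOrder0 hz), h1⟩, h2⟩
  · rintro ⟨h1, h2⟩
    exact ⟨h1.2, h2⟩

lemma nCount_mono {A : ℂ → ℂ} {P : Set ℂ} (h : MeroPlane A P) : Monotone (nCount A) := by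
  intro s t hst
  rw [nCount_eq h, nCount_eq h]
  apply Finset.sum_le_sum_of_subset
  intro z hz
  rw [mem_polesIn] at hz ⊢
  exact ⟨hz.1, hz.2.trans hst⟩

/-- index set of poles with multiplicity -/
def polesIx {A : ℂ → ℂ} {P : Set ℂ} (h : MeroPlane A P) (t : ℝ) : Finset (Σ _ : ℂ, ℕ) :=
  (polesIn h t).sigma (fun p => Finset.range (poleOrderAt A p))

lemma card_polesIx {A : ℂ → ℂ} {P : Set ℂ} (h : MeroPlane A P) (t : ℝ) :
    (polesIx h t).card = nCount A t := by
  simp [polesIx, nCount_eq h]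

lemma exists_F {A : ℂ → ℂ} {P : Set ℂ} (h : MeroPlane A P) {R s : ℝ} (hs : s ≠ 0) :
    ∃ F : ℂ → ℂ, (∀ z ∈ Metric.ball (0:ℂ) R, AnalyticAt ℂ F z) ∧
      (∀ z ∈ Metric.ball (0:ℂ) R, z ∉ P → A z * ∏ i ∈ polesIx h R, ((z - i.1) / (s : ℂ)) = F z) := by
  have hq : ∀ z, ∏ i ∈ polesIx h R, ((z - i.1) / (s : ℂ)) =
      ∏ p ∈ polesIn h R, ((z - p) / (s : ℂ)) ^ poleOrderAt A p := by
    intro z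
    rw [polesIx, Finset.prod_sigma]
    simp only [Finset.prod_const, Finset.card_range]
  have hqa : ∀ z, AnalyticAt ℂ (fun z => ∏ i ∈ polesIx h R, ((z - i.1) / (s : ℂ))) z := by
    intro z
    fun_prop
  obtain ⟨F, hF⟩ := glue (U := Metric.ball (0:ℂ) R)
    (F := fun z => A z * ∏ i ∈ polesIx h R, ((z - i.1) / (s : ℂ))) (by
      intro z hz
      by_cases hzP : z ∈ P
      · obtain ⟨hm, g, hg, hg0, hge⟩ := h.poleOrder hzP
        have hz' : z ∈ polesIn h R := (mem_polesIn h).2 ⟨hzP, by simpa using (mem_ball_zero_iff.1 hz).le⟩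
        refine ⟨fun w => g w / (s:ℂ) ^ poleOrderAt A z *
          ∏ p ∈ (polesIn h R).erase z, ((w - p) / (s : ℂ)) ^ poleOrderAt A p, by fun_prop, ?_⟩
        filter_upwards [hge, self_mem_nhdsWithin] with w h1 h2
        have h3 : w - z ≠ 0 := sub_ne_zero.2 h2
        have hs' : (s:ℂ) ≠ 0 := by exact_mod_cast hs
        rw [hq, h1, ← Finset.mul_prod_erase _ _ hz', div_pow]
        field_simp
      · exact ⟨_, (h.2.1 z hzP).mul (hqa z), EventuallyEq.rfl⟩) Metric.isOpen_ball
  refine ⟨F, fun z hz => (hF z hz).1, fun z hz hzP => ?_⟩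
  exact ((hF z hz).2.2 _ ((h.2.1 z hzP).mul (hqa z)) EventuallyEq.rfl).self_of_nhds.symm

end

section

lemma nevN_ge {A : ℂ → ℂ} {P : Set ℂ} (h : MeroPlane A P) {a r : ℝ} (ha : 1 ≤ a) (har : a ≤ r) :
    nCount A a * Real.log (r / a) ≤ nevN A r := by
  have hmono := nCount_mono h
  have hmonoR : Monotone (fun t => (nCount A t : ℝ)) := fun s t hst => Nat.cast_le.2 (hmono hst)
  obtain ⟨ε, hε, hεP⟩ : ∃ ε > 0, ∀ t < ε, nCount A t ≤ nCount A 0 := by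
    have h1 := h.isolated 0
    rw [eventually_nhdsWithin_iff, Metric.eventually_nhds_iff] at h1
    obtain ⟨ε, hε, h2⟩ := h1
    refine ⟨ε, hε, fun t ht => ?_⟩
    rw [nCount_eq h, nCount_eq h]
    apply Finset.sum_le_sum_of_subset
    intro z hz
    rw [mem_polesIn] at hz ⊢
    refine ⟨hz.1, ?_⟩
    by_contra h3
    have h4 : z ≠ 0 := by rintro rfl; simp at h3
    exact h2 (by simpa using hz.2.trans_lt ht) h4 hz.1
  set g : ℝ → ℝ := fun t => ((nCount A t : ℝ) - (nCount A 0 : ℝ)) / t with hg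
  have hgm : Measurable g := (hmonoR.measurable.sub_const _).div measurable_id
  have hg0 : ∀ t, 0 ≤ t → 0 ≤ g t := fun t ht =>
    div_nonneg (sub_nonneg.2 (hmonoR ht)) ht
  have hint : ∀ b, 0 ≤ b → IntervalIntegrable g volume 0 b := by
    intro b hb
    rw [intervalIntegrable_iff_integrableOn_Ioc_of_le hb]
    apply Measure.integrableOn_of_bounded (M := (nCount A b : ℝ) / ε) (by simp) hgm.aestronglyMeasurable
    rw [ae_restrict_iff' measurableSet_Ioc]
    refine Eventually.of_forall fun t ht => ?_
    rw [Real.norm_of_nonneg (hg0 t ht.1.le)]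
    by_cases hte : t < ε
    · have : (nCount A t : ℝ) ≤ nCount A 0 := by exact_mod_cast hεP t hte
      have h2 : g t ≤ 0 := div_nonpos_of_nonpos_of_nonneg (by linarith) ht.1.le
      exact h2.trans (by positivity)
    · have h3 : (nCount A t : ℝ) ≤ nCount A b := hmonoR ht.2
      have h4 : (0:ℝ) ≤ nCount A 0 := by positivity
      exact div_le_div₀ (by positivity) (by linarith) hε (not_lt.1 hte)
  have ha0 : 0 < a := by linarith
  have hr0 : 0 < r := by linarith
  have hsplit := intervalIntegral.integral_add_adjacent_intervals (hint a ha0.le)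
    ((hint a ha0.le).symm.trans (hint r hr0.le))
  have h1 : 0 ≤ ∫ t in (0:ℝ)..a, g t :=
    intervalIntegral.integral_nonneg ha0.le (fun t ht => hg0 t ht.1)
  have h2 : ((nCount A a : ℝ) - nCount A 0) * Real.log (r / a) ≤ ∫ t in a..r, g t := by
    rw [← integral_inv_of_pos ha0 hr0, ← intervalIntegral.integral_const_mul]
    apply intervalIntegral.integral_mono_on har
    · apply IntervalIntegrable.const_mul
      apply intervalIntegral.intervalIntegrable_inv (fun t ht => ?_) continuousOn_id
      rw [uIcc_of_le har] at ht
      exact (ha0.trans_le ht.1).ne'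
    · exact (hint a ha0.le).symm.trans (hint r hr0.le)
    · intro t ht
      simp only [hg]
      rw [div_eq_mul_inv]
      have h5 : 0 < t := ha0.trans_le ht.1
      have h6 : (nCount A a : ℝ) ≤ nCount A t := hmonoR ht.1
      gcongr
  have h3 : Real.log (r / a) ≤ Real.log r := by
    apply Real.log_le_log (by positivity)
    exact div_le_self hr0.le ha
  have h4 : (nCount A 0 : ℝ) * Real.log (r / a) ≤ nCount A 0 * Real.log r := by gcongr
  unfold nevN
  linarith

lemma nevm_eq (A : ℂ → ℂ) (r : ℝ) : nevm A r = Real.circleAverage (fun z => Real.posLog ‖A z‖) 0 r := by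
  simp only [nevm, Real.circleAverage, circleMap, smul_eq_mul, one_div, zero_add,
    Real.posLog_eq_log_max_one (norm_nonneg _)]

lemma nevm_nonneg (A : ℂ → ℂ) (r : ℝ) : 0 ≤ nevm A r := by
  rw [nevm_eq]
  exact Real.circleAverage_nonneg_of_nonneg fun z _ => Real.posLog_nonneg

lemma nevm_le {A : ℂ → ℂ} {P : Set ℂ} (h : MeroPlane A P) {r R V : ℝ} (hr : 0 < r) (hrR : r < R) {s : ℝ} (hs : r + R ≤ s)
    {F : ℂ → ℂ} (hFA : ∀ z ∈ Metric.ball (0:ℂ) R, z ∉ P → A z * ∏ i ∈ polesIx h R, ((z - i.1) / (s : ℂ)) = F z)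
    (hV : 0 ≤ V) (hF : ∀ z, ‖z‖ = r → ‖F z‖ ≤ Real.exp V) :
    nevm A r ≤ V + nCount A R * Real.log (s / r) := by
  have hs0 : 0 < s := by linarith
  rw [nevm_eq]
  set G : ℂ → ℝ := fun z => (V + nCount A R * Real.log s) - ∑ i ∈ polesIx h R, Real.log ‖z - i.1‖ with hG
  have hci : CircleIntegrable (fun z => ∑ i ∈ polesIx h R, Real.log ‖z - i.1‖) 0 r :=
    CircleIntegrable.fun_sum _ (fun i _ => circleIntegrable_log_norm_sub_const r)
  have hcG : CircleIntegrable G 0 r := (circleIntegrable_const _ _ _).sub hci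
  have h1 : Real.circleAverage (fun z => Real.posLog ‖A z‖) 0 r ≤ Real.circleAverage G 0 r := by
    classical
    have hco : Pᶜ ∈ codiscreteWithin (Metric.sphere (0:ℂ) |r|) := by
      rw [mem_codiscreteWithin]
      intro x _
      rw [disjoint_principal_right]
      filter_upwards [h.isolated x] with w hw
      simp [hw]
    set f2 : ℂ → ℝ := fun z => if z ∈ P then G z else Real.posLog ‖A z‖ with hf2
    have he : (fun z => Real.posLog ‖A z‖) =ᶠ[codiscreteWithin (Metric.sphere (0:ℂ) |r|)] f2 := by
      filter_upwards [hco] with z hz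
      simp [hf2, show z ∉ P from hz]
    rw [Real.circleAverage_congr_codiscreteWithin he hr.ne']
    have hi1 : CircleIntegrable (fun z => Real.posLog ‖A z‖) 0 r :=
      MeromorphicOn.circleIntegrable_posLog_norm (fun z _ => h.meromorphic z)
    refine Real.circleAverage_mono (hi1.congr_codiscreteWithin he) hcG fun z hz => ?_
    by_cases hzP : z ∈ P
    · simp [hf2, hzP]
    rw [abs_of_pos hr, mem_sphere_zero_iff_norm] at hz
    simp only [hf2, hzP, if_false]
    have hne : ∀ i ∈ polesIx h R, 0 < ‖z - i.1‖ := by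
      intro i hi
      rw [norm_pos_iff, sub_ne_zero]
      rintro rfl
      simp only [polesIx, Finset.mem_sigma, mem_polesIn] at hi
      exact hzP hi.1.1
    have hle : ∀ i ∈ polesIx h R, Real.log ‖z - i.1‖ ≤ Real.log s := by
      intro i hi
      apply Real.log_le_log (hne i hi)
      simp only [polesIx, Finset.mem_sigma, mem_polesIn] at hi
      exact (norm_sub_le _ _).trans (by linarith [hi.1.2])
    have hsum : ∑ i ∈ polesIx h R, Real.log ‖z - i.1‖ ≤ nCount A R * Real.log s := by
      rw [← card_polesIx h, ← nsmul_eq_mul]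
      exact Finset.sum_le_card_nsmul _ _ _ hle
    rw [Real.posLog_def]
    refine max_le (show (0:ℝ) ≤ G z by simp only [hG]; linarith) (show Real.log ‖A z‖ ≤ G z from ?_)
    by_cases hA : A z = 0
    · simp only [hA, norm_zero, Real.log_zero, hG]; linarith
    have h5 := hF z hz
    rw [← hFA z (by simpa [hz] using hrR) hzP, norm_mul, norm_prod] at h5
    have h6 : 0 < ∏ i ∈ polesIx h R, ‖(z - i.1) / (s:ℂ)‖ := by
      apply Finset.prod_pos
      intro i hi
      rw [norm_div]
      exact div_pos (hne i hi) (by simpa using hs0.ne')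
    have h7 := Real.log_le_log (mul_pos (norm_pos_iff.2 hA) h6) h5
    rw [Real.log_exp, Real.log_mul (norm_ne_zero_iff.2 hA) h6.ne', Real.log_prod (fun i hi => (norm_pos_iff.2 (div_ne_zero (norm_pos_iff.1 (hne i hi)) (by exact_mod_cast hs0.ne'))).ne')] at h7
    have h8 : ∑ i ∈ polesIx h R, Real.log ‖(z - i.1) / (s:ℂ)‖ = ∑ i ∈ polesIx h R, Real.log ‖z - i.1‖ - nCount A R * Real.log s := by
      rw [← card_polesIx h, ← nsmul_eq_mul, ← Finset.sum_const, ← Finset.sum_sub_distrib]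
      refine Finset.sum_congr rfl fun i hi => ?_
      rw [norm_div, Real.log_div (hne i hi).ne' (by simpa using hs0.ne'), Complex.norm_real, Real.norm_of_nonneg hs0.le]
    rw [h8] at h7
    simp only [hG]
    linarith
  refine h1.trans ?_
  have h2 : Real.circleAverage G 0 r = (V + nCount A R * Real.log s) -
      ∑ i ∈ polesIx h R, Real.circleAverage (fun z => Real.log ‖z - i.1‖) 0 r := by
    rw [hG, Real.circleAverage_fun_sub (circleIntegrable_const _ _ _) hci, Real.circleAverage_const, Real.circleAverage_fun_sum]
    exact fun i _ => circleIntegrable_log_norm_sub_const r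
  have h3 : (nCount A R : ℝ) * Real.log r ≤ ∑ i ∈ polesIx h R, Real.circleAverage (fun z => Real.log ‖z - i.1‖) 0 r := by
    rw [← card_polesIx h, ← nsmul_eq_mul]
    apply Finset.card_nsmul_le_sum
    intro i _
    rw [circleAverage_log_norm_sub_const_eq_log_radius_add_posLog hr.ne']
    linarith [Real.posLog_nonneg (x := r⁻¹ * ‖0 - i.1‖)]
  rw [h2, Real.log_div hs0.ne' hr.ne', mul_sub]
  linarith

end

section

lemma max_grow {F : ℂ → ℂ} {ρs r Ms R ρ2 : ℝ} {k : ℕ} (hρs : 0 < ρs) (hr : ρs < r) (h2 : r ≤ ρ2) (hR : ρ2 < R)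
    (hF : ∀ z ∈ Metric.ball (0:ℂ) R, AnalyticAt ℂ F z) (hMs : ∀ z, ‖z‖ = ρs → ‖F z‖ ≤ Ms)
    {zs : ℂ} (hzs : ‖zs‖ = r) (hbig : Ms * (r / ρs) ^ k < ‖F zs‖) :
    ∃ z', ‖z'‖ = ρ2 ∧ ∀ z, r ≤ ‖z‖ → ‖z‖ ≤ ρ2 → ‖F z / z ^ k‖ ≤ ‖F z' / z' ^ k‖ := by
  have hr0 : 0 < r := hρs.trans hr
  have hρ2 : 0 < ρ2 := by linarith
  have hdif : ∀ z, ρs ≤ ‖z‖ → ‖z‖ ≤ ρ2 → DifferentiableAt ℂ (fun z => F z / z ^ k) z := by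
    intro z h3 h4
    have hz0 : z ≠ 0 := norm_pos_iff.1 (hρs.trans_le h3)
    exact (hF z (by simpa using h4.trans_lt hR)).differentiableAt.div (by fun_prop) (pow_ne_zero _ hz0)
  obtain ⟨z', hz', hmax⟩ := (isCompact_sphere (0:ℂ) ρ2).exists_isMaxOn (f := fun z => ‖F z / z ^ k‖)
    (NormedSpace.sphere_nonempty.2 hρ2.le) (fun z hz => by
      rw [mem_sphere_zero_iff_norm] at hz
      exact ((hdif z (by rw [hz]; linarith) hz.le).continuousAt.norm).continuousWithinAt)
  rw [mem_sphere_zero_iff_norm] at hz'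
  set μ := ‖F z' / z' ^ k‖ with hμ
  have hcl : ∀ z, r ≤ ‖z‖ → ‖z‖ ≤ ρ2 → ‖F z / z ^ k‖ ≤ max μ (Ms / ρs ^ k) := by
    intro z h3 h4
    set U : Set ℂ := {z | ρs < ‖z‖ ∧ ‖z‖ < ρ2} with hU
    have hUo : IsOpen U := (isOpen_lt continuous_const continuous_norm).inter (isOpen_lt continuous_norm continuous_const)
    have hsub : closure U ⊆ {z | ρs ≤ ‖z‖ ∧ ‖z‖ ≤ ρ2} := by
      apply closure_minimal
      · exact fun w hw => ⟨hw.1.le, hw.2.le⟩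
      · exact (isClosed_le continuous_const continuous_norm).inter (isClosed_le continuous_norm continuous_const)
    have hout : ∀ w, ‖w‖ = ρ2 → ‖F w / w ^ k‖ ≤ max μ (Ms / ρs ^ k) := fun w hw =>
      (hmax (mem_sphere_zero_iff_norm.2 hw)).trans (le_max_left _ _)
    rcases h4.eq_or_lt with h5 | h5
    · exact hout z h5
    apply Complex.norm_le_of_forall_mem_frontier_norm_le (U := U) (f := fun z => F z / z ^ k)
      ((Metric.isBounded_ball (x := (0:ℂ)) (r := ρ2)).subset fun w hw => by simpa using hw.2)
    · refine DifferentiableOn.diffContOnCl fun w hw => ?_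
      exact (hdif w (hsub hw).1 (hsub hw).2).differentiableWithinAt
    · intro w hw
      have h6 := hsub hw.1
      rw [frontier, hUo.interior_eq] at hw
      by_cases h7 : ‖w‖ = ρ2
      · exact hout w h7
      have h8 : ‖w‖ = ρs := by
        by_contra h9
        exact hw.2 ⟨lt_of_le_of_ne h6.1 (Ne.symm h9), lt_of_le_of_ne h6.2 h7⟩
      refine le_trans ?_ (le_max_right _ _)
      rw [norm_div, norm_pow, h8]
      gcongr
      exact hMs w h8
    · exact subset_closure ⟨hr.trans_le h3, h5⟩
  have h3 := hcl zs hzs.ge (hzs.le.trans h2)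
  have h4 : Ms / ρs ^ k < ‖F zs / zs ^ k‖ := by
    rw [norm_div, norm_pow, hzs, div_lt_div_iff₀ (by positivity) (by positivity)]
    rw [div_pow, mul_div_assoc', div_lt_iff₀ (by positivity)] at hbig
    exact hbig
  have h5 : max μ (Ms / ρs ^ k) = μ := by
    apply max_eq_left
    by_contra h6
    rw [max_eq_right (not_le.1 h6).le] at h3
    linarith
  rw [h5] at hcl
  exact ⟨z', hz', hcl⟩

lemma intble_abs_rpow {θ : ℝ} (hθ : θ < 1) (a b : ℝ) :
    IntervalIntegrable (fun y : ℝ => |y| ^ (-θ)) volume a b := by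
  have h1 := (intervalIntegral.intervalIntegrable_cpow' (a := a) (b := b) (r := ((-θ : ℝ) : ℂ)) (by simp; linarith)).norm
  refine h1.congr_ae ?_
  refine ae_restrict_of_ae ?_
  have : ∀ᵐ y : ℝ, y ≠ 0 := by simp [ae_iff, measure_singleton]
  filter_upwards [this] with y hy
  rw [Complex.norm_cpow_of_ne_zero (by exact_mod_cast hy)]
  simp

lemma avg {θ : ℝ} (h0 : 0 < θ) (hθ : θ < 1) : ∃ C : ℝ, 0 < C ∧ ∀ (ι : Type) (I : Finset ι) (t : ι → ℝ),
    (∀ i ∈ I, 0 ≤ t i ∧ t i ≤ 4) → ∃ x : ℝ, 3 / 2 ≤ x ∧ x ≤ 2 ∧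
      (∀ i ∈ I, 1 / (C * I.card + 1) ^ (1 / θ) ≤ |x - t i|) ∧
      ∑ i ∈ I, 1 / |x - t i| ≤ (C * I.card + 1) ^ (1 / θ) := by
  set C0 := ∫ y in (-6:ℝ)..6, |y| ^ (-θ) with hC0
  have hC0n : 0 ≤ C0 := intervalIntegral.integral_nonneg (by norm_num) (fun y _ => by positivity)
  refine ⟨2 * C0 + 1, by positivity, fun ι I t ht => ?_⟩
  set W := (2 * C0 + 1) * I.card + 1 with hW
  have hW1 : 1 ≤ W := by
    have : 0 ≤ (2 * C0 + 1) * I.card := by positivity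
    linarith
  have hint : ∀ s : ℝ, IntervalIntegrable (fun x => |x - s| ^ (-θ)) volume (3/2) 2 := by
    intro s
    have := (intble_abs_rpow hθ (3/2 - s) (2 - s)).comp_sub_right s
    simpa using this
  have hb : ∀ s, 0 ≤ s → s ≤ 4 → ∫ x in (3/2:ℝ)..2, |x - s| ^ (-θ) ≤ C0 := by
    intro s h1 h2
    rw [intervalIntegral.integral_comp_sub_right (fun y => |y| ^ (-θ)) s]
    apply intervalIntegral.integral_mono_interval (by linarith) (by linarith) (by linarith)
    · exact Eventually.of_forall fun y => by simp only [Pi.zero_apply]; positivity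
    · exact intble_abs_rpow hθ _ _
  have hsumint : IntervalIntegrable (fun x => ∑ i ∈ I, |x - t i| ^ (-θ)) volume (3/2) 2 :=
    by simpa only [Finset.sum_fn] using IntervalIntegrable.sum I (f := fun i x => |x - t i| ^ (-θ)) fun i _ => hint _
  have hsum : ∫ x in (3/2:ℝ)..2, ∑ i ∈ I, |x - t i| ^ (-θ) ≤ I.card * C0 := by
    rw [intervalIntegral.integral_finsetSum fun i _ => hint _, ← nsmul_eq_mul]
    exact Finset.sum_le_card_nsmul _ _ _ fun i hi => hb _ (ht i hi).1 (ht i hi).2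
  have h32 : (3/2:ℝ) ≤ 2 := by norm_num
  obtain ⟨x, hx1, hx2, hxT, hxW⟩ : ∃ x : ℝ, 3 / 2 ≤ x ∧ x ≤ 2 ∧ (∀ i ∈ I, x ≠ t i) ∧ ∑ i ∈ I, |x - t i| ^ (-θ) ≤ W := by
    by_contra! hcon
    have h1 : ∫ x in (3/2:ℝ)..2, W ≤ ∫ x in (3/2:ℝ)..2, ∑ i ∈ I, |x - t i| ^ (-θ) := by
      apply intervalIntegral.integral_mono_ae_restrict h32 intervalIntegrable_const hsumint
      have h4 : ∀ᵐ x : ℝ, x ∉ t '' I :=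
        compl_mem_ae_iff.2 ((I.finite_toSet.image t).measure_zero volume)
      rw [EventuallyLE, ae_restrict_iff' measurableSet_Icc]
      filter_upwards [h4] with x hx hx2
      exact (hcon x hx2.1 hx2.2 fun i hi h5 => hx ⟨i, hi, h5.symm⟩).le
    rw [intervalIntegral.integral_const, smul_eq_mul] at h1
    have h3 : (2 - 3/2:ℝ) * W = I.card * C0 + I.card / 2 + 1 / 2 := by rw [hW]; ring
    have : (0:ℝ) ≤ I.card := by positivity
    linarith
  have hpos : ∀ i ∈ I, 0 < |x - t i| := fun i hi => abs_pos.2 (sub_ne_zero.2 (hxT i hi))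
  have hone : ∀ i ∈ I, |x - t i| ^ (-θ) ≤ W := fun i hi =>
    (Finset.single_le_sum (f := fun i => |x - t i| ^ (-θ)) (fun j _ => by positivity) hi).trans hxW
  have hinv : ∀ i ∈ I, 1 / |x - t i| = (|x - t i| ^ (-θ)) ^ (1 / θ) := by
    intro i hi
    rw [← Real.rpow_mul (hpos i hi).le, show -θ * (1 / θ) = -1 by field_simp, Real.rpow_neg_one, one_div]
  have hsm : ∀ i ∈ I, 1 / |x - t i| ≤ |x - t i| ^ (-θ) * W ^ (1 / θ - 1) := by
    intro i hi
    have h1 : 0 < |x - t i| ^ (-θ) := Real.rpow_pos_of_pos (hpos i hi) _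
    rw [hinv i hi, show (1 / θ) = 1 + (1 / θ - 1) by ring, Real.rpow_add h1, Real.rpow_one]
    rw [add_sub_cancel_left]
    have := (one_le_div h0).2 hθ.le
    exact mul_le_mul_of_nonneg_left (Real.rpow_le_rpow h1.le (hone i hi) (by linarith)) h1.le
  refine ⟨x, hx1, hx2, fun i hi => ?_, ?_⟩
  · have h1 : 1 / |x - t i| ≤ W ^ (1 / θ) := by
      rw [hinv i hi]
      exact Real.rpow_le_rpow (by positivity) (hone i hi) (by positivity)
    rw [one_div_le (by positivity) (hpos i hi)]
    exact h1
  · calc ∑ i ∈ I, 1 / |x - t i| ≤ ∑ i ∈ I, |x - t i| ^ (-θ) * W ^ (1 / θ - 1) := Finset.sum_le_sum hsm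
      _ ≤ W * W ^ (1 / θ - 1) := by rw [← Finset.sum_mul]; gcongr
      _ = W ^ (1 / θ) := by
        rw [← Real.rpow_one_add' (by positivity) (by simp; exact h0.ne')]
        congr 1; ring

end

section

lemma ev_pow {a b : ℝ} (c : ℝ) (hab : a < b) : ∀ᶠ r : ℝ in atTop, c * r ^ a ≤ r ^ b := by
  filter_upwards [(tendsto_rpow_atTop (sub_pos.2 hab)).eventually_ge_atTop c, eventually_gt_atTop 0] with r h1 h2
  rw [show b = (b - a) + a by ring, Real.rpow_add h2]
  have := Real.rpow_nonneg h2.le a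
  gcongr

lemma exists_circle {A : ℂ → ℂ} {P : Set ℂ} (h : MeroPlane A P) :
    ∃ ρs Ms : ℝ, 1 ≤ ρs ∧ ρs ≤ 2 ∧ 1 ≤ Ms ∧ ∀ z, ‖z‖ = ρs → z ∉ P ∧ ‖A z‖ ≤ Ms := by
  obtain ⟨ρs, h1, h2⟩ : ∃ ρs ∈ Icc (1:ℝ) 2, ρs ∉ norm '' (P ∩ Metric.closedBall 0 2) :=
    (Set.Icc_infinite (by norm_num : (1:ℝ) < 2)).exists_notMem_finite ((h.1 _ (isCompact_closedBall 0 2)).image _)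
  have h3 : ∀ z, ‖z‖ = ρs → z ∉ P := fun z hz hzP => h2 ⟨z, ⟨hzP, by simpa [hz] using h1.2⟩, hz⟩
  obtain ⟨C, hC⟩ := (isCompact_sphere (0:ℂ) ρs).exists_bound_of_continuousOn (f := A) (fun z hz =>
    (h.2.1 z (h3 z (mem_sphere_zero_iff_norm.1 hz))).continuousAt.continuousWithinAt)
  exact ⟨ρs, max 1 C, h1.1, h1.2, le_max_left _ _, fun z hz => ⟨h3 z hz,
    (hC z (mem_sphere_zero_iff_norm.2 hz)).trans (le_max_right _ _)⟩⟩

lemma exists_m {K η : ℝ} (hη : 0 < η) : ∃ m : ℕ, 16 * (K + 4) ≤ m ∧ Real.exp (5 * (2 * (K + 4)) ^ 2 / m) ≤ 1 + η ∧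
    Real.exp ((K + 4) / m) - 1 ≤ η := by
  have h1 : ∀ c : ℝ, ∀ᶠ m : ℕ in atTop, Real.exp (c / m) ≤ 1 + η := by
    intro c
    have h2 : Tendsto (fun m : ℕ => Real.exp (c / m)) atTop (𝓝 (Real.exp 0)) :=
      (Real.continuous_exp.tendsto 0).comp (tendsto_const_div_atTop_nhds_zero_nat c)
    rw [Real.exp_zero] at h2
    exact (h2.eventually (gt_mem_nhds (by linarith : (1:ℝ) < 1 + η))).mono fun _ h => h.le
  obtain ⟨m, h2, h3, h4⟩ := ((tendsto_natCast_atTop_atTop.eventually_ge_atTop (16 * (K + 4))).and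
    ((h1 (5 * (2 * (K + 4)) ^ 2)).and (h1 (K + 4)))).exists
  exact ⟨m, h2, h3, by linarith⟩

lemma no_gap {A : ℂ → ℂ} {P : Set ℂ} (h : MeroPlane A P)
    (hWV : ∃ K ε B0 : ℝ, 0 < K ∧ 0 < ε ∧ 1 ≤ B0 ∧ ∀ (z0 c : ℂ) (B : ℝ) (l : ℂ → ℂ), c ≠ 0 → B0 ≤ B →
      DifferentiableOn ℂ l (Metric.ball 0 K) →
      (∀ w ∈ Metric.ball (0:ℂ) K, ‖l w‖ ≤ ε ∧ c ^ 2 * A (z0 + c * w) = (B:ℂ) ^ 2 * Complex.exp (w + l w)) → False)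
    {ρ σ : ℝ} (hρ : 0 < ρ) (hρσ : ρ < σ) (hN : ∀ᶠ r in atTop, nevN A r ≤ r ^ ρ) :
    ∀ᶠ r in atTop, nevT A r < r ^ σ := by
  obtain ⟨K0, ε, B0, hK0, hε, hB0, hno⟩ := hWV
  obtain ⟨ρs, Ms, hρs1, hρs2, hMs1, hMs⟩ := exists_circle h
  set K := max K0 1 with hK
  set η := min (1 / 10) (ε / 6) with hη
  have hη0 : 0 < η := lt_min (by norm_num) (by positivity)
  obtain ⟨m, hm1, hm2, hm3⟩ := exists_m (K := K) hη0
  have hσ : 0 < σ := hρ.trans hρσ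
  set θ := (ρ / σ + 1) / 2 with hθ
  have hq : ρ / σ < 1 := (div_lt_one hσ).2 hρσ
  have hq0 : 0 < ρ / σ := by positivity
  have hθ0 : 0 < θ := by linarith
  have hθ1 : θ < 1 := by linarith
  set τ := ρ / θ with hτ
  have hτσ : τ < σ := by
    rw [hτ, div_lt_iff₀ hθ0]
    have : ρ / σ < θ := by linarith
    rw [div_lt_iff₀ hσ] at this
    linarith
  obtain ⟨C, hC, havg⟩ := avg hθ0 hθ1
  have hl2 : 0 < Real.log 2 := Real.log_pos (by norm_num)
  set C1 := (8:ℝ) ^ ρ / Real.log 2 with hC1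
  have hC1p : 0 < C1 := by positivity
  set C2 := (C * C1 + 1) ^ (1 / θ) with hC2
  have hC2p : 0 < C2 := by positivity
  set δ := (σ - τ) / 2 with hδ
  have hδ0 : 0 < δ := by linarith
  have e1 := ev_pow (2 * (1 + C1 * Real.log 8)) hρσ
  have e2 := ev_pow (8 * (129 * m * C2)) (show τ + δ < σ by linarith)
  have e2b : ∀ᶠ r : ℝ in atTop, Real.log r ≤ r ^ δ := by
    filter_upwards [(isLittleO_log_rpow_atTop hδ0).bound zero_lt_one, eventually_ge_atTop 1] with r h1 h2
    have : 0 ≤ r ^ δ := by positivity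
    rw [Real.norm_of_nonneg (Real.log_nonneg h2), Real.norm_of_nonneg this, one_mul] at h1
    exact h1
  have e2c := (tendsto_rpow_atTop hσ).eventually_gt_atTop (8 * Real.log Ms)
  have e3 : ∀ᶠ r : ℝ in atTop, (4 ^ m * m ^ 2 * B0 ^ 2 * 16 * C2 ^ 2) * (r ^ σ) ^ 2 ≤ Real.exp (r ^ σ / 4) := by
    have h1 := (isLittleO_pow_exp_pos_mul_atTop 2 (by norm_num : (0:ℝ) < 1 / 4)).const_mul_left
      (4 ^ m * m ^ 2 * B0 ^ 2 * 16 * C2 ^ 2)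
    have h2 := h1.bound zero_lt_one
    filter_upwards [(tendsto_rpow_atTop hσ).eventually h2] with r h3
    rw [one_mul, Real.norm_of_nonneg (Real.exp_pos _).le] at h3
    refine (le_abs_self _).trans (h3.trans_eq ?_)
    congr 1; ring
  have hN8 : ∀ᶠ r in atTop, nevN A (8 * r) ≤ (8 * r) ^ ρ :=
    (tendsto_id.const_mul_atTop (by norm_num : (0:ℝ) < 8)).eventually hN
  filter_upwards [e1, e2, e2b, e2c, e3, hN8, hN, eventually_gt_atTop 2] with r e1 e2 e2b e2c e3 hN8 hN hr2
  by_contra! hT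
  have hr : 0 < r := by linarith
  have hr1 : 1 ≤ r := by linarith
  set n := nCount A (4 * r) with hn
  have hnle : (n:ℝ) ≤ C1 * r ^ ρ := by
    have h1 := nevN_ge h (a := 4 * r) (r := 8 * r) (by linarith) (by linarith)
    rw [show 8 * r / (4 * r) = 2 by field_simp; norm_num] at h1
    rw [hC1, div_mul_eq_mul_div, le_div_iff₀ hl2, ← Real.mul_rpow (by norm_num) hr.le]
    linarith
  obtain ⟨F, hFa, hFA⟩ := exists_F h (R := 4 * r) (s := 8 * r) (by positivity)
  -- big point
  obtain ⟨zs, hzs, hzsE⟩ : ∃ z, ‖z‖ = r ∧ Real.exp (r ^ σ / 4) ≤ ‖F z‖ := by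
    by_contra! hcon
    have h1 := nevm_le h hr (by linarith : r < 4 * r) (by linarith : r + 4 * r ≤ 8 * r) hFA
      (by positivity : 0 ≤ r ^ σ / 4) (fun z hz => (hcon z hz).le)
    rw [mul_div_assoc, div_self hr.ne', mul_one] at h1
    have h8 : 0 < Real.log 8 := Real.log_pos (by norm_num)
    have h2 : (n:ℝ) * Real.log 8 ≤ C1 * r ^ ρ * Real.log 8 := by gcongr
    have h3 : 0 < r ^ σ := by positivity
    unfold nevT at hT
    linarith
  set D := (C * n + 1) ^ (1 / θ) with hD
  have hD1 : 1 ≤ D := Real.one_le_rpow (by linarith [show 0 ≤ C * (n:ℝ) by positivity]) (by positivity)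
  have hDle : D ≤ C2 * r ^ τ := by
    have h1 : 1 ≤ r ^ ρ := Real.one_le_rpow hr1 hρ.le
    have h2 : C * n + 1 ≤ (C * C1 + 1) * r ^ ρ := by
      have : C * n ≤ C * (C1 * r ^ ρ) := by gcongr
      linarith
    calc D ≤ ((C * C1 + 1) * r ^ ρ) ^ (1 / θ) := Real.rpow_le_rpow (by positivity) h2 (by positivity)
      _ = C2 * r ^ τ := by
        rw [Real.mul_rpow (by positivity) (by positivity), ← Real.rpow_mul hr.le, hC2, hτ, mul_one_div]
  set j := ⌈128 * D⌉₊ with hj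
  have hj1 : 128 * D ≤ j := Nat.le_ceil _
  have hj2 : (j:ℝ) ≤ 129 * D := by
    have := Nat.ceil_lt_add_one (by positivity : 0 ≤ 128 * D)
    linarith
  obtain ⟨x, hx1, hx2, hd1, hd2⟩ := havg _ (polesIx h (4 * r)) (fun i => ‖i.1‖ / r) (by
    intro i hi
    simp only [polesIx, Finset.mem_sigma, mem_polesIn] at hi
    exact ⟨by positivity, by rw [div_le_iff₀ hr]; exact hi.1.2⟩)
  rw [card_polesIx h, ← hn, ← hD] at hd1 hd2
  have hFs : ∀ z, ‖z‖ = ρs → ‖F z‖ ≤ Ms := by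
    intro z hz
    rw [← hFA z (by simp [hz]; linarith) (hMs z hz).1, norm_mul, norm_prod]
    have h1 : ∏ i ∈ polesIx h (4 * r), ‖(z - i.1) / ((8 * r : ℝ) : ℂ)‖ ≤ 1 := by
      apply Finset.prod_le_one (fun _ _ => norm_nonneg _)
      intro i hi
      simp only [polesIx, Finset.mem_sigma, mem_polesIn] at hi
      rw [norm_div, Complex.norm_real, Real.norm_of_nonneg (by positivity), div_le_one (by positivity)]
      exact (norm_sub_le _ _).trans (by linarith [hi.1.2])
    exact (mul_le_of_le_one_right (norm_nonneg _) h1).trans (hMs z hz).2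
  have hbig : Ms * (r / ρs) ^ (m * j) < ‖F zs‖ := by
    refine lt_of_lt_of_le ?_ hzsE
    have h1 : (r / ρs) ^ (m * j) ≤ r ^ (m * j) := pow_le_pow_left₀ (by positivity) (div_le_self hr.le hρs1) _
    have h2 : r ^ (m * j) = Real.exp ((m * j : ℝ) * Real.log r) := by
      rw [mul_comm (m * j : ℝ), Real.exp_mul, Real.exp_log hr]; exact_mod_cast (Real.rpow_natCast r (m * j)).symm
    have h3 : (m * j : ℝ) * Real.log r ≤ r ^ σ / 8 := by
      have hlog : 0 ≤ Real.log r := Real.log_nonneg hr1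
      calc (m * j : ℝ) * Real.log r ≤ (m * (129 * (C2 * r ^ τ))) * r ^ δ := by gcongr; linarith
        _ = 129 * m * C2 * r ^ (τ + δ) := by rw [Real.rpow_add hr]; ring
        _ ≤ r ^ σ / 8 := by linarith
    calc Ms * (r / ρs) ^ (m * j) ≤ Real.exp (Real.log Ms) * Real.exp (r ^ σ / 8) := by
          rw [Real.exp_log (by linarith)]
          gcongr
          exact h1.trans (h2.le.trans (Real.exp_le_exp.2 h3))
      _ < Real.exp (r ^ σ / 4) := by
          rw [← Real.exp_add]; apply Real.exp_lt_exp.2; linarith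
  have hgrow : ∀ ρ1 ρ2 z, r ≤ ρ1 → ρ1 ≤ ρ2 → ρ2 ≤ 2 * r → ‖z‖ = ρ1 →
      ∃ z', ‖z'‖ = ρ2 ∧ ‖F z‖ * (ρ2 / ρ1) ^ (m * j) ≤ ‖F z'‖ := by
    intro ρ1 ρ2 z h1 h2 h3 h4
    obtain ⟨z', hz', hz2⟩ := max_grow (by linarith : 0 < ρs) (by linarith : ρs < r) (h1.trans h2)
      (by linarith : ρ2 < 4 * r) hFa hFs hzs hbig
    refine ⟨z', hz', ?_⟩
    have h5 := hz2 z (by rw [h4]; exact h1) (by rw [h4]; exact h2)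
    have hp1 : 0 < ρ1 := by linarith
    have hp2 : 0 < ρ2 := by linarith
    rw [norm_div, norm_div, norm_pow, norm_pow, h4, hz', div_le_div_iff₀ (by positivity) (by positivity)] at h5
    rw [div_pow, mul_div_assoc', div_le_iff₀ (by positivity)]
    exact h5
  obtain ⟨z1, c, B, l, hc, hB, hl, hfin⟩ := wv_core (I := polesIx h (4 * r)) (p := fun i => i.1) (A := A) (F := F)
    (E := Real.exp (r ^ σ / 4)) (K := K) (ε := ε) (η := η) (B0 := B0) (m := m) (j := j) (x := x) hr hD1 hx1 hx2
    (fun z hz => (hFa z hz).differentiableAt.differentiableWithinAt) hj1 hgrow ⟨zs, hzs, hzsE⟩ (Real.exp_pos _)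
    (by
      intro z hz hz2
      refine hFA z hz fun hzP => ?_
      refine hz2 ⟨z, 0⟩ ?_ rfl
      simp only [polesIx, Finset.mem_sigma, mem_polesIn, Finset.mem_range]
      exact ⟨⟨hzP, (mem_ball_zero_iff.1 hz).le⟩, (h.poleOrder hzP).1⟩)
    (by
      intro i hi
      simp only [polesIx, Finset.mem_sigma, mem_polesIn] at hi
      exact hi.1.2) hd1 hd2 (le_max_right _ _) hη0 (min_le_left _ _)
    (by have : η ≤ ε / 6 := min_le_right _ _
        linarith) hm1 hm2 hm3 (by linarith) (by
      have h1 : D ^ 2 ≤ (C2 * r ^ σ) ^ 2 := by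
        apply pow_le_pow_left₀ (by positivity)
        refine hDle.trans ?_
        gcongr
      rw [div_pow, mul_div_assoc', le_div_iff₀ (by positivity)]
      have h2 : (1:ℝ) ≤ r ^ 2 := one_le_pow₀ hr1
      calc 4 ^ m * (m:ℝ) ^ 2 * B0 ^ 2 * (4 * D) ^ 2 = (4 ^ m * (m:ℝ) ^ 2 * B0 ^ 2 * 16) * D ^ 2 := by ring
        _ ≤ (4 ^ m * (m:ℝ) ^ 2 * B0 ^ 2 * 16) * (C2 * r ^ σ) ^ 2 := by gcongr
        _ ≤ Real.exp (r ^ σ / 4) := by refine le_trans (le_of_eq ?_) e3; ring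
        _ ≤ Real.exp (r ^ σ / 4) * r ^ 2 := le_mul_of_one_le_right (Real.exp_pos _).le h2)
  have hsub : Metric.ball (0:ℂ) K0 ⊆ Metric.ball 0 K := Metric.ball_subset_ball (le_max_left _ _)
  exact hno z1 c B l hc hB (hl.mono hsub) fun w hw => hfin w (hsub hw)

end

section

lemma nevN_nonneg {A : ℂ → ℂ} {P : Set ℂ} (h : MeroPlane A P) {r : ℝ} (hr : 1 ≤ r) : 0 ≤ nevN A r := by
  have := nevN_ge h hr le_rfl
  rwa [div_self (by linarith), Real.log_one, mul_zero] at this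

lemma nevN_big {A : ℂ → ℂ} {P : Set ℂ} (h : MeroPlane A P) (hP : P.Nonempty) : ∀ᶠ r in atTop, 1 ≤ nevN A r := by
  obtain ⟨p, hp⟩ := hP
  set a := max 1 ‖p‖ with ha
  have ha1 : 1 ≤ a := le_max_left _ _
  have h1 : 1 ≤ nCount A a := by
    rw [nCount_eq h]
    exact (h.poleOrder hp).1.trans_le (Finset.single_le_sum (f := fun z => poleOrderAt A z) (fun _ _ => Nat.zero_le _)
      ((mem_polesIn h).2 ⟨hp, le_max_right _ _⟩))
  filter_upwards [eventually_ge_atTop (a * Real.exp 1)] with r hr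
  have he : 1 ≤ Real.exp 1 := Real.one_le_exp (by norm_num)
  have h2 : a ≤ r := (le_mul_of_one_le_right (by linarith) he).trans hr
  have h3 : 1 ≤ Real.log (r / a) := by
    rw [Real.le_log_iff_exp_le (by apply div_pos <;> linarith), le_div_iff₀ (by linarith)]
    linarith
  have h4 : (1:ℝ) ≤ nCount A a := by exact_mod_cast h1
  calc (1:ℝ) = 1 * 1 := by ring
    _ ≤ nCount A a * Real.log (r / a) := by gcongr
    _ ≤ _ := nevN_ge h ha1 h2

lemma nevN_zero {A : ℂ → ℂ} (h : MeroPlane A ∅) (r : ℝ) : nevN A r = 0 := by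
  have : ∀ t, nCount A t = 0 := fun t => by
    rw [nCount_eq h]
    exact Finset.sum_eq_zero fun z hz => absurd ((mem_polesIn h).1 hz).1 (by simp)
  simp [nevN, this]

lemma nevm_mono {A : ℂ → ℂ} (h : MeroPlane A ∅) : MonotoneOn (nevm A) (Ioi 0) := by
  have h1 := ValueDistribution.characteristic_monotoneOn h.meromorphic
  have h2 : ValueDistribution.characteristic A ⊤ = nevm A := by
    have h3 : ValueDistribution.logCounting A ⊤ = 0 := by
      rw [ValueDistribution.logCounting_top]
      have h4 : 0 ≤ MeromorphicOn.divisor A univ := MeromorphicOn.AnalyticOnNhd.divisor_nonneg (fun z _ => h.2.1 z (by simp))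
      rw [negPart_eq_zero.2 h4, map_zero]
    rw [ValueDistribution.characteristic, h3, add_zero, ValueDistribution.proximity_top]
    funext r
    rw [nevm_eq]
  rwa [h2] at h1

lemma main_aux {A : ℂ → ℂ} {P : Set ℂ} (h : MeroPlane A P)
    (hWV : ∃ K ε B0 : ℝ, 0 < K ∧ 0 < ε ∧ 1 ≤ B0 ∧ ∀ (z0 c : ℂ) (B : ℝ) (l : ℂ → ℂ), c ≠ 0 → B0 ≤ B →
      DifferentiableOn ℂ l (Metric.ball 0 K) →
      (∀ w ∈ Metric.ball (0:ℂ) K, ‖l w‖ ≤ ε ∧ c ^ 2 * A (z0 + c * w) = (B:ℂ) ^ 2 * Complex.exp (w + l w)) → False) :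
    Filter.limsup (fun r : ℝ => ((Real.log (nevN A r) / Real.log r : ℝ) : EReal)) atTop =
    Filter.limsup (fun r : ℝ => ((Real.log (nevT A r) / Real.log r : ℝ) : EReal)) atTop := by
  have hA : 0 ≤ Filter.limsup (fun r : ℝ => ((Real.log (nevN A r) / Real.log r : ℝ) : EReal)) atTop := by
    refine le_limsup_of_frequently_le ?_
    apply Eventually.frequently
    rcases P.eq_empty_or_nonempty with rfl | hP
    · exact Eventually.of_forall fun r => by simp [nevN_zero h]
    · filter_upwards [nevN_big h hP, eventually_ge_atTop 1] with r h1 h2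
      exact_mod_cast div_nonneg (Real.log_nonneg h1) (Real.log_nonneg h2)
  apply le_antisymm
  · rcases P.eq_empty_or_nonempty with rfl | hP
    · have hT : ∀ r, nevT A r = nevm A r := fun r => by rw [nevT, nevN_zero h, add_zero]
      have h0 : Filter.limsup (fun r : ℝ => ((Real.log (nevN A r) / Real.log r : ℝ) : EReal)) atTop = 0 := by
        simp [nevN_zero h]
      rw [h0]
      by_cases hex : ∃ r0 : ℝ, 0 < r0 ∧ 0 < nevm A r0
      · obtain ⟨r0, hr0, hm⟩ := hex
        have h1 : Tendsto (fun r : ℝ => ((Real.log (nevm A r0) / Real.log r : ℝ) : EReal)) atTop (𝓝 0) := by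
          have := Real.tendsto_log_atTop.const_div_atTop (Real.log (nevm A r0))
          exact (continuous_coe_real_ereal.tendsto 0).comp this
        rw [← h1.limsup_eq]
        refine limsup_le_limsup ?_
        filter_upwards [eventually_ge_atTop r0, eventually_ge_atTop 1] with r h2 h3
        rw [EReal.coe_le_coe_iff, hT]
        have := nevm_mono h (mem_Ioi.2 hr0) (mem_Ioi.2 (hr0.trans_le h2)) h2
        have h4 := Real.log_nonneg h3
        gcongr
      · push Not at hex
        refine le_limsup_of_frequently_le ?_
        apply Eventually.frequently
        filter_upwards [eventually_gt_atTop 0] with r hr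
        rw [hT, le_antisymm (hex r hr) (nevm_nonneg A r)]
        simp
    · refine limsup_le_limsup ?_
      filter_upwards [nevN_big h hP, eventually_ge_atTop 1] with r h1 h2
      rw [EReal.coe_le_coe_iff]
      have h4 := Real.log_nonneg h2
      have h5 : nevN A r ≤ nevT A r := by rw [nevT]; linarith [nevm_nonneg A r]
      gcongr
  · by_contra! hlt
    obtain ⟨ρ, h1, h2⟩ := EReal.lt_iff_exists_real_btwn.1 hlt
    obtain ⟨σ, h3, h4⟩ := EReal.lt_iff_exists_real_btwn.1 h2
    have hρ : 0 < ρ := by exact_mod_cast hA.trans_lt h1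
    have hρσ : ρ < σ := by exact_mod_cast h3
    have hN : ∀ᶠ r in atTop, nevN A r ≤ r ^ ρ := by
      filter_upwards [eventually_lt_of_limsup_lt h1, eventually_gt_atTop 1] with r h5 h6
      rw [EReal.coe_lt_coe_iff, div_lt_iff₀ (Real.log_pos h6)] at h5
      rcases (nevN_nonneg h h6.le).eq_or_lt with h7 | h7
      · rw [← h7]; positivity
      · rw [← Real.log_le_log_iff h7 (by positivity), Real.log_rpow (by linarith)]
        exact h5.le
    refine absurd h4 (not_lt.2 ?_)
    apply limsup_le_of_le
    · isBoundedDefault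
    filter_upwards [no_gap h hWV hρ hρσ hN, eventually_gt_atTop 1] with r h5 h6
    rw [EReal.coe_le_coe_iff, div_le_iff₀ (Real.log_pos h6)]
    have h8 : 0 ≤ nevT A r := add_nonneg (nevm_nonneg A r) (nevN_nonneg h h6.le)
    rcases h8.eq_or_lt with h7 | h7
    · rw [← h7, Real.log_zero]
      exact mul_nonneg (by linarith) (Real.log_pos h6).le
    · rw [← Real.log_rpow (by linarith)]
      exact Real.log_le_log h7 h5.le

end

/-- Theorem 1.2(c): under the hypotheses of Theorem 1.2, if `A = S_f/2` is
transcendental then ∞ is not a Borel exceptional value of `A`: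
`limsup_{r→∞} log N(r,A)/log r = limsup_{r→∞} log T(r,A)/log r`. -/
theorem schwarzian_infty_not_borel_exceptional
    (M : ℕ) (hM : 0 < M)
    (f A : ℂ → ℂ) (Pf PA : Set ℂ)
    (hf : TranscMeroPlane f Pf)
    (hSf : ∀ z, z ∉ Pf → deriv f z ≠ 0 → schwarzian f z = 2 * A z)
    (hcrit : (CriticalValues f Pf).Finite)
    (hmult : ∀ z μ, MultiplePointWithMult f z μ → μ ≤ M)
    (hsing : FinitelyManyTranscSing f Pf)
    (hA : TranscMeroPlane A PA) :
    Filter.limsup (fun r : ℝ => ((Real.log (nevN A r) / Real.log r : ℝ) : EReal)) atTop =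
      Filter.limsup (fun r : ℝ => ((Real.log (nevT A r) / Real.log r : ℝ) : EReal)) atTop := by
  exact main_aux hA.1 (no_WV hM hf hSf hcrit hmult hsing)

end
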